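/- The validity problem over the frame (ℝ², <) is decidable: the predicate on temporal formulas 'φ is valid over (ℝ², <)' is computable, where < is the irreflexive part of the componentwise order on ℝ². -/

import Mathlib

namespace Temporal

/-- Temporal propositional formulas: `φ ::= q | ¬φ | φ∨φ' | Fφ | Pφ`. -/
inductive TForm : Type
  | prop : ℕ → TForm
  | neg : TForm → TForm
  | or : TForm → TForm → TForm
  | fut : TForm → TForm
  | past : TForm → TForm
  deriving DecidableEq

/-- Truth of a temporal formula at a point of a Kripke structure. -/
def TSat {X : Type*} (R : X → X → Prop) (v : ℕ → Set X) : TForm → X → Prop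
  | .prop n, x => x ∈ v n
  | .neg φ, x => ¬ TSat R v φ x
  | .or φ ψ, x => TSat R v φ x ∨ TSat R v ψ x
  | .fut φ, x => ∃ y, R x y ∧ TSat R v φ y
  | .past φ, x => ∃ y, R y x ∧ TSat R v φ y

/-- Validity of a temporal formula over a Kripke frame. -/
def TValid {X : Type*} (R : X → X → Prop) (φ : TForm) : Prop :=
  ∀ (v : ℕ → Set X) (x : X), TSat R v φ x

/-- Satisfiability of a temporal formula over a Kripke frame. -/
def TSatisfiable {X : Type*} (R : X → X → Prop) (φ : TForm) : Prop :=
  ∃ (v : ℕ → Set X) (x : X), TSat R v φ x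

/-- An explicit encoding of temporal formulas as natural numbers. -/
def encodeT : TForm → ℕ
  | .prop n => 5 * n
  | .neg φ => 5 * encodeT φ + 1
  | .or φ ψ => 5 * Nat.pair (encodeT φ) (encodeT ψ) + 2
  | .fut φ => 5 * encodeT φ + 3
  | .past φ => 5 * encodeT φ + 4

/-- The inverse decoding of natural numbers as temporal formulas. -/
def decodeT (n : ℕ) : TForm :=
  if h0 : n % 5 = 0 then .prop (n / 5)
  else
    have hn : 0 < n := Nat.pos_of_ne_zero (by rintro rfl; simp at h0)
    have hlt : n / 5 < n := Nat.div_lt_self hn (by norm_num)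
    have h1 : (n / 5).unpair.1 < n := lt_of_le_of_lt (Nat.unpair_left_le _) hlt
    have h2 : (n / 5).unpair.2 < n := lt_of_le_of_lt (Nat.unpair_right_le _) hlt
    if n % 5 = 1 then .neg (decodeT (n / 5))
    else if n % 5 = 2 then .or (decodeT (n / 5).unpair.1) (decodeT (n / 5).unpair.2)
    else if n % 5 = 3 then .fut (decodeT (n / 5))
    else .past (decodeT (n / 5))

theorem decodeT_encodeT (φ : TForm) : decodeT (encodeT φ) = φ := by
  induction φ with
  | prop n => rw [encodeT, decodeT]; simp [Nat.mul_div_cancel_left, Nat.mul_mod_right]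
  | neg φ ih => rw [encodeT, decodeT]; simp [Nat.mul_add_mod, Nat.mul_add_div, ih]
  | or φ ψ ih1 ih2 => rw [encodeT, decodeT]; simp [Nat.mul_add_mod, Nat.mul_add_div, ih1, ih2]
  | fut φ ih => rw [encodeT, decodeT]; simp [Nat.mul_add_mod, Nat.mul_add_div, ih]
  | past φ ih => rw [encodeT, decodeT]; simp [Nat.mul_add_mod, Nat.mul_add_div, ih]

theorem encodeT_decodeT (n : ℕ) : encodeT (decodeT n) = n := by
  induction n using Nat.strong_induction_on with
  | _ n ih =>
    rw [decodeT]
    by_cases h0 : n % 5 = 0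
    · simp only [h0, dif_pos]
      rw [encodeT]
      omega
    · have hn : 0 < n := Nat.pos_of_ne_zero (by rintro rfl; simp at h0)
      have hlt : n / 5 < n := Nat.div_lt_self hn (by norm_num)
      have h1 : (n / 5).unpair.1 < n := lt_of_le_of_lt (Nat.unpair_left_le _) hlt
      have h2 : (n / 5).unpair.2 < n := lt_of_le_of_lt (Nat.unpair_right_le _) hlt
      rw [dif_neg h0]
      by_cases e1 : n % 5 = 1
      · rw [if_pos e1, encodeT, ih _ hlt]
        omega
      · rw [if_neg e1]
        by_cases e2 : n % 5 = 2
        · rw [if_pos e2, encodeT, ih _ h1, ih _ h2, Nat.pair_unpair]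
          omega
        · rw [if_neg e2]
          by_cases e3 : n % 5 = 3
          · rw [if_pos e3, encodeT, ih _ hlt]
            omega
          · rw [if_neg e3, encodeT, ih _ hlt]
            omega

instance : Encodable TForm :=
  ⟨encodeT, fun n => some (decodeT n), fun φ => congrArg some (decodeT_encodeT φ)⟩

instance : Denumerable TForm :=
  ⟨fun n => ⟨decodeT n, rfl, encodeT_decodeT n⟩⟩

end Temporal

section
namespace Temporal

/-- kinds of subsets of the line -/
@[ext] structure Kd where
  ne : Prop
  mn : Prop
  mx : Prop
  sg : Prop

def kpt : Kd := ⟨True, True, True, True⟩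
def koo : Kd := ⟨True, False, False, False⟩
def kco : Kd := ⟨True, True, False, False⟩
def koc : Kd := ⟨True, False, True, False⟩
def kcc : Kd := ⟨True, True, True, False⟩
def kem : Kd := ⟨False, False, False, True⟩

def kd (S : Set ℝ) : Kd :=
  ⟨S.Nonempty, ∃ a, IsLeast S a, ∃ a, IsGreatest S a, S.Subsingleton⟩

def Kd.comb (a b : Kd) : Kd :=
  ⟨a.ne ∨ b.ne, (a.ne ∧ a.mn) ∨ (¬ a.ne ∧ b.mn), (b.ne ∧ b.mx) ∨ (¬ b.ne ∧ a.mx),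
    (a.sg ∧ ¬ b.ne) ∨ (b.sg ∧ ¬ a.ne)⟩

@[ext] structure Mo (ι : Type) where
  p : Set ι
  f : Set ι

@[ext] structure Lab (ι : Type) where
  l : Set ι
  f : Set ι
  p : Set ι

instance {ι : Type} : PartialOrder (Mo ι) where
  le a b := a.p ⊆ b.p ∧ b.f ⊆ a.f
  le_refl a := ⟨subset_rfl, subset_rfl⟩
  le_trans a b c h1 h2 := ⟨h1.1.trans h2.1, h2.2.trans h1.2⟩
  le_antisymm a b h1 h2 := Mo.ext (h1.1.antisymm h2.1) (h2.2.antisymm h1.2)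

theorem Mo.le_def {ι : Type} (a b : Mo ι) : a ≤ b ↔ a.p ⊆ b.p ∧ b.f ⊆ a.f := Iff.rfl

def W {T : Type} (κ : ℝ → T) (J : Set ℝ) : T → Kd := fun m => kd {y | y ∈ J ∧ κ y = m}

def combW {T : Type} (a b : T → Kd) : T → Kd := fun m => (a m).comb (b m)

def cW {T : Type} (k : Kd) (m : T) : T → Kd := fun m' =>
  ⟨m' = m ∧ k.ne, m' = m ∧ k.mn, m' = m ∧ k.mx, m' = m → k.sg⟩

theorem kd_empty : kd ∅ = kem := by
  simp [kd, kem, IsLeast, IsGreatest]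

theorem kd_singleton (a : ℝ) : kd {a} = kpt := by
  simp [kd, kpt, IsLeast, IsGreatest, lowerBounds, upperBounds]

theorem kd_comb {S T : Set ℝ} (h : ∀ x ∈ S, ∀ y ∈ T, x < y) :
    kd (S ∪ T) = (kd S).comb (kd T) := by
  rcases S.eq_empty_or_nonempty with rfl | ⟨s, hs⟩
  · have h1 : ¬ (∃ a, IsGreatest (∅ : Set ℝ) a) := by rintro ⟨a, ha, _⟩; exact ha
    rcases T.eq_empty_or_nonempty with rfl | hT
    · simp [kd, Kd.comb]
    · simp [kd, Kd.comb, hT]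
  rcases T.eq_empty_or_nonempty with rfl | ⟨t, ht⟩
  · have hS : S.Nonempty := ⟨s, hs⟩
    simp [kd, Kd.comb, hS]
  have hS : S.Nonempty := ⟨s, hs⟩
  have hT : T.Nonempty := ⟨t, ht⟩
  have hne : ¬ (S = ∅) := hS.ne_empty
  have hne' : ¬ (T = ∅) := hT.ne_empty
  simp only [kd, Kd.comb, Kd.mk.injEq, hS, hT, Set.union_nonempty]
  simp only [true_and, not_true_eq_false, false_and, or_false, and_false, eq_iff_iff]
  refine ⟨⟨?_, ?_⟩, ⟨?_, ?_⟩, ?_⟩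
  · rintro ⟨a, ha, hb⟩
    refine ⟨a, ?_, fun x hx => hb (Or.inl hx)⟩
    rcases ha with ha | ha
    · exact ha
    · have := h s hs a ha; have := hb (Or.inl hs); linarith
  · rintro ⟨a, ha, hb⟩
    refine ⟨a, Or.inl ha, ?_⟩
    rintro x (hx | hx)
    · exact hb hx
    · exact (h a ha x hx).le
  · rintro ⟨a, ha, hb⟩
    refine ⟨a, ?_, fun x hx => hb (Or.inr hx)⟩
    rcases ha with ha | ha
    · have := h a ha t ht; have := hb (Or.inr ht); linarith
    · exact ha
  · rintro ⟨a, ha, hb⟩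
    refine ⟨a, Or.inr ha, ?_⟩
    rintro x (hx | hx)
    · exact (h x hx a ha).le
    · exact hb hx
  · simp only [iff_false]
    intro hh
    have := h s hs t ht
    have := hh (Or.inl hs) (Or.inr ht); linarith

theorem W_comb {T : Type} (κ : ℝ → T) {I J : Set ℝ} (h : ∀ x ∈ I, ∀ y ∈ J, x < y) :
    W κ (I ∪ J) = combW (W κ I) (W κ J) := by
  funext m
  simp only [W, combW]
  rw [← kd_comb]
  · congr 1; ext y; simp [or_and_right]
  · intro x hx y hy; exact h x hx.1 y hy.1

theorem W_const {T : Type} (κ : ℝ → T) {J : Set ℝ} (m : T) (h : ∀ y ∈ J, κ y = m) :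
    W κ J = cW (kd J) m := by
  funext m'
  simp only [W, cW]
  by_cases hm : m' = m
  · subst hm
    have : {y | y ∈ J ∧ κ y = m'} = J := by ext y; simp; exact h y
    rw [this]; simp
  · have : {y | y ∈ J ∧ κ y = m'} = ∅ := by
      ext y; simp; intro hy h2; exact hm (h2 ▸ h y hy)
    rw [this, kd_empty]; simp [hm, kem]

theorem W_ne {T : Type} {κ : ℝ → T} {J : Set ℝ} {m : T} :
    (W κ J m).ne ↔ ∃ y ∈ J, κ y = m := Iff.rfl

theorem W_const_of {T : Type} {κ : ℝ → T} {J : Set ℝ} {k : Kd} {m : T} (h : W κ J = cW k m) :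
    ∀ y ∈ J, κ y = m := by
  intro y hy
  have : (W κ J (κ y)).ne := ⟨y, hy, rfl⟩
  rw [h] at this
  exact this.1

theorem W_congr {T : Type} {κ κ' : ℝ → T} {J : Set ℝ} (h : ∀ y ∈ J, κ y = κ' y) :
    W κ J = W κ' J := by
  funext m
  simp only [W]; congr 1; ext y; simp; intro hy; rw [h y hy]

/-- order isomorphism between sets of reals -/
def SIso (S S' : Set ℝ) (e : ℝ → ℝ) : Prop := StrictMonoOn e S ∧ e '' S = S'

theorem SIso.mem {S S' : Set ℝ} {e : ℝ → ℝ} (h : SIso S S' e) {x : ℝ} (hx : x ∈ S) : e x ∈ S' := by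
  rw [← h.2]; exact ⟨x, hx, rfl⟩

theorem SIso.id (S : Set ℝ) : SIso S S (fun x => x) := ⟨fun _ _ _ _ h => h, by simp⟩

theorem SIso.ex {S S' : Set ℝ} {e : ℝ → ℝ} (h : SIso S S' e) {x : ℝ} (hx : x ∈ S') :
    ∃ y ∈ S, e y = x := by
  rw [← h.2] at hx; exact hx

theorem SIso.comp {S S' S'' : Set ℝ} {e e' : ℝ → ℝ} (h : SIso S S' e) (h' : SIso S' S'' e') :
    SIso S S'' (e' ∘ e) :=
  ⟨fun _ hx _ hy hxy => h'.1 (h.mem hx) (h.mem hy) (h.1 hx hy hxy), by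
    rw [Set.image_comp, h.2, h'.2]⟩

theorem SIso.symm {S S' : Set ℝ} {e : ℝ → ℝ} (h : SIso S S' e) : ∃ e', SIso S' S e' := by
  classical
  choose! g hg using fun x (hx : x ∈ S') => h.ex hx
  refine ⟨g, ?_, ?_⟩
  · intro x hx y hy hxy
    by_contra hc
    have := h.1.monotoneOn (hg y hy).1 (hg x hx).1 (not_lt.1 hc)
    rw [(hg x hx).2, (hg y hy).2] at this; linarith
  · ext x; constructor
    · rintro ⟨y, hy, rfl⟩; exact (hg y hy).1
    · intro hx
      refine ⟨e x, h.mem hx, ?_⟩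
      exact h.1.injOn (hg _ (h.mem hx)).1 hx (hg _ (h.mem hx)).2

theorem SIso.kd {S S' : Set ℝ} {e : ℝ → ℝ} (h : SIso S S' e) : kd S = kd S' := by
  have key : ∀ {S S' : Set ℝ} {e : ℝ → ℝ}, SIso S S' e →
     (S.Nonempty → S'.Nonempty) ∧ ((∃ a, IsLeast S a) → ∃ a, IsLeast S' a) ∧
     ((∃ a, IsGreatest S a) → ∃ a, IsGreatest S' a) ∧ (S.Subsingleton → S'.Subsingleton) := by
    intro S S' e h
    refine ⟨fun ⟨x, hx⟩ => ⟨_, h.mem hx⟩, ?_, ?_, ?_⟩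
    · rintro ⟨a, ha, hb⟩
      refine ⟨e a, h.mem ha, fun x hx => ?_⟩
      obtain ⟨y, hy, rfl⟩ := h.ex hx
      exact h.1.monotoneOn ha hy (hb hy)
    · rintro ⟨a, ha, hb⟩
      refine ⟨e a, h.mem ha, fun x hx => ?_⟩
      obtain ⟨y, hy, rfl⟩ := h.ex hx
      exact h.1.monotoneOn hy ha (hb hy)
    · intro hs
      rw [← h.2]; exact hs.image e
  obtain ⟨e', h'⟩ := h.symm
  obtain ⟨a1, a2, a3, a4⟩ := key h
  obtain ⟨b1, b2, b3, b4⟩ := key h'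
  simp only [Temporal.kd, Kd.mk.injEq, eq_iff_iff]
  exact ⟨⟨a1, b1⟩, ⟨a2, b2⟩, ⟨a3, b3⟩, ⟨a4, b4⟩⟩

def canon (mn mx : Prop) : Set ℝ := {t | 0 ≤ t ∧ t ≤ 1 ∧ (t = 0 → mn) ∧ (t = 1 → mx)}

theorem SIso_canon {S : Set ℝ} (hS : S.OrdConnected) (hn : ¬ S.Subsingleton) :
    ∃ e, SIso S (canon (kd S).mn (kd S).mx) e := by
  -- bounded copy
  let φ : ℝ → ℝ := fun x => (orderIsoIooNegOneOne ℝ x : ℝ)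
  have hφ : StrictMono φ := fun x y h => (orderIsoIooNegOneOne ℝ).strictMono h
  have hφs : ∀ t, -1 < t → t < 1 → ∃ x, φ x = t := fun t h1 h2 =>
    ⟨(orderIsoIooNegOneOne ℝ).symm ⟨t, h1, h2⟩, by simp [φ]⟩
  have hφb : ∀ x, -1 < φ x ∧ φ x < 1 := fun x => (orderIsoIooNegOneOne ℝ x).2
  rw [Set.not_subsingleton_iff] at hn
  obtain ⟨u, hu, v, hv, huv⟩ := hn.exists_lt
  set S1 := φ '' S with hS1
  have hb : BddBelow S1 := ⟨-1, by rintro _ ⟨x, _, rfl⟩; exact (hφb x).1.le⟩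
  have ha : BddAbove S1 := ⟨1, by rintro _ ⟨x, _, rfl⟩; exact (hφb x).2.le⟩
  have hne : S1.Nonempty := ⟨φ u, u, hu, rfl⟩
  set a := sInf S1
  set b := sSup S1
  have hau : a ≤ φ u := csInf_le hb ⟨u, hu, rfl⟩
  have hvb : φ v ≤ b := le_csSup ha ⟨v, hv, rfl⟩
  have hab : a < b := by have := hφ huv; linarith
  have hpos : 0 < b - a := by linarith
  refine ⟨fun x => (φ x - a) / (b - a), fun x _ y _ hxy => ?_, ?_⟩
  · have := hφ hxy
    simp only
    rw [div_lt_div_iff_of_pos_right hpos]; linarith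
  · ext t
    simp only [Set.mem_image, canon, Set.mem_ofPred_eq, kd]
    constructor
    · rintro ⟨x, hx, rfl⟩
      have h1 : a ≤ φ x := csInf_le hb ⟨x, hx, rfl⟩
      have h2 : φ x ≤ b := le_csSup ha ⟨x, hx, rfl⟩
      refine ⟨div_nonneg (by linarith) hpos.le, by rw [div_le_one hpos]; linarith, ?_, ?_⟩
      · intro h0
        rw [div_eq_zero_iff] at h0
        have h0' : φ x = a := by rcases h0 with h0 | h0 <;> linarith
        refine ⟨x, hx, fun y hy => ?_⟩
        have : a ≤ φ y := csInf_le hb ⟨y, hy, rfl⟩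
        rw [← h0'] at this; exact hφ.le_iff_le.1 this
      · intro h0
        rw [div_eq_one_iff_eq hpos.ne'] at h0
        have h0' : φ x = b := by linarith
        refine ⟨x, hx, fun y hy => ?_⟩
        have : φ y ≤ b := le_csSup ha ⟨y, hy, rfl⟩
        rw [← h0'] at this; exact hφ.le_iff_le.1 this
    · rintro ⟨h0, h1, hm, hM⟩
      rcases h0.eq_or_lt with h0 | h0
      · obtain ⟨x, hx, hmin⟩ := hm h0.symm
        refine ⟨x, hx, ?_⟩
        have : a = φ x := le_antisymm (csInf_le hb ⟨x, hx, rfl⟩)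
          (le_csInf hne (by rintro _ ⟨y, hy, rfl⟩; exact hφ.monotone (hmin hy)))
        rw [← this, ← h0]; simp
      rcases h1.eq_or_lt with h1 | h1
      · obtain ⟨x, hx, hmax⟩ := hM h1
        refine ⟨x, hx, ?_⟩
        have : b = φ x := le_antisymm
          (csSup_le hne (by rintro _ ⟨y, hy, rfl⟩; exact hφ.monotone (hmax hy)))
          (le_csSup ha ⟨x, hx, rfl⟩)
        rw [← this, h1, div_self hpos.ne']
      · have e1 : a < a + t * (b - a) := by nlinarith [mul_pos h0 hpos]
        have e2 : a + t * (b - a) < b := by nlinarith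
        obtain ⟨_, ⟨x, hx, rfl⟩, hx2⟩ := exists_lt_of_csInf_lt hne e1
        obtain ⟨_, ⟨y, hy, rfl⟩, hy2⟩ := exists_lt_of_lt_csSup hne e2
        obtain ⟨z, hz⟩ := hφs (a + t * (b - a)) (by have := (hφb x).1; linarith)
          (by have := (hφb y).2; linarith)
        refine ⟨z, hS.out hx hy ⟨?_, ?_⟩, ?_⟩
        · exact (hφ.lt_iff_lt.1 (by rw [hz]; exact hx2)).le
        · exact (hφ.lt_iff_lt.1 (by rw [hz]; exact hy2)).le
        · rw [hz]; field_simp; ring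

theorem exists_SIso {S S' : Set ℝ} (hS : S.OrdConnected) (hS' : S'.OrdConnected)
    (h : kd S = kd S') : ∃ e, SIso S S' e := by
  by_cases hs : S.Subsingleton
  · have hs' : S'.Subsingleton := by have := congrArg Kd.sg h; simp [kd] at this; exact this.1 hs
    have hn : S.Nonempty ↔ S'.Nonempty := by have := congrArg Kd.ne h; simp [kd] at this; exact this
    rcases S.eq_empty_or_nonempty with rfl | ⟨x, hx⟩
    · have : S' = ∅ := by
        rw [← Set.not_nonempty_iff_eq_empty, ← hn]; simp
      exact ⟨fun x => x, by rw [this]; exact SIso.id _⟩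
    · obtain ⟨y, hy⟩ := hn.1 ⟨x, hx⟩
      refine ⟨fun _ => y, fun a ha b hb hab => absurd (hs ha hb) hab.ne, ?_⟩
      ext z; constructor
      · rintro ⟨_, _, rfl⟩; exact hy
      · intro hz; exact ⟨x, hx, hs' hy hz⟩
  · have hs' : ¬ S'.Subsingleton := by
      have := congrArg Kd.sg h; simp [kd] at this; rwa [← this]
    obtain ⟨e, he⟩ := SIso_canon hS hs
    obtain ⟨e', he'⟩ := SIso_canon hS' hs'
    rw [h] at he
    obtain ⟨g, hg⟩ := he'.symm
    exact ⟨_, he.comp hg⟩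

theorem level_ordConnected {T : Type} [PartialOrder T] {κ : ℝ → T} {J : Set ℝ}
    (hJ : J.OrdConnected) (hκ : MonotoneOn κ J) (m : T) : {y | y ∈ J ∧ κ y = m}.OrdConnected := by
  constructor
  rintro x ⟨hx, hxm⟩ y ⟨hy, hym⟩ z ⟨h1, h2⟩
  have hz : z ∈ J := hJ.out hx hy ⟨h1, h2⟩
  refine ⟨hz, le_antisymm ?_ ?_⟩
  · rw [← hym]; exact hκ hz hy h2
  · rw [← hxm]; exact hκ hx hz h1

theorem Wiso {T : Type} [PartialOrder T] {κ κ' : ℝ → T} {J J' : Set ℝ}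
    (hJ : J.OrdConnected) (hJ' : J'.OrdConnected)
    (hκ : MonotoneOn κ J) (hκ' : MonotoneOn κ' J') (h : W κ J = W κ' J') :
    ∃ e, SIso J' J e ∧ ∀ y ∈ J', κ (e y) = κ' y := by
  have : ∀ m, ∃ e, SIso {y | y ∈ J' ∧ κ' y = m} {y | y ∈ J ∧ κ y = m} e := fun m =>
    exists_SIso (level_ordConnected hJ' hκ' m) (level_ordConnected hJ hκ m) (congrFun h m).symm
  choose e he using this
  have hm : ∀ y ∈ J', e (κ' y) y ∈ J ∧ κ (e (κ' y) y) = κ' y := fun y hy =>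
    (he (κ' y)).mem ⟨hy, rfl⟩
  refine ⟨fun y => e (κ' y) y, ⟨?_, ?_⟩, fun y hy => (hm y hy).2⟩
  · intro x hx y hy hxy
    by_cases hk : κ' x = κ' y
    · simp only; rw [hk]
      exact (he (κ' y)).1 ⟨hx, hk⟩ ⟨hy, rfl⟩ hxy
    · by_contra hc
      have h1 := hκ (hm y hy).1 (hm x hx).1 (not_lt.1 hc)
      rw [(hm x hx).2, (hm y hy).2] at h1
      exact hk (le_antisymm (hκ' hx hy hxy.le) h1)
  · ext z; constructor
    · rintro ⟨y, hy, rfl⟩; exact (hm y hy).1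
    · intro hz
      obtain ⟨y, ⟨hy, hk⟩, hyz⟩ := (he (κ z)).ex (x := z) ⟨hz, rfl⟩
      refine ⟨y, hy, ?_⟩
      simp only; rw [hk]; exact hyz

theorem SIso.W {T : Type} {κ : ℝ → T} {J J' : Set ℝ} {e : ℝ → ℝ} (h : SIso J' J e) :
    W (fun y => κ (e y)) J' = W κ J := by
  funext m
  simp only [Temporal.W]
  refine SIso.kd (e := e) ⟨fun x hx y hy hxy => h.1 hx.1 hy.1 hxy, ?_⟩
  ext z; constructor
  · rintro ⟨y, ⟨hy, hk⟩, rfl⟩; exact ⟨h.mem hy, hk⟩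
  · rintro ⟨hz, hk⟩
    obtain ⟨y, hy, rfl⟩ := h.ex hz
    exact ⟨y, ⟨hy, hk⟩, rfl⟩

end Temporal
end

section
namespace Temporal

@[ext] structure Ds (ι : Type) where
  kI : Kd
  kJ : Kd
  L : Mo ι → Kd
  R : Mo ι → Kd
  T : Mo ι → Kd
  B : Mo ι → Kd

def Ds.swap {ι : Type} (d : Ds ι) : Ds ι := ⟨d.kJ, d.kI, d.B, d.T, d.R, d.L⟩

def TC {ι : Type} (C : Lab ι → Prop) (A B : Set ι) (t : Lab ι) : Prop :=
  C t ∧ t.f = A ∧ t.p = B ∧ t.l ⊆ A ∧ t.l ⊆ B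

def Lit {ι : Type} (C : Lab ι → Prop) (A B : Set ι) : Set ι := {i | ∃ t, TC C A B t ∧ i ∈ t.l}

structure LStep {ι : Type} (mr mb : Mo ι) (d UL UR LL d' : Ds ι) : Prop where
  kI : d.kI = koo
  kJ : d.kJ = koo
  dR : d.R = cW koo mr
  dB : d.B = cW koo mb
  ulI : UL.kI = koc
  ulJ : UL.kJ = kco
  urI : UR.kI = koo
  urJ : UR.kJ = kco
  llI : LL.kI = koc
  llJ : LL.kJ = koo
  left : ∃ m0, LL.L = cW koo m0 ∧ (UL.L m0).ne ∧ (UL.L m0).mn ∧ ¬ (UL.L m0).sg ∧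
    (∀ m, (UL.L m).ne → m0 ≤ m) ∧ d.L = combW (cW koo m0) UL.L
  top : ∃ m1, UR.T = cW koo m1 ∧ (UL.T m1).ne ∧ (UL.T m1).mx ∧ ¬ (UL.T m1).sg ∧
    (∀ m, (UL.T m).ne → m ≤ m1) ∧ d.T = combW UL.T (cW koo m1)
  urR : UR.R = cW kco mr
  llB : LL.B = cW koc mb
  ulur : UL.R = UR.L
  lld : LL.R = d'.L
  ulll : UL.B = LL.T
  urd : UR.B = d'.T
  mB : ∀ m m', (UL.B m).ne → (UR.B m').ne → m ≤ m'
  mR : ∀ m m', (LL.R m).ne → (UL.R m').ne → m ≤ m'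

structure Item {ι : Type} (B' A : Set ι) (d : Ds ι) : Prop where
  imn : d.kI.mn
  imx : d.kI.mx
  jmn : d.kJ.mn
  jmx : d.kJ.mx
  L : ∀ m, (d.L m).ne → m.p = B'
  B : ∀ m, (d.B m).ne → m.p = B'
  R : ∀ m, (d.R m).ne → m.f = A
  T : ∀ m, (d.T m).ne → m.f = A

structure Closed {ι : Type} (C : Lab ι → Prop) (X : Set (Ds ι)) : Prop where
  pt : ∀ (t : Lab ι) (oL oR oT oB : Set ι), C t → t.f = oR ∪ oT → t.p = oL ∪ oB →
    (⟨kpt, kpt, cW kpt ⟨oL, t.l ∪ t.f⟩, cW kpt ⟨t.l ∪ t.p, oR⟩, cW kpt ⟨t.l ∪ t.p, oT⟩,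
      cW kpt ⟨oB, t.l ∪ t.f⟩⟩ : Ds ι) ∈ X
  cl : ∀ (kI kJ : Kd) (A B' oL oR oT oB : Set ι), (kI = kpt ∨ kI = koo) → (kJ = kpt ∨ kJ = koo) →
    ¬ (kI = kpt ∧ kJ = kpt) → (∃ t, TC C A B' t) →
    A = Lit C A B' ∪ oR ∪ oT → B' = Lit C A B' ∪ oL ∪ oB →
    (⟨kI, kJ, cW kJ ⟨oL, A⟩, cW kJ ⟨B', oR⟩, cW kI ⟨B', oT⟩, cW kI ⟨oB, A⟩⟩ : Ds ι) ∈ X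
  join : ∀ d1 ∈ X, ∀ d2 ∈ X, d1.R = d2.L → d1.kJ = d2.kJ → (d1.kI.mx ↔ ¬ d2.kI.mn) →
    (∀ m m', (d1.B m).ne → (d2.B m').ne → m ≤ m') →
    (∀ m m', (d1.T m).ne → (d2.T m').ne → m ≤ m') →
    (⟨d1.kI.comb d2.kI, d1.kJ, d1.L, d2.R, combW d1.T d2.T, combW d1.B d2.B⟩ : Ds ι) ∈ X
  swap : ∀ d ∈ X, d.swap ∈ X
  lim : ∀ (Y : Set (Ds ι)) (mr mb : Mo ι),
    (∀ d ∈ Y, ∃ d' ∈ Y, ∃ UL ∈ X, ∃ UR ∈ X, ∃ LL ∈ X, LStep mr mb d UL UR LL d') →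
    ∀ d ∈ Y, d ∈ X
  shuf : ∀ (A' B' A B oL oR oT oB : Set ι) (t : Lab ι) (K : Set (Ds ι)),
    (∃ s, TC C A' B' s) → (∃ s, TC C A B s) →
    A = Lit C A B ∪ oR ∪ oT → B' = Lit C A' B' ∪ oL ∪ oB →
    C t → t.f = A → t.p = B' → t.l ⊆ A' → t.l ⊆ B →
    (∀ d ∈ K, d ∈ X ∧ Item B' A d) →
    A' = Lit C A' B' ∪ A ∪ t.l ∪ {i | ∃ d ∈ K, ∃ m, (d.L m).ne ∧ i ∈ m.f} →
    B = Lit C A B ∪ B' ∪ t.l ∪ {i | ∃ d ∈ K, ∃ m, (d.R m).ne ∧ i ∈ m.p} →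
    (⟨koo, koo, cW koo ⟨oL, A'⟩, cW koo ⟨B, oR⟩, cW koo ⟨B, oT⟩, cW koo ⟨oB, A'⟩⟩ : Ds ι) ∈ X

/-- region data -/
structure RD (ι : Type) where
  I : Set ℝ
  J : Set ℝ
  h : ℝ → ℝ → Lab ι
  oL : ℝ → Set ι
  oR : ℝ → Set ι
  oB : ℝ → Set ι
  oT : ℝ → Set ι

variable {ι : Type}

def RD.lit (r : RD ι) (i : ι) (x y : ℝ) : Prop := x ∈ r.I ∧ y ∈ r.J ∧ i ∈ (r.h x y).l

def RD.eL (r : RD ι) (y : ℝ) : Mo ι :=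
  ⟨r.oL y, {i | (∃ x' y', r.lit i x' y' ∧ y ≤ y') ∨ i ∈ r.oR y ∨ ∃ x ∈ r.I, i ∈ r.oT x}⟩
def RD.eR (r : RD ι) (y : ℝ) : Mo ι :=
  ⟨{i | (∃ x' y', r.lit i x' y' ∧ y' ≤ y) ∨ i ∈ r.oL y ∨ ∃ x ∈ r.I, i ∈ r.oB x}, r.oR y⟩
def RD.eB (r : RD ι) (x : ℝ) : Mo ι :=
  ⟨r.oB x, {i | (∃ x' y', r.lit i x' y' ∧ x ≤ x') ∨ i ∈ r.oT x ∨ ∃ y ∈ r.J, i ∈ r.oR y}⟩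
def RD.eT (r : RD ι) (x : ℝ) : Mo ι :=
  ⟨{i | (∃ x' y', r.lit i x' y' ∧ x' ≤ x) ∨ i ∈ r.oB x ∨ ∃ y ∈ r.J, i ∈ r.oL y}, r.oT x⟩

structure RD.Ok (C : Lab ι → Prop) (r : RD ι) : Prop where
  Ic : r.I.OrdConnected
  Jc : r.J.OrdConnected
  In : r.I.Nonempty
  Jn : r.J.Nonempty
  mL : ∀ a ∈ r.J, ∀ b ∈ r.J, a ≤ b → r.oL a ⊆ r.oL b
  mR : ∀ a ∈ r.J, ∀ b ∈ r.J, a ≤ b → r.oR b ⊆ r.oR a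
  mB : ∀ a ∈ r.I, ∀ b ∈ r.I, a ≤ b → r.oB a ⊆ r.oB b
  mT : ∀ a ∈ r.I, ∀ b ∈ r.I, a ≤ b → r.oT b ⊆ r.oT a
  hC : ∀ x ∈ r.I, ∀ y ∈ r.J, C (r.h x y)
  hf : ∀ x ∈ r.I, ∀ y ∈ r.J, ∀ i, i ∈ (r.h x y).f ↔
    (∃ x' y', r.lit i x' y' ∧ x ≤ x' ∧ y ≤ y' ∧ ¬ (x' = x ∧ y' = y)) ∨ i ∈ r.oR y ∨ i ∈ r.oT x
  hp : ∀ x ∈ r.I, ∀ y ∈ r.J, ∀ i, i ∈ (r.h x y).p ↔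
    (∃ x' y', r.lit i x' y' ∧ x' ≤ x ∧ y' ≤ y ∧ ¬ (x' = x ∧ y' = y)) ∨ i ∈ r.oL y ∨ i ∈ r.oB x

def RD.desc (r : RD ι) : Ds ι :=
  ⟨kd r.I, kd r.J, W r.eL r.J, W r.eR r.J, W r.eT r.I, W r.eB r.I⟩

def Rl (C : Lab ι → Prop) : Set (Ds ι) := {d | ∃ r : RD ι, r.Ok C ∧ r.desc = d}

def RD.swap (r : RD ι) : RD ι :=
  ⟨r.J, r.I, fun x y => r.h y x, r.oB, r.oT, r.oL, r.oR⟩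

theorem RD.swap_lit (r : RD ι) (i : ι) (x y : ℝ) : r.swap.lit i x y ↔ r.lit i y x := by
  simp only [lit, swap]; tauto

theorem RD.swap_eL (r : RD ι) : r.swap.eL = r.eB := by
  funext y
  simp only [eL, eB, swap_lit]
  ext i <;> simp only [swap, Set.mem_ofPred_eq]
  rw [exists_comm]
theorem RD.swap_eR (r : RD ι) : r.swap.eR = r.eT := by
  funext y
  simp only [eR, eT, swap_lit]
  ext i <;> simp only [swap, Set.mem_ofPred_eq]
  rw [exists_comm]
theorem RD.swap_eB (r : RD ι) : r.swap.eB = r.eL := by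
  funext y
  simp only [eL, eB, swap_lit]
  ext i <;> simp only [swap, Set.mem_ofPred_eq]
  rw [exists_comm]
theorem RD.swap_eT (r : RD ι) : r.swap.eT = r.eR := by
  funext y
  simp only [eR, eT, swap_lit]
  ext i <;> simp only [swap, Set.mem_ofPred_eq]
  rw [exists_comm]

theorem RD.swap_desc (r : RD ι) : r.swap.desc = r.desc.swap := by
  simp only [desc, Ds.swap, swap_eL, swap_eR, swap_eB, swap_eT]
  rfl

theorem RD.Ok.swap {C : Lab ι → Prop} {r : RD ι} (h : r.Ok C) : r.swap.Ok C where
  Ic := h.Jc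
  Jc := h.Ic
  In := h.Jn
  Jn := h.In
  mL := h.mB
  mR := h.mT
  mB := h.mL
  mT := h.mR
  hC := fun x hx y hy => h.hC y hy x hx
  hf := fun x hx y hy i => by
    rw [show (r.swap.h x y) = r.h y x from rfl, h.hf y hy x hx i, exists_comm]
    simp only [swap_lit]
    constructor
    · rintro (⟨a, b, h1, h2, h3, h4⟩ | h | h)
      · exact Or.inl ⟨a, b, h1, h3, h2, fun hh => h4 ⟨hh.2, hh.1⟩⟩
      · exact Or.inr (Or.inr h)
      · exact Or.inr (Or.inl h)
    · rintro (⟨a, b, h1, h2, h3, h4⟩ | h | h)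
      · exact Or.inl ⟨a, b, h1, h3, h2, fun hh => h4 ⟨hh.2, hh.1⟩⟩
      · exact Or.inr (Or.inr h)
      · exact Or.inr (Or.inl h)
  hp := fun x hx y hy i => by
    rw [show (r.swap.h x y) = r.h y x from rfl, h.hp y hy x hx i, exists_comm]
    simp only [swap_lit]
    constructor
    · rintro (⟨a, b, h1, h2, h3, h4⟩ | h | h)
      · exact Or.inl ⟨a, b, h1, h3, h2, fun hh => h4 ⟨hh.2, hh.1⟩⟩
      · exact Or.inr (Or.inr h)
      · exact Or.inr (Or.inl h)
    · rintro (⟨a, b, h1, h2, h3, h4⟩ | h | h)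
      · exact Or.inl ⟨a, b, h1, h3, h2, fun hh => h4 ⟨hh.2, hh.1⟩⟩
      · exact Or.inr (Or.inr h)
      · exact Or.inr (Or.inl h)

theorem Rl_swap (C : Lab ι → Prop) : ∀ d ∈ Rl C, d.swap ∈ Rl C := by
  rintro _ ⟨r, hr, rfl⟩
  exact ⟨r.swap, hr.swap, r.swap_desc⟩

theorem RD.Ok.eL_mono {C : Lab ι → Prop} {r : RD ι} (h : r.Ok C) : MonotoneOn r.eL r.J := by
  intro a ha b hb hab
  refine ⟨h.mL a ha b hb hab, ?_⟩
  rintro i (⟨x, y, h1, h2⟩ | h1 | h1)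
  · exact Or.inl ⟨x, y, h1, hab.trans h2⟩
  · exact Or.inr (Or.inl (h.mR a ha b hb hab h1))
  · exact Or.inr (Or.inr h1)

theorem RD.Ok.eR_mono {C : Lab ι → Prop} {r : RD ι} (h : r.Ok C) : MonotoneOn r.eR r.J := by
  intro a ha b hb hab
  refine ⟨?_, h.mR a ha b hb hab⟩
  rintro i (⟨x, y, h1, h2⟩ | h1 | h1)
  · exact Or.inl ⟨x, y, h1, h2.trans hab⟩
  · exact Or.inr (Or.inl (h.mL a ha b hb hab h1))
  · exact Or.inr (Or.inr h1)

theorem RD.Ok.eB_mono {C : Lab ι → Prop} {r : RD ι} (h : r.Ok C) : MonotoneOn r.eB r.I := by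
  have := h.swap.eL_mono; rwa [swap_eL] at this

theorem RD.Ok.eT_mono {C : Lab ι → Prop} {r : RD ι} (h : r.Ok C) : MonotoneOn r.eT r.I := by
  have := h.swap.eR_mono; rwa [swap_eR] at this

def RD.place (r : RD ι) (I' J' : Set ℝ) (ex ey : ℝ → ℝ) : RD ι :=
  ⟨I', J', fun x y => r.h (ex x) (ey y), fun y => r.oL (ey y), fun y => r.oR (ey y),
    fun x => r.oB (ex x), fun x => r.oT (ex x)⟩

theorem SIso.le_iff {S S' : Set ℝ} {e : ℝ → ℝ} (h : SIso S S' e) {x y : ℝ} (hx : x ∈ S)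
    (hy : y ∈ S) : e x ≤ e y ↔ x ≤ y := h.1.le_iff_le hx hy

theorem SIso.eq_iff {S S' : Set ℝ} {e : ℝ → ℝ} (h : SIso S S' e) {x y : ℝ} (hx : x ∈ S)
    (hy : y ∈ S) : e x = e y ↔ x = y := h.1.injOn.eq_iff hx hy

section place
variable {r : RD ι} {I' J' : Set ℝ} {ex ey : ℝ → ℝ} (hx : SIso I' r.I ex) (hy : SIso J' r.J ey)
include hx hy

/-- existential transfer -/
theorem RD.place_ex (i : ι) (Q : ℝ → ℝ → Prop) (Q' : ℝ → ℝ → Prop)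
    (hQ : ∀ x ∈ I', ∀ y ∈ J', (Q' x y ↔ Q (ex x) (ey y))) :
    (∃ x y, (r.place I' J' ex ey).lit i x y ∧ Q' x y) ↔ (∃ x y, r.lit i x y ∧ Q x y) := by
  constructor
  · rintro ⟨x, y, ⟨h1, h2, h3⟩, h4⟩
    exact ⟨ex x, ey y, ⟨hx.mem h1, hy.mem h2, h3⟩, (hQ x h1 y h2).1 h4⟩
  · rintro ⟨x, y, ⟨h1, h2, h3⟩, h4⟩
    obtain ⟨x, g1, rfl⟩ := hx.ex h1
    obtain ⟨y, g2, rfl⟩ := hy.ex h2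
    exact ⟨x, y, ⟨g1, g2, h3⟩, (hQ x g1 y g2).2 h4⟩

theorem RD.place_eL {y : ℝ} (h : y ∈ J') : (r.place I' J' ex ey).eL y = r.eL (ey y) := by
  ext i
  · rfl
  · simp only [eL, Set.mem_ofPred_eq]
    rw [RD.place_ex hx hy i (fun _ y' => ey y ≤ y') _ (fun x _ y' h' => (hy.le_iff h h').symm)]
    refine or_congr Iff.rfl (or_congr Iff.rfl ⟨?_, ?_⟩)
    · rintro ⟨x, h1, h2⟩; exact ⟨ex x, hx.mem h1, h2⟩
    · rintro ⟨x, h1, h2⟩; obtain ⟨x, g1, rfl⟩ := hx.ex h1; exact ⟨x, g1, h2⟩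

theorem RD.place_eR {y : ℝ} (h : y ∈ J') : (r.place I' J' ex ey).eR y = r.eR (ey y) := by
  ext i
  · simp only [eR, Set.mem_ofPred_eq]
    rw [RD.place_ex hx hy i (fun _ y' => y' ≤ ey y) _ (fun x _ y' h' => (hy.le_iff h' h).symm)]
    refine or_congr Iff.rfl (or_congr Iff.rfl ⟨?_, ?_⟩)
    · rintro ⟨x, h1, h2⟩; exact ⟨ex x, hx.mem h1, h2⟩
    · rintro ⟨x, h1, h2⟩; obtain ⟨x, g1, rfl⟩ := hx.ex h1; exact ⟨x, g1, h2⟩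
  · rfl

theorem RD.place_eB {x : ℝ} (h : x ∈ I') : (r.place I' J' ex ey).eB x = r.eB (ex x) := by
  have := RD.place_eL (r := r.swap) hy hx h
  rw [swap_eL] at this
  rw [← this, ← swap_eL]; rfl

theorem RD.place_eT {x : ℝ} (h : x ∈ I') : (r.place I' J' ex ey).eT x = r.eT (ex x) := by
  have := RD.place_eR (r := r.swap) hy hx h
  rw [swap_eR] at this
  rw [← this, ← swap_eR]; rfl

theorem RD.place_ok {C : Lab ι → Prop} (hr : r.Ok C) (hI : I'.OrdConnected) (hJ : J'.OrdConnected) :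
    (r.place I' J' ex ey).Ok C where
  Ic := hI
  Jc := hJ
  In := by obtain ⟨x, h⟩ := hr.In; obtain ⟨y, h, _⟩ := hx.ex h; exact ⟨y, h⟩
  Jn := by obtain ⟨x, h⟩ := hr.Jn; obtain ⟨y, h, _⟩ := hy.ex h; exact ⟨y, h⟩
  mL := fun a ha b hb hab => hr.mL _ (hy.mem ha) _ (hy.mem hb) ((hy.le_iff ha hb).2 hab)
  mR := fun a ha b hb hab => hr.mR _ (hy.mem ha) _ (hy.mem hb) ((hy.le_iff ha hb).2 hab)
  mB := fun a ha b hb hab => hr.mB _ (hx.mem ha) _ (hx.mem hb) ((hx.le_iff ha hb).2 hab)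
  mT := fun a ha b hb hab => hr.mT _ (hx.mem ha) _ (hx.mem hb) ((hx.le_iff ha hb).2 hab)
  hC := fun x h1 y h2 => hr.hC _ (hx.mem h1) _ (hy.mem h2)
  hf := fun x h1 y h2 i => by
    have := hr.hf _ (hx.mem h1) _ (hy.mem h2) i
    rw [show (r.place I' J' ex ey).h x y = r.h (ex x) (ey y) from rfl, this]
    refine or_congr ?_ Iff.rfl
    rw [RD.place_ex hx hy i (fun x' y' => ex x ≤ x' ∧ ey y ≤ y' ∧ ¬ (x' = ex x ∧ y' = ey y))]
    intro x' h1' y' h2'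
    rw [hx.le_iff h1 h1', hy.le_iff h2 h2', hx.eq_iff h1' h1, hy.eq_iff h2' h2]
  hp := fun x h1 y h2 i => by
    have := hr.hp _ (hx.mem h1) _ (hy.mem h2) i
    rw [show (r.place I' J' ex ey).h x y = r.h (ex x) (ey y) from rfl, this]
    refine or_congr ?_ Iff.rfl
    rw [RD.place_ex hx hy i (fun x' y' => x' ≤ ex x ∧ y' ≤ ey y ∧ ¬ (x' = ex x ∧ y' = ey y))]
    intro x' h1' y' h2'
    rw [hx.le_iff h1' h1, hy.le_iff h2' h2, hx.eq_iff h1' h1, hy.eq_iff h2' h2]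

theorem RD.place_desc : (r.place I' J' ex ey).desc = r.desc := by
  refine Ds.ext hx.kd hy.kd ?_ ?_ ?_ ?_
  · exact (W_congr (fun y h => RD.place_eL hx hy h)).trans hy.W
  · exact (W_congr (fun y h => RD.place_eR hx hy h)).trans hy.W
  · exact (W_congr (fun y h => RD.place_eT hx hy h)).trans hx.W
  · exact (W_congr (fun y h => RD.place_eB hx hy h)).trans hx.W
end place
end Temporal
end

section
namespace Temporal
variable {ι : Type}

instance [Finite ι] : Finite (Lab ι) :=
  Finite.of_injective (fun t : Lab ι => (t.l, t.f, t.p)) (by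
    rintro ⟨a, b, c⟩ ⟨a', b', c'⟩ h; simp at h; simp [h])

theorem exists_dense_fiber : ∃ g : ℝ → ℕ, (∀ n a b, a < b → ∃ x, a < x ∧ x < b ∧ g x = n) ∧
    {x | g x ≠ 0}.Countable := by
  classical
  let P : ℝ → ℕ → Prop := fun x n => ∃ q : ℚ, x = q + n * √2
  have hu : ∀ x n n', P x n → P x n' → n = n' := by
    rintro x n n' ⟨q, h1⟩ ⟨q', h2⟩
    by_contra hne
    have hne' : ((n : ℝ) - n') ≠ 0 := by
      intro h; apply hne; have : (n : ℝ) = n' := by linarith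
      exact_mod_cast this
    have : √2 = ((q' - q) / ((n : ℚ) - n') : ℚ) := by
      push_cast
      rw [eq_div_iff hne']; linarith
    exact irrational_sqrt_two ⟨_, this.symm⟩
  let g : ℝ → ℕ := fun x => if h : ∃ n, P x n then h.choose else 0
  have hg : ∀ x n, P x n → g x = n := by
    intro x n h
    have hh : ∃ n, P x n := ⟨n, h⟩
    simp only [g, dif_pos hh]
    exact hu x _ _ hh.choose_spec h
  refine ⟨g, ?_, ?_⟩
  · intro n a b hab
    obtain ⟨q, h1, h2⟩ := exists_rat_btwn (show a - n * √2 < b - n * √2 by linarith)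
    exact ⟨q + n * √2, by linarith, by linarith, hg _ _ ⟨q, rfl⟩⟩
  · refine (Set.countable_range (fun z : ℚ × ℕ => (z.1 : ℝ) + z.2 * √2)).mono ?_
    intro x hx
    by_cases h : ∃ n, P x n
    · obtain ⟨n, q, h⟩ := h
      exact ⟨(q, n), h.symm⟩
    · exact absurd (by simp only [g, dif_neg h]) hx

theorem kd_univ : kd Set.univ = koo := by
  simp only [kd, koo, Kd.mk.injEq, Set.univ_nonempty, true_and, eq_iff_iff, iff_false]
  refine ⟨?_, ?_, ?_⟩
  · rintro ⟨a, -, h⟩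
    have : a ≤ a - 1 := h (Set.mem_univ (a - 1))
    linarith
  · rintro ⟨a, -, h⟩
    have : a + 1 ≤ a := h (Set.mem_univ (a + 1))
    linarith
  · intro h
    have : (0 : ℝ) = 1 := h trivial trivial
    linarith

theorem Rl_pt (C : Lab ι → Prop) (t : Lab ι) (oL oR oT oB : Set ι) (hC : C t)
    (hf : t.f = oR ∪ oT) (hp : t.p = oL ∪ oB) :
    (⟨kpt, kpt, cW kpt ⟨oL, t.l ∪ t.f⟩, cW kpt ⟨t.l ∪ t.p, oR⟩, cW kpt ⟨t.l ∪ t.p, oT⟩,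
      cW kpt ⟨oB, t.l ∪ t.f⟩⟩ : Ds ι) ∈ Rl C := by
  let r : RD ι := ⟨{0}, {0}, fun _ _ => t, fun _ => oL, fun _ => oR, fun _ => oB, fun _ => oT⟩
  have hlit : ∀ i x y, r.lit i x y ↔ x = 0 ∧ y = 0 ∧ i ∈ t.l := fun i x y => by
    simp [RD.lit, r]
  refine ⟨r, ?_, ?_⟩
  · constructor
    · exact Set.ordConnected_singleton
    · exact Set.ordConnected_singleton
    · exact ⟨0, rfl⟩
    · exact ⟨0, rfl⟩
    · intros; exact subset_rfl
    · intros; exact subset_rfl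
    · intros; exact subset_rfl
    · intros; exact subset_rfl
    · intros; exact hC
    · rintro x hx y hy i
      obtain rfl : x = 0 := hx
      obtain rfl : y = 0 := hy
      simp only [hlit]
      simp only [r, hf]
      constructor
      · exact Or.inr
      · rintro (⟨x, y, ⟨h1, h2, -⟩, -, -, h⟩ | h)
        · exact absurd ⟨h1, h2⟩ h
        · exact h
    · rintro x hx y hy i
      obtain rfl : x = 0 := hx
      obtain rfl : y = 0 := hy
      simp only [hlit]
      simp only [r, hp]
      constructor
      · exact Or.inr
      · rintro (⟨x, y, ⟨h1, h2, -⟩, -, -, h⟩ | h)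
        · exact absurd ⟨h1, h2⟩ h
        · exact h
  · have hk : kd ({0} : Set ℝ) = kpt := kd_singleton 0
    have hk1 : kd r.I = kpt := hk
    have hk2 : kd r.J = kpt := hk
    refine Ds.ext hk hk ?_ ?_ ?_ ?_
    · simp only [RD.desc]
      rw [← hk2]
      refine W_const _ _ (fun y hy => ?_)
      obtain rfl : y = 0 := hy
      ext i
      · rfl
      · simp only [RD.eL, hlit]
        simp [r, hf]
    · simp only [RD.desc]
      rw [← hk2]
      refine W_const _ _ (fun y hy => ?_)
      obtain rfl : y = 0 := hy
      ext i
      · simp only [RD.eR, hlit]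
        simp [r, hp]
      · rfl
    · simp only [RD.desc]
      rw [← hk1]
      refine W_const _ _ (fun y hy => ?_)
      obtain rfl : y = 0 := hy
      ext i
      · simp only [RD.eT, hlit]
        simp [r, hp]; grind
      · rfl
    · simp only [RD.desc]
      rw [← hk1]
      refine W_const _ _ (fun y hy => ?_)
      obtain rfl : y = 0 := hy
      ext i
      · rfl
      · simp only [RD.eB, hlit]
        simp [r, hf]; grind

theorem Rl_cl [Finite ι] (C : Lab ι → Prop) (kI kJ : Kd) (A B' oL oR oT oB : Set ι)
    (hkI : kI = kpt ∨ kI = koo) (hkJ : kJ = kpt ∨ kJ = koo)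
    (hnn : ¬ (kI = kpt ∧ kJ = kpt)) (hex : ∃ t, TC C A B' t)
    (hA : A = Lit C A B' ∪ oR ∪ oT) (hB : B' = Lit C A B' ∪ oL ∪ oB) :
    (⟨kI, kJ, cW kJ ⟨oL, A⟩, cW kJ ⟨B', oR⟩, cW kI ⟨B', oT⟩, cW kI ⟨oB, A⟩⟩ : Ds ι) ∈ Rl C := by
  have hset : ∀ k, (k = kpt ∨ k = koo) → ∃ I : Set ℝ, (I.OrdConnected ∧ I.Nonempty) ∧ kd I = k ∧
      (k ≠ kpt → I = Set.univ) := by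
    rintro k (rfl | rfl)
    · exact ⟨{0}, ⟨Set.ordConnected_singleton, ⟨0, rfl⟩⟩, kd_singleton 0, fun h => absurd rfl h⟩
    · exact ⟨Set.univ, ⟨Set.ordConnected_univ, Set.univ_nonempty⟩, kd_univ, fun _ => rfl⟩
  obtain ⟨I, ⟨hI, hIn⟩, rfl, hI2⟩ := hset kI hkI
  obtain ⟨J, ⟨hJ, hJn⟩, rfl, hJ2⟩ := hset kJ hkJ
  have huniv : I = Set.univ ∨ J = Set.univ := by
    by_contra h; push Not at h; apply hnn
    constructor
    · by_contra hc; exact h.1 (hI2 hc)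
    · by_contra hc; exact h.2 (hJ2 hc)
  obtain ⟨g, hg, -⟩ := exists_dense_fiber
  obtain ⟨en, hen⟩ := (Set.to_countable {t | TC C A B' t}).exists_eq_range hex
  have hen1 : ∀ n, TC C A B' (en n) := fun n => by
    have : en n ∈ {t | TC C A B' t} := by rw [hen]; exact ⟨n, rfl⟩
    exact this
  have hen2 : ∀ t, TC C A B' t → ∃ n, en n = t := fun t ht => by
    have : t ∈ {t | TC C A B' t} := ht
    rw [hen] at this; exact this
  let r : RD ι := ⟨I, J, fun x y => en (g (x + y)), fun _ => oL, fun _ => oR, fun _ => oB,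
    fun _ => oT⟩
  -- dense witnesses
  have hup : ∀ i ∈ Lit C A B', ∀ x ∈ I, ∀ y ∈ J, ∃ x' y', r.lit i x' y' ∧ x ≤ x' ∧ y ≤ y' ∧
      ¬ (x' = x ∧ y' = y) := by
    rintro i ⟨t, ht, hi⟩ x hx y hy
    obtain ⟨n, rfl⟩ := hen2 t ht
    obtain ⟨z, h1, h2, h3⟩ := hg n (x + y) (x + y + 1) (by linarith)
    rcases huniv with h | h
    · refine ⟨z - y, y, ⟨by simp [r, h], hy, ?_⟩, by linarith, le_rfl, by
        rintro ⟨h, -⟩; linarith⟩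
      simp only [r]; rw [sub_add_cancel, h3]; exact hi
    · refine ⟨x, z - x, ⟨hx, by simp [r, h], ?_⟩, le_rfl, by linarith, by
        rintro ⟨-, h⟩; linarith⟩
      simp only [r]; rw [add_sub_cancel, h3]; exact hi
  have hdn : ∀ i ∈ Lit C A B', ∀ x ∈ I, ∀ y ∈ J, ∃ x' y', r.lit i x' y' ∧ x' ≤ x ∧ y' ≤ y ∧
      ¬ (x' = x ∧ y' = y) := by
    rintro i ⟨t, ht, hi⟩ x hx y hy
    obtain ⟨n, rfl⟩ := hen2 t ht
    obtain ⟨z, h1, h2, h3⟩ := hg n (x + y - 1) (x + y) (by linarith)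
    rcases huniv with h | h
    · refine ⟨z - y, y, ⟨by simp [r, h], hy, ?_⟩, by linarith, le_rfl, by
        rintro ⟨h, -⟩; linarith⟩
      simp only [r]; rw [sub_add_cancel, h3]; exact hi
    · refine ⟨x, z - x, ⟨hx, by simp [r, h], ?_⟩, le_rfl, by linarith, by
        rintro ⟨-, h⟩; linarith⟩
      simp only [r]; rw [add_sub_cancel, h3]; exact hi
  have hlit : ∀ i x y, r.lit i x y → i ∈ Lit C A B' := fun i x y h => ⟨_, hen1 _, h.2.2⟩
  have hA' : ∀ i, i ∈ A ↔ i ∈ Lit C A B' ∨ i ∈ oR ∨ i ∈ oT := fun i => by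
    conv_lhs => rw [hA]
    simp [or_assoc]
  have hB' : ∀ i, i ∈ B' ↔ i ∈ Lit C A B' ∨ i ∈ oL ∨ i ∈ oB := fun i => by
    conv_lhs => rw [hB]
    simp [or_assoc]
  refine ⟨r, ?_, ?_⟩
  · constructor
    · exact hI
    · exact hJ
    · exact hIn
    · exact hJn
    · intros; exact subset_rfl
    · intros; exact subset_rfl
    · intros; exact subset_rfl
    · intros; exact subset_rfl
    · intros; exact (hen1 _).1
    · intro x hx y hy i
      rw [show (r.h x y).f = A from (hen1 _).2.1, hA' i]
      refine or_congr ⟨fun h => hup i h x hx y hy, ?_⟩ Iff.rfl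
      rintro ⟨_, _, h, -⟩; exact hlit _ _ _ h
    · intro x hx y hy i
      rw [show (r.h x y).p = B' from (hen1 _).2.2.1, hB' i]
      refine or_congr ⟨fun h => hdn i h x hx y hy, ?_⟩ Iff.rfl
      rintro ⟨_, _, h, -⟩; exact hlit _ _ _ h
  · obtain ⟨x0, hx0⟩ := hIn
    obtain ⟨y0, hy0⟩ := hJn
    refine Ds.ext rfl rfl ?_ ?_ ?_ ?_
    · refine W_const _ _ (fun y hy => ?_)
      ext i
      · rfl
      · rw [hA' i]
        refine or_congr ⟨?_, fun h => ?_⟩ (or_congr Iff.rfl ⟨?_, fun h => ⟨x0, hx0, h⟩⟩)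
        · rintro ⟨_, _, h, -⟩; exact hlit _ _ _ h
        · obtain ⟨x', y', h1, -, h2, -⟩ := hup i h x0 hx0 y hy
          exact ⟨x', y', h1, h2⟩
        · rintro ⟨_, _, h⟩; exact h
    · refine W_const _ _ (fun y hy => ?_)
      ext i
      · rw [hB' i]
        refine or_congr ⟨?_, fun h => ?_⟩ (or_congr Iff.rfl ⟨?_, fun h => ⟨x0, hx0, h⟩⟩)
        · rintro ⟨_, _, h, -⟩; exact hlit _ _ _ h
        · obtain ⟨x', y', h1, -, h2, -⟩ := hdn i h x0 hx0 y hy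
          exact ⟨x', y', h1, h2⟩
        · rintro ⟨_, _, h⟩; exact h
      · rfl
    · refine W_const _ _ (fun x hx => ?_)
      ext i
      · rw [hB' i, or_comm (a := i ∈ oL)]
        refine or_congr ⟨?_, fun h => ?_⟩ (or_congr Iff.rfl ⟨?_, fun h => ⟨y0, hy0, h⟩⟩)
        · rintro ⟨_, _, h, -⟩; exact hlit _ _ _ h
        · obtain ⟨x', y', h1, h2, -⟩ := hdn i h x hx y0 hy0
          exact ⟨x', y', h1, h2⟩
        · rintro ⟨_, _, h⟩; exact h
      · rfl
    · refine W_const _ _ (fun x hx => ?_)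
      ext i
      · rfl
      · rw [hA' i, or_comm (a := i ∈ oR)]
        refine or_congr ⟨?_, fun h => ?_⟩ (or_congr Iff.rfl ⟨?_, fun h => ⟨y0, hy0, h⟩⟩)
        · rintro ⟨_, _, h, -⟩; exact hlit _ _ _ h
        · obtain ⟨x', y', h1, h2, -⟩ := hup i h x hx y0 hy0
          exact ⟨x', y', h1, h2⟩
        · rintro ⟨_, _, h⟩; exact h

end Temporal
end

section
namespace Temporal
variable {ι : Type}

theorem canon_ordConnected (mn mx : Prop) : (canon mn mx).OrdConnected := by
  constructor
  rintro x ⟨h1, h2, h3, h4⟩ y ⟨g1, g2, g3, g4⟩ z ⟨hz1, hz2⟩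
  refine ⟨by linarith, by linarith, fun h => h3 ?_, fun h => g4 ?_⟩
  · subst h; linarith
  · subst h; linarith

theorem SIso.shift (S : Set ℝ) (c : ℝ) : SIso ((fun x => x + c) '' S) S (fun x => x - c) := by
  refine ⟨fun x _ y _ h => by simpa using h, ?_⟩
  rw [Set.image_image]; simp

theorem ordConnected_shift {S : Set ℝ} (h : S.OrdConnected) (c : ℝ) :
    ((fun x => x + c) '' S).OrdConnected := by
  constructor
  rintro _ ⟨x, hx, rfl⟩ _ ⟨y, hy, rfl⟩ z ⟨h1, h2⟩
  simp only at h1 h2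
  exact ⟨z - c, h.out hx hy ⟨by linarith, by linarith⟩, by simp⟩

theorem exists_place (S : Set ℝ) (hS : S.OrdConnected) (hn : S.Nonempty) :
    ∃ S' e, SIso S' S e ∧ S'.OrdConnected ∧ (∀ t ∈ S', 0 ≤ t ∧ t ≤ 1) ∧
      ((∃ c, S' = {c}) ∨ (Set.Ioo 0 1 ⊆ S' ∧ ((0:ℝ) ∈ S' ↔ (kd S).mn) ∧ ((1:ℝ) ∈ S' ↔ (kd S).mx))) := by
  by_cases hs : S.Subsingleton
  · obtain ⟨x, hx⟩ := hn
    have : S = {x} := hs.eq_singleton_of_mem hx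
    refine ⟨{0}, fun _ => x, ⟨fun a ha b hb h => ?_, by simp [this]⟩, Set.ordConnected_singleton, ?_,
      Or.inl ⟨0, rfl⟩⟩
    · obtain rfl : a = 0 := ha
      obtain rfl : b = 0 := hb
      exact absurd h (lt_irrefl _)
    · intro t ht; obtain rfl : t = 0 := ht; norm_num
  · obtain ⟨e, he⟩ := SIso_canon hS hs
    obtain ⟨g, hg⟩ := he.symm
    refine ⟨_, g, hg, canon_ordConnected _ _, fun t ht => ⟨ht.1, ht.2.1⟩, Or.inr ⟨?_, ?_, ?_⟩⟩
    · intro t ht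
      exact ⟨ht.1.le, ht.2.le, fun h => absurd h ht.1.ne', fun h => absurd h ht.2.ne⟩
    · simp [canon]
    · simp [canon]

/-- two nonempty intervals can be placed next to each other -/
theorem exists_adjacent (S T : Set ℝ) (hS : S.OrdConnected) (hSn : S.Nonempty)
    (hT : T.OrdConnected) (hTn : T.Nonempty) (h : (kd S).mx ↔ ¬ (kd T).mn) :
    ∃ S' T' e e', SIso S' S e ∧ SIso T' T e' ∧ S'.OrdConnected ∧ T'.OrdConnected ∧
      (S' ∪ T').OrdConnected ∧ ∀ x ∈ S', ∀ y ∈ T', x < y := by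
  have hl : ∃ S' e, SIso S' S e ∧ S'.OrdConnected ∧ (∀ t ∈ S', t ≤ 0) ∧
     (∀ a < 0, ∀ x ∈ S', x ≤ a → a ∈ S') ∧ ((0:ℝ) ∈ S' ↔ (kd S).mx) ∧
       ((∀ a < 0, ∃ x ∈ S', a < x)) := by
    obtain ⟨S', e, he, ho, hb, h⟩ := exists_place S hS hSn
    rcases h with ⟨c, rfl⟩ | ⟨h1, h2, h3⟩
    · have hm : (kd S).mx := by rw [← he.kd, kd_singleton]; trivial
      refine ⟨{0}, fun _ => e c, ⟨?_, ?_⟩, Set.ordConnected_singleton, ?_, ?_, ?_, ?_⟩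
      · rintro a ha b hb h
        obtain rfl : a = 0 := ha
        obtain rfl : b = 0 := hb
        exact absurd h (lt_irrefl _)
      · rw [← he.2]; simp
      · rintro t ht; exact (show t = 0 from ht).le
      · rintro a ha x hx hxa
        obtain rfl : x = 0 := hx
        linarith
      · simp [hm]
      · intro a ha; exact ⟨0, rfl, ha⟩
    · refine ⟨_, _, (SIso.shift S' (-1)).comp he, ordConnected_shift ho _, ?_, ?_, ?_, ?_⟩
      · rintro _ ⟨t, ht, rfl⟩; have := hb t ht; simp only; linarith
      · rintro a ha _ ⟨t, ht, rfl⟩ hx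
        simp only at hx
        refine ⟨a + 1, ?_, by simp⟩
        rcases (hb t ht).1.eq_or_lt with h0 | h0
        · by_cases hh : a + 1 = t
          · rw [hh]; exact ht
          · exact h1 ⟨lt_of_le_of_ne (by linarith) (by rw [h0]; exact Ne.symm hh), by linarith⟩
        · exact h1 ⟨by linarith, by linarith⟩
      · rw [← h3]
        constructor
        · rintro ⟨t, ht, h⟩; simp only at h; rw [show (1:ℝ) = t by linarith]; exact ht
        · intro h; exact ⟨1, h, by norm_num⟩
      · intro a ha
        refine ⟨max (a/2) (-1/2), ⟨max (a/2) (-1/2) + 1, h1 ⟨?_, ?_⟩, by simp⟩, ?_⟩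
        · have := le_max_right (a/2) (-1/2); linarith
        · have : max (a/2) (-1/2) < 0 := max_lt (by linarith) (by norm_num)
          linarith
        · have := le_max_left (a/2) (-1/2); linarith
  have hr : ∃ S' e, SIso S' T e ∧ S'.OrdConnected ∧ (∀ t ∈ S', 0 ≤ t) ∧
     (∀ a > 0, ∀ x ∈ S', a ≤ x → a ∈ S') ∧ ((0:ℝ) ∈ S' ↔ (kd T).mn) := by
    obtain ⟨S', e, he, ho, hb, h⟩ := exists_place T hT hTn
    rcases h with ⟨c, rfl⟩ | ⟨h1, h2, h3⟩
    · have hm : (kd T).mn := by rw [← he.kd, kd_singleton]; trivial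
      refine ⟨{0}, fun _ => e c, ⟨?_, ?_⟩, Set.ordConnected_singleton, ?_, ?_, ?_⟩
      · rintro a ha b hb h
        obtain rfl : a = 0 := ha
        obtain rfl : b = 0 := hb
        exact absurd h (lt_irrefl _)
      · rw [← he.2]; simp
      · rintro t ht; exact (show t = 0 from ht).ge
      · rintro a ha x hx hxa
        obtain rfl : x = 0 := hx
        linarith
      · simp [hm]
    · refine ⟨S', e, he, ho, fun t ht => (hb t ht).1, ?_, h2⟩
      intro a ha x hx hax
      rcases (hb x hx).2.eq_or_lt with h0 | h0
      · by_cases hh : a = x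
        · rw [hh]; exact hx
        · exact h1 ⟨ha, by rw [← h0]; exact lt_of_le_of_ne hax hh⟩
      · exact h1 ⟨ha, by linarith⟩
  obtain ⟨S', e, he, ho, hb, hc, h0, -⟩ := hl
  obtain ⟨T', e', he', ho', hb', hc', h0'⟩ := hr
  refine ⟨S', T', e, e', he, he', ho, ho', ?_, ?_⟩
  · constructor
    rintro x hx y hy z ⟨h1, h2⟩
    rcases lt_trichotomy z 0 with hz | hz | hz
    · rcases hx with hx | hx
      · exact Or.inl (hc z hz x hx h1)
      · have := hb' x hx; linarith
    · subst hz
      by_cases h : (0:ℝ) ∈ S'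
      · exact Or.inl h
      · right; rw [h0']; rw [h0] at h; tauto
    · rcases hy with hy | hy
      · have := hb y hy; linarith
      · exact Or.inr (hc' z hz y hy h2)
  · intro x hx y hy
    refine lt_of_le_of_ne ((hb x hx).trans (hb' y hy)) ?_
    rintro rfl
    obtain rfl : x = 0 := le_antisymm (hb x hx) (hb' x hy)
    tauto

open Classical in
noncomputable def RD.join (r1 r2 : RD ι) : RD ι :=
  ⟨r1.I ∪ r2.I, r1.J, fun x y => if x ∈ r1.I then r1.h x y else r2.h x y, r1.oL, r2.oR,
    fun x => if x ∈ r1.I then r1.oB x else r2.oB x, fun x => if x ∈ r1.I then r1.oT x else r2.oT x⟩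

section join
variable {C : Lab ι → Prop} {r1 r2 : RD ι} (h1 : r1.Ok C) (h2 : r2.Ok C) (hJ : r2.J = r1.J)
  (hlt : ∀ x ∈ r1.I, ∀ y ∈ r2.I, x < y) (hoc : (r1.I ∪ r2.I).OrdConnected)
  (hRL : ∀ y ∈ r1.J, r1.eR y = r2.eL y) (hB : ∀ x ∈ r1.I, ∀ x' ∈ r2.I, r1.eB x ≤ r2.eB x')
  (hT : ∀ x ∈ r1.I, ∀ x' ∈ r2.I, r1.eT x ≤ r2.eT x')

include hlt in
theorem RD.join_not {x : ℝ} (h : x ∈ r2.I) : x ∉ r1.I := fun h' => lt_irrefl _ (hlt x h' x h)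

include hlt hJ in
theorem RD.join_lit (i : ι) (x y : ℝ) : (r1.join r2).lit i x y ↔ r1.lit i x y ∨ r2.lit i x y := by
  simp only [lit, join, hJ, Set.mem_union]
  by_cases h : x ∈ r1.I
  · have : x ∉ r2.I := fun h' => RD.join_not hlt h' h
    simp [h, this]
  · simp [h]

include hRL in
theorem RD.join_p (y : ℝ) (hy : y ∈ r1.J) (i : ι) : i ∈ r2.oL y ↔
    ((∃ x' y', r1.lit i x' y' ∧ y' ≤ y) ∨ i ∈ r1.oL y ∨ ∃ x ∈ r1.I, i ∈ r1.oB x) := by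
  have := congrArg Mo.p (hRL y hy)
  simp only [eL, eR] at this; rw [← this]; rfl

include hRL in
theorem RD.join_f (y : ℝ) (hy : y ∈ r1.J) (i : ι) : i ∈ r1.oR y ↔
    ((∃ x' y', r2.lit i x' y' ∧ y ≤ y') ∨ i ∈ r2.oR y ∨ ∃ x ∈ r2.I, i ∈ r2.oT x) := by
  have := congrArg Mo.f (hRL y hy)
  simp only [eL, eR] at this; rw [this]; rfl

include hlt hJ h1 h2 hoc hRL hB hT in
theorem RD.join_ok : (r1.join r2).Ok C := by
  have hl := RD.join_lit hJ hlt
  have hn : ∀ x ∈ r2.I, x ∉ r1.I := fun x h => RD.join_not hlt h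
  have hB' : ∀ x ∈ r1.I, ∀ x' ∈ r2.I, r1.oB x ⊆ r2.oB x' := fun x hx x' hx' => (hB x hx x' hx').1
  have hT' : ∀ x ∈ r1.I, ∀ x' ∈ r2.I, r2.oT x' ⊆ r1.oT x := fun x hx x' hx' => (hT x hx x' hx').2
  constructor
  · exact hoc
  · exact h1.Jc
  · exact h1.In.inl
  · exact h1.Jn
  · exact h1.mL
  · have := h2.mR; rw [hJ] at this; exact this
  · rintro a (ha | ha) b (hb | hb) hab
    · simp only [join, if_pos ha, if_pos hb]; exact h1.mB a ha b hb hab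
    · simp only [join, if_pos ha, if_neg (hn b hb)]; exact hB' a ha b hb
    · have := hlt b hb a ha; linarith
    · simp only [join, if_neg (hn a ha), if_neg (hn b hb)]; exact h2.mB a ha b hb hab
  · rintro a (ha | ha) b (hb | hb) hab
    · simp only [join, if_pos ha, if_pos hb]; exact h1.mT a ha b hb hab
    · simp only [join, if_pos ha, if_neg (hn b hb)]; exact hT' a ha b hb
    · have := hlt b hb a ha; linarith
    · simp only [join, if_neg (hn a ha), if_neg (hn b hb)]; exact h2.mT a ha b hb hab
  · rintro a (ha | ha) b hb
    · simp only [join, if_pos ha]; exact h1.hC a ha b hb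
    · simp only [join, if_neg (hn a ha)]; exact h2.hC a ha b (hJ ▸ hb)
  · rintro x (hx | hx) y hy i
    · simp only [hl]
      simp only [join, if_pos hx]
      rw [h1.hf x hx y hy i, RD.join_f hRL y hy i]
      constructor
      · rintro (⟨x', y', g1, g2, g3, g4⟩ | (⟨x', y', g1, g2⟩ | g | ⟨x', g1, g2⟩) | g)
        · exact Or.inl ⟨x', y', Or.inl g1, g2, g3, g4⟩
        · have := hlt x hx x' g1.1
          exact Or.inl ⟨x', y', Or.inr g1, this.le, g2, fun h => this.ne h.1.symm⟩
        · exact Or.inr (Or.inl g)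
        · exact Or.inr (Or.inr (hT' x hx x' g1 g2))
        · exact Or.inr (Or.inr g)
      · rintro (⟨x', y', g1 | g1, g2, g3, g4⟩ | g | g)
        · exact Or.inl ⟨x', y', g1, g2, g3, g4⟩
        · exact Or.inr (Or.inl (Or.inl ⟨x', y', g1, g3⟩))
        · exact Or.inr (Or.inl (Or.inr (Or.inl g)))
        · exact Or.inr (Or.inr g)
    · simp only [hl]
      simp only [join, if_neg (hn x hx)]
      rw [h2.hf x hx y (hJ ▸ hy) i]
      refine or_congr ⟨?_, ?_⟩ Iff.rfl
      · rintro ⟨x', y', g1, g2⟩; exact ⟨x', y', Or.inr g1, g2⟩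
      · rintro ⟨x', y', g1 | g1, g2⟩
        · have := hlt x' g1.1 x hx; linarith
        · exact ⟨x', y', g1, g2⟩
  · rintro x (hx | hx) y hy i
    · simp only [hl]
      simp only [join, if_pos hx]
      rw [h1.hp x hx y hy i]
      refine or_congr ⟨?_, ?_⟩ Iff.rfl
      · rintro ⟨x', y', g1, g2⟩; exact ⟨x', y', Or.inl g1, g2⟩
      · rintro ⟨x', y', g1 | g1, g2⟩
        · exact ⟨x', y', g1, g2⟩
        · have := hlt x hx x' g1.1; linarith
    · simp only [hl]
      simp only [join, if_neg (hn x hx)]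
      rw [h2.hp x hx y (hJ ▸ hy) i, RD.join_p hRL y hy i]
      constructor
      · rintro (⟨x', y', g1, g2, g3, g4⟩ | (⟨x', y', g1, g2⟩ | g | ⟨x', g1, g2⟩) | g)
        · exact Or.inl ⟨x', y', Or.inr g1, g2, g3, g4⟩
        · have := hlt x' g1.1 x hx
          exact Or.inl ⟨x', y', Or.inl g1, this.le, g2, fun h => this.ne h.1⟩
        · exact Or.inr (Or.inl g)
        · exact Or.inr (Or.inr (hB' x' g1 x hx g2))
        · exact Or.inr (Or.inr g)
      · rintro (⟨x', y', g1 | g1, g2, g3, g4⟩ | g | g)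
        · exact Or.inr (Or.inl (Or.inl ⟨x', y', g1, g3⟩))
        · exact Or.inl ⟨x', y', g1, g2, g3, g4⟩
        · exact Or.inr (Or.inl (Or.inr (Or.inl g)))
        · exact Or.inr (Or.inr g)

include hlt hJ hRL in
theorem RD.join_eL {y : ℝ} (hy : y ∈ r1.J) : (r1.join r2).eL y = r1.eL y := by
  have hl := RD.join_lit hJ hlt
  have hn : ∀ x ∈ r2.I, x ∉ r1.I := fun x h => RD.join_not hlt h
  ext i
  · rfl
  · simp only [eL, hl, Set.mem_ofPred_eq, RD.join_f hRL y hy i]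
    simp only [join, Set.mem_union]
    constructor
    · rintro (⟨x', y', g1 | g1, g2⟩ | g | ⟨x', g1 | g1, g2⟩)
      · exact Or.inl ⟨x', y', g1, g2⟩
      · exact Or.inr (Or.inl (Or.inl ⟨x', y', g1, g2⟩))
      · exact Or.inr (Or.inl (Or.inr (Or.inl g)))
      · rw [if_pos g1] at g2; exact Or.inr (Or.inr ⟨x', g1, g2⟩)
      · rw [if_neg (hn x' g1)] at g2; exact Or.inr (Or.inl (Or.inr (Or.inr ⟨x', g1, g2⟩)))
    · rintro (⟨x', y', g1, g2⟩ | (⟨x', y', g1, g2⟩ | g | ⟨x', g1, g2⟩) | ⟨x', g1, g2⟩)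
      · exact Or.inl ⟨x', y', Or.inl g1, g2⟩
      · exact Or.inl ⟨x', y', Or.inr g1, g2⟩
      · exact Or.inr (Or.inl g)
      · exact Or.inr (Or.inr ⟨x', Or.inr g1, by rwa [if_neg (hn x' g1)]⟩)
      · exact Or.inr (Or.inr ⟨x', Or.inl g1, by rwa [if_pos g1]⟩)

include hlt hJ hRL in
theorem RD.join_eR {y : ℝ} (hy : y ∈ r1.J) : (r1.join r2).eR y = r2.eR y := by
  have hl := RD.join_lit hJ hlt
  have hn : ∀ x ∈ r2.I, x ∉ r1.I := fun x h => RD.join_not hlt h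
  ext i
  · simp only [eR, hl, Set.mem_ofPred_eq, RD.join_p hRL y hy i]
    simp only [join, Set.mem_union]
    constructor
    · rintro (⟨x', y', g1 | g1, g2⟩ | g | ⟨x', g1 | g1, g2⟩)
      · exact Or.inr (Or.inl (Or.inl ⟨x', y', g1, g2⟩))
      · exact Or.inl ⟨x', y', g1, g2⟩
      · exact Or.inr (Or.inl (Or.inr (Or.inl g)))
      · rw [if_pos g1] at g2; exact Or.inr (Or.inl (Or.inr (Or.inr ⟨x', g1, g2⟩)))
      · rw [if_neg (hn x' g1)] at g2; exact Or.inr (Or.inr ⟨x', g1, g2⟩)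
    · rintro (⟨x', y', g1, g2⟩ | (⟨x', y', g1, g2⟩ | g | ⟨x', g1, g2⟩) | ⟨x', g1, g2⟩)
      · exact Or.inl ⟨x', y', Or.inr g1, g2⟩
      · exact Or.inl ⟨x', y', Or.inl g1, g2⟩
      · exact Or.inr (Or.inl g)
      · exact Or.inr (Or.inr ⟨x', Or.inl g1, by rwa [if_pos g1]⟩)
      · exact Or.inr (Or.inr ⟨x', Or.inr g1, by rwa [if_neg (hn x' g1)]⟩)
  · rfl

open Classical in
include hlt hJ hRL h1 hT in
theorem RD.join_eB {x : ℝ} (hx : x ∈ r1.I ∪ r2.I) :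
    (r1.join r2).eB x = if x ∈ r1.I then r1.eB x else r2.eB x := by
  have hl := RD.join_lit hJ hlt
  have hn : ∀ x ∈ r2.I, x ∉ r1.I := fun x h => RD.join_not hlt h
  obtain ⟨y0, hy0⟩ := h1.Jn
  rcases hx with hx | hx
  · rw [if_pos hx]
    ext i
    · simp only [eB]; simp only [join, if_pos hx]
    · simp only [eB, hl, Set.mem_ofPred_eq]
      simp only [join, if_pos hx]
      constructor
      · rintro (⟨x', y', g1 | g1, g2⟩ | g | ⟨y', g1, g2⟩)
        · exact Or.inl ⟨x', y', g1, g2⟩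
        · have hy' : y' ∈ r1.J := hJ ▸ g1.2.1
          exact Or.inr (Or.inr ⟨y', hy', (RD.join_f hRL y' hy' i).2 (Or.inl ⟨x', y', g1, le_rfl⟩)⟩)
        · exact Or.inr (Or.inl g)
        · exact Or.inr (Or.inr ⟨y', g1, (RD.join_f hRL y' g1 i).2 (Or.inr (Or.inl g2))⟩)
      · rintro (⟨x', y', g1, g2⟩ | g | ⟨y', g1, g2⟩)
        · exact Or.inl ⟨x', y', Or.inl g1, g2⟩
        · exact Or.inr (Or.inl g)
        · rcases (RD.join_f hRL y' g1 i).1 g2 with ⟨x', y'', k1, k2⟩ | k | k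
          · exact Or.inl ⟨x', y'', Or.inr k1, (hlt x hx x' k1.1).le⟩
          · exact Or.inr (Or.inr ⟨y', g1, k⟩)
          · obtain ⟨x', k1, k2⟩ := k
            exact Or.inr (Or.inl ((hT x hx x' k1).2 k2))
  · rw [if_neg (hn x hx)]
    ext i
    · simp only [eB]; simp only [join, if_neg (hn x hx)]
    · simp only [eB, hl, Set.mem_ofPred_eq]
      simp only [join, if_neg (hn x hx), hJ]
      refine or_congr ⟨?_, ?_⟩ Iff.rfl
      · rintro ⟨x', y', g1 | g1, g2⟩
        · have := hlt x' g1.1 x hx; linarith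
        · exact ⟨x', y', g1, g2⟩
      · rintro ⟨x', y', g1, g2⟩; exact ⟨x', y', Or.inr g1, g2⟩
open Classical in
include hlt hJ hRL h1 hB in
theorem RD.join_eT {x : ℝ} (hx : x ∈ r1.I ∪ r2.I) :
    (r1.join r2).eT x = if x ∈ r1.I then r1.eT x else r2.eT x := by
  have hl := RD.join_lit hJ hlt
  have hn : ∀ x ∈ r2.I, x ∉ r1.I := fun x h => RD.join_not hlt h
  rcases hx with hx | hx
  · rw [if_pos hx]
    ext i
    · simp only [eT, hl, Set.mem_ofPred_eq]
      simp only [join, if_pos hx]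
      refine or_congr ⟨?_, ?_⟩ Iff.rfl
      · rintro ⟨x', y', g1 | g1, g2⟩
        · exact ⟨x', y', g1, g2⟩
        · have := hlt x hx x' g1.1; linarith
      · rintro ⟨x', y', g1, g2⟩; exact ⟨x', y', Or.inl g1, g2⟩
    · simp only [eT]; simp only [join, if_pos hx]
  · rw [if_neg (hn x hx)]
    ext i
    · simp only [eT, hl, Set.mem_ofPred_eq]
      simp only [join, if_neg (hn x hx), hJ]
      constructor
      · rintro (⟨x', y', g1 | g1, g2⟩ | g | ⟨y', g1, g2⟩)
        · have hy' : y' ∈ r1.J := g1.2.1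
          exact Or.inr (Or.inr ⟨y', hy', (RD.join_p hRL y' hy' i).2 (Or.inl ⟨x', y', g1, le_rfl⟩)⟩)
        · exact Or.inl ⟨x', y', g1, g2⟩
        · exact Or.inr (Or.inl g)
        · exact Or.inr (Or.inr ⟨y', g1, (RD.join_p hRL y' g1 i).2 (Or.inr (Or.inl g2))⟩)
      · rintro (⟨x', y', g1, g2⟩ | g | ⟨y', g1, g2⟩)
        · exact Or.inl ⟨x', y', Or.inr g1, g2⟩
        · exact Or.inr (Or.inl g)
        · rcases (RD.join_p hRL y' g1 i).1 g2 with ⟨x', y'', k1, k2⟩ | k | k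
          · exact Or.inl ⟨x', y'', Or.inl k1, (hlt x' k1.1 x hx).le⟩
          · exact Or.inr (Or.inr ⟨y', g1, k⟩)
          · obtain ⟨x', k1, k2⟩ := k
            exact Or.inr (Or.inl ((hB x' k1 x hx).1 k2))
    · simp only [eT]; simp only [join, if_neg (hn x hx)]

open Classical in
include hlt hJ hRL h1 hB hT in
theorem RD.join_desc : (r1.join r2).desc =
    ⟨r1.desc.kI.comb r2.desc.kI, r1.desc.kJ, r1.desc.L, r2.desc.R, combW r1.desc.T r2.desc.T,
      combW r1.desc.B r2.desc.B⟩ := by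
  have hn : ∀ x ∈ r2.I, x ∉ r1.I := fun x h => RD.join_not hlt h
  have e1 : ∀ {x}, x ∈ r1.I → x ∈ r1.I ∪ r2.I := fun h => Or.inl h
  have e2 : ∀ {x}, x ∈ r2.I → x ∈ r1.I ∪ r2.I := fun h => Or.inr h
  simp only [desc]
  congr 1
  · exact kd_comb hlt
  · exact W_congr fun y hy => RD.join_eL hJ hlt hRL hy
  · rw [hJ]; exact W_congr fun y hy => RD.join_eR hJ hlt hRL hy
  · change W _ (r1.I ∪ r2.I) = _
    rw [W_comb _ hlt]
    congr 1
    · exact W_congr fun x hx => by rw [RD.join_eT h1 hJ hlt hRL hB (e1 hx), if_pos hx]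
    · exact W_congr fun x hx => by rw [RD.join_eT h1 hJ hlt hRL hB (e2 hx), if_neg (hn x hx)]
  · change W _ (r1.I ∪ r2.I) = _
    rw [W_comb _ hlt]
    congr 1
    · exact W_congr fun x hx => by rw [RD.join_eB h1 hJ hlt hRL hT (e1 hx), if_pos hx]
    · exact W_congr fun x hx => by rw [RD.join_eB h1 hJ hlt hRL hT (e2 hx), if_neg (hn x hx)]
end join

theorem Rl_join (C : Lab ι → Prop) : ∀ d1 ∈ Rl C, ∀ d2 ∈ Rl C, d1.R = d2.L → d1.kJ = d2.kJ →
    (d1.kI.mx ↔ ¬ d2.kI.mn) →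
    (∀ m m', (d1.B m).ne → (d2.B m').ne → m ≤ m') →
    (∀ m m', (d1.T m).ne → (d2.T m').ne → m ≤ m') →
    (⟨d1.kI.comb d2.kI, d1.kJ, d1.L, d2.R, combW d1.T d2.T, combW d1.B d2.B⟩ : Ds ι) ∈ Rl C := by
  rintro _ ⟨r1, h1, rfl⟩ _ ⟨r2, h2, rfl⟩ hRL hk hI hB hT
  obtain ⟨I1, I2, e1, e2, he1, he2, ho1, ho2, hoc, hlt⟩ :=
    exists_adjacent r1.I r2.I h1.Ic h1.In h2.Ic h2.In hI
  obtain ⟨g, hg, hge⟩ := Wiso h2.Jc h1.Jc h2.eL_mono h1.eR_mono hRL.symm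
  have hid := SIso.id r1.J
  rw [← RD.place_desc he1 hid, ← RD.place_desc he2 hg] at *
  have k1 := RD.place_ok he1 hid h1 ho1 h1.Jc
  have k2 := RD.place_ok he2 hg h2 ho2 h1.Jc
  have hRL' : ∀ y ∈ (r1.place I1 r1.J e1 fun x => x).J,
      (r1.place I1 r1.J e1 fun x => x).eR y = (r2.place I2 r1.J e2 g).eL y := by
    intro y hy
    rw [RD.place_eR he1 hid hy, RD.place_eL he2 hg hy, hge y hy]
  refine ⟨_, RD.join_ok k1 k2 rfl hlt hoc hRL' ?_ ?_, RD.join_desc k1 rfl hlt hRL' ?_ ?_⟩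
  · exact fun x hx x' hx' => hB _ _ (W_ne.2 ⟨x, hx, rfl⟩) (W_ne.2 ⟨x', hx', rfl⟩)
  · exact fun x hx x' hx' => hT _ _ (W_ne.2 ⟨x, hx, rfl⟩) (W_ne.2 ⟨x', hx', rfl⟩)
  · exact fun x hx x' hx' => hB _ _ (W_ne.2 ⟨x, hx, rfl⟩) (W_ne.2 ⟨x', hx', rfl⟩)
  · exact fun x hx x' hx' => hT _ _ (W_ne.2 ⟨x, hx, rfl⟩) (W_ne.2 ⟨x', hx', rfl⟩)
end Temporal
end

section
namespace Temporal

section limcore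
variable {a b : ℕ → ℝ} {lit : ℝ → ℝ → Prop} {F : ℝ → ℝ → Prop} {τ δ S : ℕ → ℝ → Prop} {mrf mbf : Prop}
  (ha : StrictMono a) (hb : StrictAnti b) (hau : ∀ x, ∃ n, x ≤ a n) (hbu : ∀ y, ∃ n, b n ≤ y)
  (hlit : ∀ x y, lit x y → a 0 < x ∧ y < b 0)
  (hτ : ∀ n x x', a n < x → x ≤ x' → τ n x' → τ n x)
  (hR : ∀ n x y, a n < x → b (n+1) ≤ y ∧ y < b n → (F x y ↔ (∃ x' y', lit x' y' ∧ x ≤ x' ∧ y ≤ y' ∧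
    y' < b n ∧ ¬ (x' = x ∧ y' = y)) ∨ τ n x ∨ mrf))
  (hT : ∀ n x, a (n+1) < x → (τ (n+1) x ↔ (∃ x' y', lit x' y' ∧ x ≤ x' ∧ b (n+1) ≤ y' ∧ y' < b n) ∨
    τ n x ∨ mrf))
  (hC : ∀ n x y, a n < x ∧ x ≤ a (n+1) → y < b (n+1) → (F x y ↔ (∃ x' y', lit x' y' ∧ x ≤ x' ∧
    x' ≤ a (n+1) ∧ y ≤ y' ∧ y' < b (n+1) ∧ ¬ (x' = x ∧ y' = y)) ∨ S n x ∨ δ (n+1) y))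
  (hS : ∀ n x, a n < x ∧ x ≤ a (n+1) → (S n x ↔ (∃ x' y', lit x' y' ∧ x ≤ x' ∧ b (n+1) ≤ y' ∧ y' < b n) ∨
    τ n x ∨ mrf))
  (hD0 : ∀ n y, b (n+1) ≤ y ∧ y < b n → (δ n y ↔ (∃ x' y', lit x' y' ∧ a n < x' ∧ y ≤ y' ∧ y' < b n) ∨
    mrf ∨ ∃ x, a n < x ∧ τ n x))
  (hD1 : ∀ n y, y < b (n+1) → (δ n y ↔ (∃ x' y', lit x' y' ∧ a n < x' ∧ x' ≤ a (n+1) ∧ y ≤ y' ∧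
    y' < b (n+1)) ∨ δ (n+1) y ∨ ∃ x, (a n < x ∧ x ≤ a (n+1)) ∧ S n x))
  (hE : ∀ n x, a n < x ∧ x ≤ a (n+1) → (mbf ↔ (∃ x' y', lit x' y' ∧ x ≤ x' ∧ x' ≤ a (n+1) ∧
    y' < b (n+1)) ∨ S n x ∨ ∃ y, y < b (n+1) ∧ δ (n+1) y))

include hau ha in
theorem lim_col (n : ℕ) {x : ℝ} (hx : a n < x) : ∃ k, a (n+k) < x ∧ x ≤ a (n+k+1) := by
  classical
  have : ∃ k, x ≤ a (n+k+1) := by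
    obtain ⟨m, hm⟩ := hau x
    exact ⟨m, hm.trans (ha.monotone (by omega))⟩
  refine ⟨Nat.find this, ?_, Nat.find_spec this⟩
  rcases h : Nat.find this with _ | k
  · exact hx
  · have := Nat.find_min this (m := k) (by omega)
    exact not_le.1 this

include hbu hb in
theorem lim_row (n : ℕ) {y : ℝ} (hy : y < b n) : ∃ k, b (n+k+1) ≤ y ∧ y < b (n+k) := by
  obtain ⟨k, h1, h2⟩ := lim_col (a := fun n => - b n) (fun i j h => neg_lt_neg (hb h))
    (fun x => by obtain ⟨n, h⟩ := hbu (-x); exact ⟨n, by linarith⟩) n (x := -y) (by simpa using hy)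
  exact ⟨k, by linarith, by linarith⟩

include hb hlit ha hT in
theorem lim1 (n : ℕ) : ∀ x, a n < x → (τ n x ↔ (∃ x' y', lit x' y' ∧ x ≤ x' ∧ b n ≤ y') ∨ τ 0 x ∨
    (0 < n ∧ mrf)) := by
  induction n with
  | zero =>
    intro x hx
    constructor
    · intro h; exact Or.inr (Or.inl h)
    · rintro (⟨x', y', h1, h2, h3⟩ | h | h)
      · have := (hlit _ _ h1).2; linarith
      · exact h
      · exact absurd h.1 (lt_irrefl _)
  | succ n ih =>
    intro x hx
    have := hb n.lt_succ_self
    rw [hT n x hx, ih x (lt_trans (ha n.lt_succ_self) hx)]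
    constructor
    · rintro (⟨x', y', h1, h2, h3, h4⟩ | (⟨x', y', h1, h2, h3⟩ | h | h) | h)
      · exact Or.inl ⟨x', y', h1, h2, h3⟩
      · exact Or.inl ⟨x', y', h1, h2, this.le.trans h3⟩
      · exact Or.inr (Or.inl h)
      · exact Or.inr (Or.inr ⟨n.succ_pos, h.2⟩)
      · exact Or.inr (Or.inr ⟨n.succ_pos, h⟩)
    · rintro (⟨x', y', h1, h2, h3⟩ | h | h)
      · rcases lt_or_ge y' (b n) with h4 | h4
        · exact Or.inl ⟨x', y', h1, h2, h3, h4⟩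
        · exact Or.inr (Or.inl (Or.inl ⟨x', y', h1, h2, h4⟩))
      · exact Or.inr (Or.inl (Or.inr (Or.inl h)))
      · exact Or.inr (Or.inr h.2)

include hb hlit ha hT hR in
theorem lim2 (n : ℕ) (x y : ℝ) (hx : a n < x) (hy : b (n+1) ≤ y ∧ y < b n) : F x y ↔
    (∃ x' y', lit x' y' ∧ x ≤ x' ∧ y ≤ y' ∧ ¬ (x' = x ∧ y' = y)) ∨ τ 0 x ∨ mrf := by
  rw [hR n x y hx hy, lim1 ha hb hlit hT n x hx]
  constructor
  · rintro (⟨x', y', h1, h2, h3, h4, h5⟩ | (⟨x', y', h1, h2, h3⟩ | h | h) | h)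
    · exact Or.inl ⟨x', y', h1, h2, h3, h5⟩
    · exact Or.inl ⟨x', y', h1, h2, hy.2.le.trans h3, fun h => by linarith [h.2]⟩
    · exact Or.inr (Or.inl h)
    · exact Or.inr (Or.inr h.2)
    · exact Or.inr (Or.inr h)
  · rintro (⟨x', y', h1, h2, h3, h5⟩ | h | h)
    · rcases lt_or_ge y' (b n) with h4 | h4
      · exact Or.inl ⟨x', y', h1, h2, h3, h4, h5⟩
      · exact Or.inr (Or.inl (Or.inl ⟨x', y', h1, h2, h4⟩))
    · exact Or.inr (Or.inl (Or.inr (Or.inl h)))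
    · exact Or.inr (Or.inr h)

include hb hlit ha hT hS in
theorem limS (n : ℕ) (x : ℝ) (hx : a n < x ∧ x ≤ a (n+1)) : S n x ↔
    (∃ x' y', lit x' y' ∧ x ≤ x' ∧ b (n+1) ≤ y') ∨ τ 0 x ∨ mrf := by
  have := hb n.lt_succ_self
  rw [hS n x hx, lim1 ha hb hlit hT n x hx.1]
  constructor
  · rintro (⟨x', y', h1, h2, h3, h4⟩ | (⟨x', y', h1, h2, h3⟩ | h | h) | h)
    · exact Or.inl ⟨x', y', h1, h2, h3⟩
    · exact Or.inl ⟨x', y', h1, h2, this.le.trans h3⟩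
    · exact Or.inr (Or.inl h)
    · exact Or.inr (Or.inr h.2)
    · exact Or.inr (Or.inr h)
  · rintro (⟨x', y', h1, h2, h3⟩ | h | h)
    · rcases lt_or_ge y' (b n) with h4 | h4
      · exact Or.inl ⟨x', y', h1, h2, h3, h4⟩
      · exact Or.inr (Or.inl (Or.inl ⟨x', y', h1, h2, h4⟩))
    · exact Or.inr (Or.inl (Or.inr (Or.inl h)))
    · exact Or.inr (Or.inr h)

include hb hlit ha hT hS hD0 hD1 in
theorem lim3 (k : ℕ) : ∀ (n : ℕ) (y : ℝ), b (n+k+1) ≤ y ∧ y < b (n+k) → (δ n y ↔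
    (∃ x' y', lit x' y' ∧ a n < x' ∧ y ≤ y') ∨ mrf ∨ ∃ x, a n < x ∧ τ 0 x) := by
  induction k with
  | zero =>
    intro n y hy
    rw [hD0 n y hy]
    constructor
    · rintro (⟨x', y', h1, h2, h3, h4⟩ | h | ⟨x, h1, h2⟩)
      · exact Or.inl ⟨x', y', h1, h2, h3⟩
      · exact Or.inr (Or.inl h)
      · rw [lim1 ha hb hlit hT n x h1] at h2
        rcases h2 with ⟨x', y', h2, h3, h4⟩ | h | h
        · exact Or.inl ⟨x', y', h2, h1.trans_le h3, hy.2.le.trans h4⟩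
        · exact Or.inr (Or.inr ⟨x, h1, h⟩)
        · exact Or.inr (Or.inl h.2)
    · rintro (⟨x', y', h1, h2, h3⟩ | h | ⟨x, h1, h2⟩)
      · rcases lt_or_ge y' (b n) with h4 | h4
        · exact Or.inl ⟨x', y', h1, h2, h3, h4⟩
        · exact Or.inr (Or.inr ⟨x', h2, (lim1 ha hb hlit hT n x' h2).2
            (Or.inl ⟨x', y', h1, le_rfl, h4⟩)⟩)
      · exact Or.inr (Or.inl h)
      · exact Or.inr (Or.inr ⟨x, h1, (lim1 ha hb hlit hT n x h1).2 (Or.inr (Or.inl h2))⟩)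
  | succ k ih =>
    intro n y hy
    have e : n + 1 + k = n + (k + 1) := by omega
    have hy1 : y < b (n+1) := hy.2.trans_le (hb.antitone (by omega))
    have hab := ha n.lt_succ_self
    rw [hD1 n y hy1, ih (n+1) y (by rw [e]; exact hy)]
    have hSS := fun x hx => limS ha hb hlit hT hS n x hx
    constructor
    · rintro (⟨x', y', h1, h2, h3, h4, h5⟩ | (⟨x', y', h1, h2, h3⟩ | h | ⟨x, h1, h2⟩) | ⟨x, h1, h2⟩)
      · exact Or.inl ⟨x', y', h1, h2, h4⟩
      · exact Or.inl ⟨x', y', h1, hab.trans h2, h3⟩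
      · exact Or.inr (Or.inl h)
      · exact Or.inr (Or.inr ⟨x, hab.trans h1, h2⟩)
      · rcases (hSS x h1).1 h2 with ⟨x', y', h3, h4, h5⟩ | h | h
        · exact Or.inl ⟨x', y', h3, h1.1.trans_le h4, hy1.le.trans h5⟩
        · exact Or.inr (Or.inr ⟨x, h1.1, h⟩)
        · exact Or.inr (Or.inl h)
    · rintro (⟨x', y', h1, h2, h3⟩ | h | ⟨x, h1, h2⟩)
      · rcases le_or_gt x' (a (n+1)) with h5 | h5
        · rcases lt_or_ge y' (b (n+1)) with h4 | h4
          · exact Or.inl ⟨x', y', h1, h2, h5, h3, h4⟩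
          · exact Or.inr (Or.inr ⟨x', ⟨h2, h5⟩, (hSS x' ⟨h2, h5⟩).2 (Or.inl ⟨x', y', h1, le_rfl, h4⟩)⟩)
        · exact Or.inr (Or.inl (Or.inl ⟨x', y', h1, h5, h3⟩))
      · exact Or.inr (Or.inl (Or.inr (Or.inl h)))
      · rcases le_or_gt x (a (n+1)) with h5 | h5
        · exact Or.inr (Or.inr ⟨x, ⟨h1, h5⟩, (hSS x ⟨h1, h5⟩).2 (Or.inr (Or.inl h2))⟩)
        · exact Or.inr (Or.inl (Or.inr (Or.inr ⟨x, h5, h2⟩)))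

include hb hlit ha hT hS hD0 hD1 hbu in
theorem lim3' (n : ℕ) (y : ℝ) (hy : y < b n) : δ n y ↔
    (∃ x' y', lit x' y' ∧ a n < x' ∧ y ≤ y') ∨ mrf ∨ ∃ x, a n < x ∧ τ 0 x := by
  obtain ⟨k, hk⟩ := lim_row hb hbu n hy
  exact lim3 ha hb hlit hT hS hD0 hD1 k n y hk

include hb hlit ha hT hS hD0 hD1 hbu hC hτ in
theorem lim4 (n : ℕ) (x y : ℝ) (hx : a n < x ∧ x ≤ a (n+1)) (hy : y < b (n+1)) : F x y ↔
    (∃ x' y', lit x' y' ∧ x ≤ x' ∧ y ≤ y' ∧ ¬ (x' = x ∧ y' = y)) ∨ τ 0 x ∨ mrf := by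
  have h0 : a 0 ≤ a n := ha.monotone n.zero_le
  rw [hC n x y hx hy, limS ha hb hlit hT hS n x hx, lim3' ha hb hbu hlit hT hS hD0 hD1 (n+1) y hy]
  constructor
  · rintro (⟨x', y', h1, h2, h3, h4, h5, h6⟩ | (⟨x', y', h1, h2, h3⟩ | h | h) |
      (⟨x', y', h1, h2, h3⟩ | h | ⟨x', h1, h2⟩))
    · exact Or.inl ⟨x', y', h1, h2, h4, h6⟩
    · exact Or.inl ⟨x', y', h1, h2, hy.le.trans h3, fun h => by linarith [h.2]⟩
    · exact Or.inr (Or.inl h)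
    · exact Or.inr (Or.inr h)
    · exact Or.inl ⟨x', y', h1, hx.2.trans h2.le, h3, fun h => by linarith [h.1, hx.2]⟩
    · exact Or.inr (Or.inr h)
    · exact Or.inr (Or.inl (hτ 0 x x' (h0.trans_lt hx.1) (hx.2.trans h1.le) h2))
  · rintro (⟨x', y', h1, h2, h3, h4⟩ | h | h)
    · rcases lt_or_ge y' (b (n+1)) with h5 | h5
      · rcases le_or_gt x' (a (n+1)) with h6 | h6
        · exact Or.inl ⟨x', y', h1, h2, h6, h3, h5, h4⟩
        · exact Or.inr (Or.inr (Or.inl ⟨x', y', h1, h6, h3⟩))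
      · exact Or.inr (Or.inl (Or.inl ⟨x', y', h1, h2, h5⟩))
    · exact Or.inr (Or.inl (Or.inr (Or.inl h)))
    · exact Or.inr (Or.inl (Or.inr (Or.inr h)))

include hb hlit ha hT hS hD0 hD1 hbu hτ hE hau in
theorem lim5 (x : ℝ) (hx : a 0 < x) : mbf ↔ (∃ x' y', lit x' y' ∧ x ≤ x') ∨ τ 0 x ∨ mrf := by
  obtain ⟨n, hx⟩ := lim_col ha hau 0 hx
  rw [zero_add] at hx
  have h0 : a 0 ≤ a n := ha.monotone n.zero_le
  have h3 := lim3' ha hb hbu hlit hT hS hD0 hD1 (n+1)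
  rw [hE n x hx, limS ha hb hlit hT hS n x hx]
  constructor
  · rintro (⟨x', y', h1, h2, -⟩ | (⟨x', y', h1, h2, -⟩ | h | h) | ⟨y, h1, h2⟩)
    · exact Or.inl ⟨x', y', h1, h2⟩
    · exact Or.inl ⟨x', y', h1, h2⟩
    · exact Or.inr (Or.inl h)
    · exact Or.inr (Or.inr h)
    · rcases (h3 y h1).1 h2 with ⟨x', y', h1, h2, -⟩ | h | ⟨x', h1, h2⟩
      · exact Or.inl ⟨x', y', h1, hx.2.trans h2.le⟩
      · exact Or.inr (Or.inr h)
      · exact Or.inr (Or.inl (hτ 0 x x' (h0.trans_lt hx.1) (hx.2.trans h1.le) h2))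
  · rintro (⟨x', y', h1, h2⟩ | h | h)
    · rcases lt_or_ge y' (b (n+1)) with h5 | h5
      · rcases le_or_gt x' (a (n+1)) with h6 | h6
        · exact Or.inl ⟨x', y', h1, h2, h6, h5⟩
        · exact Or.inr (Or.inr ⟨y', h5, (h3 y' h5).2 (Or.inl ⟨x', y', h1, h6, le_rfl⟩)⟩)
      · exact Or.inr (Or.inl (Or.inl ⟨x', y', h1, h2, h5⟩))
    · exact Or.inr (Or.inl (Or.inr (Or.inl h)))
    · exact Or.inr (Or.inl (Or.inr (Or.inr h)))
end limcore
end Temporal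
end

section
namespace Temporal
variable {ι : Type}

def Mo.anti (m : Mo ι) : Mo ι := ⟨m.f, m.p⟩
def Lab.anti (m : Lab ι) : Lab ι := ⟨m.l, m.p, m.f⟩

theorem Mo.anti_le {a b : Mo ι} (h : a ≤ b) : b.anti ≤ a.anti := ⟨h.2, h.1⟩

def RD.anti (r : RD ι) : RD ι :=
  ⟨{x | -x ∈ r.J}, {y | -y ∈ r.I}, fun x y => (r.h (-y) (-x)).anti, fun y => r.oT (-y),
    fun y => r.oB (-y), fun x => r.oR (-x), fun x => r.oL (-x)⟩

theorem RD.anti_lit (r : RD ι) (i : ι) (x y : ℝ) : r.anti.lit i x y ↔ r.lit i (-y) (-x) := by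
  simp only [lit, anti, Lab.anti, Set.mem_ofPred_eq]; tauto

theorem exists_neg_swap {P : ℝ → ℝ → Prop} : (∃ x y, P (-y) (-x)) ↔ ∃ x y, P x y := by
  constructor
  · rintro ⟨x, y, h⟩; exact ⟨_, _, h⟩
  · rintro ⟨x, y, h⟩; exact ⟨-y, -x, by simpa using h⟩

theorem exists_neg' {P : ℝ → Prop} : (∃ x, P (-x)) ↔ ∃ x, P x :=
  ⟨fun ⟨x, h⟩ => ⟨_, h⟩, fun ⟨x, h⟩ => ⟨-x, by simpa using h⟩⟩

theorem RD.anti_eL (r : RD ι) (y : ℝ) : r.anti.eL y = (r.eT (-y)).anti := by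
  ext i
  · rfl
  · simp only [eL, eT, Mo.anti, Set.mem_ofPred_eq, anti_lit]
    rw [← exists_neg_swap (P := fun x' y' => r.lit i x' y' ∧ x' ≤ -y),
      ← exists_neg' (P := fun x => x ∈ r.J ∧ i ∈ r.oL x)]
    simp only [neg_le_neg_iff]; rfl

theorem RD.anti_eT (r : RD ι) (y : ℝ) : r.anti.eT y = (r.eL (-y)).anti := by
  ext i
  · simp only [eL, eT, Mo.anti, Set.mem_ofPred_eq, anti_lit]
    rw [← exists_neg_swap (P := fun x' y' => r.lit i x' y' ∧ -y ≤ y'),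
      ← exists_neg' (P := fun x => x ∈ r.I ∧ i ∈ r.oT x)]
    simp only [neg_le_neg_iff]; rfl
  · rfl

theorem RD.anti_eR (r : RD ι) (y : ℝ) : r.anti.eR y = (r.eB (-y)).anti := by
  ext i
  · simp only [eR, eB, Mo.anti, Set.mem_ofPred_eq, anti_lit]
    rw [← exists_neg_swap (P := fun x' y' => r.lit i x' y' ∧ -y ≤ x'),
      ← exists_neg' (P := fun x => x ∈ r.J ∧ i ∈ r.oR x)]
    simp only [neg_le_neg_iff]; rfl
  · rfl

theorem RD.anti_eB (r : RD ι) (y : ℝ) : r.anti.eB y = (r.eR (-y)).anti := by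
  ext i
  · rfl
  · simp only [eR, eB, Mo.anti, Set.mem_ofPred_eq, anti_lit]
    rw [← exists_neg_swap (P := fun x' y' => r.lit i x' y' ∧ y' ≤ -y),
      ← exists_neg' (P := fun x => x ∈ r.I ∧ i ∈ r.oB x)]
    simp only [neg_le_neg_iff]; rfl

theorem ordConnected_neg {S : Set ℝ} (h : S.OrdConnected) : {x | -x ∈ S}.OrdConnected := by
  constructor
  rintro x hx y hy z ⟨h1, h2⟩
  exact h.out hy hx ⟨neg_le_neg h2, neg_le_neg h1⟩

def antiC (C : Lab ι → Prop) : Lab ι → Prop := fun t => C t.anti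

theorem RD.Ok.anti {C : Lab ι → Prop} {r : RD ι} (h : r.Ok C) : r.anti.Ok (antiC C) where
  Ic := ordConnected_neg h.Jc
  Jc := ordConnected_neg h.Ic
  In := by obtain ⟨x, hx⟩ := h.Jn; exact ⟨-x, by simpa [RD.anti] using hx⟩
  Jn := by obtain ⟨x, hx⟩ := h.In; exact ⟨-x, by simpa [RD.anti] using hx⟩
  mL := fun a ha b hb hab => h.mT _ hb _ ha (neg_le_neg hab)
  mR := fun a ha b hb hab => h.mB _ hb _ ha (neg_le_neg hab)
  mB := fun a ha b hb hab => h.mR _ hb _ ha (neg_le_neg hab)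
  mT := fun a ha b hb hab => h.mL _ hb _ ha (neg_le_neg hab)
  hC := fun x hx y hy => h.hC (-y) hy (-x) hx
  hf := fun x hx y hy i => by
    change i ∈ (r.h (-y) (-x)).p ↔ _
    rw [h.hp (-y) hy (-x) hx i]
    simp only [anti_lit]
    rw [← exists_neg_swap (P := fun x' y' => r.lit i x' y' ∧ x' ≤ -y ∧ y' ≤ -x ∧ ¬ (x' = -y ∧ y' = -x))]
    simp only [neg_le_neg_iff, neg_inj]
    constructor
    · rintro (⟨a, b, h1, h2, h3, h4⟩ | h | h)
      · exact Or.inl ⟨a, b, h1, h3, h2, fun hh => h4 ⟨hh.2, hh.1⟩⟩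
      · exact Or.inr (Or.inr h)
      · exact Or.inr (Or.inl h)
    · rintro (⟨a, b, h1, h2, h3, h4⟩ | h | h)
      · exact Or.inl ⟨a, b, h1, h3, h2, fun hh => h4 ⟨hh.2, hh.1⟩⟩
      · exact Or.inr (Or.inr h)
      · exact Or.inr (Or.inl h)
  hp := fun x hx y hy i => by
    change i ∈ (r.h (-y) (-x)).f ↔ _
    rw [h.hf (-y) hy (-x) hx i]
    simp only [anti_lit]
    rw [← exists_neg_swap (P := fun x' y' => r.lit i x' y' ∧ -y ≤ x' ∧ -x ≤ y' ∧ ¬ (x' = -y ∧ y' = -x))]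
    simp only [neg_le_neg_iff, neg_inj]
    constructor
    · rintro (⟨a, b, h1, h2, h3, h4⟩ | h | h)
      · exact Or.inl ⟨a, b, h1, h3, h2, fun hh => h4 ⟨hh.2, hh.1⟩⟩
      · exact Or.inr (Or.inr h)
      · exact Or.inr (Or.inl h)
    · rintro (⟨a, b, h1, h2, h3, h4⟩ | h | h)
      · exact Or.inl ⟨a, b, h1, h3, h2, fun hh => h4 ⟨hh.2, hh.1⟩⟩
      · exact Or.inr (Or.inr h)
      · exact Or.inr (Or.inl h)

/-- data of an infinite staircase decomposition -/
structure LD (ι : Type) where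
  a : ℕ → ℝ
  b : ℕ → ℝ
  h : ℝ → ℝ → Lab ι
  UL : ℕ → RD ι
  UR : ℕ → RD ι
  LL : ℕ → RD ι
  tT : ℕ → ℝ → Mo ι
  tL : ℕ → ℝ → Mo ι
  mr : Mo ι
  mb : Mo ι

structure LD.Ok (C : Lab ι → Prop) (g : LD ι) : Prop where
  ha : StrictMono g.a
  hb : StrictAnti g.b
  hau : ∀ x, ∃ n, x ≤ g.a n
  hbu : ∀ y, ∃ n, g.b n ≤ y
  ULI : ∀ n, (g.UL n).I = Set.Ioc (g.a n) (g.a (n+1))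
  URI : ∀ n, (g.UR n).I = Set.Ioi (g.a (n+1))
  LLI : ∀ n, (g.LL n).I = Set.Ioc (g.a n) (g.a (n+1))
  ULJ : ∀ n, (g.UL n).J = Set.Ico (g.b (n+1)) (g.b n)
  URJ : ∀ n, (g.UR n).J = Set.Ico (g.b (n+1)) (g.b n)
  LLJ : ∀ n, (g.LL n).J = Set.Iio (g.b (n+1))
  ULo : ∀ n, (g.UL n).Ok C
  URo : ∀ n, (g.UR n).Ok C
  LLo : ∀ n, (g.LL n).Ok C
  ULh : ∀ n, ∀ x ∈ (g.UL n).I, ∀ y ∈ (g.UL n).J, (g.UL n).h x y = g.h x y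
  URh : ∀ n, ∀ x ∈ (g.UR n).I, ∀ y ∈ (g.UR n).J, (g.UR n).h x y = g.h x y
  LLh : ∀ n, ∀ x ∈ (g.LL n).I, ∀ y ∈ (g.LL n).J, (g.LL n).h x y = g.h x y
  tTm : ∀ n, MonotoneOn (g.tT n) (Set.Ioi (g.a n))
  tLm : ∀ n, MonotoneOn (g.tL n) (Set.Iio (g.b n))
  ULT : ∀ n, ∀ x ∈ (g.UL n).I, (g.UL n).eT x = g.tT n x
  URT : ∀ n, ∀ x ∈ (g.UR n).I, (g.UR n).eT x = g.tT n x
  ULL : ∀ n, ∀ y ∈ (g.UL n).J, (g.UL n).eL y = g.tL n y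
  LLL : ∀ n, ∀ y ∈ (g.LL n).J, (g.LL n).eL y = g.tL n y
  URB : ∀ n, ∀ x ∈ (g.UR n).I, (g.UR n).eB x = g.tT (n+1) x
  LLR : ∀ n, ∀ y ∈ (g.LL n).J, (g.LL n).eR y = g.tL (n+1) y
  ULR : ∀ n, ∀ y ∈ (g.UL n).J, (g.UL n).eR y = (g.UR n).eL y
  ULB : ∀ n, ∀ x ∈ (g.UL n).I, (g.UL n).eB x = (g.LL n).eT x
  URR : ∀ n, ∀ y ∈ (g.UR n).J, (g.UR n).eR y = g.mr
  LLB : ∀ n, ∀ x ∈ (g.LL n).I, (g.LL n).eB x = g.mb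
  URBm : ∀ n, ∀ x ∈ (g.UL n).I, ∀ x' ∈ (g.UR n).I, (g.UL n).eB x ≤ (g.UR n).eB x'
  LLRm : ∀ n, ∀ y ∈ (g.LL n).J, ∀ y' ∈ (g.UL n).J, (g.LL n).eR y ≤ (g.UL n).eR y'

def LD.anti (g : LD ι) : LD ι :=
  ⟨fun n => - g.b n, fun n => - g.a n, fun x y => (g.h (-y) (-x)).anti, fun n => (g.UL n).anti,
    fun n => (g.LL n).anti, fun n => (g.UR n).anti, fun n x => (g.tL n (-x)).anti,
    fun n x => (g.tT n (-x)).anti, g.mb.anti, g.mr.anti⟩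

theorem LD.Ok.anti {C : Lab ι → Prop} {g : LD ι} (h : g.Ok C) : g.anti.Ok (antiC C) where
  ha := fun i j hij => neg_lt_neg (h.hb hij)
  hb := fun i j hij => neg_lt_neg (h.ha hij)
  hau := fun x => by obtain ⟨n, hn⟩ := h.hbu (-x); exact ⟨n, by simp only [LD.anti]; linarith⟩
  hbu := fun x => by obtain ⟨n, hn⟩ := h.hau (-x); exact ⟨n, by simp only [LD.anti]; linarith⟩
  ULI := fun n => by
    ext x; simp only [LD.anti, RD.anti, h.ULJ, Set.mem_ofPred_eq, Set.mem_Ico, Set.mem_Ioc]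
    constructor <;> rintro ⟨h1, h2⟩ <;> constructor <;> linarith
  URI := fun n => by
    ext x; simp only [LD.anti, RD.anti, h.LLJ, Set.mem_ofPred_eq, Set.mem_Iio, Set.mem_Ioi]
    constructor <;> intro h <;> linarith
  LLI := fun n => by
    ext x; simp only [LD.anti, RD.anti, h.URJ, Set.mem_ofPred_eq, Set.mem_Ico, Set.mem_Ioc]
    constructor <;> rintro ⟨h1, h2⟩ <;> constructor <;> linarith
  ULJ := fun n => by
    ext x; simp only [LD.anti, RD.anti, h.ULI, Set.mem_ofPred_eq, Set.mem_Ico, Set.mem_Ioc]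
    constructor <;> rintro ⟨h1, h2⟩ <;> constructor <;> linarith
  URJ := fun n => by
    ext x; simp only [LD.anti, RD.anti, h.LLI, Set.mem_ofPred_eq, Set.mem_Ico, Set.mem_Ioc]
    constructor <;> rintro ⟨h1, h2⟩ <;> constructor <;> linarith
  LLJ := fun n => by
    ext x; simp only [LD.anti, RD.anti, h.URI, Set.mem_ofPred_eq, Set.mem_Iio, Set.mem_Ioi]
    constructor <;> intro h <;> linarith
  ULo := fun n => (h.ULo n).anti
  URo := fun n => (h.LLo n).anti
  LLo := fun n => (h.URo n).anti
  ULh := fun n x hx y hy => congrArg Lab.anti (h.ULh n (-y) hy (-x) hx)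
  URh := fun n x hx y hy => congrArg Lab.anti (h.LLh n (-y) hy (-x) hx)
  LLh := fun n x hx y hy => congrArg Lab.anti (h.URh n (-y) hy (-x) hx)
  tTm := fun n x hx y hy hxy => Mo.anti_le (h.tLm n (a := -y) (b := -x)
    (by simpa [LD.anti, neg_lt] using hy) (by simpa [LD.anti, neg_lt] using hx) (neg_le_neg hxy))
  tLm := fun n x hx y hy hxy => Mo.anti_le (h.tTm n (a := -y) (b := -x)
    (by simpa [LD.anti, lt_neg] using hy) (by simpa [LD.anti, lt_neg] using hx) (neg_le_neg hxy))
  ULT := fun n x hx => ((g.UL n).anti_eT x).trans (congrArg Mo.anti (h.ULL n (-x) hx))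
  URT := fun n x hx => ((g.LL n).anti_eT x).trans (congrArg Mo.anti (h.LLL n (-x) hx))
  ULL := fun n x hx => ((g.UL n).anti_eL x).trans (congrArg Mo.anti (h.ULT n (-x) hx))
  LLL := fun n x hx => ((g.UR n).anti_eL x).trans (congrArg Mo.anti (h.URT n (-x) hx))
  URB := fun n x hx => ((g.LL n).anti_eB x).trans (congrArg Mo.anti (h.LLR n (-x) hx))
  LLR := fun n x hx => ((g.UR n).anti_eR x).trans (congrArg Mo.anti (h.URB n (-x) hx))
  ULR := fun n x hx => ((g.UL n).anti_eR x).trans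
    ((congrArg Mo.anti (h.ULB n (-x) hx)).trans ((g.LL n).anti_eL x).symm)
  ULB := fun n x hx => ((g.UL n).anti_eB x).trans
    ((congrArg Mo.anti (h.ULR n (-x) hx)).trans ((g.UR n).anti_eT x).symm)
  URR := fun n x hx => ((g.LL n).anti_eR x).trans (congrArg Mo.anti (h.LLB n (-x) hx))
  LLB := fun n x hx => ((g.UR n).anti_eB x).trans (congrArg Mo.anti (h.URR n (-x) hx))
  URBm := fun n x hx x' hx' => by
    change (g.UL n).anti.eB x ≤ (g.LL n).anti.eB x'
    rw [RD.anti_eB, RD.anti_eB]; exact Mo.anti_le (h.LLRm n _ hx' _ hx)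
  LLRm := fun n x hx x' hx' => by
    change (g.UR n).anti.eR x ≤ (g.UL n).anti.eR x'
    rw [RD.anti_eR, RD.anti_eR]; exact Mo.anti_le (h.URBm n _ hx' _ hx)
end Temporal
end

section
namespace Temporal
variable {ι : Type}

def LD.lit (g : LD ι) (i : ι) (x y : ℝ) : Prop := g.a 0 < x ∧ y < g.b 0 ∧ i ∈ (g.h x y).l

noncomputable def LD.row (g : LD ι) (n : ℕ) : RD ι := (g.UL n).join (g.UR n)

section
variable {C : Lab ι → Prop} {g : LD ι} (h : g.Ok C)
include h

theorem LD.Ok.a0 (n : ℕ) : g.a 0 ≤ g.a n := h.ha.monotone n.zero_le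
theorem LD.Ok.b0 (n : ℕ) : g.b n ≤ g.b 0 := h.hb.antitone n.zero_le
theorem LD.Ok.a1 (n : ℕ) : g.a n < g.a (n+1) := h.ha n.lt_succ_self
theorem LD.Ok.b1 (n : ℕ) : g.b (n+1) < g.b n := h.hb n.lt_succ_self

theorem LD.Ok.rI (n : ℕ) : (g.row n).I = Set.Ioi (g.a n) := by
  change (g.UL n).I ∪ (g.UR n).I = _
  rw [h.ULI, h.URI, Set.Ioc_union_Ioi_eq_Ioi (h.a1 n).le]

theorem LD.Ok.rJ (n : ℕ) : (g.row n).J = Set.Ico (g.b (n+1)) (g.b n) := h.ULJ n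

theorem LD.Ok.rhlt (n : ℕ) : ∀ x ∈ (g.UL n).I, ∀ y ∈ (g.UR n).I, x < y := by
  rw [h.ULI, h.URI]
  intro x hx y hy
  exact hx.2.trans_lt hy

theorem LD.Ok.rhJ (n : ℕ) : (g.UR n).J = (g.UL n).J := by rw [h.ULJ, h.URJ]

theorem LD.Ok.rT (n : ℕ) : ∀ x ∈ (g.UL n).I, ∀ x' ∈ (g.UR n).I, (g.UL n).eT x ≤ (g.UR n).eT x' := by
  intro x hx x' hx'
  rw [h.ULT n x hx, h.URT n x' hx']
  have h1 := h.rhlt n x hx x' hx'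
  rw [h.ULI] at hx
  exact h.tTm n hx.1 (hx.1.trans h1) h1.le

theorem LD.Ok.rok (n : ℕ) : (g.row n).Ok C := by
  refine RD.join_ok (h.ULo n) (h.URo n) (h.rhJ n) (h.rhlt n) ?_ (h.ULR n) (h.URBm n) (h.rT n)
  have := h.rI n
  change (g.UL n).I ∪ (g.UR n).I = _ at this
  rw [this]; exact Set.ordConnected_Ioi

theorem LD.Ok.rh (n : ℕ) {x y : ℝ} (hx : g.a n < x) (hy : y ∈ Set.Ico (g.b (n+1)) (g.b n)) :
    (g.row n).h x y = g.h x y := by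
  simp only [row, RD.join]
  split_ifs with hh
  · exact h.ULh n x hh y (by rwa [h.ULJ])
  · refine h.URh n x ?_ y (by rwa [h.URJ])
    rw [h.ULI] at hh
    rw [h.URI]; by_contra hc; exact hh ⟨hx, not_lt.1 hc⟩

theorem LD.Ok.rlit (n : ℕ) (i : ι) (x y : ℝ) : (g.row n).lit i x y ↔
    g.lit i x y ∧ g.a n < x ∧ g.b (n+1) ≤ y ∧ y < g.b n := by
  simp only [RD.lit, LD.lit, h.rI, h.rJ]
  constructor
  · rintro ⟨h1, h2, h3⟩
    rw [h.rh n h1 h2] at h3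
    exact ⟨⟨(h.a0 n).trans_lt h1, h2.2.trans_le (h.b0 n), h3⟩, h1, h2⟩
  · rintro ⟨h1, h2, h3⟩
    refine ⟨h2, h3, ?_⟩
    rw [h.rh n h2 h3]; exact h1.2.2

theorem LD.Ok.llit (n : ℕ) (i : ι) (x y : ℝ) : (g.LL n).lit i x y ↔
    g.lit i x y ∧ (g.a n < x ∧ x ≤ g.a (n+1)) ∧ y < g.b (n+1) := by
  simp only [RD.lit, LD.lit]
  constructor
  · rintro ⟨h1, h2, h3⟩
    rw [h.LLh n _ h1 _ h2] at h3
    rw [h.LLI] at h1; rw [h.LLJ] at h2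
    exact ⟨⟨(h.a0 n).trans_lt h1.1, lt_of_lt_of_le h2 (h.b0 (n+1)), h3⟩, h1, h2⟩
  · rintro ⟨h1, h2, h3⟩
    have k1 : x ∈ (g.LL n).I := by rw [h.LLI]; exact h2
    have k2 : y ∈ (g.LL n).J := by rw [h.LLJ]; exact h3
    exact ⟨k1, k2, by rw [h.LLh n _ k1 _ k2]; exact h1.2.2⟩

theorem LD.Ok.roT (n : ℕ) {x : ℝ} (hx : g.a n < x) : (g.row n).oT x = (g.tT n x).f := by
  have : (g.row n).eT x = g.tT n x := by
    rw [row, RD.join_eT (h.ULo n) (h.rhJ n) (h.rhlt n) (h.ULR n) (h.URBm n)]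
    · split_ifs with hh
      · exact h.ULT n x hh
      · refine h.URT n x ?_
        rw [h.ULI] at hh
        rw [h.URI]; by_contra hc; exact hh ⟨hx, not_lt.1 hc⟩
    · change x ∈ (g.row n).I
      rw [h.rI]; exact hx
  rw [← this]; rfl

theorem LD.Ok.roR (n : ℕ) {y : ℝ} (hy : y ∈ Set.Ico (g.b (n+1)) (g.b n)) : (g.row n).oR y = g.mr.f := by
  have := h.URR n y (by rwa [h.URJ])
  rw [← this]; rfl

theorem LD.Ok.reB1 (n : ℕ) {x : ℝ} (hx : g.a n < x ∧ x ≤ g.a (n+1)) :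
    (g.row n).eB x = (g.LL n).eT x := by
  have hx' : x ∈ (g.UL n).I := by rw [h.ULI]; exact hx
  rw [row, RD.join_eB (h.ULo n) (h.rhJ n) (h.rhlt n) (h.ULR n) (h.rT n) (Or.inl hx'), if_pos hx']
  exact h.ULB n x hx'

theorem LD.Ok.reB2 (n : ℕ) {x : ℝ} (hx : g.a (n+1) < x) :
    (g.row n).eB x = g.tT (n+1) x := by
  have hx' : x ∈ (g.UR n).I := by rw [h.URI]; exact hx
  rw [row, RD.join_eB (h.ULo n) (h.rhJ n) (h.rhlt n) (h.ULR n) (h.rT n) (Or.inr hx'), if_neg]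
  · exact h.URB n x hx'
  · rw [h.ULI]; exact fun hh => absurd hh.2 (not_le.2 hx)

theorem LD.Ok.reBf (n : ℕ) (i : ι) {x : ℝ} (hx : g.a n < x) : i ∈ ((g.row n).eB x).f ↔
    (∃ x' y', g.lit i x' y' ∧ x ≤ x' ∧ g.b (n+1) ≤ y' ∧ y' < g.b n) ∨ i ∈ (g.tT n x).f ∨ i ∈ g.mr.f := by
  simp only [RD.eB, Set.mem_ofPred_eq, h.rlit, h.roT n hx]
  refine or_congr ⟨?_, ?_⟩ (or_congr Iff.rfl ⟨?_, ?_⟩)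
  · rintro ⟨x', y', ⟨h1, h2, h3⟩, h4⟩; exact ⟨x', y', h1, h4, h3⟩
  · rintro ⟨x', y', h1, h4, h3⟩; exact ⟨x', y', ⟨h1, hx.trans_le h4, h3⟩, h4⟩
  · rintro ⟨y, hy, h1⟩
    rw [h.rJ] at hy; rwa [h.roR n hy] at h1
  · intro h1
    have : g.b (n+1) ∈ Set.Ico (g.b (n+1)) (g.b n) := ⟨le_rfl, h.b1 n⟩
    exact ⟨g.b (n+1), by rwa [h.rJ], by rwa [h.roR n this]⟩

theorem LD.Ok.reL (n : ℕ) {y : ℝ} (hy : y ∈ Set.Ico (g.b (n+1)) (g.b n)) :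
    (g.row n).eL y = g.tL n y := by
  have : y ∈ (g.UL n).J := by rwa [h.ULJ]
  rw [row, RD.join_eL (h.rhJ n) (h.rhlt n) (h.ULR n) this]
  exact h.ULL n y this

theorem LD.Ok.LoR (n : ℕ) {y : ℝ} (hy : y < g.b (n+1)) : (g.LL n).oR y = (g.tL (n+1) y).f := by
  have := h.LLR n y (by rw [h.LLJ]; exact hy)
  rw [← this]; rfl

theorem LD.Ok.kτ (i : ι) : ∀ n x x', g.a n < x → x ≤ x' → i ∈ (g.tT n x').f → i ∈ (g.tT n x).f :=
  fun n x x' h1 h2 h3 => (h.tTm n (a := x) (b := x') h1 (h1.trans_le h2) h2).2 h3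

theorem LD.Ok.kR (i : ι) : ∀ n x y, g.a n < x → g.b (n+1) ≤ y ∧ y < g.b n → (i ∈ (g.h x y).f ↔
    (∃ x' y', g.lit i x' y' ∧ x ≤ x' ∧ y ≤ y' ∧
    y' < g.b n ∧ ¬ (x' = x ∧ y' = y)) ∨ i ∈ (g.tT n x).f ∨ i ∈ g.mr.f) := by
  intro n x y hx hy
  have := (h.rok n).hf x (by rw [h.rI]; exact hx) y (by rw [h.rJ]; exact hy) i
  rw [h.rh n hx hy, h.roT n hx, h.roR n hy] at this
  rw [this, or_comm (a := i ∈ g.mr.f)]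
  simp only [h.rlit]
  refine or_congr ⟨?_, ?_⟩ Iff.rfl
  · rintro ⟨x', y', ⟨h1, h2, h3⟩, h4, h5, h6⟩; exact ⟨x', y', h1, h4, h5, h3.2, h6⟩
  · rintro ⟨x', y', h1, h4, h5, h3, h6⟩
    exact ⟨x', y', ⟨h1, hx.trans_le h4, hy.1.trans h5, h3⟩, h4, h5, h6⟩

theorem LD.Ok.kT (i : ι) : ∀ n x, g.a (n+1) < x → (i ∈ (g.tT (n+1) x).f ↔
    (∃ x' y', g.lit i x' y' ∧ x ≤ x' ∧ g.b (n+1) ≤ y' ∧ y' < g.b n) ∨ i ∈ (g.tT n x).f ∨ i ∈ g.mr.f) := by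
  intro n x hx
  rw [← h.reB2 n hx]; exact h.reBf n i ((h.a1 n).trans hx)

theorem LD.Ok.kS (i : ι) : ∀ n x, g.a n < x ∧ x ≤ g.a (n+1) → (i ∈ (g.LL n).oT x ↔
    (∃ x' y', g.lit i x' y' ∧ x ≤ x' ∧ g.b (n+1) ≤ y' ∧ y' < g.b n) ∨ i ∈ (g.tT n x).f ∨ i ∈ g.mr.f) := by
  intro n x hx
  change i ∈ ((g.LL n).eT x).f ↔ _
  rw [← h.reB1 n hx]; exact h.reBf n i hx.1

theorem LD.Ok.kC (i : ι) : ∀ n x y, g.a n < x ∧ x ≤ g.a (n+1) → y < g.b (n+1) →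
    (i ∈ (g.h x y).f ↔ (∃ x' y', g.lit i x' y' ∧ x ≤ x' ∧
    x' ≤ g.a (n+1) ∧ y ≤ y' ∧ y' < g.b (n+1) ∧ ¬ (x' = x ∧ y' = y)) ∨ i ∈ (g.LL n).oT x ∨
    i ∈ (g.tL (n+1) y).f) := by
  intro n x y hx hy
  have k1 : x ∈ (g.LL n).I := by rw [h.LLI]; exact hx
  have k2 : y ∈ (g.LL n).J := by rw [h.LLJ]; exact hy
  rw [← h.LLh n x k1 y k2, (h.LLo n).hf x k1 y k2 i, h.LoR n hy, or_comm (a := i ∈ (g.LL n).oT x)]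
  simp only [h.llit]
  refine or_congr ⟨?_, ?_⟩ Iff.rfl
  · rintro ⟨x', y', ⟨h1, h2, h3⟩, h4, h5, h6⟩; exact ⟨x', y', h1, h4, h2.2, h5, h3, h6⟩
  · rintro ⟨x', y', h1, h4, h2, h5, h3, h6⟩
    exact ⟨x', y', ⟨h1, ⟨hx.1.trans_le h4, h2⟩, h3⟩, h4, h5, h6⟩

theorem LD.Ok.kD0 (i : ι) : ∀ n y, g.b (n+1) ≤ y ∧ y < g.b n → (i ∈ (g.tL n y).f ↔
    (∃ x' y', g.lit i x' y' ∧ g.a n < x' ∧ y ≤ y' ∧ y' < g.b n) ∨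
    i ∈ g.mr.f ∨ ∃ x, g.a n < x ∧ i ∈ (g.tT n x).f) := by
  intro n y hy
  rw [← h.reL n hy]
  simp only [RD.eL, h.rlit, h.roR n hy, Set.mem_ofPred_eq, h.rI]
  refine or_congr ⟨?_, ?_⟩ (or_congr Iff.rfl ⟨?_, ?_⟩)
  · rintro ⟨x', y', ⟨h1, h2, h3⟩, h4⟩; exact ⟨x', y', h1, h2, h4, h3.2⟩
  · rintro ⟨x', y', h1, h2, h4, h3⟩; exact ⟨x', y', ⟨h1, h2, hy.1.trans h4, h3⟩, h4⟩
  · rintro ⟨x, hx, h1⟩; rw [h.roT n hx] at h1; exact ⟨x, hx, h1⟩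
  · rintro ⟨x, hx, h1⟩; rw [← h.roT n hx] at h1; exact ⟨x, hx, h1⟩

theorem LD.Ok.kD1 (i : ι) : ∀ n y, y < g.b (n+1) → (i ∈ (g.tL n y).f ↔
    (∃ x' y', g.lit i x' y' ∧ g.a n < x' ∧ x' ≤ g.a (n+1) ∧ y ≤ y' ∧
    y' < g.b (n+1)) ∨ i ∈ (g.tL (n+1) y).f ∨ ∃ x, (g.a n < x ∧ x ≤ g.a (n+1)) ∧ i ∈ (g.LL n).oT x) := by
  intro n y hy
  rw [← h.LLL n y (by rw [h.LLJ]; exact hy)]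
  simp only [RD.eL, h.llit, h.LoR n hy, Set.mem_ofPred_eq, h.LLI]
  refine or_congr ⟨?_, ?_⟩ Iff.rfl
  · rintro ⟨x', y', ⟨h1, h2, h3⟩, h4⟩; exact ⟨x', y', h1, h2.1, h2.2, h4, h3⟩
  · rintro ⟨x', y', h1, h2, h2', h4, h3⟩; exact ⟨x', y', ⟨h1, ⟨h2, h2'⟩, h3⟩, h4⟩

theorem LD.Ok.kE (i : ι) : ∀ n x, g.a n < x ∧ x ≤ g.a (n+1) → (i ∈ g.mb.f ↔
    (∃ x' y', g.lit i x' y' ∧ x ≤ x' ∧ x' ≤ g.a (n+1) ∧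
    y' < g.b (n+1)) ∨ i ∈ (g.LL n).oT x ∨ ∃ y, y < g.b (n+1) ∧ i ∈ (g.tL (n+1) y).f) := by
  intro n x hx
  rw [← h.LLB n x (by rw [h.LLI]; exact hx)]
  simp only [RD.eB, h.llit, Set.mem_ofPred_eq, h.LLJ]
  refine or_congr ⟨?_, ?_⟩ (or_congr Iff.rfl ⟨?_, ?_⟩)
  · rintro ⟨x', y', ⟨h1, h2, h3⟩, h4⟩; exact ⟨x', y', h1, h4, h2.2, h3⟩
  · rintro ⟨x', y', h1, h4, h2, h3⟩; exact ⟨x', y', ⟨h1, ⟨hx.1.trans_le h4, h2⟩, h3⟩, h4⟩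
  · rintro ⟨x, hx, h1⟩; rw [h.LoR n hx] at h1; exact ⟨x, hx, h1⟩
  · rintro ⟨x, hx, h1⟩; rw [← h.LoR n hx] at h1; exact ⟨x, hx, h1⟩

theorem LD.Ok.f1 (i : ι) (x y : ℝ) (hx : g.a 0 < x) (hy : y < g.b 0) : i ∈ (g.h x y).f ↔
    (∃ x' y', g.lit i x' y' ∧ x ≤ x' ∧ y ≤ y' ∧ ¬ (x' = x ∧ y' = y)) ∨ i ∈ (g.tT 0 x).f ∨
      i ∈ g.mr.f := by
  obtain ⟨n, hn⟩ := lim_col h.ha h.hau 0 hx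
  obtain ⟨m, hm⟩ := lim_row h.hb h.hbu 0 hy
  rw [zero_add] at hn hm
  by_cases hnm : m ≤ n
  · exact lim2 h.ha h.hb (fun x y hh => ⟨hh.1, hh.2.1⟩) (h.kR i) (h.kT i) m x y
      ((h.ha.monotone hnm).trans_lt hn.1) hm
  · exact lim4 h.ha h.hb h.hbu (fun x y hh => ⟨hh.1, hh.2.1⟩) (h.kτ i) (h.kT i) (h.kC i) (h.kS i)
      (h.kD0 i) (h.kD1 i) n x y hn (hm.2.trans_le (h.hb.antitone (by omega)))

theorem LD.Ok.f2 (i : ι) (y : ℝ) (hy : y < g.b 0) : i ∈ (g.tL 0 y).f ↔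
    (∃ x' y', g.lit i x' y' ∧ g.a 0 < x' ∧ y ≤ y') ∨ i ∈ g.mr.f ∨ ∃ x, g.a 0 < x ∧ i ∈ (g.tT 0 x).f :=
  lim3' h.ha h.hb h.hbu (fun x y hh => ⟨hh.1, hh.2.1⟩) (h.kT i) (h.kS i)
      (h.kD0 i) (h.kD1 i) 0 y hy

theorem LD.Ok.f3 (i : ι) (x : ℝ) (hx : g.a 0 < x) : i ∈ g.mb.f ↔
    (∃ x' y', g.lit i x' y' ∧ x ≤ x') ∨ i ∈ (g.tT 0 x).f ∨ i ∈ g.mr.f :=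
  lim5 h.ha h.hb h.hau h.hbu (fun x y hh => ⟨hh.1, hh.2.1⟩) (h.kτ i) (h.kT i) (h.kS i)
      (h.kD0 i) (h.kD1 i) (h.kE i) x hx
end

def LD.region (g : LD ι) : RD ι :=
  ⟨Set.Ioi (g.a 0), Set.Iio (g.b 0), g.h, fun y => (g.tL 0 y).p, fun _ => g.mr.f, fun _ => g.mb.p,
    fun x => (g.tT 0 x).f⟩

theorem LD.region_lit (g : LD ι) (i : ι) (x y : ℝ) : g.region.lit i x y ↔ g.lit i x y := Iff.rfl

theorem LD.anti_lit (g : LD ι) (i : ι) (x y : ℝ) : g.anti.lit i x y ↔ g.lit i (-y) (-x) := by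
  simp only [LD.lit, LD.anti, Lab.anti, lt_neg, neg_lt]; tauto

section
variable {C : Lab ι → Prop} {g : LD ι} (h : g.Ok C)
include h
theorem LD.Ok.p1 (i : ι) (x y : ℝ) (hx : g.a 0 < x) (hy : y < g.b 0) : i ∈ (g.h x y).p ↔
    (∃ x' y', g.lit i x' y' ∧ x' ≤ x ∧ y' ≤ y ∧ ¬ (x' = x ∧ y' = y)) ∨ i ∈ (g.tL 0 y).p ∨
      i ∈ g.mb.p := by
  have := h.anti.f1 i (-y) (-x) (neg_lt_neg hy) (neg_lt_neg hx)
  simp only [anti_lit] at this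
  simp only [LD.anti, Lab.anti, Mo.anti, neg_neg] at this
  rw [this, ← exists_neg_swap (P := fun x' y' => g.lit i x' y' ∧ x' ≤ x ∧ y' ≤ y ∧ ¬ (x' = x ∧ y' = y))]
  refine or_congr ⟨?_, ?_⟩ Iff.rfl
  · rintro ⟨x', y', h1, h2, h3, h4⟩
    exact ⟨x', y', h1, by linarith, by linarith, fun hh => h4 ⟨by linarith [hh.2], by linarith [hh.1]⟩⟩
  · rintro ⟨x', y', h1, h2, h3, h4⟩
    exact ⟨x', y', h1, by linarith, by linarith, fun hh => h4 ⟨by linarith [hh.2], by linarith [hh.1]⟩⟩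

theorem LD.Ok.p2 (i : ι) (x : ℝ) (hx : g.a 0 < x) : i ∈ (g.tT 0 x).p ↔
    (∃ x' y', g.lit i x' y' ∧ x' ≤ x) ∨ i ∈ g.mb.p ∨ ∃ y, y < g.b 0 ∧ i ∈ (g.tL 0 y).p := by
  have := h.anti.f2 i (-x) (neg_lt_neg hx)
  simp only [anti_lit] at this
  simp only [LD.anti, Mo.anti, neg_neg] at this
  rw [this, ← exists_neg_swap (P := fun x' y' => g.lit i x' y' ∧ x' ≤ x),
    ← exists_neg' (P := fun y => y < g.b 0 ∧ i ∈ (g.tL 0 y).p)]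
  refine or_congr ⟨?_, ?_⟩ (or_congr Iff.rfl ⟨?_, ?_⟩)
  · rintro ⟨x', y', h1, h2, h3⟩; exact ⟨x', y', h1, by linarith⟩
  · rintro ⟨x', y', h1, h2⟩; exact ⟨x', y', h1, by linarith [h1.2.1], by linarith⟩
  · rintro ⟨y, h1, h2⟩; exact ⟨y, by linarith, h2⟩
  · rintro ⟨y, h1, h2⟩; exact ⟨y, by linarith, h2⟩

theorem LD.Ok.p3 (i : ι) (y : ℝ) (hy : y < g.b 0) : i ∈ g.mr.p ↔
    (∃ x' y', g.lit i x' y' ∧ y' ≤ y) ∨ i ∈ (g.tL 0 y).p ∨ i ∈ g.mb.p := by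
  have := h.anti.f3 i (-y) (neg_lt_neg hy)
  simp only [anti_lit] at this
  simp only [LD.anti, Mo.anti, neg_neg] at this
  rw [this, ← exists_neg_swap (P := fun x' y' => g.lit i x' y' ∧ y' ≤ y)]
  refine or_congr ⟨?_, ?_⟩ Iff.rfl
  · rintro ⟨x', y', h1, h2⟩; exact ⟨x', y', h1, by linarith⟩
  · rintro ⟨x', y', h1, h2⟩; exact ⟨x', y', h1, by linarith⟩

theorem LD.Ok.C_h (x y : ℝ) (hx : g.a 0 < x) (hy : y < g.b 0) : C (g.h x y) := by
  obtain ⟨n, hn⟩ := lim_col h.ha h.hau 0 hx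
  obtain ⟨m, hm⟩ := lim_row h.hb h.hbu 0 hy
  rw [zero_add] at hn hm
  by_cases hnm : m ≤ n
  · have hx' := (h.ha.monotone hnm).trans_lt hn.1
    rw [← h.rh m hx' hm]
    exact (h.rok m).hC x (by rw [h.rI]; exact hx') y (by rw [h.rJ]; exact hm)
  · have k1 : x ∈ (g.LL n).I := by rw [h.LLI]; exact hn
    have k2 : y ∈ (g.LL n).J := by rw [h.LLJ]; exact hm.2.trans_le (h.hb.antitone (by omega))
    rw [← h.LLh n x k1 y k2]
    exact (h.LLo n).hC x k1 y k2

theorem LD.Ok.region_ok : g.region.Ok C where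
  Ic := Set.ordConnected_Ioi
  Jc := Set.ordConnected_Iio
  In := Set.nonempty_Ioi
  Jn := Set.nonempty_Iio
  mL := fun a ha b hb hab => (h.tLm 0 ha hb hab).1
  mR := fun a ha b hb hab => subset_rfl
  mB := fun a ha b hb hab => subset_rfl
  mT := fun a ha b hb hab => (h.tTm 0 ha hb hab).2
  hC := fun x hx y hy => h.C_h x y hx hy
  hf := fun x hx y hy i => by
    refine (h.f1 i x y hx hy).trans (or_congr Iff.rfl or_comm)
  hp := fun x hx y hy i => h.p1 i x y hx hy

theorem LD.Ok.region_desc : g.region.desc =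
    ⟨koo, koo, W (g.tL 0) (Set.Iio (g.b 0)), cW koo g.mr, W (g.tT 0) (Set.Ioi (g.a 0)), cW koo g.mb⟩ := by
  have e1 : kd (Set.Ioi (g.a 0)) = koo := by
    have := (SIso.kd (S := Set.Ioi (g.a 0)) (S' := Set.univ) (e := fun x => Real.log (x - g.a 0))
      ⟨fun x hx y hy hxy => Real.log_lt_log (by simpa using hx) (by linarith), by
        ext y; simp only [Set.mem_image, Set.mem_Ioi, Set.mem_univ, iff_true]
        exact ⟨g.a 0 + Real.exp y, by linarith [Real.exp_pos y], by simp⟩⟩)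
    rw [this, kd_univ]
  have e2 : kd (Set.Iio (g.b 0)) = koo := by
    have := (SIso.kd (S := Set.Iio (g.b 0)) (S' := Set.univ) (e := fun x => - Real.log (g.b 0 - x))
      ⟨fun x hx y hy hxy => neg_lt_neg (Real.log_lt_log (by simpa using hy) (by linarith)), by
        ext y; simp only [Set.mem_image, Set.mem_Iio, Set.mem_univ, iff_true]
        exact ⟨g.b 0 - Real.exp (-y), by linarith [Real.exp_pos (-y)], by simp⟩⟩)
    rw [this, kd_univ]
  refine Ds.ext e1 e2 ?_ ?_ ?_ ?_
  · refine W_congr fun y hy => ?_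
    ext i
    · rfl
    · rw [h.f2 i y hy]
      refine or_congr ⟨?_, ?_⟩ Iff.rfl
      · rintro ⟨x', y', h1, h2⟩; exact ⟨x', y', h1, h1.1, h2⟩
      · rintro ⟨x', y', h1, h2, h3⟩; exact ⟨x', y', h1, h3⟩
  · change W _ (Set.Iio (g.b 0)) = _
    rw [W_const _ g.mr, e2]
    intro y hy
    ext i
    · rw [h.p3 i y hy]
      refine or_congr Iff.rfl (or_congr Iff.rfl ⟨?_, ?_⟩)
      · rintro ⟨x, -, hx⟩; exact hx
      · intro hh; exact ⟨g.a 1, h.a1 0, hh⟩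
    · rfl
  · refine W_congr fun y hy => ?_
    ext i
    · rw [h.p2 i y hy]; rfl
    · rfl
  · change W _ (Set.Ioi (g.a 0)) = _
    rw [W_const _ g.mb, e1]
    intro y hy
    ext i
    · rfl
    · rw [h.f3 i y hy]
      refine or_congr Iff.rfl (or_congr Iff.rfl ⟨?_, ?_⟩)
      · rintro ⟨x, -, hx⟩; exact hx
      · intro hh; exact ⟨g.b 1, h.b1 0, hh⟩
end
end Temporal
end

section
namespace Temporal
variable {ι : Type}

theorem kd_comb_kem (S : Set ℝ) : (kd S).comb kem = kd S := by
  rw [← kd_empty, ← kd_comb (by simp), Set.union_empty]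
theorem kem_comb_kd (S : Set ℝ) : kem.comb (kd S) = kd S := by
  rw [← kd_empty, ← kd_comb (by simp), Set.empty_union]
theorem cW_ne {T : Type} {k : Kd} {m m' : T} (h : m' ≠ m) : cW k m m' = kem := by
  simp [cW, h, kem]
theorem cW_eq {T : Type} {k : Kd} {m : T} : cW k m m = k := by
  simp [cW]

theorem cut_top {T : Type} [PartialOrder T] {κ κ' : ℝ → T} {S : Set ℝ} {a : ℝ} {m1 : T}
    (hκ : MonotoneOn κ (Set.Ioi a)) (hne : (W κ' S m1).ne) (hmx : (W κ' S m1).mx)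
    (hsg : ¬ (W κ' S m1).sg) (hle : ∀ m, (W κ' S m).ne → m ≤ m1)
    (hW : W κ (Set.Ioi a) = combW (W κ' S) (cW koo m1)) (N : ℝ) :
    ∃ a', N ≤ a' ∧ a < a' ∧ W κ (Set.Ioc a a') = W κ' S ∧ ∀ x, a' < x → κ x = m1 := by
  have hle' : ∀ x, a < x → κ x ≤ m1 := by
    intro x hx
    have : (W κ (Set.Ioi a) (κ x)).ne := ⟨x, hx, rfl⟩
    rw [hW] at this
    rcases this with h | h
    · exact hle _ h
    · exact h.1.le
  have hZ : (W κ (Set.Ioi a) m1).ne := by rw [hW]; exact Or.inl hne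
  obtain ⟨z0, hz0, hz1⟩ := hZ
  have hup : ∀ x, z0 ≤ x → κ x = m1 := fun x hx =>
    le_antisymm (hle' x (lt_of_lt_of_le hz0 hx)) (hz1 ▸ hκ hz0 (lt_of_lt_of_le hz0 hx) hx)
  have hz0' : a < z0 := hz0
  refine ⟨max N (z0 + 1), le_max_left _ _, ?_, ?_, ?_⟩
  · have := le_max_right N (z0 + 1); linarith
  · have hm := le_max_right N (z0 + 1)
    set a' := max N (z0 + 1)
    funext m
    by_cases h : m = m1
    · subst h
      have h0 := congrFun hW m
      simp only [combW, cW_eq] at h0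
      refine Kd.ext ?_ ?_ ?_ ?_
      · exact propext ⟨fun _ => hne, fun _ => ⟨z0, ⟨hz0, by linarith⟩, hz1⟩⟩
      · have h1 : (W κ (Set.Ioi a) m).mn = (W κ' S m).mn := by
          rw [h0]; simp [Kd.comb, hne]
        rw [← h1]
        refine propext ⟨?_, ?_⟩
        · rintro ⟨c, ⟨hc1, hc2⟩, hc3⟩
          refine ⟨c, ⟨hc1.1, hc2⟩, fun x hx => ?_⟩
          by_contra hlt
          exact hlt (hc3 ⟨⟨hx.1, by linarith [hc1.2]⟩, hx.2⟩)
        · rintro ⟨c, ⟨hc1, hc2⟩, hc3⟩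
          refine ⟨c, ⟨⟨hc1, ?_⟩, hc2⟩, fun x hx => hc3 ⟨hx.1.1, hx.2⟩⟩
          have := hc3 (a := z0) ⟨hz0, hz1⟩
          linarith
      · exact propext ⟨fun _ => hmx, fun _ => ⟨a', ⟨⟨by linarith, le_rfl⟩, hup _ (by linarith)⟩,
          fun x hx => hx.1.2⟩⟩
      · refine propext ⟨fun hh => ?_, fun hh => absurd hh hsg⟩
        have := hh (x := z0) (y := a') ⟨⟨hz0, by linarith⟩, hz1⟩ ⟨⟨by linarith, le_rfl⟩, hup _ (by linarith)⟩
        linarith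
    · have h0 := congrFun hW m
      simp only [combW, cW_ne h] at h0
      rw [W.eq_def κ', kd_comb_kem] at h0
      rw [W.eq_def κ', ← h0]
      simp only [W]
      congr 1
      ext x
      constructor
      · rintro ⟨h1, h2⟩; exact ⟨h1.1, h2⟩
      · rintro ⟨h1, h2⟩
        refine ⟨⟨h1, ?_⟩, h2⟩
        by_contra hc
        exact h (h2.symm.trans (hup x (by linarith)))
  · intro x hx
    have := le_max_right N (z0 + 1)
    exact hup x (by linarith)

theorem cut_left {T : Type} [PartialOrder T] {κ κ' : ℝ → T} {S : Set ℝ} {a : ℝ} {m1 : T}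
    (hκ : MonotoneOn κ (Set.Iio a)) (hne : (W κ' S m1).ne) (hmx : (W κ' S m1).mn)
    (hsg : ¬ (W κ' S m1).sg) (hle : ∀ m, (W κ' S m).ne → m1 ≤ m)
    (hW : W κ (Set.Iio a) = combW (cW koo m1) (W κ' S)) (N : ℝ) :
    ∃ a', a' ≤ N ∧ a' < a ∧ W κ (Set.Ico a' a) = W κ' S ∧ ∀ x, x < a' → κ x = m1 := by
  have hle' : ∀ x, x < a → m1 ≤ κ x := by
    intro x hx
    have : (W κ (Set.Iio a) (κ x)).ne := ⟨x, hx, rfl⟩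
    rw [hW] at this
    rcases this with h | h
    · exact h.1.ge
    · exact hle _ h
  have hZ : (W κ (Set.Iio a) m1).ne := by rw [hW]; exact Or.inr hne
  obtain ⟨z0, hz0, hz1⟩ := hZ
  have hz0' : z0 < a := hz0
  have hup : ∀ x, x ≤ z0 → κ x = m1 := fun x hx =>
    le_antisymm (hz1 ▸ hκ (lt_of_le_of_lt hx hz0) hz0 hx) (hle' x (lt_of_le_of_lt hx hz0))
  refine ⟨min N (z0 - 1), min_le_left _ _, ?_, ?_, ?_⟩
  · have := min_le_right N (z0 - 1); linarith
  · have hm := min_le_right N (z0 - 1)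
    set a' := min N (z0 - 1)
    funext m
    by_cases h : m = m1
    · subst h
      have h0 := congrFun hW m
      simp only [combW, cW_eq] at h0
      refine Kd.ext ?_ ?_ ?_ ?_
      · exact propext ⟨fun _ => hne, fun _ => ⟨z0, ⟨by linarith, hz0⟩, hz1⟩⟩
      · exact propext ⟨fun _ => hmx, fun _ => ⟨a', ⟨⟨le_rfl, by linarith⟩, hup _ (by linarith)⟩,
          fun x hx => hx.1.1⟩⟩
      · have h1 : (W κ (Set.Iio a) m).mx = (W κ' S m).mx := by
          rw [h0]; simp [Kd.comb, hne]
        rw [← h1]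
        refine propext ⟨?_, ?_⟩
        · rintro ⟨c, ⟨hc1, hc2⟩, hc3⟩
          refine ⟨c, ⟨hc1.2, hc2⟩, fun x hx => ?_⟩
          by_contra hlt
          exact hlt (hc3 ⟨⟨by linarith [hc1.1], hx.1⟩, hx.2⟩)
        · rintro ⟨c, ⟨hc1, hc2⟩, hc3⟩
          refine ⟨c, ⟨⟨?_, hc1⟩, hc2⟩, fun x hx => hc3 ⟨hx.1.2, hx.2⟩⟩
          have := hc3 (a := z0) ⟨hz0, hz1⟩
          linarith
      · refine propext ⟨fun hh => ?_, fun hh => absurd hh hsg⟩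
        have := hh (x := z0) (y := a') ⟨⟨by linarith, hz0⟩, hz1⟩ ⟨⟨le_rfl, by linarith⟩, hup _ (by linarith)⟩
        linarith
    · have h0 := congrFun hW m
      simp only [combW, cW_ne h] at h0
      rw [W.eq_def κ', kem_comb_kd] at h0
      rw [W.eq_def κ', ← h0]
      simp only [W]
      congr 1
      ext x
      constructor
      · rintro ⟨h1, h2⟩; exact ⟨h1.2, h2⟩
      · rintro ⟨h1, h2⟩
        refine ⟨⟨?_, h1⟩, h2⟩
        by_contra hc
        exact h (h2.symm.trans (hup x (by linarith)))
  · intro x hx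
    have := min_le_right N (z0 - 1)
    exact hup x (by linarith)

theorem kd_Ioi (a : ℝ) : kd (Set.Ioi a) = koo := by
  have := (SIso.kd (S := Set.Ioi a) (S' := Set.univ) (e := fun x => Real.log (x - a))
    ⟨fun x hx y hy hxy => Real.log_lt_log (by simpa using hx) (by linarith), by
      ext y; simp only [Set.mem_image, Set.mem_Ioi, Set.mem_univ, iff_true]
      exact ⟨a + Real.exp y, by linarith [Real.exp_pos y], by simp⟩⟩)
  rw [this, kd_univ]
theorem kd_Iio (b : ℝ) : kd (Set.Iio b) = koo := by
  have := (SIso.kd (S := Set.Iio b) (S' := Set.univ) (e := fun x => - Real.log (b - x))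
    ⟨fun x hx y hy hxy => neg_lt_neg (Real.log_lt_log (by simpa using hy) (by linarith)), by
      ext y; simp only [Set.mem_image, Set.mem_Iio, Set.mem_univ, iff_true]
      exact ⟨b - Real.exp (-y), by linarith [Real.exp_pos (-y)], by simp⟩⟩)
  rw [this, kd_univ]

/-- state of the limit construction -/
structure LSt (Y : Set (Ds ι)) where
  d : Ds ι
  a : ℝ
  b : ℝ
  tT : ℝ → Mo ι
  tL : ℝ → Mo ι
  hd : d ∈ Y
  tTm : MonotoneOn tT (Set.Ioi a)
  tLm : MonotoneOn tL (Set.Iio b)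
  wT : W tT (Set.Ioi a) = d.T
  wL : W tL (Set.Iio b) = d.L

structure LSt.Step {Y : Set (Ds ι)} (C : Lab ι → Prop) (mr mb : Mo ι) (s s' : LSt Y)
    (UL UR LL : RD ι) : Prop where
  ha : s.a + 1 ≤ s'.a
  hb : s'.b ≤ s.b - 1
  ULI : UL.I = Set.Ioc s.a s'.a
  URI : UR.I = Set.Ioi s'.a
  LLI : LL.I = Set.Ioc s.a s'.a
  ULJ : UL.J = Set.Ico s'.b s.b
  URJ : UR.J = Set.Ico s'.b s.b
  LLJ : LL.J = Set.Iio s'.b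
  ULo : UL.Ok C
  URo : UR.Ok C
  LLo : LL.Ok C
  ULT : ∀ x ∈ UL.I, UL.eT x = s.tT x
  URT : ∀ x ∈ UR.I, UR.eT x = s.tT x
  ULL : ∀ y ∈ UL.J, UL.eL y = s.tL y
  LLL : ∀ y ∈ LL.J, LL.eL y = s.tL y
  URB : ∀ x ∈ UR.I, UR.eB x = s'.tT x
  LLR : ∀ y ∈ LL.J, LL.eR y = s'.tL y
  ULR : ∀ y ∈ UL.J, UL.eR y = UR.eL y
  ULB : ∀ x ∈ UL.I, UL.eB x = LL.eT x
  URR : ∀ y ∈ UR.J, UR.eR y = mr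
  LLB : ∀ x ∈ LL.I, LL.eB x = mb
  URBm : ∀ x ∈ UL.I, ∀ x' ∈ UR.I, UL.eB x ≤ UR.eB x'
  LLRm : ∀ y ∈ LL.J, ∀ y' ∈ UL.J, LL.eR y ≤ UL.eR y'

theorem LSt.exists_step {Y : Set (Ds ι)} {C : Lab ι → Prop} {mr mb : Mo ι}
    (hY : ∀ d ∈ Y, ∃ d' ∈ Y, ∃ UL ∈ Rl C, ∃ UR ∈ Rl C, ∃ LL ∈ Rl C, LStep mr mb d UL UR LL d')
    (s : LSt Y) : ∃ (s' : LSt Y) (UL UR LL : RD ι), LSt.Step C mr mb s s' UL UR LL := by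
  obtain ⟨d', hd', _, ⟨rU, hU, rfl⟩, _, ⟨rV, hV, rfl⟩, _, ⟨rL, hL, rfl⟩, st⟩ := hY s.d s.hd
  obtain ⟨m1, t1, t2, t3, t4, t5, t6⟩ := st.top
  obtain ⟨m0, l1, l2, l3, l4, l5, l6⟩ := st.left
  rw [← s.wT] at t6
  rw [← s.wL] at l6
  obtain ⟨a', ha1, ha2, ha3, ha4⟩ := cut_top s.tTm t2 t3 t4 t5 t6 (s.a + 1)
  obtain ⟨b', hb1, hb2, hb3, hb4⟩ := cut_left s.tLm l2 l3 l4 l5 l6 (s.b - 1)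
  have mT : MonotoneOn s.tT (Set.Ioc s.a a') := s.tTm.mono (fun x hx => hx.1)
  have mL : MonotoneOn s.tL (Set.Ico b' s.b) := s.tLm.mono (fun x hx => hx.2)
  obtain ⟨ex, hex, hexT⟩ := Wiso hU.Ic Set.ordConnected_Ioc hU.eT_mono mT ha3.symm
  obtain ⟨ey, hey, heyL⟩ := Wiso hU.Jc Set.ordConnected_Ico hU.eL_mono mL hb3.symm
  have hU' := RD.place_ok hex hey hU Set.ordConnected_Ioc Set.ordConnected_Ico
  have dU := RD.place_desc hex hey
  set U := rU.place (Set.Ioc s.a a') (Set.Ico b' s.b) ex ey with hUdef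
  -- UR
  obtain ⟨vx, hvx⟩ := exists_SIso (S := Set.Ioi a') (S' := rV.I) Set.ordConnected_Ioi hV.Ic
    (by rw [kd_Ioi]; exact st.urI.symm)
  obtain ⟨vy, hvy, hvyL⟩ := Wiso hV.Jc (J' := Set.Ico b' s.b) Set.ordConnected_Ico hV.eL_mono hU'.eR_mono
    (by have := st.ulur; rw [← dU] at this; exact this.symm)
  have hV' := RD.place_ok hvx hvy hV Set.ordConnected_Ioi Set.ordConnected_Ico
  have dV := RD.place_desc hvx hvy
  obtain ⟨wy, hwy⟩ := exists_SIso (S := Set.Iio b') (S' := rL.J) Set.ordConnected_Iio hL.Jc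
    (by rw [kd_Iio]; exact st.llJ.symm)
  obtain ⟨wx, hwx, hwxT⟩ := Wiso hL.Ic (J' := Set.Ioc s.a a') Set.ordConnected_Ioc hL.eT_mono hU'.eB_mono
    (by have := st.ulll; rw [← dU] at this; exact this.symm)
  have hL' := RD.place_ok hwx hwy hL Set.ordConnected_Ioc Set.ordConnected_Iio
  have dL := RD.place_desc hwx hwy
  set V := rV.place (Set.Ioi a') (Set.Ico b' s.b) vx vy with hVdef
  set L := rL.place (Set.Ioc s.a a') (Set.Iio b') wx wy with hLdef
  rw [← dU, ← dV, ← dL] at st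
  rw [← dV] at t1
  rw [← dL] at l1
  have cV := W_const_of (κ := V.eT) (J := V.I) t1
  have cL := W_const_of (κ := L.eL) (J := L.J) l1
  refine ⟨⟨d', a', b', V.eB, L.eR, hd', hV'.eB_mono, hL'.eR_mono, st.urd, st.lld⟩, U, V, L, ?_⟩
  exact {
    ha := ha1
    hb := hb1
    ULI := rfl
    URI := rfl
    LLI := rfl
    ULJ := rfl
    URJ := rfl
    LLJ := rfl
    ULo := hU'
    URo := hV'
    LLo := hL'
    ULT := fun x hx => (RD.place_eT hex hey hx).trans (hexT x hx)
    URT := fun x hx => (cV x hx).trans (ha4 x hx).symm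
    ULL := fun y hy => (RD.place_eL hex hey hy).trans (heyL y hy)
    LLL := fun y hy => (cL y hy).trans (hb4 y hy).symm
    URB := fun _ _ => rfl
    LLR := fun _ _ => rfl
    ULR := fun y hy => ((RD.place_eL hvx hvy hy).trans (hvyL y hy)).symm
    ULB := fun x hx => ((RD.place_eT hwx hwy hx).trans (hwxT x hx)).symm
    URR := W_const_of (κ := V.eR) (J := V.J) st.urR
    LLB := W_const_of (κ := L.eB) (J := L.I) st.llB
    URBm := fun x hx x' hx' => st.mB _ _ (W_ne.2 ⟨x, hx, rfl⟩) (W_ne.2 ⟨x', hx', rfl⟩)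
    LLRm := fun x hx x' hx' => st.mR _ _ (W_ne.2 ⟨x, hx, rfl⟩) (W_ne.2 ⟨x', hx', rfl⟩) }

open Classical in
theorem Rl_lim (C : Lab ι → Prop) (Y : Set (Ds ι)) (mr mb : Mo ι)
    (hY : ∀ d ∈ Y, ∃ d' ∈ Y, ∃ UL ∈ Rl C, ∃ UR ∈ Rl C, ∃ LL ∈ Rl C, LStep mr mb d UL UR LL d') :
    ∀ d ∈ Y, d ∈ Rl C := by
  intro d hd
  -- initial state
  have h0 : ∃ s : LSt Y, s.d = d := by
    obtain ⟨d', hd', _, ⟨rU, hU, rfl⟩, _, ⟨rV, hV, rfl⟩, _, ⟨rL, hL, rfl⟩, st⟩ := hY d hd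
    obtain ⟨m1, t1, t2, t3, t4, t5, t6⟩ := st.top
    obtain ⟨m0, l1, l2, l3, l4, l5, l6⟩ := st.left
    -- top word
    have kT : kd rU.I = koc := st.ulI
    have kL : kd rU.J = kco := st.ulJ
    have top : ∃ tT, MonotoneOn tT (Set.Ioi (0:ℝ)) ∧ W tT (Set.Ioi 0) = d.T := by
      obtain ⟨S', T', e, e', h1, h2, h3, h4, h5, h6⟩ := exists_adjacent rU.I rV.I hU.Ic hU.In hV.Ic hV.In
        (by rw [kT, show kd rV.I = koo from st.urI]; simp [koc, koo])
      have hk : kd (S' ∪ T') = kd (Set.Ioi 0) := by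
        rw [kd_comb h6, h1.kd, h2.kd, kT, show kd rV.I = koo from st.urI, kd_Ioi]
        simp [Kd.comb, koc, koo]
      obtain ⟨z, hz⟩ := exists_SIso Set.ordConnected_Ioi h5 hk.symm
      have hn : ∀ x ∈ T', x ∉ S' := fun x hx hx' => lt_irrefl _ (h6 x hx' x hx)
      have hmono : MonotoneOn (fun x => if x ∈ S' then rU.eT (e x) else m1) (S' ∪ T') := by
        rintro x (hx | hx) y (hy | hy) hxy
        · simp only [if_pos hx, if_pos hy]
          exact hU.eT_mono (h1.mem hx) (h1.mem hy) ((h1.le_iff hx hy).2 hxy)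
        · simp only [if_pos hx, if_neg (hn y hy)]
          exact t5 _ ⟨e x, h1.mem hx, rfl⟩
        · exact absurd (h6 y hy x hx) (not_lt.2 hxy)
        · simp only [if_neg (hn x hx), if_neg (hn y hy)]; exact le_rfl
      refine ⟨fun x => (fun x => if x ∈ S' then rU.eT (e x) else m1) (z x), ?_, ?_⟩
      · intro x hx y hy hxy
        exact hmono (hz.mem hx) (hz.mem hy) ((hz.le_iff hx hy).2 hxy)
      · rw [SIso.W (κ := fun x => if x ∈ S' then rU.eT (e x) else m1) hz, W_comb _ h6, t6]
        congr 1
        · rw [W_congr (κ' := fun x => rU.eT (e x)) (fun y hy => if_pos hy), h1.W]; rfl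
        · rw [W_const _ m1 (fun y hy => if_neg (hn y hy)), h2.kd, show kd rV.I = koo from st.urI]
    have left : ∃ tL, MonotoneOn tL (Set.Iio (0:ℝ)) ∧ W tL (Set.Iio 0) = d.L := by
      obtain ⟨S', T', e, e', h1, h2, h3, h4, h5, h6⟩ := exists_adjacent rL.J rU.J hL.Jc hL.Jn hU.Jc hU.Jn
        (by rw [kL, show kd rL.J = koo from st.llJ]; simp [kco, koo])
      have hk : kd (S' ∪ T') = kd (Set.Iio 0) := by
        rw [kd_comb h6, h1.kd, h2.kd, kL, show kd rL.J = koo from st.llJ, kd_Iio]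
        simp [Kd.comb, kco, koo]
      obtain ⟨z, hz⟩ := exists_SIso Set.ordConnected_Iio h5 hk.symm
      have hn : ∀ x ∈ T', x ∉ S' := fun x hx hx' => lt_irrefl _ (h6 x hx' x hx)
      have hmono : MonotoneOn (fun x => if x ∈ S' then m0 else rU.eL (e' x)) (S' ∪ T') := by
        rintro x (hx | hx) y (hy | hy) hxy
        · simp only [if_pos hx, if_pos hy]; exact le_rfl
        · simp only [if_pos hx, if_neg (hn y hy)]
          exact l5 _ ⟨e' y, h2.mem hy, rfl⟩
        · exact absurd (h6 y hy x hx) (not_lt.2 hxy)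
        · simp only [if_neg (hn x hx), if_neg (hn y hy)]
          exact hU.eL_mono (h2.mem hx) (h2.mem hy) ((h2.le_iff hx hy).2 hxy)
      refine ⟨fun x => (fun x => if x ∈ S' then m0 else rU.eL (e' x)) (z x), ?_, ?_⟩
      · intro x hx y hy hxy
        exact hmono (hz.mem hx) (hz.mem hy) ((hz.le_iff hx hy).2 hxy)
      · rw [SIso.W (κ := fun x => if x ∈ S' then m0 else rU.eL (e' x)) hz, W_comb _ h6, l6]
        congr 1
        · rw [W_const _ m0 (fun y hy => if_pos hy), h1.kd, show kd rL.J = koo from st.llJ]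
        · rw [W_congr (κ' := fun x => rU.eL (e' x)) (fun y hy => if_neg (hn y hy)), h2.W]; rfl
    obtain ⟨tT, hT1, hT2⟩ := top
    obtain ⟨tL, hL1, hL2⟩ := left
    exact ⟨⟨d, 0, 0, tT, tL, hd, hT1, hL1, hT2, hL2⟩, rfl⟩
  obtain ⟨s0, rfl⟩ := h0
  choose nx U V L hst using fun s => LSt.exists_step (C := C) hY s
  let q : ℕ → LSt Y := fun n => Nat.rec s0 (fun _ s => nx s) n
  have q1 : ∀ n, q (n+1) = nx (q n) := fun n => rfl
  have st : ∀ n, LSt.Step C mr mb (q n) (q (n+1)) (U (q n)) (V (q n)) (L (q n)) := fun n => hst (q n)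
  have ha : StrictMono fun n => (q n).a := strictMono_nat_of_lt_succ fun n => by
    have := (st n).ha; linarith
  have hb : StrictAnti fun n => (q n).b := strictAnti_nat_of_succ_lt fun n => by
    have := (st n).hb; linarith
  have ha' : ∀ n, (q 0).a + n ≤ (q n).a := by
    intro n; induction n with
    | zero => simp
    | succ n ih => have := (st n).ha; push_cast; linarith
  have hb' : ∀ n, (q n).b ≤ (q 0).b - n := by
    intro n; induction n with
    | zero => simp
    | succ n ih => have := (st n).hb; push_cast; linarith
  -- uniqueness of indices
  have uc : ∀ n m x, (q n).a < x → x ≤ (q (n+1)).a → (q m).a < x → x ≤ (q (m+1)).a → n = m := by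
    intro n m x h1 h2 h3 h4
    rcases lt_trichotomy n m with h | h | h
    · have := ha.monotone (show n + 1 ≤ m from h); linarith
    · exact h
    · have := ha.monotone (show m + 1 ≤ n from h); linarith
  have ur : ∀ n m y, y < (q n).b → (q (n+1)).b ≤ y → y < (q m).b → (q (m+1)).b ≤ y → n = m := by
    intro n m x h1 h2 h3 h4
    rcases lt_trichotomy n m with h | h | h
    · have := hb.antitone (show n + 1 ≤ m from h); linarith
    · exact h
    · have := hb.antitone (show m + 1 ≤ n from h); linarith
  let h : ℝ → ℝ → Lab ι := fun x y =>
    if hU : ∃ n, x ∈ (U (q n)).I ∧ y ∈ (U (q n)).J then (U (q hU.choose)).h x y else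
    if hV : ∃ n, x ∈ (V (q n)).I ∧ y ∈ (V (q n)).J then (V (q hV.choose)).h x y else
    if hL : ∃ n, x ∈ (L (q n)).I ∧ y ∈ (L (q n)).J then (L (q hL.choose)).h x y else ⟨∅, ∅, ∅⟩
  let g : LD ι := ⟨fun n => (q n).a, fun n => (q n).b, h, fun n => U (q n), fun n => V (q n),
    fun n => L (q n), fun n => (q n).tT, fun n => (q n).tL, mr, mb⟩
  have hg : g.Ok C := {
    ha := ha
    hb := hb
    hau := fun x => by
      obtain ⟨n, hn⟩ := exists_nat_ge (x - (q 0).a)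
      exact ⟨n, by have := ha' n; simp only [g]; linarith⟩
    hbu := fun x => by
      obtain ⟨n, hn⟩ := exists_nat_ge ((q 0).b - x)
      exact ⟨n, by have := hb' n; simp only [g]; linarith⟩
    ULI := fun n => (st n).ULI
    URI := fun n => (st n).URI
    LLI := fun n => (st n).LLI
    ULJ := fun n => (st n).ULJ
    URJ := fun n => (st n).URJ
    LLJ := fun n => (st n).LLJ
    ULo := fun n => (st n).ULo
    URo := fun n => (st n).URo
    LLo := fun n => (st n).LLo
    ULh := fun n x hx y hy => by
      have hU : ∃ n, x ∈ (U (q n)).I ∧ y ∈ (U (q n)).J := ⟨n, hx, hy⟩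
      have hc := hU.choose_spec
      simp only [g, h, dif_pos hU]
      have hc1 := hc.1
      have hx' : x ∈ (U (q n)).I := hx
      rw [(st _).ULI] at hx' hc1
      rw [uc _ _ x hc1.1 hc1.2 hx'.1 hx'.2]
    URh := fun n x hx y hy => by
      have hx' : x ∈ (V (q n)).I := hx
      have hy' : y ∈ (V (q n)).J := hy
      rw [(st _).URI] at hx'; rw [(st _).URJ] at hy'
      have hU : ¬ ∃ n, x ∈ (U (q n)).I ∧ y ∈ (U (q n)).J := by
        rintro ⟨m, h1, h2⟩
        rw [(st _).ULI] at h1; rw [(st _).ULJ] at h2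
        obtain rfl := ur _ _ y h2.2 h2.1 hy'.2 hy'.1
        exact absurd h1.2 (not_le.2 hx')
      have hV : ∃ n, x ∈ (V (q n)).I ∧ y ∈ (V (q n)).J := ⟨n, hx, hy⟩
      have hc := hV.choose_spec
      simp only [g, h, dif_neg hU, dif_pos hV]
      have hc2 := hc.2
      rw [(st _).URJ] at hc2
      rw [ur _ _ y hc2.2 hc2.1 hy'.2 hy'.1]
    LLh := fun n x hx y hy => by
      have hx' : x ∈ (L (q n)).I := hx
      have hy' : y ∈ (L (q n)).J := hy
      rw [(st _).LLI] at hx'; rw [(st _).LLJ] at hy'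
      have hU : ¬ ∃ n, x ∈ (U (q n)).I ∧ y ∈ (U (q n)).J := by
        rintro ⟨m, h1, h2⟩
        rw [(st _).ULI] at h1; rw [(st _).ULJ] at h2
        obtain rfl := uc _ _ x h1.1 h1.2 hx'.1 hx'.2
        exact absurd h2.1 (not_le.2 hy')
      have hV : ¬ ∃ n, x ∈ (V (q n)).I ∧ y ∈ (V (q n)).J := by
        rintro ⟨m, h1, h2⟩
        rw [(st _).URI] at h1; rw [(st _).URJ] at h2
        have h1' : (q (m+1)).a < x := h1
        have hy'' : y < (q (n+1)).b := hy'
        have k1 : m + 1 < n + 1 := ha.lt_iff_lt.1 (by linarith [hx'.2])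
        have k2 := hb.antitone (show m + 1 ≤ n + 1 by omega)
        linarith [h2.1]
      have hL : ∃ n, x ∈ (L (q n)).I ∧ y ∈ (L (q n)).J := ⟨n, hx, hy⟩
      have hc := hL.choose_spec
      simp only [g, h, dif_neg hU, dif_neg hV, dif_pos hL]
      have hc2 := hc.1
      rw [(st _).LLI] at hc2
      rw [uc _ _ x hc2.1 hc2.2 hx'.1 hx'.2]
    tTm := fun n => (q n).tTm
    tLm := fun n => (q n).tLm
    ULT := fun n => (st n).ULT
    URT := fun n => (st n).URT
    ULL := fun n => (st n).ULL
    LLL := fun n => (st n).LLL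
    URB := fun n => (st n).URB
    LLR := fun n => (st n).LLR
    ULR := fun n => (st n).ULR
    ULB := fun n => (st n).ULB
    URR := fun n => (st n).URR
    LLB := fun n => (st n).LLB
    URBm := fun n => (st n).URBm
    LLRm := fun n => (st n).LLRm }
  refine ⟨g.region, hg.region_ok, ?_⟩
  rw [hg.region_desc]
  obtain ⟨d', hd', _, _, _, _, _, _, sst⟩ := hY s0.d hd
  exact Ds.ext sst.kI.symm sst.kJ.symm s0.wL sst.dR.symm s0.wT sst.dB.symm
end Temporal
end

section
namespace Temporal
variable {ι : Type}

theorem exists_jump (S : Set ℝ) (hS : S.Countable) : ∃ σ : ℝ → ℝ, Monotone σ ∧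
    ∀ s, ∃ lo hi, lo ≤ hi ∧ {x | σ x = s} = Set.Icc lo hi ∧ (lo < hi ↔ s ∈ S) := by
  classical
  have := hS.toEncodable
  let w : S → ℝ := fun c => (1 / 2 : ℝ) ^ (Encodable.encode c)
  have hw : Summable w := summable_geometric_two_encode
  have hw0 : ∀ c, 0 < w c := fun c => by positivity
  let j : S → ℝ → ℝ := fun c s => if (c : ℝ) ≤ s then w c else 0
  have hj0 : ∀ c s, 0 ≤ j c s := fun c s => by
    simp only [j]; split_ifs
    · exact (hw0 c).le
    · exact le_rfl
  have hjw : ∀ c s, j c s ≤ w c := fun c s => by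
    simp only [j]; split_ifs
    · exact le_rfl
    · exact (hw0 c).le
  have hjs : ∀ s, Summable (fun c => j c s) := fun s =>
    Summable.of_nonneg_of_le (fun c => hj0 c s) (fun c => hjw c s) hw
  have hjm : ∀ c, Monotone (j c) := by
    intro c s s' h
    simp only [j]; split_ifs with h1 h2
    · exact le_rfl
    · exact absurd (h1.trans h) h2
    · exact (hw0 c).le
    · exact le_rfl
  let ψ : ℝ → ℝ := fun s => s + ∑' c, j c s
  have hsm : Monotone (fun s => ∑' c, j c s) := fun s s' h =>
    (hjs s).tsum_le_tsum (fun c => hjm c h) (hjs s')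
  have hψ : StrictMono ψ := fun s s' h => add_lt_add_of_lt_of_le h (hsm h.le)
  have hlow : ∀ s, s ≤ ψ s := fun s => le_add_of_nonneg_right (tsum_nonneg (fun c => hj0 c s))
  have hup : ∀ s, ψ s ≤ s + ∑' c, w c := fun s => by
    have := (hjs s).tsum_le_tsum (fun c => hjw c s) hw
    simp only [ψ]; linarith
  have hm := hψ.monotone
  let ll := Function.leftLim ψ
  let rl := Function.rightLim ψ
  have h1 : ∀ s s', s < s' → ψ s ≤ ll s' := fun s s' h => hm.le_leftLim h
  have h2 : ∀ s, ll s ≤ ψ s := fun s => hm.leftLim_le le_rfl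
  have h3 : ∀ s, ψ s ≤ rl s := fun s => hm.le_rightLim le_rfl
  have h4 : ∀ s s', s < s' → rl s ≤ ψ s' := fun s s' h => hm.rightLim_le h
  have h5 : ∀ s s', s < s' → rl s < ll s' := by
    intro s s' h
    obtain ⟨a, ha, ha'⟩ := exists_between h
    obtain ⟨b, hb, hb'⟩ := exists_between ha'
    exact (h4 s a ha).trans_lt ((hψ hb).trans_le (h1 b s' hb'))
  have h6 : ∀ s z, (∀ s' < s, ψ s' ≤ z) → ll s ≤ z := by
    intro s z h
    refine le_of_tendsto (hm.tendsto_leftLim s) ?_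
    filter_upwards [self_mem_nhdsWithin] with a ha using h a ha
  have h7 : ∀ s z, (∀ s', s < s' → z ≤ ψ s') → z ≤ rl s := by
    intro s z h
    refine ge_of_tendsto (hm.tendsto_rightLim s) ?_
    filter_upwards [self_mem_nhdsWithin] with a ha using h a ha
  have hex : ∀ x, ∃ s, ll s ≤ x ∧ x ≤ rl s := by
    intro x
    have hne : {s | ψ s ≤ x}.Nonempty := ⟨x - ∑' c, w c, by
      have := hup (x - ∑' c, w c); simp only [Set.mem_ofPred_eq]; linarith⟩
    have hbd : BddAbove {s | ψ s ≤ x} := ⟨x, fun s hs => (hlow s).trans hs⟩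
    refine ⟨sSup {s | ψ s ≤ x}, h6 _ _ ?_, h7 _ _ ?_⟩
    · intro s' hs'
      obtain ⟨s'', hh, hh'⟩ := exists_lt_of_lt_csSup hne hs'
      exact (hm hh'.le).trans hh
    · intro s' hs'
      by_contra hc
      exact absurd (le_csSup hbd (show s' ∈ {s | ψ s ≤ x} from (not_le.1 hc).le)) (not_le.2 hs')
  choose σ hσ1 hσ2 using hex
  have huniq : ∀ x s, ll s ≤ x → x ≤ rl s → σ x = s := by
    intro x s ha hb
    rcases lt_trichotomy (σ x) s with h | h | h
    · have := h5 _ _ h; linarith [hσ2 x]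
    · exact h
    · have := h5 _ _ h; linarith [hσ1 x]
  refine ⟨σ, ?_, fun s => ⟨ll s, rl s, (h2 s).trans (h3 s), ?_, ?_⟩⟩
  · intro x y hxy
    by_contra hc
    have := h5 _ _ (not_le.1 hc)
    linarith [hσ2 y, hσ1 x]
  · ext x; constructor
    · rintro rfl; exact ⟨hσ1 x, hσ2 x⟩
    · rintro ⟨ha, hb⟩; exact huniq x s ha hb
  · constructor
    · intro hlt
      by_contra hs
      -- continuity on the complement of S
      have hc : ContinuousOn ψ Sᶜ := by
        refine continuousOn_id.add (continuousOn_tsum (u := w) ?_ hw ?_)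
        · intro c s hs
          refine ContinuousAt.continuousWithinAt ?_
          have hne : (c : ℝ) ≠ s := fun h => hs (h ▸ c.2)
          rcases lt_or_gt_of_ne hne with h | h
          · refine ContinuousAt.congr (f := fun _ => w c) continuousAt_const ?_
            filter_upwards [lt_mem_nhds h] with a ha
            simp [j, (le_of_lt ha : (c:ℝ) ≤ a)]
          · refine ContinuousAt.congr (f := fun _ => 0) continuousAt_const ?_
            filter_upwards [gt_mem_nhds h] with a ha
            simp [j, ha]
        · intro c s _
          rw [Real.norm_of_nonneg (hj0 c s)]; exact hjw c s
      have hc' := Metric.continuousOn_iff.1 hc s hs ((rl s - ll s) / 2) (by linarith)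
      obtain ⟨δ, hδ, hc'⟩ := hc'
      have hd : Dense Sᶜ := hS.dense_compl ℝ
      obtain ⟨a, ha, ha1⟩ := hd.exists_between (show s - δ < s by linarith)
      obtain ⟨b, hb, hb1⟩ := hd.exists_between (show s < s + δ by linarith)
      have e1 := hc' a ha (by rw [Real.dist_eq, abs_lt]; constructor <;> linarith [ha1.1, ha1.2])
      have e2 := hc' b hb (by rw [Real.dist_eq, abs_lt]; constructor <;> linarith [hb1.1, hb1.2])
      rw [Real.dist_eq, abs_lt] at e1 e2
      have := h1 a s ha1.2
      have := h4 s b hb1.1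
      linarith [e1.1, e2.2]
    · intro hs
      have : ∀ s' < s, ψ s' ≤ rl s - w ⟨s, hs⟩ := by
        intro s' hs'
        suffices ψ s' + w ⟨s, hs⟩ ≤ ψ s by linarith [h3 s]
        have e : ∑' c, j c s' + w ⟨s, hs⟩ ≤ ∑' c, j c s := by
          rw [← tsum_ite_eq (⟨s, hs⟩ : S) w, ← (hjs s').tsum_add]
          · refine Summable.tsum_le_tsum ?_ ?_ (hjs s)
            · intro c
              by_cases hcs : c = ⟨s, hs⟩
              · subst hcs; simp [j, not_le.2 hs']
              · simp only [hcs, if_false, add_zero]; exact hjm c hs'.le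
            · exact (hjs s').add (summable_of_hasFiniteSupport
                (Set.Finite.subset (Set.finite_singleton (⟨s, hs⟩ : S)) (by
                  intro c hc; by_contra h; simp only [Set.mem_singleton_iff] at h; simp [h] at hc)))
          · exact (summable_of_hasFiniteSupport
                (Set.Finite.subset (Set.finite_singleton (⟨s, hs⟩ : S)) (by
                  intro c hc; by_contra h; simp only [Set.mem_singleton_iff] at h; simp [h] at hc)))
        simp only [ψ]; linarith
      have := h6 s _ this
      linarith [hw0 ⟨s, hs⟩]

/-- data for the shuffle construction -/
structure SD (C : Lab ι → Prop) (A' B' A B oL oR oT oB : Set ι) (u v : ℝ → ℝ) (R : ℝ → RD ι)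
    (e' e : ℝ → Lab ι) : Prop where
  um : Monotone u
  vm : Antitone v
  RI : ∀ s, (R s).I = {x | u x = s}
  RJ : ∀ s, (R s).J = {y | v y = s}
  ok : ∀ s, (R s).Ok C
  it : ∀ s, Item B' A (R s).desc
  dn : ∀ s a b, a < b → ∃ s', a < s' ∧ s' < b ∧ (R s').desc = (R s).desc
  e'1 : ∀ x, TC C A' B' (e' x)
  e1 : ∀ x, TC C A B (e x)
  e'2 : ∀ t, TC C A' B' t → ∀ a b, a < b → ∃ x, a < x ∧ x < b ∧ e' x = t
  e2 : ∀ t, TC C A B t → ∀ a b, a < b → ∃ x, a < x ∧ x < b ∧ e x = t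
  hA : A = Lit C A B ∪ oR ∪ oT
  hB' : B' = Lit C A' B' ∪ oL ∪ oB
  hA' : A' = Lit C A' B' ∪ A ∪ {i | ∃ s, ∃ m, ((R s).desc.L m).ne ∧ i ∈ m.f}
  hB : B = Lit C A B ∪ B' ∪ {i | ∃ s, ∃ m, ((R s).desc.R m).ne ∧ i ∈ m.p}

section SD
variable {C : Lab ι → Prop} {A' B' A B oL oR oT oB : Set ι} {u v : ℝ → ℝ} {R : ℝ → RD ι}
    {e' e : ℝ → Lab ι}

open Classical in
noncomputable def shR (oL oR oT oB : Set ι) (u v : ℝ → ℝ) (R : ℝ → RD ι) (e' e : ℝ → Lab ι) : RD ι :=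
  ⟨Set.univ, Set.univ, fun x y => if u x < v y then e' x else if v y < u x then e x else
    (R (u x)).h x y, fun _ => oL, fun _ => oR, fun _ => oB, fun _ => oT⟩

variable (H : SD C A' B' A B oL oR oT oB u v R e' e)
include H

theorem SD.us (s : ℝ) : ∃ x, u x = s := by
  obtain ⟨x, hx⟩ := (H.ok s).In
  rw [H.RI] at hx; exact ⟨x, hx⟩
theorem SD.vs (s : ℝ) : ∃ x, v x = s := by
  obtain ⟨x, hx⟩ := (H.ok s).Jn
  rw [H.RJ] at hx; exact ⟨x, hx⟩
theorem SD.mI (x : ℝ) : x ∈ (R (u x)).I := by rw [H.RI]; rfl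
theorem SD.mJ (x : ℝ) : x ∈ (R (v x)).J := by rw [H.RJ]; rfl

theorem SD.oRA (y : ℝ) : (R (v y)).oR y = A :=
  (H.it (v y)).R ((R (v y)).eR y) ⟨y, H.mJ y, rfl⟩
theorem SD.oTA (y : ℝ) : (R (u y)).oT y = A :=
  (H.it (u y)).T ((R (u y)).eT y) ⟨y, H.mI y, rfl⟩
theorem SD.oLB (y : ℝ) : (R (v y)).oL y = B' :=
  (H.it (v y)).L ((R (v y)).eL y) ⟨y, H.mJ y, rfl⟩
theorem SD.oBB (y : ℝ) : (R (u y)).oB y = B' :=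
  (H.it (u y)).B ((R (u y)).eB y) ⟨y, H.mI y, rfl⟩

theorem SD.ult {x y : ℝ} (h : u x < u y) : x < y := by
  by_contra hc; exact absurd (H.um (not_lt.1 hc)) (not_le.2 h)
theorem SD.vlt {x y : ℝ} (h : v y < v x) : x < y := by
  by_contra hc; exact absurd (H.vm (not_lt.1 hc)) (not_le.2 h)

theorem SD.lit1 {i : ι} {x y : ℝ} (h : u x < v y) :
    (shR oL oR oT oB u v R e' e).lit i x y ↔ i ∈ (e' x).l := by
  simp [RD.lit, shR, h]
theorem SD.lit2 {i : ι} {x y : ℝ} (h : v y < u x) :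
    (shR oL oR oT oB u v R e' e).lit i x y ↔ i ∈ (e x).l := by
  simp [RD.lit, shR, h, not_lt.2 h.le]
theorem SD.lit3 {i : ι} {x y s : ℝ} (h : u x = s) (h' : v y = s) :
    (shR oL oR oT oB u v R e' e).lit i x y ↔ (R s).lit i x y := by
  subst h
  have a1 := H.mI x
  have a2 := H.mJ y
  rw [h'] at a2
  simp [RD.lit, shR, h', a1, a2]

theorem SD.AA' : A ⊆ A' := by rw [H.hA']; intro i hi; exact Or.inl (Or.inr hi)
theorem SD.BB' : B' ⊆ B := by rw [H.hB]; intro i hi; exact Or.inl (Or.inr hi)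
theorem SD.rA : oR ⊆ A := by rw [H.hA]; intro i hi; exact Or.inl (Or.inr hi)
theorem SD.tA : oT ⊆ A := by rw [H.hA]; intro i hi; exact (Or.inr hi)
theorem SD.lB : oL ⊆ B' := by rw [H.hB']; intro i hi; exact Or.inl (Or.inr hi)
theorem SD.bB : oB ⊆ B' := by rw [H.hB']; intro i hi; exact (Or.inr hi)

theorem SD.litA' {i : ι} {x y : ℝ} (h : (shR oL oR oT oB u v R e' e).lit i x y) : i ∈ A' ∧ i ∈ B := by
  rcases lt_trichotomy (u x) (v y) with h1 | h1 | h1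
  · rw [H.lit1 h1] at h
    exact ⟨(H.e'1 x).2.2.2.1 h, H.BB' ((H.e'1 x).2.2.2.2 h)⟩
  · rw [H.lit3 rfl h1.symm] at h
    constructor
    · rw [H.hA']
      exact Or.inr ⟨u x, _, ⟨y, h.2.1, rfl⟩, Or.inl ⟨x, y, h, le_rfl⟩⟩
    · rw [H.hB]
      exact Or.inr ⟨u x, _, ⟨y, h.2.1, rfl⟩, Or.inl ⟨x, y, h, le_rfl⟩⟩
  · rw [H.lit2 h1] at h
    exact ⟨H.AA' ((H.e1 x).2.2.2.1 h), ((H.e1 x).2.2.2.2 h)⟩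

theorem SD.exA {i : ι} (x y : ℝ) (hi : i ∈ A) (hxy : v y ≤ u x ∨ u x < v y) :
    (∃ x' y', (shR oL oR oT oB u v R e' e).lit i x' y' ∧ x ≤ x' ∧ y ≤ y' ∧ ¬ (x' = x ∧ y' = y)) ∨
    i ∈ oR ∨ i ∈ oT := by
  rw [H.hA] at hi
  rcases hi with (⟨t, ht, hi⟩ | hi) | hi
  · left
    obtain ⟨x1, hx1⟩ := H.us (max (u x) (v y) + 1)
    obtain ⟨x0, hx0⟩ := H.us (max (u x) (v y) + 1/2)
    have g1 := le_max_left (u x) (v y)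
    have g2 := le_max_right (u x) (v y)
    have l1 : x < x0 := H.ult (by linarith)
    have l2 : x0 < x1 := H.ult (by linarith)
    obtain ⟨x2, k1, k2, k3⟩ := H.e2 t ht x0 x1 l2
    refine ⟨x2, y, ?_, by linarith, le_rfl, fun h => by linarith [h.1]⟩
    have := H.um k1.le
    rw [H.lit2 (by linarith), k3]; exact hi
  · exact Or.inr (Or.inl hi)
  · exact Or.inr (Or.inr hi)

theorem SD.exB {i : ι} (x y : ℝ) (hi : i ∈ B') :
    (∃ x' y', (shR oL oR oT oB u v R e' e).lit i x' y' ∧ x' ≤ x ∧ y' ≤ y ∧ ¬ (x' = x ∧ y' = y)) ∨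
    i ∈ oL ∨ i ∈ oB := by
  rw [H.hB'] at hi
  rcases hi with (⟨t, ht, hi⟩ | hi) | hi
  · left
    obtain ⟨x1, hx1⟩ := H.us (min (u x) (v y) - 1)
    obtain ⟨x0, hx0⟩ := H.us (min (u x) (v y) - 1/2)
    have g1 := min_le_left (u x) (v y)
    have g2 := min_le_right (u x) (v y)
    have l1 : x0 < x := H.ult (by linarith)
    have l2 : x1 < x0 := H.ult (by linarith)
    obtain ⟨x2, k1, k2, k3⟩ := H.e'2 t ht x1 x0 l2
    refine ⟨x2, y, ?_, by linarith, le_rfl, fun h => by linarith [h.1]⟩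
    have := H.um k2.le
    rw [H.lit1 (by linarith), k3]; exact hi
  · exact Or.inr (Or.inl hi)
  · exact Or.inr (Or.inr hi)

theorem SD.exA' {i : ι} (x y : ℝ) (hi : i ∈ A') (hxy : u x < v y) :
    (∃ x' y', (shR oL oR oT oB u v R e' e).lit i x' y' ∧ x ≤ x' ∧ y ≤ y' ∧ ¬ (x' = x ∧ y' = y)) ∨
    i ∈ oR ∨ i ∈ oT := by
  rw [H.hA'] at hi
  rcases hi with (⟨t, ht, hi⟩ | hi) | ⟨s, m, hm, hi⟩
  · left
    obtain ⟨s, hs1, hs2⟩ := exists_between hxy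
    obtain ⟨x1, rfl⟩ := H.us s
    obtain ⟨x2, k1, k2, k3⟩ := H.e'2 t ht x x1 (H.ult hs1)
    refine ⟨x2, y, ?_, by linarith, le_rfl, fun h => by linarith [h.1]⟩
    have := H.um k2.le
    rw [H.lit1 (by linarith), k3]; exact hi
  · exact H.exA x y hi (Or.inr hxy)
  · obtain ⟨s', hs1, hs2, hs3⟩ := H.dn s _ _ hxy
    rw [← hs3] at hm
    obtain ⟨y0, hy0, rfl⟩ := hm
    have hy0' : v y0 = s' := by rw [H.RJ] at hy0; exact hy0
    rcases hi with ⟨x', y', hl, hle⟩ | hi | ⟨x', hx', hi⟩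
    · left
      have q1 : u x' = s' := by have := hl.1; rw [H.RI] at this; exact this
      have q2 : v y' = s' := by have := hl.2.1; rw [H.RJ] at this; exact this
      have p1 : x < x' := H.ult (by linarith)
      have p2 : y < y' := H.vlt (by linarith)
      exact ⟨x', y', (H.lit3 q1 q2).2 hl, p1.le, p2.le, fun h => by linarith [h.1]⟩
    · subst hy0'
      rw [H.oRA] at hi; exact H.exA x y hi (Or.inr hxy)
    · have q1 : u x' = s' := by rw [H.RI] at hx'; exact hx'
      subst q1
      rw [H.oTA] at hi; exact H.exA x y hi (Or.inr hxy)

theorem SD.exB0 {i : ι} (x y : ℝ) (hi : i ∈ B) (hxy : v y < u x) :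
    (∃ x' y', (shR oL oR oT oB u v R e' e).lit i x' y' ∧ x' ≤ x ∧ y' ≤ y ∧ ¬ (x' = x ∧ y' = y)) ∨
    i ∈ oL ∨ i ∈ oB := by
  rw [H.hB] at hi
  rcases hi with (⟨t, ht, hi⟩ | hi) | ⟨s, m, hm, hi⟩
  · left
    obtain ⟨s, hs1, hs2⟩ := exists_between hxy
    obtain ⟨x1, rfl⟩ := H.us s
    obtain ⟨x2, k1, k2, k3⟩ := H.e2 t ht x1 x (H.ult hs2)
    refine ⟨x2, y, ?_, by linarith, le_rfl, fun h => by linarith [h.1]⟩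
    have := H.um k1.le
    rw [H.lit2 (by linarith), k3]; exact hi
  · exact H.exB x y hi
  · obtain ⟨s', hs1, hs2, hs3⟩ := H.dn s _ _ hxy
    rw [← hs3] at hm
    obtain ⟨y0, hy0, rfl⟩ := hm
    have hy0' : v y0 = s' := by rw [H.RJ] at hy0; exact hy0
    rcases hi with ⟨x', y', hl, hle⟩ | hi | ⟨x', hx', hi⟩
    · left
      have q1 : u x' = s' := by have := hl.1; rw [H.RI] at this; exact this
      have q2 : v y' = s' := by have := hl.2.1; rw [H.RJ] at this; exact this
      have p1 : x' < x := H.ult (by linarith)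
      have p2 : y' < y := H.vlt (by linarith)
      exact ⟨x', y', (H.lit3 q1 q2).2 hl, p1.le, p2.le, fun h => by linarith [h.1]⟩
    · subst hy0'
      rw [H.oLB] at hi; exact H.exB x y hi
    · have q1 : u x' = s' := by rw [H.RI] at hx'; exact hx'
      subst q1
      rw [H.oBB] at hi; exact H.exB x y hi

theorem SD.hok : (shR oL oR oT oB u v R e' e).Ok C where
  Ic := Set.ordConnected_univ
  Jc := Set.ordConnected_univ
  In := Set.univ_nonempty
  Jn := Set.univ_nonempty
  mL := fun _ _ _ _ _ => subset_rfl
  mR := fun _ _ _ _ _ => subset_rfl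
  mB := fun _ _ _ _ _ => subset_rfl
  mT := fun _ _ _ _ _ => subset_rfl
  hC := by
    intro x _ y _
    simp only [shR]
    split_ifs with h1 h2
    · exact (H.e'1 x).1
    · exact (H.e1 x).1
    · have : u x = v y := le_antisymm (not_lt.1 h2) (not_lt.1 h1)
      exact (H.ok _).hC x (H.mI x) y (this ▸ H.mJ y)
  hf := by
    intro x _ y _ i
    rcases lt_trichotomy (u x) (v y) with h1 | h1 | h1
    · have : (shR oL oR oT oB u v R e' e).h x y = e' x := by simp [shR, h1]
      rw [this, (H.e'1 x).2.1]
      refine ⟨fun hi => H.exA' x y hi h1, ?_⟩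
      rintro (⟨x', y', hl, -⟩ | hi | hi)
      · exact (H.litA' hl).1
      · exact H.AA' (H.rA hi)
      · exact H.AA' (H.tA hi)
    · have : (shR oL oR oT oB u v R e' e).h x y = (R (u x)).h x y := by simp [shR, h1]
      have hy : y ∈ (R (u x)).J := h1 ▸ H.mJ y
      rw [this, (H.ok _).hf x (H.mI x) y hy, H.oTA, h1, H.oRA, or_self, ← h1]
      constructor
      · rintro (⟨x', y', hl, hh⟩ | hi)
        · have q1 : u x' = u x := by have := hl.1; rw [H.RI] at this; exact this
          have q2 : v y' = u x := by have := hl.2.1; rw [H.RJ] at this; exact this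
          exact Or.inl ⟨x', y', (H.lit3 q1 q2).2 hl, hh⟩
        · exact H.exA x y hi (Or.inl h1.ge)
      · rintro (⟨x', y', hl, hh⟩ | hi | hi)
        · have k1 := H.um hh.1
          have k2 := H.vm hh.2.1
          rcases lt_or_eq_of_le (show v y' ≤ u x' by linarith) with k | k
          · right; rw [H.lit2 k] at hl; exact (H.e1 x').2.2.2.1 hl
          · left
            exact ⟨x', y', (H.lit3 (by linarith) (by linarith)).1 hl, hh⟩
        · exact Or.inr (H.rA hi)
        · exact Or.inr (H.tA hi)
    · have : (shR oL oR oT oB u v R e' e).h x y = e x := by simp [shR, h1, not_lt.2 h1.le]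
      rw [this, (H.e1 x).2.1]
      refine ⟨fun hi => H.exA x y hi (Or.inl h1.le), ?_⟩
      rintro (⟨x', y', hl, hh⟩ | hi | hi)
      · have k1 := H.um hh.1
        have k2 := H.vm hh.2.1
        rw [H.lit2 (by linarith)] at hl; exact (H.e1 x').2.2.2.1 hl
      · exact (H.rA hi)
      · exact (H.tA hi)
  hp := by
    intro x _ y _ i
    rcases lt_trichotomy (u x) (v y) with h1 | h1 | h1
    · have : (shR oL oR oT oB u v R e' e).h x y = e' x := by simp [shR, h1]
      rw [this, (H.e'1 x).2.2.1]
      refine ⟨fun hi => H.exB x y hi, ?_⟩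
      rintro (⟨x', y', hl, hh⟩ | hi | hi)
      · have k1 := H.um hh.1
        have k2 := H.vm hh.2.1
        rw [H.lit1 (by linarith)] at hl; exact (H.e'1 x').2.2.2.2 hl
      · exact (H.lB hi)
      · exact (H.bB hi)
    · have : (shR oL oR oT oB u v R e' e).h x y = (R (u x)).h x y := by simp [shR, h1]
      have hy : y ∈ (R (u x)).J := h1 ▸ H.mJ y
      rw [this, (H.ok _).hp x (H.mI x) y hy, H.oBB, h1, H.oLB, or_self, ← h1]
      constructor
      · rintro (⟨x', y', hl, hh⟩ | hi)
        · have q1 : u x' = u x := by have := hl.1; rw [H.RI] at this; exact this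
          have q2 : v y' = u x := by have := hl.2.1; rw [H.RJ] at this; exact this
          exact Or.inl ⟨x', y', (H.lit3 q1 q2).2 hl, hh⟩
        · exact H.exB x y hi
      · rintro (⟨x', y', hl, hh⟩ | hi | hi)
        · have k1 := H.um hh.1
          have k2 := H.vm hh.2.1
          rcases lt_or_eq_of_le (show u x' ≤ v y' by linarith) with k | k
          · right; rw [H.lit1 k] at hl; exact (H.e'1 x').2.2.2.2 hl
          · left
            exact ⟨x', y', (H.lit3 (by linarith) (by linarith)).1 hl, hh⟩
        · exact Or.inr (H.lB hi)
        · exact Or.inr (H.bB hi)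
    · have : (shR oL oR oT oB u v R e' e).h x y = e x := by simp [shR, h1, not_lt.2 h1.le]
      rw [this, (H.e1 x).2.2.1]
      refine ⟨fun hi => H.exB0 x y hi h1, ?_⟩
      rintro (⟨x', y', hl, -⟩ | hi | hi)
      · exact (H.litA' hl).2
      · exact H.BB' (H.lB hi)
      · exact H.BB' (H.bB hi)

theorem SD.desc : (shR oL oR oT oB u v R e' e).desc =
    ⟨koo, koo, cW koo ⟨oL, A'⟩, cW koo ⟨B, oR⟩, cW koo ⟨B, oT⟩, cW koo ⟨oB, A'⟩⟩ := by
  have key : ∀ κ : ℝ → Mo ι, ∀ m, (∀ y, κ y = m) → W κ Set.univ = cW koo m := by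
    intro κ m h
    rw [W_const κ m (fun y _ => h y), kd_univ]
  refine Ds.ext kd_univ kd_univ (key _ _ ?_) (key _ _ ?_) (key _ _ ?_) (key _ _ ?_)
  · intro y
    ext i
    · rfl
    · constructor
      · rintro (⟨x', y', hl, -⟩ | hi | ⟨_, _, hi⟩)
        · exact (H.litA' hl).1
        · exact H.AA' (H.rA hi)
        · exact H.AA' (H.tA hi)
      · intro hi
        obtain ⟨x, hx⟩ := H.us (v y - 1)
        rcases H.exA' x y hi (by linarith) with ⟨x', y', hl, h1, h2, -⟩ | hi | hi
        · exact Or.inl ⟨x', y', hl, h2⟩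
        · exact Or.inr (Or.inl hi)
        · exact Or.inr (Or.inr ⟨x, trivial, hi⟩)
  · intro y
    ext i
    · constructor
      · rintro (⟨x', y', hl, -⟩ | hi | ⟨_, _, hi⟩)
        · exact (H.litA' hl).2
        · exact H.BB' (H.lB hi)
        · exact H.BB' (H.bB hi)
      · intro hi
        obtain ⟨x, hx⟩ := H.us (v y + 1)
        rcases H.exB0 x y hi (by linarith) with ⟨x', y', hl, h1, h2, -⟩ | hi | hi
        · exact Or.inl ⟨x', y', hl, h2⟩
        · exact Or.inr (Or.inl hi)
        · exact Or.inr (Or.inr ⟨x, trivial, hi⟩)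
    · rfl
  · intro x
    ext i
    · constructor
      · rintro (⟨x', y', hl, -⟩ | hi | ⟨_, _, hi⟩)
        · exact (H.litA' hl).2
        · exact H.BB' (H.bB hi)
        · exact H.BB' (H.lB hi)
      · intro hi
        obtain ⟨y, hy⟩ := H.vs (u x - 1)
        rcases H.exB0 x y hi (by linarith) with ⟨x', y', hl, h1, h2, -⟩ | hi | hi
        · exact Or.inl ⟨x', y', hl, h1⟩
        · exact Or.inr (Or.inr ⟨y, trivial, hi⟩)
        · exact Or.inr (Or.inl hi)
    · rfl
  · intro x
    ext i
    · rfl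
    · constructor
      · rintro (⟨x', y', hl, -⟩ | hi | ⟨_, _, hi⟩)
        · exact (H.litA' hl).1
        · exact H.AA' (H.tA hi)
        · exact H.AA' (H.rA hi)
      · intro hi
        obtain ⟨y, hy⟩ := H.vs (u x + 1)
        rcases H.exA' x y hi (by linarith) with ⟨x', y', hl, h1, h2, -⟩ | hi | hi
        · exact Or.inl ⟨x', y', hl, h1⟩
        · exact Or.inr (Or.inr ⟨y, trivial, hi⟩)
        · exact Or.inr (Or.inl hi)
end SD

instance : Finite Kd := Finite.of_injective (fun k : Kd => (k.ne, k.mn, k.mx, k.sg)) (by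
    rintro ⟨a, b, c, d⟩ ⟨a', b', c', d'⟩ h; simp at h; simp [h])
instance [Finite ι] : Finite (Mo ι) := Finite.of_injective (fun k : Mo ι => (k.p, k.f)) (by
    rintro ⟨a, b⟩ ⟨a', b'⟩ h; simp at h; simp [h])
instance [Finite ι] : Finite (Ds ι) := Finite.of_injective
  (fun d : Ds ι => (d.kI, d.kJ, d.L, d.R, d.T, d.B)) (by
    rintro ⟨a, b, c, d, e, f⟩ ⟨a', b', c', d', e', f'⟩ h; simp at h; simp [h])

theorem kd_Icc {lo hi : ℝ} (h : lo ≤ hi) {k : Kd} (h1 : k.ne) (h2 : k.mn) (h3 : k.mx)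
    (h4 : lo < hi ↔ ¬ k.sg) : kd (Set.Icc lo hi) = k := by
  ext
  · simp [kd, h1, h]
  · simp only [kd, h2, iff_true]; exact ⟨lo, isLeast_Icc h⟩
  · simp only [kd, h3, iff_true]; exact ⟨hi, isGreatest_Icc h⟩
  · simp only [kd]
    constructor
    · intro hs; by_contra hc
      have := hs (Set.left_mem_Icc.2 h) (Set.right_mem_Icc.2 h)
      linarith [h4.2 hc]
    · intro hs
      have : ¬ lo < hi := fun hh => h4.1 hh hs
      have : lo = hi := by linarith
      subst this; simp

theorem exists_enum [Finite ι] {P : Lab ι → Prop} (h : ∃ t, P t) (g : ℝ → ℕ)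
    (hg : ∀ n a b, a < b → ∃ x, a < x ∧ x < b ∧ g x = n) :
    ∃ e : ℝ → Lab ι, (∀ x, P (e x)) ∧
      ∀ t, P t → ∀ a b, a < b → ∃ x, a < x ∧ x < b ∧ e x = t := by
  obtain ⟨en, hen⟩ := (Set.to_countable {t | P t}).exists_eq_range h
  refine ⟨fun x => en (g x), fun x => ?_, fun t ht a b hab => ?_⟩
  · have : en (g x) ∈ {t | P t} := by rw [hen]; exact ⟨_, rfl⟩
    exact this
  · have : t ∈ {t | P t} := ht
    rw [hen] at this
    obtain ⟨n, rfl⟩ := this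
    obtain ⟨x, h1, h2, h3⟩ := hg n a b hab
    exact ⟨x, h1, h2, congrArg en h3⟩

theorem or_aux (a b c d : Prop) : (((a ∨ b) ∨ c) ∨ d) ↔ ((a ∨ b) ∨ ((c ∨ b) ∨ d)) := by tauto

theorem Rl_shuf [Finite ι] (C : Lab ι → Prop) (A' B' A B oL oR oT oB : Set ι) (t : Lab ι)
    (K : Set (Ds ι))
    (h1 : ∃ s, TC C A' B' s) (h2 : ∃ s, TC C A B s)
    (hA : A = Lit C A B ∪ oR ∪ oT) (hB' : B' = Lit C A' B' ∪ oL ∪ oB)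
    (ht : C t) (htf : t.f = A) (htp : t.p = B') (htA : t.l ⊆ A') (htB : t.l ⊆ B)
    (hK : ∀ d ∈ K, d ∈ Rl C ∧ Item B' A d)
    (hA' : A' = Lit C A' B' ∪ A ∪ t.l ∪ {i | ∃ d ∈ K, ∃ m, (d.L m).ne ∧ i ∈ m.f})
    (hB : B = Lit C A B ∪ B' ∪ t.l ∪ {i | ∃ d ∈ K, ∃ m, (d.R m).ne ∧ i ∈ m.p}) :
    (⟨koo, koo, cW koo ⟨oL, A'⟩, cW koo ⟨B, oR⟩, cW koo ⟨B, oT⟩, cW koo ⟨oB, A'⟩⟩ : Ds ι) ∈ Rl C := by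
  classical
  have h0 := Rl_pt C t B' A A B' ht (by simp [htf]) (by simp [htp])
  rw [htf, htp] at h0
  set d0 : Ds ι := ⟨kpt, kpt, cW kpt ⟨B', t.l ∪ A⟩, cW kpt ⟨t.l ∪ B', A⟩, cW kpt ⟨t.l ∪ B', A⟩,
      cW kpt ⟨B', t.l ∪ A⟩⟩ with hd0
  obtain ⟨en, hen⟩ := (Set.to_countable (insert d0 K)).exists_eq_range ⟨d0, Set.mem_insert _ _⟩
  let c : ℕ → Ds ι := fun n => if n = 0 then d0 else en (n - 1)
  have hi0 : Item B' A d0 := by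
    constructor
    · trivial
    · trivial
    · trivial
    · trivial
    all_goals
      rintro m ⟨rfl, -⟩; rfl
  have hc : ∀ n, c n = d0 ∨ c n ∈ K := by
    intro n
    by_cases hn : n = 0
    · left; simp [c, hn]
    · have : en (n - 1) ∈ insert d0 K := by rw [hen]; exact ⟨_, rfl⟩
      simpa [c, hn] using this
  have hcR : ∀ n, c n ∈ Rl C ∧ Item B' A (c n) := by
    intro n
    rcases hc n with h | h
    · rw [h]; exact ⟨h0, hi0⟩
    · exact hK _ h
  have hcs : ∀ d ∈ insert d0 K, ∃ n, c n = d := by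
    intro d hd; rw [hen] at hd; obtain ⟨n, rfl⟩ := hd
    exact ⟨n + 1, by simp [c]⟩
  obtain ⟨g, hg, hg0⟩ := exists_dense_fiber
  choose r hr hrd using fun n => (hcR n).1
  have hcnt : ∀ k : Ds ι → Kd, k d0 = kpt → {s | ¬ (k (c (g s))).sg}.Countable := by
    intro k hk
    refine hg0.mono ?_
    intro s hs hgs
    apply hs
    simp [c, hgs, hk, kpt]
  obtain ⟨u, hu, hu2⟩ := exists_jump _ (hcnt Ds.kI rfl)
  obtain ⟨w, hw, hw2⟩ := exists_jump _ (hcnt Ds.kJ rfl)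
  have hkI : ∀ s, kd (r (g s)).I = (c (g s)).kI := fun s => by rw [← hrd]; rfl
  have hkJ : ∀ s, kd (r (g s)).J = (c (g s)).kJ := fun s => by rw [← hrd]; rfl
  have eI : ∀ s, {x | u x = s}.OrdConnected ∧ ∃ e, SIso {x | u x = s} (r (g s)).I e := by
    intro s
    obtain ⟨lo, hi, k1, k2, k3⟩ := hu2 s
    rw [k2]
    refine ⟨Set.ordConnected_Icc, exists_SIso Set.ordConnected_Icc (hr _).Ic ?_⟩
    rw [hkI]
    refine kd_Icc k1 ?_ (hcR _).2.imn (hcR _).2.imx k3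
    rw [← hkI]; exact (hr _).In
  have eJ : ∀ s, {y | w (-y) = s}.OrdConnected ∧ ∃ e, SIso {y | w (-y) = s} (r (g s)).J e := by
    intro s
    obtain ⟨lo, hi, k1, k2, k3⟩ := hw2 s
    have : {y | w (-y) = s} = Set.Icc (-hi) (-lo) := by
      ext y
      have : -y ∈ {x | w x = s} ↔ -y ∈ Set.Icc lo hi := by rw [k2]
      simp only [Set.mem_ofPred_eq, Set.mem_Icc] at this ⊢
      rw [this]; constructor <;> rintro ⟨a, b⟩ <;> constructor <;> linarith
    rw [this]
    refine ⟨Set.ordConnected_Icc, exists_SIso Set.ordConnected_Icc (hr _).Jc ?_⟩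
    rw [hkJ]
    refine kd_Icc (by linarith) ?_ (hcR _).2.jmn (hcR _).2.jmx ?_
    · rw [← hkJ]; exact (hr _).Jn
    · refine Iff.trans ?_ k3; constructor <;> intro <;> linarith
  choose ex hex using fun s => (eI s).2
  choose ey hey using fun s => (eJ s).2
  obtain ⟨e', he'1, he'2⟩ := exists_enum h1 g hg
  obtain ⟨e, he1, he2⟩ := exists_enum h2 g hg
  let R : ℝ → RD ι := fun s => (r (g s)).place {x | u x = s} {y | w (-y) = s} (ex s) (ey s)
  have hRd : ∀ s, (R s).desc = c (g s) := fun s => by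
    rw [← hrd]; exact RD.place_desc (hex s) (hey s)
  have hset : ∀ Q : Ds ι → Prop, (∃ s, Q ((R s).desc)) ↔ (Q d0 ∨ ∃ d ∈ K, Q d) := by
    intro Q
    constructor
    · rintro ⟨s, hs⟩
      rw [hRd] at hs
      rcases hc (g s) with h | h
      · left; rwa [h] at hs
      · right; exact ⟨_, h, hs⟩
    · intro h
      have : ∃ d ∈ insert d0 K, Q d := by
        rcases h with h | ⟨d, hd, h⟩
        · exact ⟨d0, Set.mem_insert _ _, h⟩
        · exact ⟨d, Set.mem_insert_of_mem _ hd, h⟩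
      obtain ⟨d, hd, h⟩ := this
      obtain ⟨n, rfl⟩ := hcs d hd
      obtain ⟨s, -, -, rfl⟩ := hg n 0 1 one_pos
      exact ⟨s, by rwa [hRd]⟩
  have H : SD C A' B' A B oL oR oT oB u (fun y => w (-y)) R e' e := by
    refine ⟨hu, fun a b h => hw (by linarith), fun _ => rfl, fun _ => rfl,
      fun s => RD.place_ok (hex s) (hey s) (hr _) (eI s).1 (eJ s).1, fun s => by rw [hRd]; exact (hcR _).2,
      ?_, he'1, he1, he'2, he2, hA, hB', ?_, ?_⟩
    · intro s a b hab
      obtain ⟨s', q1, q2, q3⟩ := hg (g s) a b hab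
      exact ⟨s', q1, q2, by rw [hRd, hRd, q3]⟩
    · ext i
      have q1 := hset (fun d => ∃ m, (d.L m).ne ∧ i ∈ m.f)
      have q2 : (∃ m, (d0.L m).ne ∧ i ∈ m.f) ↔ i ∈ t.l ∨ i ∈ A := by
        constructor
        · rintro ⟨m, ⟨rfl, -⟩, hi⟩; exact hi
        · intro hi; exact ⟨_, ⟨rfl, trivial⟩, hi⟩
      rw [q2] at q1
      conv_lhs => rw [hA']
      simp only [Set.mem_union, Set.mem_ofPred_eq]
      rw [q1]; exact or_aux _ _ _ _
    · ext i
      have q1 := hset (fun d => ∃ m, (d.R m).ne ∧ i ∈ m.p)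
      have q2 : (∃ m, (d0.R m).ne ∧ i ∈ m.p) ↔ i ∈ t.l ∨ i ∈ B' := by
        constructor
        · rintro ⟨m, ⟨rfl, -⟩, hi⟩; exact hi
        · intro hi; exact ⟨_, ⟨rfl, trivial⟩, hi⟩
      rw [q2] at q1
      conv_lhs => rw [hB]
      simp only [Set.mem_union, Set.mem_ofPred_eq]
      rw [q1]; exact or_aux _ _ _ _
  exact ⟨_, H.hok, H.desc⟩

theorem Rl_closed [Finite ι] (C : Lab ι → Prop) : Closed C (Rl C) :=
  ⟨Rl_pt C, Rl_cl C, Rl_join C, Rl_swap C, Rl_lim C, Rl_shuf C⟩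
end Temporal
end

section
namespace Temporal
variable {ι : Type}
open Set

def ff (l : ℝ → ℝ → Set ι) (x y : ℝ) : Set ι :=
  {i | ∃ x' y', x ≤ x' ∧ y ≤ y' ∧ ¬ (x' = x ∧ y' = y) ∧ i ∈ l x' y'}
def pp (l : ℝ → ℝ → Set ι) (x y : ℝ) : Set ι :=
  {i | ∃ x' y', x' ≤ x ∧ y' ≤ y ∧ ¬ (x' = x ∧ y' = y) ∧ i ∈ l x' y'}
def lsw (l : ℝ → ℝ → Set ι) : ℝ → ℝ → Set ι := fun x y => l y x

theorem ff_lsw (l : ℝ → ℝ → Set ι) (x y : ℝ) : ff (lsw l) x y = ff l y x := by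
  ext i; constructor
  · rintro ⟨x', y', h1, h2, h3, h4⟩; exact ⟨y', x', h2, h1, fun h => h3 ⟨h.2, h.1⟩, h4⟩
  · rintro ⟨x', y', h1, h2, h3, h4⟩; exact ⟨y', x', h2, h1, fun h => h3 ⟨h.2, h.1⟩, h4⟩
theorem pp_lsw (l : ℝ → ℝ → Set ι) (x y : ℝ) : pp (lsw l) x y = pp l y x := by
  ext i; constructor
  · rintro ⟨x', y', h1, h2, h3, h4⟩; exact ⟨y', x', h2, h1, fun h => h3 ⟨h.2, h.1⟩, h4⟩
  · rintro ⟨x', y', h1, h2, h3, h4⟩; exact ⟨y', x', h2, h1, fun h => h3 ⟨h.2, h.1⟩, h4⟩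

def VV (l : ℝ → ℝ → Set ι) (Λ : Set ℝ) (y : ℝ) : Mo ι :=
  ⟨{i | ∃ x' ∈ Λ, ∃ y' ≤ y, i ∈ l x' y'}, {i | ∃ x', x' ∉ Λ ∧ ∃ y', y ≤ y' ∧ i ∈ l x' y'}⟩

theorem VV_mono (l : ℝ → ℝ → Set ι) (Λ : Set ℝ) : Monotone (VV l Λ) := by
  intro a b h
  refine ⟨?_, ?_⟩
  · rintro i ⟨x', hx, y', hy, hi⟩; exact ⟨x', hx, y', hy.trans h, hi⟩
  · rintro i ⟨x', hx, y', hy, hi⟩; exact ⟨x', hx, y', h.trans hy, hi⟩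

def lo (I : Set ℝ) : Set ℝ := {x | ∀ a ∈ I, x < a}
def hi (I : Set ℝ) : Set ℝ := {x | ∃ a ∈ I, x ≤ a}

def dsc (l : ℝ → ℝ → Set ι) (I J : Set ℝ) : Ds ι :=
  ⟨kd I, kd J, W (VV l (lo I)) J, W (VV l (hi I)) J, W (VV (lsw l) (hi J)) I, W (VV (lsw l) (lo J)) I⟩

theorem dsc_lsw (l : ℝ → ℝ → Set ι) (I J : Set ℝ) : dsc (lsw l) J I = (dsc l I J).swap := rfl

/-- nonempty intervals in the open unit interval -/
structure Iv (I : Set ℝ) : Prop where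
  ne : I.Nonempty
  oc : I.OrdConnected
  sub : I ⊆ Ioo 0 1

theorem Iv.pt {x : ℝ} (h : x ∈ Ioo (0:ℝ) 1) : Iv {x} := ⟨⟨x, rfl⟩, ordConnected_singleton, by simpa using h⟩
theorem Iv.oo {a b : ℝ} (h : a < b) (ha : 0 ≤ a) (hb : b ≤ 1) : Iv (Ioo a b) :=
  ⟨nonempty_Ioo.2 h, ordConnected_Ioo, fun _ hx => ⟨ha.trans_lt hx.1, hx.2.trans_le hb⟩⟩

structure Cx (C : Lab ι → Prop) (X : Set (Ds ι)) (l : ℝ → ℝ → Set ι) : Prop where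
  cl : Closed C X
  md : ∀ x ∈ Ioo (0:ℝ) 1, ∀ y ∈ Ioo (0:ℝ) 1, C ⟨l x y, ff l x y, pp l x y⟩

theorem Cx.sw {C : Lab ι → Prop} {X : Set (Ds ι)} {l : ℝ → ℝ → Set ι} (h : Cx C X l) :
    Cx C X (lsw l) := ⟨h.cl, fun x hx y hy => by
      rw [ff_lsw, pp_lsw]; exact h.md y hy x hx⟩

theorem hi_eq_lo {I1 I2 : Set ℝ} (h1 : I1.Nonempty) (h2 : I2.Nonempty) (hlt : ∀ x ∈ I1, ∀ y ∈ I2, x < y)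
    (hoc : (I1 ∪ I2).OrdConnected) : hi I1 = lo I2 := by
  ext x; constructor
  · rintro ⟨a, ha, h⟩ b hb; exact h.trans_lt (hlt a ha b hb)
  · intro h
    by_contra hc
    have hc' : ∀ a ∈ I1, a < x := fun a ha => by
      by_contra hh; exact hc ⟨a, ha, not_lt.1 hh⟩
    obtain ⟨a, ha⟩ := h1
    obtain ⟨b, hb⟩ := h2
    rcases hoc.out (Or.inl ha) (Or.inr hb) ⟨(hc' a ha).le, (h b hb).le⟩ with hx | hx
    · exact lt_irrefl _ (hc' x hx)
    · exact lt_irrefl _ (h x hx)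

theorem mx_iff {I1 I2 : Set ℝ} (h1 : I1.Nonempty) (h2 : I2.Nonempty) (hlt : ∀ x ∈ I1, ∀ y ∈ I2, x < y)
    (hoc : (I1 ∪ I2).OrdConnected) : (∃ a, IsGreatest I1 a) ↔ ¬ (∃ a, IsLeast I2 a) := by
  constructor
  · rintro ⟨a, ha, ha'⟩ ⟨b, hb, hb'⟩
    obtain ⟨c, hc1, hc2⟩ := exists_between (hlt a ha b hb)
    rcases hoc.out (Or.inl ha) (Or.inr hb) ⟨hc1.le, hc2.le⟩ with h | h
    · exact absurd (ha' h) (not_le.2 hc1)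
    · exact absurd (hb' h) (not_le.2 hc2)
  · intro hn
    by_contra hc
    obtain ⟨a, ha⟩ := h1
    obtain ⟨b, hb⟩ := h2
    have hbd : BddAbove I1 := ⟨b, fun x hx => (hlt x hx b hb).le⟩
    have k1 : a ≤ sSup I1 := le_csSup hbd ha
    have k2 : ∀ b' ∈ I2, sSup I1 ≤ b' := fun b' hb' => csSup_le ⟨a, ha⟩ (fun x hx => (hlt x hx b' hb').le)
    rcases hoc.out (Or.inl ha) (Or.inr hb) ⟨k1, k2 b hb⟩ with h | h
    · exact hc ⟨_, h, fun x hx => le_csSup hbd hx⟩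
    · exact hn ⟨_, h, k2⟩

section
variable {C : Lab ι → Prop} {X : Set (Ds ι)} {l : ℝ → ℝ → Set ι} (hc : Cx C X l)
include hc

theorem DR_join {I1 I2 J : Set ℝ} (h1 : I1.Nonempty) (h2 : I2.Nonempty) (hlt : ∀ x ∈ I1, ∀ y ∈ I2, x < y)
    (hoc : (I1 ∪ I2).OrdConnected) (d1 : dsc l I1 J ∈ X) (d2 : dsc l I2 J ∈ X) :
    dsc l (I1 ∪ I2) J ∈ X := by
  have hh := hi_eq_lo h1 h2 hlt hoc
  have := hc.cl.join _ d1 _ d2 (by simp only [dsc, hh]) rfl (mx_iff h1 h2 hlt hoc)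
    (by rintro m m' ⟨x, hx, rfl⟩ ⟨x', hx', rfl⟩; exact VV_mono _ _ (hlt x hx x' hx').le)
    (by rintro m m' ⟨x, hx, rfl⟩ ⟨x', hx', rfl⟩; exact VV_mono _ _ (hlt x hx x' hx').le)
  convert this using 1
  have e1 : lo (I1 ∪ I2) = lo I1 := by
    ext x; constructor
    · intro h a ha; exact h a (Or.inl ha)
    · rintro h a (ha | ha)
      · exact h a ha
      · obtain ⟨b, hb⟩ := h1; exact (h b hb).trans (hlt b hb a ha)
  have e2 : hi (I1 ∪ I2) = hi I2 := by
    ext x; constructor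
    · rintro ⟨a, ha | ha, h⟩
      · obtain ⟨b, hb⟩ := h2; exact ⟨b, hb, h.trans (hlt a ha b hb).le⟩
      · exact ⟨a, ha, h⟩
    · rintro ⟨a, ha, h⟩; exact ⟨a, Or.inr ha, h⟩
  simp only [dsc]
  rw [e1, e2, kd_comb hlt, W_comb _ hlt, W_comb _ hlt]

theorem DR_swap {I J : Set ℝ} (h : dsc (lsw l) J I ∈ X) : dsc l I J ∈ X := hc.cl.swap _ h

theorem DR_joinY {I J1 J2 : Set ℝ} (h1 : J1.Nonempty) (h2 : J2.Nonempty) (hlt : ∀ x ∈ J1, ∀ y ∈ J2, x < y)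
    (hoc : (J1 ∪ J2).OrdConnected) (d1 : dsc l I J1 ∈ X) (d2 : dsc l I J2 ∈ X) :
    dsc l I (J1 ∪ J2) ∈ X :=
  DR_swap hc (DR_join hc.sw h1 h2 hlt hoc (hc.cl.swap _ d1) (hc.cl.swap _ d2))
end

/-- core lemma for intervals -/
theorem core_ind {U : Set ℝ} (hU : Iv U) (G : Set ℝ → Prop) (pt : ∀ y ∈ U, G {y})
    (op : ∀ a b, a < b → 0 ≤ a → b ≤ 1 → Ioo a b ⊆ U → (∀ x ∈ U, a ≤ x ∧ x ≤ b) → G (Ioo a b))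
    (jn : ∀ U1 U2, U1.Nonempty → U2.Nonempty → U1 ∪ U2 ⊆ U → (∀ x ∈ U1, ∀ y ∈ U2, x < y) →
      (U1 ∪ U2).OrdConnected → G U1 → G U2 → G (U1 ∪ U2)) : G U := by
  have hbb : BddBelow U := ⟨0, fun x hx => (hU.sub hx).1.le⟩
  have hba : BddAbove U := ⟨1, fun x hx => (hU.sub hx).2.le⟩
  set a := sInf U with ha
  set b := sSup U with hb
  have h1 : ∀ x ∈ U, a ≤ x ∧ x ≤ b := fun x hx => ⟨csInf_le hbb hx, le_csSup hba hx⟩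
  have h2 : Ioo a b ⊆ U := by
    intro x hx
    obtain ⟨y, hy, hyx⟩ := exists_lt_of_csInf_lt hU.ne hx.1
    obtain ⟨z, hz, hxz⟩ := exists_lt_of_lt_csSup hU.ne hx.2
    exact hU.oc.out hy hz ⟨hyx.le, hxz.le⟩
  have ha0 : 0 ≤ a := le_csInf hU.ne (fun x hx => (hU.sub hx).1.le)
  have hb0 : b ≤ 1 := csSup_le hU.ne (fun x hx => (hU.sub hx).2.le)
  obtain ⟨z, hz⟩ := hU.ne
  rcases eq_or_lt_of_le ((h1 z hz).1.trans (h1 z hz).2) with hab | hab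
  · have : U = {z} := by
      ext x; constructor
      · intro hx; have := h1 x hx; have := h1 z hz; simp only [mem_singleton_iff]; linarith
      · rintro rfl; exact hz
    have h := pt z hz
    rwa [← this] at h
  have g1 := op a b hab ha0 hb0 h2 h1
  have g2 : ∀ V, (V = Ioo a b ∨ (a ∈ U ∧ V = Ico a b)) → G V := by
    rintro V (rfl | ⟨h, rfl⟩)
    · exact g1
    · have e : Ico a b = {a} ∪ Ioo a b := by
        rw [Set.union_comm, Set.Ioo_union_left hab]
      rw [e]
      refine jn _ _ (singleton_nonempty _) (nonempty_Ioo.2 hab) ?_ ?_ ?_ (pt a h) g1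
      · rintro x (rfl | hx)
        · exact h
        · exact h2 hx
      · rintro x rfl y hy; exact hy.1
      · rw [← e]; exact ordConnected_Ico
  have h3 : ∀ x ∈ U, x ≠ a → x ≠ b → x ∈ Ioo a b := fun x hx hxa hxb =>
    ⟨lt_of_le_of_ne (h1 x hx).1 (Ne.symm hxa), lt_of_le_of_ne (h1 x hx).2 hxb⟩
  have g3 : ∃ V, V = U \ {b} ∧ V.Nonempty ∧ V.OrdConnected ∧ G V := by
    by_cases haU : a ∈ U
    · refine ⟨Ico a b, ?_, nonempty_Ico.2 hab, ordConnected_Ico, g2 _ (Or.inr ⟨haU, rfl⟩)⟩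
      ext x; constructor
      · intro hx
        refine ⟨?_, fun h => by have : x = b := h; linarith [hx.2]⟩
        rcases eq_or_lt_of_le hx.1 with h | h
        · rw [← h]; exact haU
        · exact h2 ⟨h, hx.2⟩
      · rintro ⟨hx, hxb⟩
        exact ⟨(h1 x hx).1, lt_of_le_of_ne (h1 x hx).2 hxb⟩
    · refine ⟨Ioo a b, ?_, nonempty_Ioo.2 hab, ordConnected_Ioo, g1⟩
      ext x; constructor
      · intro hx
        exact ⟨h2 hx, fun h => by have : x = b := h; linarith [hx.2]⟩
      · rintro ⟨hx, hxb⟩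
        exact h3 x hx (fun h => haU (h ▸ hx)) hxb
  obtain ⟨V, rfl, hVn, hVo, hVG⟩ := g3
  by_cases hbU : b ∈ U
  · have e : U = (U \ {b}) ∪ {b} := by simp [hbU]
    rw [e]
    refine jn _ _ hVn (singleton_nonempty _) e.ge ?_ (e ▸ hU.oc) hVG (pt b hbU)
    rintro x hx y rfl
    exact lt_of_le_of_ne (h1 x hx.1).2 hx.2
  · rwa [diff_singleton_eq_self hbU] at hVG

theorem cut_ind {T : Type} [PartialOrder T] [Finite T] (κ : ℝ → T) {J : Set ℝ} (hJ : Iv J)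
    (hκ : MonotoneOn κ J) (G : Set ℝ → Prop) (pt : ∀ y ∈ J, G {y})
    (op : ∀ a b, a < b → 0 ≤ a → b ≤ 1 → Ioo a b ⊆ J → (∀ x ∈ Ioo a b, ∀ y ∈ Ioo a b, κ x = κ y) → G (Ioo a b))
    (jn : ∀ U1 U2, U1.Nonempty → U2.Nonempty → U1 ∪ U2 ⊆ J → (∀ x ∈ U1, ∀ y ∈ U2, x < y) →
      (U1 ∪ U2).OrdConnected → G U1 → G U2 → G (U1 ∪ U2)) : G J := by
  suffices ∀ n, ∀ U, Iv U → U ⊆ J → (κ '' U).ncard = n → G U from this _ J hJ subset_rfl rfl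
  intro n
  induction n using Nat.strong_induction_on with
  | _ n ih =>
  intro U hU hUJ hn
  obtain ⟨m, ⟨y, hy, rfl⟩, hm⟩ := (Set.toFinite (κ '' U)).exists_maximal (hU.ne.image κ)
  have hm' : ∀ z ∈ U, κ y ≤ κ z → κ z = κ y := fun z hz h =>
    le_antisymm (hm ⟨z, hz, rfl⟩ h) h
  set U2 := {z | z ∈ U ∧ κ z = κ y} with hU2
  set U1 := {z | z ∈ U ∧ κ z ≠ κ y} with hU1
  have hun : U1 ∪ U2 = U := by
    ext z; simp only [U1, U2, mem_union, mem_ofPred_eq]; tauto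
  have hlt : ∀ x ∈ U1, ∀ z ∈ U2, x < z := by
    intro x hx z hz
    by_contra hc
    exact hx.2 (hm' x hx.1 (hz.2 ▸ hκ (hUJ hz.1) (hUJ hx.1) (not_lt.1 hc)))
  have i2 : Iv U2 := ⟨⟨y, hy, rfl⟩, level_ordConnected hU.oc (hκ.mono hUJ) _, fun x hx => hU.sub hx.1⟩
  have g2 : G U2 := by
    refine core_ind i2 G (fun z hz => pt z (hUJ hz.1)) ?_ ?_
    · intro a b hab ha hb hsub _
      refine op a b hab ha hb (fun x hx => hUJ (hsub hx).1) ?_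
      intro x hx z hz; rw [(hsub hx).2, (hsub hz).2]
    · intro V1 V2 n1 n2 hs; exact jn V1 V2 n1 n2 (fun x hx => hUJ (hs hx).1)
  rcases U1.eq_empty_or_nonempty with he | hne
  · rw [he, Set.empty_union] at hun; rwa [← hun]
  · have i1 : Iv U1 := by
      refine ⟨hne, ⟨?_⟩, fun x hx => hU.sub hx.1⟩
      intro x hx z hz w hw
      have hwU : w ∈ U := hU.oc.out hx.1 hz.1 hw
      refine ⟨hwU, fun h => ?_⟩
      exact absurd (hlt z hz w ⟨hwU, h⟩) (not_lt.2 hw.2)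
    have : (κ '' U1).ncard < n := by
      rw [← hn]
      refine Set.ncard_lt_ncard ⟨image_mono (fun x hx => hx.1), ?_⟩ (Set.toFinite _)
      intro h
      obtain ⟨z, hz, hh⟩ := h ⟨y, hy, rfl⟩
      exact hz.2 hh
    have g1 := ih _ this U1 i1 (fun x hx => hUJ hx.1) rfl
    rw [← hun]
    exact jn _ _ hne i2.ne (hun.le.trans hUJ) hlt (hun ▸ hU.oc) g1 g2
end Temporal
end

section
namespace Temporal
variable {ι : Type}
open Set

theorem lo_pt (x : ℝ) : lo {x} = Iio x := by ext z; simp [lo]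
theorem hi_pt (x : ℝ) : hi {x} = Iic x := by ext z; simp [hi]
theorem lo_oo {a b : ℝ} (h : a < b) : lo (Ioo a b) = Iic a := by
  ext z; constructor
  · intro hz; by_contra hc
    have hc : a < z := not_le.1 hc
    obtain ⟨w, hw1, hw2⟩ := exists_between (lt_min hc h)
    have := hz w ⟨hw1, hw2.trans_le (min_le_right _ _)⟩
    linarith [min_le_left z b]
  · intro hz x hx; exact lt_of_le_of_lt hz hx.1
theorem hi_oo {a b : ℝ} (h : a < b) : hi (Ioo a b) = Iio b := by
  ext z; constructor
  · rintro ⟨w, hw, h⟩; exact lt_of_le_of_lt h hw.2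
  · intro hz
    obtain ⟨w, hw1, hw2⟩ := exists_between (max_lt hz h)
    exact ⟨w, ⟨(le_max_right _ _).trans_lt hw1, hw2⟩, ((le_max_left _ _).trans_lt hw1).le⟩

theorem mem_lpf (l : ℝ → ℝ → Set ι) {x y x' y' : ℝ} {i : ι} (hi : i ∈ l x' y') (h1 : x ≤ x') (h2 : y ≤ y') :
    i ∈ l x y ∨ i ∈ ff l x y := by
  by_cases h : x' = x ∧ y' = y
  · left; rw [← h.1, ← h.2]; exact hi
  · right; exact ⟨x', y', h1, h2, h, hi⟩
theorem mem_lpp (l : ℝ → ℝ → Set ι) {x y x' y' : ℝ} {i : ι} (hi : i ∈ l x' y') (h1 : x' ≤ x) (h2 : y' ≤ y) :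
    i ∈ l x y ∨ i ∈ pp l x y := by
  by_cases h : x' = x ∧ y' = y
  · left; rw [← h.1, ← h.2]; exact hi
  · right; exact ⟨x', y', h1, h2, h, hi⟩

section
variable {C : Lab ι → Prop} {X : Set (Ds ι)} {l : ℝ → ℝ → Set ι} (hc : Cx C X l)
include hc

theorem DR_pt {x y : ℝ} (hx : x ∈ Ioo (0:ℝ) 1) (hy : y ∈ Ioo (0:ℝ) 1) : dsc l {x} {y} ∈ X := by
  have := hc.cl.pt ⟨l x y, ff l x y, pp l x y⟩ (VV l (Iio x) y).p (VV l (Iic x) y).f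
    (VV (lsw l) (Iic y) x).f (VV (lsw l) (Iio y) x).p (hc.md x hx y hy) (by
      ext i; constructor
      · rintro ⟨x', y', h1, h2, h3, h4⟩
        rcases eq_or_lt_of_le h1 with h | h
        · right
          refine ⟨y', fun (hh : y' ≤ y) => h3 ⟨h.symm, le_antisymm hh h2⟩, x', h1, h4⟩
        · left; exact ⟨x', not_le.2 h, y', h2, h4⟩
      · rintro (⟨x', h1, y', h2, h4⟩ | ⟨y', h1, x', h2, h4⟩)
        · have h1 : x < x' := not_le.1 h1
          exact ⟨x', y', h1.le, h2, fun h => by linarith [h.1], h4⟩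
        · have h1 : y < y' := not_le.1 h1
          exact ⟨x', y', h2, h1.le, fun h => by linarith [h.2], h4⟩) (by
      ext i; constructor
      · rintro ⟨x', y', h1, h2, h3, h4⟩
        rcases eq_or_lt_of_le h1 with h | h
        · right
          refine ⟨y', lt_of_le_of_ne h2 (fun hh => h3 ⟨h, hh⟩), x', h1, h4⟩
        · left; exact ⟨x', h, y', h2, h4⟩
      · rintro (⟨x', h1, y', h2, h4⟩ | ⟨y', h1, x', h2, h4⟩)
        · have h1 : x' < x := h1
          exact ⟨x', y', h1.le, h2, fun h => by linarith [h.1], h4⟩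
        · have h1 : y' < y := h1
          exact ⟨x', y', h2, h1.le, fun h => by linarith [h.2], h4⟩)
  convert this using 1
  have key : ∀ (κ : ℝ → Mo ι) (z : ℝ) m, κ z = m → W κ {z} = cW kpt m := by
    intro κ z m h
    rw [W_const κ m (by rintro _ rfl; exact h), kd_singleton]
  refine Ds.ext (kd_singleton _) (kd_singleton _) (key _ _ _ ?_) (key _ _ _ ?_) (key _ _ _ ?_) (key _ _ _ ?_)
  · rw [lo_pt]; ext i
    · rfl
    · constructor
      · rintro ⟨x', h1, y', h2, h3⟩; exact mem_lpf l h3 (not_lt.1 h1) h2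
      · rintro (h | ⟨x', y', h1, h2, -, h3⟩)
        · exact ⟨x, lt_irrefl x, y, le_rfl, h⟩
        · exact ⟨x', not_lt.2 h1, y', h2, h3⟩
  · rw [hi_pt]; ext i
    · constructor
      · rintro ⟨x', h1, y', h2, h3⟩; exact mem_lpp l h3 h1 h2
      · rintro (h | ⟨x', y', h1, h2, -, h3⟩)
        · exact ⟨x, le_refl x, y, le_rfl, h⟩
        · exact ⟨x', h1, y', h2, h3⟩
    · rfl
  · rw [hi_pt]; ext i
    · constructor
      · rintro ⟨y', h1, x', h2, h3⟩; exact mem_lpp l h3 h2 h1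
      · rintro (h | ⟨x', y', h1, h2, -, h3⟩)
        · exact ⟨y, le_refl y, x, le_rfl, h⟩
        · exact ⟨y', h2, x', h1, h3⟩
    · rfl
  · rw [lo_pt]; ext i
    · rfl
    · constructor
      · rintro ⟨y', h1, x', h2, h3⟩; exact mem_lpf l h3 h2 (not_lt.1 h1)
      · rintro (h | ⟨x', y', h1, h2, -, h3⟩)
        · exact ⟨y, lt_irrefl y, x, le_rfl, h⟩
        · exact ⟨y', not_lt.2 h2, x', h1, h3⟩

omit hc in
/-- a box all of whose points lie in one reflexive cluster -/
def TCon (l : ℝ → ℝ → Set ι) (A B : Set ι) (I J : Set ℝ) : Prop :=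
  ∀ x ∈ I, ∀ y ∈ J, ff l x y = A ∧ pp l x y = B ∧ l x y ⊆ A ∧ l x y ⊆ B

omit hc in
theorem TCon.sw {A B : Set ι} {I J : Set ℝ} (h : TCon l A B I J) : TCon (lsw l) A B J I := by
  intro x hx y hy
  rw [ff_lsw, pp_lsw]; exact h y hy x hx

omit hc in
theorem TCon.loA {A B : Set ι} {I J : Set ℝ} (h : TCon l A B I J) (hI : I.Nonempty) {y : ℝ} (hy : y ∈ J) :
    (VV l (lo I) y).f = A := by
  ext i; constructor
  · rintro ⟨x', h1, y', h2, h3⟩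
    have : ∃ a ∈ I, a ≤ x' := by
      by_contra hcc; push Not at hcc; exact h1 hcc
    obtain ⟨a, ha, hle⟩ := this
    have := h a ha y hy
    rcases mem_lpf l h3 hle h2 with h | h
    · exact this.2.2.1 h
    · rw [← this.1]; exact h
  · intro hi
    obtain ⟨a, ha⟩ := hI
    rw [← (h a ha y hy).1] at hi
    obtain ⟨x', y', h1, h2, -, h3⟩ := hi
    exact ⟨x', fun h => absurd (h a ha) (not_lt.2 h1), y', h2, h3⟩

omit hc in
theorem TCon.hiB {A B : Set ι} {I J : Set ℝ} (h : TCon l A B I J) (hI : I.Nonempty) {y : ℝ} (hy : y ∈ J) :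
    (VV l (hi I) y).p = B := by
  ext i; constructor
  · rintro ⟨x', ⟨a, ha, hle⟩, y', h2, h3⟩
    have := h a ha y hy
    rcases mem_lpp l h3 hle h2 with h | h
    · exact this.2.2.2 h
    · rw [← this.2.1]; exact h
  · intro hi
    obtain ⟨a, ha⟩ := hI
    rw [← (h a ha y hy).2.1] at hi
    obtain ⟨x', y', h1, h2, -, h3⟩ := hi
    exact ⟨x', ⟨a, ha, h1⟩, y', h2, h3⟩

theorem DR_cl {A B oL oR oT oB : Set ι} {I J : Set ℝ} (hI : Iv I) (hJ : Iv J)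
    (kI : kd I = kpt ∨ kd I = koo) (kJ : kd J = kpt ∨ kd J = koo) (hn : ¬ (kd I = kpt ∧ kd J = kpt))
    (h : TCon l A B I J)
    (hL : ∀ y ∈ J, (VV l (lo I) y).p = oL) (hR : ∀ y ∈ J, (VV l (hi I) y).f = oR)
    (hT : ∀ x ∈ I, (VV (lsw l) (hi J) x).f = oT) (hB : ∀ x ∈ I, (VV (lsw l) (lo J) x).p = oB) :
    dsc l I J ∈ X := by
  have tc : ∀ x ∈ I, ∀ y ∈ J, TC C A B ⟨l x y, ff l x y, pp l x y⟩ := fun x hx y hy =>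
    ⟨hc.md x (hI.sub hx) y (hJ.sub hy), (h x hx y hy).1, (h x hx y hy).2.1, (h x hx y hy).2.2.1, (h x hx y hy).2.2.2⟩
  obtain ⟨x0, hx0⟩ := hI.ne
  obtain ⟨y0, hy0⟩ := hJ.ne
  have := hc.cl.cl (kd I) (kd J) A B oL oR oT oB kI kJ hn ⟨_, tc x0 hx0 y0 hy0⟩ (by
    ext i; constructor
    · intro hi
      rw [← (h x0 hx0 y0 hy0).1] at hi
      obtain ⟨x', y', h1, h2, -, h3⟩ := hi
      by_cases hx' : x' ∈ hi I
      · by_cases hy' : y' ∈ hi J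
        · obtain ⟨a, ha, hxa⟩ := hx'
          obtain ⟨b, hb, hyb⟩ := hy'
          left; left
          exact ⟨_, tc x' (hI.oc.out hx0 ha ⟨h1, hxa⟩) y' (hJ.oc.out hy0 hb ⟨h2, hyb⟩), h3⟩
        · right; rw [← hT x0 hx0]; exact ⟨y', hy', x', h1, h3⟩
      · left; right; rw [← hR y0 hy0]; exact ⟨x', hx', y', h2, h3⟩
    · rintro ((⟨t, ht, hi⟩ | hi) | hi)
      · exact ht.2.2.2.1 hi
      · rw [← hR y0 hy0] at hi
        obtain ⟨x', h1, y', h2, h3⟩ := hi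
        have hlt : x0 < x' := by by_contra hcc; exact h1 ⟨x0, hx0, not_lt.1 hcc⟩
        rw [← (h x0 hx0 y0 hy0).1]
        exact ⟨x', y', hlt.le, h2, fun h => by linarith [h.1], h3⟩
      · rw [← hT x0 hx0] at hi
        obtain ⟨y', h1, x', h2, h3⟩ := hi
        have hlt : y0 < y' := by by_contra hcc; exact h1 ⟨y0, hy0, not_lt.1 hcc⟩
        rw [← (h x0 hx0 y0 hy0).1]
        exact ⟨x', y', h2, hlt.le, fun h => by linarith [h.2], h3⟩) (by
    ext i; constructor
    · intro hi
      rw [← (h x0 hx0 y0 hy0).2.1] at hi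
      obtain ⟨x', y', h1, h2, -, h3⟩ := hi
      by_cases hx' : x' ∈ lo I
      · left; right; rw [← hL y0 hy0]; exact ⟨x', hx', y', h2, h3⟩
      · by_cases hy' : y' ∈ lo J
        · right; rw [← hB x0 hx0]; exact ⟨y', hy', x', h1, h3⟩
        · simp only [lo, mem_ofPred_eq, not_forall, not_lt] at hx' hy'
          obtain ⟨a, ha, hxa⟩ := hx'
          obtain ⟨b, hb, hyb⟩ := hy'
          left; left
          exact ⟨_, tc x' (hI.oc.out ha hx0 ⟨hxa, h1⟩) y' (hJ.oc.out hb hy0 ⟨hyb, h2⟩), h3⟩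
    · rintro ((⟨t, ht, hi⟩ | hi) | hi)
      · exact ht.2.2.2.2 hi
      · rw [← hL y0 hy0] at hi
        obtain ⟨x', h1, y', h2, h3⟩ := hi
        have hlt : x' < x0 := h1 x0 hx0
        rw [← (h x0 hx0 y0 hy0).2.1]
        exact ⟨x', y', hlt.le, h2, fun h => by linarith [h.1], h3⟩
      · rw [← hB x0 hx0] at hi
        obtain ⟨y', h1, x', h2, h3⟩ := hi
        have hlt : y' < y0 := h1 y0 hy0
        rw [← (h x0 hx0 y0 hy0).2.1]
        exact ⟨x', y', h2, hlt.le, fun h => by linarith [h.2], h3⟩)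
  convert this using 1
  refine Ds.ext rfl rfl (W_const _ _ ?_) (W_const _ _ ?_) (W_const _ _ ?_) (W_const _ _ ?_)
  · intro y hy; exact Mo.ext (hL y hy) (h.loA hI.ne hy)
  · intro y hy; exact Mo.ext (h.hiB hI.ne hy) (hR y hy)
  · intro y hy; exact Mo.ext (h.sw.hiB hJ.ne hy) (hT y hy)
  · intro y hy; exact Mo.ext (hB y hy) (h.sw.loA hJ.ne hy)

omit hc in
theorem kd_oo {a b : ℝ} (h : a < b) : kd (Ioo a b) = koo := by
  ext
  · simp [kd, koo, h]
  · simp only [kd, koo, iff_false]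
    rintro ⟨z, hz, hz'⟩
    obtain ⟨w, h1, h2⟩ := exists_between hz.1
    have := hz' (show w ∈ Ioo a b from ⟨h1, h2.trans hz.2⟩); linarith
  · simp only [kd, koo, iff_false]
    rintro ⟨z, hz, hz'⟩
    obtain ⟨w, h1, h2⟩ := exists_between hz.2
    have := hz' (show w ∈ Ioo a b from ⟨hz.1.trans h1, h2⟩); linarith
  · simp only [kd, koo, iff_false]
    intro hs
    obtain ⟨w, h1, h2⟩ := exists_between h
    obtain ⟨w', h1', h2'⟩ := exists_between h2
    have := hs (show w ∈ Ioo a b from ⟨h1, h2⟩) (show w' ∈ Ioo a b from ⟨h1.trans h1', h2'⟩)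
    linarith

theorem DR_line [Finite ι] {x : ℝ} (hx : x ∈ Ioo (0:ℝ) 1) {J : Set ℝ} (hJ : Iv J) : dsc l {x} J ∈ X := by
  refine cut_ind (fun y => (VV l (Iio x) y, VV l (Iic x) y)) hJ
    (fun a _ b _ h => Prod.mk_le_mk.2 ⟨VV_mono _ _ h, VV_mono _ _ h⟩) (fun J => dsc l {x} J ∈ X)
    (fun y hy => DR_pt hc hx (hJ.sub hy)) ?_ (fun U1 U2 n1 n2 _ => DR_joinY hc n1 n2)
  intro a b hab ha hb hsub hk
  have iv := Iv.oo hab ha hb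
  obtain ⟨y0, hy0⟩ := iv.ne
  have k1 : ∀ y ∈ Ioo a b, VV l (Iio x) y = VV l (Iio x) y0 := fun y hy => (Prod.ext_iff.1 (hk y hy y0 hy0)).1
  have k2 : ∀ y ∈ Ioo a b, VV l (Iic x) y = VV l (Iic x) y0 := fun y hy => (Prod.ext_iff.1 (hk y hy y0 hy0)).2
  have tc : TCon l (VV l (Iio x) y0).f (VV l (Iic x) y0).p {x} (Ioo a b) := by
    intro x1 hx1 y hy
    have hx1 : x1 = x := hx1
    subst x1
    have e1 : l x y ⊆ (VV l (Iio x) y0).f := by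
      rw [← k1 y hy]; intro i hi; exact ⟨x, lt_irrefl x, y, le_rfl, hi⟩
    have e2 : l x y ⊆ (VV l (Iic x) y0).p := by
      rw [← k2 y hy]; intro i hi; exact ⟨x, le_refl x, y, le_rfl, hi⟩
    refine ⟨?_, ?_, e1, e2⟩
    · ext i; constructor
      · rintro ⟨x', y', h1, h2, -, h3⟩
        rw [← k1 y hy]; exact ⟨x', not_lt.2 h1, y', h2, h3⟩
      · intro hi
        obtain ⟨z, hz1, hz2⟩ := exists_between hy.2
        rw [← k1 z ⟨hy.1.trans hz1, hz2⟩] at hi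
        obtain ⟨x', h1, y', h2, h3⟩ := hi
        exact ⟨x', y', not_lt.1 h1, by linarith, fun h => by linarith [h.2], h3⟩
    · ext i; constructor
      · rintro ⟨x', y', h1, h2, -, h3⟩
        rw [← k2 y hy]; exact ⟨x', h1, y', h2, h3⟩
      · intro hi
        obtain ⟨z, hz1, hz2⟩ := exists_between hy.1
        rw [← k2 z ⟨hz1, hz2.trans hy.2⟩] at hi
        obtain ⟨x', h1, y', h2, h3⟩ := hi
        exact ⟨x', y', h1, by linarith, fun h => by linarith [h.2], h3⟩
  refine DR_cl hc (Iv.pt hx) iv (Or.inl (kd_singleton x)) (Or.inr (kd_oo hab))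
    (fun h => by rw [kd_oo hab] at h; have := congrArg Kd.sg h.2; simp [koo, kpt] at this) tc
    (oL := (VV l (Iio x) y0).p) (oR := (VV l (Iic x) y0).f)
    (oT := (VV (lsw l) (hi (Ioo a b)) x).f) (oB := (VV (lsw l) (lo (Ioo a b)) x).p)
    ?_ ?_ ?_ ?_
  · intro y hy; rw [lo_pt, k1 y hy]
  · intro y hy; rw [hi_pt, k2 y hy]
  · rintro _ rfl; rfl
  · rintro _ rfl; rfl

theorem DR_lineY [Finite ι] {y : ℝ} (hy : y ∈ Ioo (0:ℝ) 1) {I : Set ℝ} (hI : Iv I) : dsc l I {y} ∈ X :=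
  DR_swap hc (DR_line hc.sw hy hI)

omit hc in
theorem TCon.constL {A B : Set ι} {I I' J J' : Set ℝ} (h : TCon l A B I J) (hI : Iv I)
    (hI' : Iv I') (hs : I' ⊆ I) (hJ' : J' ⊆ J)
    (hk : ∀ y ∈ J', ∀ z ∈ J', VV l (lo I) y = VV l (lo I) z) :
    ∀ y ∈ J', ∀ z ∈ J', (VV l (lo I') y).p = (VV l (lo I') z).p := by
  by_cases he : ∃ x0 ∈ I, x0 ∈ lo I'
  · have : ∀ y ∈ J', (VV l (lo I') y).p = B := by
      intro y hy
      ext i; constructor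
      · rintro ⟨x', h1, y', h2, h3⟩
        have : ∃ a ∈ I, x' ≤ a ∧ a ∈ lo I' := by
          obtain ⟨x0, hx0, hx0'⟩ := he
          rcases le_total x' x0 with h | h
          · exact ⟨x0, hx0, h, hx0'⟩
          · obtain ⟨b, hb⟩ := hI'.ne
            exact ⟨x', hI.oc.out hx0 (hs hb) ⟨h, (h1 b hb).le⟩, le_rfl, h1⟩
        obtain ⟨a, ha, hle, ha'⟩ := this
        have := h a ha y (hJ' hy)
        rcases mem_lpp l h3 hle h2 with h | h
        · exact this.2.2.2 h
        · rw [← this.2.1]; exact h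
      · intro hi
        obtain ⟨x0, hx0, hx0'⟩ := he
        rw [← (h x0 hx0 y (hJ' hy)).2.1] at hi
        obtain ⟨x', y', h1, h2, -, h3⟩ := hi
        exact ⟨x', fun a ha => h1.trans_lt (hx0' a ha), y', h2, h3⟩
    intro y hy z hz
    rw [this y hy, this z hz]
  · have : lo I' = lo I := by
      ext x; constructor
      · intro hx a ha
        by_contra hcc
        refine he ⟨a, ha, fun b hb => lt_of_le_of_lt (not_lt.1 hcc) (hx b hb)⟩
      · intro hx a ha; exact hx a (hs ha)
    rw [this]; intro y hy z hz; rw [hk y hy z hz]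

omit hc in
theorem TCon.constR {A B : Set ι} {I I' J J' : Set ℝ} (h : TCon l A B I J) (hI : Iv I)
    (hI' : Iv I') (hs : I' ⊆ I) (hJ' : J' ⊆ J)
    (hk : ∀ y ∈ J', ∀ z ∈ J', VV l (hi I) y = VV l (hi I) z) :
    ∀ y ∈ J', ∀ z ∈ J', (VV l (hi I') y).f = (VV l (hi I') z).f := by
  by_cases he : ∃ x0 ∈ I, x0 ∉ hi I'
  · have : ∀ y ∈ J', (VV l (hi I') y).f = A := by
      intro y hy
      ext i; constructor
      · rintro ⟨x', h1, y', h2, h3⟩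
        have : ∃ a ∈ I, a ≤ x' ∧ a ∉ hi I' := by
          obtain ⟨x0, hx0, hx0'⟩ := he
          rcases le_total x0 x' with h | h
          · exact ⟨x0, hx0, h, hx0'⟩
          · obtain ⟨b, hb⟩ := hI'.ne
            refine ⟨x', hI.oc.out (hs hb) hx0 ⟨?_, h⟩, le_rfl, h1⟩
            by_contra hcc; exact h1 ⟨b, hb, (not_le.1 hcc).le⟩
        obtain ⟨a, ha, hle, ha'⟩ := this
        have := h a ha y (hJ' hy)
        rcases mem_lpf l h3 hle h2 with h | h
        · exact this.2.2.1 h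
        · rw [← this.1]; exact h
      · intro hi
        obtain ⟨x0, hx0, hx0'⟩ := he
        rw [← (h x0 hx0 y (hJ' hy)).1] at hi
        obtain ⟨x', y', h1, h2, -, h3⟩ := hi
        exact ⟨x', fun ⟨a, ha, hle⟩ => hx0' ⟨a, ha, h1.trans hle⟩, y', h2, h3⟩
    intro y hy z hz
    rw [this y hy, this z hz]
  · have : hi I' = hi I := by
      ext x; constructor
      · rintro ⟨a, ha, h⟩; exact ⟨a, hs ha, h⟩
      · rintro ⟨a, ha, h⟩
        by_contra hcc
        exact he ⟨a, ha, fun ⟨b, hb, hab⟩ => hcc ⟨b, hb, h.trans hab⟩⟩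
    rw [this]; intro y hy z hz; rw [hk y hy z hz]

theorem DR_const [Finite ι] {A B : Set ι} {I J : Set ℝ} (hI : Iv I) (hJ : Iv J) (h : TCon l A B I J) :
    dsc l I J ∈ X := by
  refine cut_ind (fun y => (VV l (lo I) y, VV l (hi I) y)) hJ
    (fun a _ b _ h => Prod.mk_le_mk.2 ⟨VV_mono _ _ h, VV_mono _ _ h⟩) (fun J => dsc l I J ∈ X)
    (fun y hy => DR_lineY hc (hJ.sub hy) hI) ?_ (fun U1 U2 n1 n2 _ => DR_joinY hc n1 n2)
  intro c d hcd hc0 hd0 hsub hk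
  have ivJ := Iv.oo hcd hc0 hd0
  obtain ⟨y0, hy0⟩ := ivJ.ne
  refine cut_ind (fun x => (VV (lsw l) (lo (Ioo c d)) x, VV (lsw l) (hi (Ioo c d)) x)) hI
    (fun a _ b _ h => Prod.mk_le_mk.2 ⟨VV_mono _ _ h, VV_mono _ _ h⟩) (fun I => dsc l I (Ioo c d) ∈ X)
    (fun y hy => DR_line hc (hI.sub hy) ivJ) ?_ (fun U1 U2 n1 n2 _ => DR_join hc n1 n2)
  intro a b hab ha0 hb0 hsub' hk'
  have ivI := Iv.oo hab ha0 hb0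
  obtain ⟨x0, hx0⟩ := ivI.ne
  refine DR_cl hc ivI ivJ (Or.inr (kd_oo hab)) (Or.inr (kd_oo hcd))
    (fun h => by rw [kd_oo hab] at h; have := congrArg Kd.sg h.1; simp [koo, kpt] at this)
    (fun x hx y hy => h x (hsub' hx) y (hsub hy))
    (oL := (VV l (lo (Ioo a b)) y0).p) (oR := (VV l (hi (Ioo a b)) y0).f)
    (oT := (VV (lsw l) (hi (Ioo c d)) x0).f) (oB := (VV (lsw l) (lo (Ioo c d)) x0).p)
    ?_ ?_ ?_ ?_
  · intro y hy
    exact h.constL hI ivI hsub' hsub (fun y hy z hz => (Prod.ext_iff.1 (hk y hy z hz)).1) y hy y0 hy0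
  · intro y hy
    exact h.constR hI ivI hsub' hsub (fun y hy z hz => (Prod.ext_iff.1 (hk y hy z hz)).2) y hy y0 hy0
  · intro y hy; exact congrArg Mo.f (Prod.ext_iff.1 (hk' y hy x0 hx0)).2
  · intro y hy; exact congrArg Mo.p (Prod.ext_iff.1 (hk' y hy x0 hx0)).1

omit hc in
/-- open boxes -/
def DO (X : Set (Ds ι)) (l : ℝ → ℝ → Set ι) (a b c d : ℝ) : Prop :=
  a < b → c < d → dsc l (Ioo a b) (Ioo c d) ∈ X

theorem DO.sw {a b c d : ℝ} (h : DO X l a b c d) : DO X (lsw l) c d a b :=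
  fun h1 h2 => hc.cl.swap _ (h h2 h1)

theorem DR_core [Finite ι] {I J : Set ℝ} (hI : Iv I) (hJ : Iv J)
    (h : ∀ a b c d, a < b → c < d → Ioo a b ⊆ I → (∀ x ∈ I, a ≤ x ∧ x ≤ b) → Ioo c d ⊆ J →
      (∀ y ∈ J, c ≤ y ∧ y ≤ d) → dsc l (Ioo a b) (Ioo c d) ∈ X) : dsc l I J ∈ X := by
  refine core_ind hJ (fun J => dsc l I J ∈ X) (fun y hy => DR_lineY hc (hJ.sub hy) hI) ?_
    (fun U1 U2 n1 n2 _ => DR_joinY hc n1 n2)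
  intro c d hcd h1 h2 h3 h4
  refine core_ind hI (fun I => dsc l I (Ioo c d) ∈ X)
    (fun y hy => DR_line hc (hI.sub hy) (Iv.oo hcd h1 h2)) ?_
    (fun U1 U2 n1 n2 _ => DR_join hc n1 n2)
  intro a b hab _ _ h7 h8
  exact h a b c d hab hcd h7 h8 h3 h4

theorem DO.cutX [Finite ι] {a x b c d : ℝ} (ha : 0 ≤ a) (hb : b ≤ 1) (hc0 : 0 ≤ c) (hd : d ≤ 1)
    (h1 : a ≤ x) (h2 : x ≤ b) (k1 : DO X l a x c d) (k2 : DO X l x b c d) : DO X l a b c d := by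
  intro hab hcd
  rcases eq_or_lt_of_le h1 with rfl | h1
  · exact k2 hab hcd
  rcases eq_or_lt_of_le h2 with rfl | h2
  · exact k1 hab hcd
  have e1 : Ioo a x ∪ {x} = Ioc a x := Ioo_union_right h1
  have e2 : Ioc a x ∪ Ioo x b = Ioo a b := Ioc_union_Ioo_eq_Ioo h1.le h2
  have g1 : dsc l (Ioc a x) (Ioo c d) ∈ X := by
    rw [← e1]
    refine DR_join hc (nonempty_Ioo.2 h1) (singleton_nonempty _) ?_ (e1 ▸ ordConnected_Ioc) (k1 h1 hcd)
      (DR_line hc ⟨by linarith, by linarith⟩ (Iv.oo hcd hc0 hd))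
    rintro y hy _ rfl; exact hy.2
  rw [← e2]
  refine DR_join hc (nonempty_Ioc.2 h1) (nonempty_Ioo.2 h2) ?_ (e2 ▸ ordConnected_Ioo) g1 (k2 h2 hcd)
  intro y hy z hz; exact lt_of_le_of_lt hy.2 hz.1

theorem DO.cutY [Finite ι] {a b c y d : ℝ} (ha : 0 ≤ a) (hb : b ≤ 1) (hc0 : 0 ≤ c) (hd : d ≤ 1)
    (h1 : c ≤ y) (h2 : y ≤ d) (k1 : DO X l a b c y) (k2 : DO X l a b y d) : DO X l a b c d :=
  DO.sw hc.sw (DO.cutX hc.sw hc0 hd ha hb h1 h2 (k1.sw hc) (k2.sw hc))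
end
end Temporal
end

section
namespace Temporal
variable {ι : Type}
open Set

theorem ev_left {T : Type} [PartialOrder T] [Finite T] (κ : ℝ → T) (hκ : Monotone κ) (p : ℝ) :
    ∃ q < p, ∃ m, ∀ z, q ≤ z → z < p → κ z = m := by
  obtain ⟨m, ⟨q, hq, rfl⟩, hm⟩ := (Set.toFinite (κ '' Iio p)).exists_maximal ((nonempty_Iio).image κ)
  exact ⟨q, hq, κ q, fun z h1 h2 => le_antisymm (hm ⟨z, h2, rfl⟩ (hκ h1)) (hκ h1)⟩
theorem ev_right {T : Type} [PartialOrder T] [Finite T] (κ : ℝ → T) (hκ : Monotone κ) (p : ℝ) :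
    ∃ q > p, ∃ m, ∀ z, z ≤ q → p < z → κ z = m := by
  obtain ⟨m, ⟨q, hq, rfl⟩, hm⟩ := (Set.toFinite (κ '' Ioi p)).exists_minimal ((nonempty_Ioi).image κ)
  exact ⟨q, hq, κ q, fun z h1 h2 => le_antisymm (hκ h1) (hm ⟨z, h2, rfl⟩ (hκ h1))⟩

theorem ends_eq {I : Set ℝ} {a b p q : ℝ} (hpq : p < q) (hab : a < b) (h1 : Ioo p q ⊆ I) (h2 : ∀ x ∈ I, p ≤ x ∧ x ≤ q)
    (h3 : Ioo a b ⊆ I) (h4 : ∀ x ∈ I, a ≤ x ∧ x ≤ b) : a = p ∧ b = q := by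
  have k1 : Ioo p q ⊆ Icc a b := fun x hx => h4 x (h1 hx)
  have k2 : Ioo a b ⊆ Icc p q := fun x hx => h2 x (h3 hx)
  have k3 := isClosed_Icc.closure_subset_iff.2 k1
  have k4 := isClosed_Icc.closure_subset_iff.2 k2
  rw [closure_Ioo hpq.ne] at k3
  rw [closure_Ioo hab.ne] at k4
  have := k3 ⟨le_rfl, hpq.le⟩
  have := k3 ⟨hpq.le, le_rfl⟩
  have := k4 ⟨le_rfl, hab.le⟩
  have := k4 ⟨hab.le, le_rfl⟩
  simp only [mem_Icc] at *
  constructor <;> linarith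

theorem kd_co {a b : ℝ} (h : a < b) : kd (Ico a b) = kco := by
  ext
  · simp [kd, kco, h]
  · simp only [kd, kco, iff_true]; exact ⟨a, isLeast_Ico h⟩
  · simp only [kd, kco, iff_false]
    rintro ⟨z, hz, hz'⟩
    obtain ⟨w, h1, h2⟩ := exists_between hz.2
    have := hz' (show w ∈ Ico a b from ⟨hz.1.trans h1.le, h2⟩); linarith
  · simp only [kd, kco, iff_false]
    intro hs
    obtain ⟨w, h1, h2⟩ := exists_between h
    have := hs (show w ∈ Ico a b from ⟨h1.le, h2⟩) (show a ∈ Ico a b from ⟨le_rfl, h⟩)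
    linarith
theorem kd_oc {a b : ℝ} (h : a < b) : kd (Ioc a b) = koc := by
  ext
  · simp [kd, koc, h]
  · simp only [kd, koc, iff_false]
    rintro ⟨z, hz, hz'⟩
    obtain ⟨w, h1, h2⟩ := exists_between hz.1
    have := hz' (show w ∈ Ioc a b from ⟨h1, h2.le.trans hz.2⟩); linarith
  · simp only [kd, koc, iff_true]; exact ⟨b, isGreatest_Ioc h⟩
  · simp only [kd, koc, iff_false]
    intro hs
    obtain ⟨w, h1, h2⟩ := exists_between h
    have := hs (show w ∈ Ioc a b from ⟨h1, h2.le⟩) (show b ∈ Ioc a b from ⟨h, le_rfl⟩)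
    linarith
theorem lo_oc {a b : ℝ} (h : a < b) : lo (Ioc a b) = Iic a := by
  ext z; constructor
  · intro hz; by_contra hc
    have hc : a < z := not_le.1 hc
    obtain ⟨w, hw1, hw2⟩ := exists_between (lt_min hc h)
    have := hz w ⟨hw1, hw2.le.trans (min_le_right _ _)⟩
    linarith [min_le_left z b]
  · intro hz x hx; exact lt_of_le_of_lt hz hx.1
theorem hi_oc {a b : ℝ} (h : a < b) : hi (Ioc a b) = Iic b := by
  ext z; constructor
  · rintro ⟨w, hw, h⟩; exact h.trans hw.2
  · intro hz; exact ⟨b, ⟨h, le_rfl⟩, hz⟩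
theorem lo_co {a b : ℝ} (h : a < b) : lo (Ico a b) = Iio a := by
  ext z; constructor
  · intro hz; exact hz a ⟨le_rfl, h⟩
  · intro hz x hx; exact lt_of_lt_of_le hz hx.1
theorem hi_co {a b : ℝ} (h : a < b) : hi (Ico a b) = Iio b := by
  ext z; constructor
  · rintro ⟨w, hw, h⟩; exact lt_of_le_of_lt h hw.2
  · intro hz
    obtain ⟨w, hw1, hw2⟩ := exists_between (max_lt hz h)
    exact ⟨w, ⟨((le_max_right _ _).trans_lt hw1).le, hw2⟩, ((le_max_left _ _).trans_lt hw1).le⟩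

/-- abstract separating curve -/
structure Cv (X : Set (Ds ι)) (l : ℝ → ℝ → Set ι) (x y : ℝ → ℝ) (s0 s1 : ℝ) : Prop where
  mx : Monotone x
  my : Antitone y
  xy : ∀ s, x s - y s = 2 * s
  x0 : 0 ≤ x s0
  x1 : x s1 ≤ 1
  y0 : 0 ≤ y s1
  y1 : y s0 ≤ 1
  LL : ∀ s m s', s0 ≤ s → s ≤ m → m ≤ s' → s' ≤ s1 → DO X l (x s) (x m) (y s') (y m)
  UR : ∀ s m s', s0 ≤ s → s ≤ m → m ≤ s' → s' ≤ s1 → DO X l (x m) (x s') (y m) (y s)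

def EE (X : Set (Ds ι)) (l : ℝ → ℝ → Set ι) (x y : ℝ → ℝ) (s s' : ℝ) : Prop :=
  DO X l (x s) (x s') (y s') (y s)

section
variable {C : Lab ι → Prop} {X : Set (Ds ι)} {l : ℝ → ℝ → Set ι} (hc : Cx C X l)
include hc

theorem DR_box [Finite ι] {I J : Set ℝ} {a b c d : ℝ} (hI : Iv I) (hJ : Iv J) (hab : a < b) (hcd : c < d)
    (h1 : Ioo a b ⊆ I) (h2 : ∀ x ∈ I, a ≤ x ∧ x ≤ b) (h3 : Ioo c d ⊆ J) (h4 : ∀ x ∈ J, c ≤ x ∧ x ≤ d)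
    (h : DO X l a b c d) : dsc l I J ∈ X := by
  refine DR_core hc hI hJ ?_
  intro a' b' c' d' hab' hcd' k1 k2 k3 k4
  obtain ⟨rfl, rfl⟩ := ends_eq hab hab' h1 h2 k1 k2
  obtain ⟨rfl, rfl⟩ := ends_eq hcd hcd' h3 h4 k3 k4
  exact h hab' hcd'

variable {x y : ℝ → ℝ} {s0 s1 : ℝ} (hv : Cv X l x y s0 s1)
include hv

theorem Cv.sw : Cv X (lsw l) (fun s => y (-s)) (fun s => x (-s)) (-s1) (-s0) where
  mx := fun a b h => hv.my (neg_le_neg h)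
  my := fun a b h => hv.mx (neg_le_neg h)
  xy := fun s => by have := hv.xy (-s); linarith
  x0 := by simpa using hv.y0
  x1 := by simpa using hv.y1
  y0 := by simpa using hv.x0
  y1 := by simpa using hv.x1
  LL := fun s m s' h1 h2 h3 h4 => DO.sw hc (hv.LL (-s') (-m) (-s) (by linarith) (by linarith) (by linarith) (by linarith))
  UR := fun s m s' h1 h2 h3 h4 => DO.sw hc (hv.UR (-s') (-m) (-s) (by linarith) (by linarith) (by linarith) (by linarith))

omit hv in
theorem EE.sw {s s' : ℝ} (h : EE X l x y s s') : EE X (lsw l) (fun s => y (-s)) (fun s => x (-s)) (-s') (-s) := by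
  have := DO.sw hc h
  simpa [EE] using this
omit hv in
theorem EE.unsw {s s' : ℝ} (h : EE X (lsw l) (fun s => y (-s)) (fun s => x (-s)) (-s') (-s)) : EE X l x y s s' := by
  have : DO X (lsw l) (y s') (y s) (x s) (x s') := by simpa [EE] using h
  exact DO.sw hc.sw this

theorem EE.tr [Finite ι] {s m s' : ℝ} (h0 : s0 ≤ s) (h1 : s ≤ m) (h2 : m ≤ s') (h3 : s' ≤ s1)
    (e1 : EE X l x y s m) (e2 : EE X l x y m s') : EE X l x y s s' := by
  have a0 : 0 ≤ x s := hv.x0.trans (hv.mx h0)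
  have a1 : x s' ≤ 1 := (hv.mx h3).trans hv.x1
  have b0 : 0 ≤ y s' := hv.y0.trans (hv.my h3)
  have b1 : y s ≤ 1 := (hv.my h0).trans hv.y1
  have c1 := hv.mx h1
  have c2 := hv.mx h2
  have d1 := hv.my h1
  have d2 := hv.my h2
  refine DO.cutX hc a0 a1 b0 b1 c1 c2 ?_ ?_
  · exact DO.cutY hc a0 (c2.trans a1) b0 b1 d2 d1 (hv.LL s m s' h0 h1 h2 h3) e1
  · exact DO.cutY hc (a0.trans c1) a1 b0 b1 d2 d1 e2 (hv.UR s m s' h0 h1 h2 h3)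

omit hc in
theorem Cv.lipx {s t : ℝ} (h : s ≤ t) : x t - x s ≤ 2 * (t - s) := by
  have := hv.xy s; have := hv.xy t; have := hv.my h; linarith
omit hc in
theorem Cv.lipy {s t : ℝ} (h : s ≤ t) : y s - y t ≤ 2 * (t - s) := by
  have := hv.xy s; have := hv.xy t; have := hv.mx h; linarith

theorem EE_left [Finite ι] {b m : ℝ} (h0 : s0 ≤ b) (hbm : b < m) (h1 : m ≤ s1)
    (H : ∀ u v, b ≤ u → u ≤ v → v < m → EE X l x y u v) : EE X l x y b m := by
  by_cases hx : ∃ b1, b ≤ b1 ∧ b1 < m ∧ (x m ≤ x b1 ∨ y b1 ≤ y m)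
  · obtain ⟨b1, k1, k2, k3⟩ := hx
    refine EE.tr hc hv h0 k1 k2.le h1 (H b b1 le_rfl k1 k2) ?_
    intro h2 h3
    rcases k3 with k3 | k3 <;> linarith
  push Not at hx
  obtain ⟨p1, hp1, mr, hmr⟩ := ev_right (VV l (Iio (x m))) (VV_mono _ _) (y m)
  obtain ⟨p2, hp2, mb, hmb⟩ := ev_left (VV (lsw l) (Iic (y m))) (VV_mono _ _) (x m)
  -- b0
  obtain ⟨b0, k1, k2, k3, k4⟩ : ∃ b0, b ≤ b0 ∧ b0 < m ∧ y b0 ≤ p1 ∧ p2 ≤ x b0 := by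
    refine ⟨max b (max (m - (p1 - y m) / 2) (m - (x m - p2) / 2)), le_max_left _ _, ?_, ?_, ?_⟩
    · refine max_lt hbm (max_lt ?_ ?_) <;> linarith
    · have e : m - (p1 - y m) / 2 ≤ max b (max (m - (p1 - y m) / 2) (m - (x m - p2) / 2)) :=
        (le_max_left _ _).trans (le_max_right _ _)
      have := hv.my e
      have := hv.lipy (show m - (p1 - y m) / 2 ≤ m by linarith)
      linarith
    · have e : m - (x m - p2) / 2 ≤ max b (max (m - (p1 - y m) / 2) (m - (x m - p2) / 2)) :=
        (le_max_right _ _).trans (le_max_right _ _)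
      have := hv.mx e
      have := hv.lipx (show m - (x m - p2) / 2 ≤ m by linarith)
      linarith
  refine EE.tr hc hv h0 k1 k2.le h1 (H b b0 le_rfl k1 k2) ?_
  have key := hc.cl.lim {d | ∃ u, b0 ≤ u ∧ u < m ∧ d = dsc l (Ioo (x u) (x m)) (Ioo (y m) (y u))} mr mb ?_
  · intro _ _
    exact key _ ⟨b0, le_rfl, k2, rfl⟩
  rintro _ ⟨u, hu0, hu1, rfl⟩
  have hbu := k1.trans hu0
  obtain ⟨hxu, hyu⟩ := hx u hbu hu1
  obtain ⟨q1, hq1, m0, hm0⟩ := ev_right (VV l (Iic (x u))) (VV_mono _ _) (y m)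
  obtain ⟨q2, hq2, m1, hm1⟩ := ev_left (VV (lsw l) (Iio (y u))) (VV_mono _ _) (x m)
  obtain ⟨v, hv0, hv1, g1, g2, g3, g4⟩ : ∃ v, u < v ∧ v < m ∧ x u < x v ∧ y v < y u ∧ y v < q1 ∧ q2 < x v := by
    obtain ⟨e1, he1, he1'⟩ := exists_between (lt_min hq1 hyu)
    obtain ⟨e2, he2, he2'⟩ := exists_between (max_lt hq2 hxu)
    have z1 := min_le_left q1 (y u)
    have z2 := min_le_right q1 (y u)
    have z3 := le_max_left q2 (x u)
    have z4 := le_max_right q2 (x u)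
    obtain ⟨v, w1, w2⟩ : ∃ v, max (max u (m - (e1 - y m) / 2)) (m - (x m - e2) / 2) < v ∧ v < m :=
      exists_between (max_lt (max_lt hu1 (by linarith)) (by linarith))
    have w3 : u < v := lt_of_le_of_lt ((le_max_left _ _).trans (le_max_left _ _)) w1
    have w4 : m - (e1 - y m) / 2 < v := lt_of_le_of_lt ((le_max_right _ _).trans (le_max_left _ _)) w1
    have w5 : m - (x m - e2) / 2 < v := lt_of_le_of_lt (le_max_right _ _) w1
    have w6 := hv.lipx w2.le
    have w7 := hv.lipy w2.le
    refine ⟨v, w3, w2, ?_, ?_, ?_, ?_⟩ <;> linarith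
  obtain ⟨g5, g6⟩ := hx v (hbu.trans hv0.le) hv1
  have a0 : 0 ≤ x u := hv.x0.trans (hv.mx (h0.trans hbu))
  have a1 : x m ≤ 1 := (hv.mx h1).trans hv.x1
  have c0 : 0 ≤ y m := hv.y0.trans (hv.my h1)
  have c1 : y u ≤ 1 := (hv.my (h0.trans hbu)).trans hv.y1
  have yub : y u ≤ y b0 := hv.my hu0
  have xub : x b0 ≤ x u := hv.mx hu0
  have i1 : Iv (Ioc (x u) (x v)) := ⟨nonempty_Ioc.2 g1, ordConnected_Ioc, fun z hz => ⟨by linarith [hz.1], by linarith [hz.2]⟩⟩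
  have i2 : Iv (Ico (y v) (y u)) := ⟨nonempty_Ico.2 g2, ordConnected_Ico, fun z hz => ⟨by linarith [hz.1], by linarith [hz.2]⟩⟩
  have i3 : Iv (Ioo (x v) (x m)) := Iv.oo g5 (by linarith) a1
  have i4 : Iv (Ioo (y m) (y v)) := Iv.oo g6 c0 (by linarith)
  refine ⟨_, ⟨v, hu0.trans hv0.le, hv1, rfl⟩, dsc l (Ioc (x u) (x v)) (Ico (y v) (y u)), ?_,
    dsc l (Ioo (x v) (x m)) (Ico (y v) (y u)), ?_, dsc l (Ioc (x u) (x v)) (Ioo (y m) (y v)), ?_, ?_⟩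
  · exact DR_box hc i1 i2 g1 g2 Ioo_subset_Ioc_self (fun z hz => ⟨hz.1.le, hz.2⟩) Ioo_subset_Ico_self
      (fun z hz => ⟨hz.1, hz.2.le⟩) (H u v hbu hv0.le hv1)
  · exact DR_box hc i3 i2 g5 g2 subset_rfl (fun z hz => ⟨hz.1.le, hz.2.le⟩) Ioo_subset_Ico_self
      (fun z hz => ⟨hz.1, hz.2.le⟩) (hv.UR u v m (h0.trans hbu) hv0.le hv1.le h1)
  · exact DR_box hc i1 i4 g1 g6 Ioo_subset_Ioc_self (fun z hz => ⟨hz.1.le, hz.2⟩) subset_rfl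
      (fun z hz => ⟨hz.1.le, hz.2.le⟩) (hv.LL u v m (h0.trans hbu) hv0.le hv1.le h1)
  have ey : Ioo (y m) (y v) ∪ Ico (y v) (y u) = Ioo (y m) (y u) := Ioo_union_Ico_eq_Ioo g6 g2.le
  have ex : Ioc (x u) (x v) ∪ Ioo (x v) (x m) = Ioo (x u) (x m) := Ioc_union_Ioo_eq_Ioo g1.le g5
  have cW' : ∀ (κ : ℝ → Mo ι) (S : Set ℝ) (k : Kd) (mm : Mo ι), kd S = k → (∀ z ∈ S, κ z = mm) → W κ S = cW k mm := by
    rintro κ S _ mm rfl h; exact W_const _ _ h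
  refine { kI := kd_oo hxu, kJ := kd_oo hyu, dR := ?_, dB := ?_, ulI := kd_oc g1, ulJ := kd_co g2, urI := kd_oo g5, urJ := kd_co g2, llI := kd_oc g1, llJ := kd_oo g6, left := ⟨m0, ?_, ?_, ?_, ?_, ?_, ?_⟩, top := ⟨m1, ?_, ?_, ?_, ?_, ?_, ?_⟩, urR := ?_, llB := ?_, ulur := ?_, lld := ?_, ulll := ?_, urd := ?_, mB := ?_, mR := ?_ }
  all_goals simp only [dsc, lo_oc g1, hi_oc g1, lo_co g2, hi_co g2, lo_oo g5, hi_oo g5, lo_oo g6, hi_oo g6, lo_oo hxu, hi_oo hxu, lo_oo hyu, hi_oo hyu]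
  · exact cW' _ _ _ _ (kd_oo hyu) (fun z hz => hmr z (by linarith [hz.2]) hz.1)
  · exact cW' _ _ _ _ (kd_oo hxu) (fun z hz => hmb z (by linarith [hz.1]) hz.2)
  · exact cW' _ _ _ _ (kd_oo g6) (fun z hz => hm0 z (by linarith [hz.2]) hz.1)
  · exact ⟨y v, ⟨le_rfl, g2⟩, hm0 _ g3.le g6⟩
  · exact ⟨y v, ⟨⟨le_rfl, g2⟩, hm0 _ g3.le g6⟩, fun z hz => hz.1.1⟩
  · intro hs
    obtain ⟨z, z1, z2⟩ := exists_between (lt_min g3 g2)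
    have := min_le_left q1 (y u)
    have := min_le_right q1 (y u)
    have := hs (show y v ∈ _ from ⟨⟨le_rfl, g2⟩, hm0 _ g3.le g6⟩)
      (show z ∈ _ from ⟨⟨z1.le, by linarith⟩, hm0 z (by linarith) (by linarith)⟩)
    linarith
  · rintro _ ⟨z, hz, rfl⟩
    rw [← hm0 (y v) g3.le g6]; exact VV_mono _ _ hz.1
  · rw [← ey, W_comb _ (fun z hz w hw => lt_of_lt_of_le hz.2 hw.1)]
    rw [cW' (VV l (Iic (x u))) _ _ m0 (kd_oo g6) (fun z hz => hm0 z (by linarith [hz.2]) hz.1)]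
  · exact cW' _ _ _ _ (kd_oo g5) (fun z hz => hm1 z (by linarith [hz.1]) hz.2)
  · exact ⟨x v, ⟨g1, le_rfl⟩, hm1 _ g4.le g5⟩
  · exact ⟨x v, ⟨⟨g1, le_rfl⟩, hm1 _ g4.le g5⟩, fun z hz => hz.1.2⟩
  · intro hs
    obtain ⟨z, z1, z2⟩ := exists_between (max_lt g4 g1)
    have := le_max_left q2 (x u)
    have := le_max_right q2 (x u)
    have := hs (show x v ∈ _ from ⟨⟨g1, le_rfl⟩, hm1 _ g4.le g5⟩)
      (show z ∈ _ from ⟨⟨by linarith, z2.le⟩, hm1 z (by linarith) (by linarith)⟩)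
    linarith
  · rintro _ ⟨z, hz, rfl⟩
    rw [← hm1 (x v) g4.le g5]; exact VV_mono _ _ hz.2
  · rw [← ex, W_comb _ (fun z hz w hw => lt_of_le_of_lt hz.2 hw.1)]
    rw [cW' (VV (lsw l) (Iio (y u))) _ _ m1 (kd_oo g5) (fun z hz => hm1 z (by linarith [hz.1]) hz.2)]
  · exact cW' _ _ _ _ (kd_co g2) (fun z hz => hmr z (by linarith [hz.2]) (by linarith [hz.1]))
  · exact cW' _ _ _ _ (kd_oc g1) (fun z hz => hmb z (by linarith [hz.1]) (by linarith [hz.2]))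
  · rintro _ _ ⟨z, hz, rfl⟩ ⟨w, hw, rfl⟩; exact VV_mono _ _ (hz.2.trans hw.1.le)
  · rintro _ _ ⟨z, hz, rfl⟩ ⟨w, hw, rfl⟩; exact VV_mono _ _ (hz.2.le.trans hw.1)

theorem EE_right [Finite ι] {b m : ℝ} (h0 : s0 ≤ m) (hbm : m < b) (h1 : b ≤ s1)
    (H : ∀ u v, m < u → u ≤ v → v ≤ b → EE X l x y u v) : EE X l x y m b := by
  refine EE.unsw hc (EE_left hc.sw (hv.sw hc) (b := -b) (m := -m) (by linarith) (by linarith) (by linarith) ?_)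
  intro u v h1 h2 h3
  have := EE.sw hc (H (-v) (-u) (by linarith) (by linarith) (by linarith))
  simpa using this
end
end Temporal
end

section
set_option linter.unusedVariables false
namespace Temporal
open Set

/-- abstract properties of the relation `EE` -/
structure ER (E : ℝ → ℝ → Prop) (s0 s1 : ℝ) : Prop where
  rf : ∀ s, E s s
  tr : ∀ s m s', s0 ≤ s → s ≤ m → m ≤ s' → s' ≤ s1 → E s m → E m s' → E s s'
  lc : ∀ b m, s0 ≤ b → b < m → m ≤ s1 → (∀ u v, b ≤ u → u ≤ v → v < m → E u v) → E b m
  rc : ∀ m b, s0 ≤ m → m < b → b ≤ s1 → (∀ u v, m < u → u ≤ v → v ≤ b → E u v) → E m b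

def QQ (E : ℝ → ℝ → Prop) (s s' : ℝ) : Prop := ∀ u v, s ≤ u → u ≤ v → v ≤ s' → E u v

theorem QQ.sub {E : ℝ → ℝ → Prop} {s s' t t' : ℝ} (h : QQ E s s') (h1 : s ≤ t) (h2 : t' ≤ s') : QQ E t t' :=
  fun u v k1 k2 k3 => h u v (h1.trans k1) k2 (k3.trans h2)

section
variable {E : ℝ → ℝ → Prop} {s0 s1 : ℝ} (h : ER E s0 s1)
include h

theorem ER.qtr {s m s' : ℝ} (h0 : s0 ≤ s) (h3 : s' ≤ s1)
    (e1 : QQ E s m) (e2 : QQ E m s') (h1 : s ≤ m) (h2 : m ≤ s') : QQ E s s' := by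
  intro u v k1 k2 k3
  rcases le_total v m with k | k
  · exact e1 u v k1 k2 k
  rcases le_total m u with k' | k'
  · exact e2 u v k' k2 k3
  exact h.tr u m v (h0.trans k1) k' k (k3.trans h3) (e1 u m k1 k' le_rfl) (e2 m v le_rfl k k3)

theorem ER.sup {s : ℝ} (h0 : s0 ≤ s) (h1 : s ≤ s1) :
    ∃ M, s ≤ M ∧ M ≤ s1 ∧ QQ E s M ∧ ∀ t, M < t → t ≤ s1 → ¬ QQ E M t := by
  set S := {t | s ≤ t ∧ t ≤ s1 ∧ QQ E s t} with hS
  have hsS : s ∈ S := ⟨le_rfl, h1, fun u v k1 k2 k3 => by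
    have : u = v := by linarith
    rw [this]; exact h.rf v⟩
  have hb : BddAbove S := ⟨s1, fun t ht => ht.2.1⟩
  have hM : ∀ v, s ≤ v → v < sSup S → QQ E s v := by
    intro v hv hv'
    obtain ⟨t, ht, hvt⟩ := exists_lt_of_lt_csSup ⟨s, hsS⟩ hv'
    exact ht.2.2.sub le_rfl hvt.le
  have hle : sSup S ≤ s1 := csSup_le ⟨s, hsS⟩ (fun t ht => ht.2.1)
  have hsM : s ≤ sSup S := le_csSup hb hsS
  have hQ : QQ E s (sSup S) := by
    intro u v k1 k2 k3
    rcases eq_or_lt_of_le k3 with e | k3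
    · rcases eq_or_lt_of_le k2 with e' | k2
      · rw [e']; exact h.rf v
      · refine h.lc u v (h0.trans k1) k2 (e ▸ hle) ?_
        intro u' v' j1 j2 j3
        exact hM v' (by linarith) (by linarith) u' v' (by linarith) j2 le_rfl
    · exact hM v (by linarith) k3 u v k1 k2 le_rfl
  refine ⟨sSup S, hsM, hle, hQ, ?_⟩
  intro t ht ht1 hq
  have := le_csSup hb (show t ∈ S from ⟨by linarith, ht1, h.qtr h0 ht1 hQ hq hsM ht.le⟩)
  linarith

theorem ER.ng : ER (fun s t => E (-t) (-s)) (-s1) (-s0) where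
  rf := fun s => h.rf _
  tr := fun s m s' h1 h2 h3 h4 e1 e2 => h.tr (-s') (-m) (-s) (by linarith) (by linarith) (by linarith) (by linarith) e2 e1
  lc := fun b m h1 h2 h3 e => h.rc (-m) (-b) (by linarith) (by linarith) (by linarith) (fun u v k1 k2 k3 => by
    have := e (-v) (-u) (by linarith) (by linarith) (by linarith); simpa using this)
  rc := fun b m h1 h2 h3 e => h.lc (-m) (-b) (by linarith) (by linarith) (by linarith) (fun u v k1 k2 k3 => by
    have := e (-v) (-u) (by linarith) (by linarith) (by linarith); simpa using this)

omit h in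
theorem QQ.ng {s t : ℝ} : QQ (fun s t => E (-t) (-s)) s t ↔ QQ E (-t) (-s) := by
  constructor
  · intro h u v k1 k2 k3
    have := h (-v) (-u) (by linarith) (by linarith) (by linarith); simpa using this
  · intro h u v k1 k2 k3
    exact h (-v) (-u) (by linarith) (by linarith) (by linarith)

theorem ER.inf {s : ℝ} (h0 : s0 ≤ s) (h1 : s ≤ s1) :
    ∃ M, s0 ≤ M ∧ M ≤ s ∧ QQ E M s ∧ ∀ t, s0 ≤ t → t < M → ¬ QQ E t M := by
  obtain ⟨M, k1, k2, k3, k4⟩ := h.ng.sup (s := -s) (by linarith) (by linarith)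
  refine ⟨-M, by linarith, by linarith, ?_, ?_⟩
  · have := QQ.ng.1 k3; simpa using this
  · intro t ht1 ht2 hq
    refine k4 (-t) (by linarith) (by linarith) (QQ.ng.2 ?_)
    simpa using hq

theorem ER.dense {p q : ℝ} (h0 : s0 ≤ p) (hpq : p ≤ q) (h1 : q ≤ s1) (hn : ¬ QQ E p q) :
    ∃ m, p < m ∧ m < q ∧ ¬ QQ E p m ∧ ¬ QQ E m q := by
  obtain ⟨M, a1, a2, a3, a4⟩ := h.sup h0 (hpq.trans h1)
  obtain ⟨N, b1, b2, b3, b4⟩ := h.inf (h0.trans hpq) h1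
  have hMq : M < q := by
    by_contra hcc; exact hn (a3.sub le_rfl (not_lt.1 hcc))
  have hpN : p < N := by
    by_contra hcc; exact hn (b3.sub (not_lt.1 hcc) le_rfl)
  have hMN : M < N := by
    by_contra hcc
    exact hn (h.qtr h0 h1 a3 (b3.sub (not_lt.1 hcc) le_rfl) a1 hMq.le)
  obtain ⟨m, c1, c2⟩ := exists_between hMN
  refine ⟨m, by linarith, by linarith, ?_, ?_⟩
  · intro hq; exact a4 m c1 (by linarith) (hq.sub a1 le_rfl)
  · intro hq; exact b4 m (by linarith) c2 (hq.sub le_rfl b2)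

theorem ER.step {p p' : ℝ} (h0 : s0 ≤ p) (hpq : p < p') (h1 : p' ≤ s1) (hn : ¬ QQ E p p') (q : ℝ) :
    ∃ a b, p < a ∧ a < b ∧ b < p' ∧ ¬ QQ E a b ∧ ∀ z, a ≤ z → z ≤ b → ¬ (QQ E z q ∧ QQ E q z) := by
  obtain ⟨m1, a1, a2, a3, a4⟩ := h.dense h0 hpq.le h1 hn
  obtain ⟨m2, b1, b2, b3, b4⟩ := h.dense (h0.trans a1.le) a2.le h1 a4
  obtain ⟨m3, c1, c2, c3, c4⟩ := h.dense (by linarith) b2.le h1 b4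
  obtain ⟨m4, d1, d2, d3, d4⟩ := h.dense (by linarith) c2.le h1 c4
  by_cases hq : ∃ z, m1 ≤ z ∧ z ≤ m2 ∧ QQ E z q ∧ QQ E q z
  · obtain ⟨z, z1, z2, z3, z4⟩ := hq
    refine ⟨m3, m4, by linarith, d1, by linarith, d3, ?_⟩
    rintro w w1 w2 ⟨w3, w4⟩
    apply c3
    rcases le_total q z with k | k
    · exact w4.sub (by linarith) w1
    rcases le_total w q with k' | k'
    · exact z3.sub z2 (by linarith)
    · exact (h.qtr (by linarith) (by linarith) z3 w4 k k').sub z2 w1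
  · refine ⟨m1, m2, a1, b1, b2, b3, ?_⟩
    intro z z1 z2 z3
    exact hq ⟨z, z1, z2, z3⟩

/-- there are singleton classes -/
theorem ER.single {p p' : ℝ} (h0 : s0 ≤ p) (hpq : p < p') (h1 : p' ≤ s1) (hn : ¬ QQ E p p') :
    ∃ r, p < r ∧ r < p' ∧ (∀ s < r, ¬ QQ E s r) ∧ (∀ s > r, ¬ QQ E r s) := by
  obtain ⟨en, hen⟩ := exists_surjective_nat ℚ
  let T := {z : ℝ × ℝ // p ≤ z.1 ∧ z.1 < z.2 ∧ z.2 ≤ p' ∧ ¬ QQ E z.1 z.2}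
  have st : ∀ (n : ℕ) (z : T), ∃ w : T, z.1.1 < w.1.1 ∧ w.1.2 < z.1.2 ∧
      ∀ t, w.1.1 ≤ t → t ≤ w.1.2 → ¬ (QQ E t (en n) ∧ QQ E (en n) t) := by
    rintro n ⟨⟨a, b⟩, k1, k2, k3, k4⟩
    simp only at k1 k2 k3 k4
    obtain ⟨a', b', j1, j2, j3, j4, j5⟩ := h.step (by linarith) k2 (by linarith) k4 (en n)
    exact ⟨⟨(a', b'), by simp only; linarith, j2, by simp only; linarith, j4⟩, j1, j3, j5⟩
  choose f f1 f2 f3 using st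
  let g : ℕ → T := fun n => Nat.rec ⟨(p, p'), le_rfl, hpq, le_rfl, hn⟩ (fun n z => f n z) n
  have g1 : ∀ n, g (n+1) = f n (g n) := fun n => rfl
  have mono : ∀ n, Icc (g (n+1)).1.1 (g (n+1)).1.2 ⊆ Icc (g n).1.1 (g n).1.2 := by
    intro n
    rw [g1]
    exact Icc_subset_Icc (f1 n _).le (f2 n _).le
  have hne := IsCompact.nonempty_iInter_of_sequence_nonempty_isCompact_isClosed
    (fun n => Icc (g n).1.1 (g n).1.2) mono (fun n => nonempty_Icc.2 (g n).2.2.1.le) isCompact_Icc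
    (fun n => isClosed_Icc)
  obtain ⟨r, hr⟩ := hne
  have hr : ∀ n, (g n).1.1 ≤ r ∧ r ≤ (g n).1.2 := fun n => mem_iInter.1 hr n
  have hr1 : ∀ q : ℚ, ¬ (QQ E r q ∧ QQ E q r) := by
    intro q
    obtain ⟨n, rfl⟩ := hen q
    have := hr (n+1)
    rw [g1] at this
    exact f3 n _ r this.1 this.2
  have vac : ∀ {s t : ℝ}, t < s → QQ E s t := fun h u v k1 k2 k3 => by linarith
  refine ⟨r, ?_, ?_, ?_, ?_⟩
  · have := (hr (0+1)).1; rw [g1] at this; exact lt_of_lt_of_le (f1 0 (g 0)) this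
  · have := (hr (0+1)).2; rw [g1] at this; exact lt_of_le_of_lt this (f2 0 (g 0))
  · intro s hs hq
    obtain ⟨q, q1, q2⟩ := exists_rat_btwn hs
    exact hr1 q ⟨vac q2, hq.sub q1.le le_rfl⟩
  · intro s hs hq
    obtain ⟨q, q1, q2⟩ := exists_rat_btwn hs
    exact hr1 q ⟨hq.sub le_rfl q2.le, vac q1⟩
end

theorem EE_ER {ι : Type} [Finite ι] {C : Lab ι → Prop} {X : Set (Ds ι)} {l : ℝ → ℝ → Set ι} (hc : Cx C X l)
    {x y : ℝ → ℝ} {s0 s1 : ℝ} (hv : Cv X l x y s0 s1) : ER (EE X l x y) s0 s1 where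
  rf := fun s h => absurd h (lt_irrefl _)
  tr := fun s m s' h0 h1 h2 h3 => EE.tr hc hv h0 h1 h2 h3
  lc := fun b m h0 h1 h2 => EE_left hc hv h0 h1 h2
  rc := fun m b h0 h1 h2 => EE_right hc hv h0 h1 h2
end Temporal
end

section
set_option linter.unusedVariables false
namespace Temporal
variable {ι : Type}
open Set

def tD (l : ℝ → ℝ → Set ι) (A B : Set ι) (p q : ℝ) : Prop :=
  ff l p q = A ∧ pp l p q = B ∧ l p q ⊆ A ∧ l p q ⊆ B

theorem tD.up {l : ℝ → ℝ → Set ι} {A B : Set ι} {p q p' q' : ℝ} (h : tD l A B p q) (h1 : p ≤ p') (h2 : q ≤ q') :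
    l p' q' ⊆ A := by
  intro i hi
  rcases mem_lpf l hi h1 h2 with k | k
  · exact h.2.2.1 k
  · rw [← h.1]; exact k
theorem tD.dn {l : ℝ → ℝ → Set ι} {A B : Set ι} {p q p' q' : ℝ} (h : tD l A B p q) (h1 : p' ≤ p) (h2 : q' ≤ q) :
    l p' q' ⊆ B := by
  intro i hi
  rcases mem_lpp l hi h1 h2 with k | k
  · exact h.2.2.2 k
  · rw [← h.2.1]; exact k

theorem genf {l : ℝ → ℝ → Set ι} {A Λ} {q : ℝ} (h1 : ∀ x', x' ∉ Λ → ∀ y', q ≤ y' → l x' y' ⊆ A)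
    (h2 : ∃ w1 w2, (∀ x', w1 ≤ x' → x' ∉ Λ) ∧ q ≤ w2 ∧ A ⊆ ff l w1 w2) : (VV l Λ q).f = A := by
  ext i; constructor
  · rintro ⟨x', k1, y', k2, k3⟩; exact h1 x' k1 y' k2 k3
  · intro hi
    obtain ⟨w1, w2, k1, k2, k3⟩ := h2
    obtain ⟨x', y', j1, j2, -, j3⟩ := k3 hi
    exact ⟨x', k1 x' j1, y', k2.trans j2, j3⟩
theorem genp {l : ℝ → ℝ → Set ι} {A Λ} {q : ℝ} (h1 : ∀ x' ∈ Λ, ∀ y', y' ≤ q → l x' y' ⊆ A)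
    (h2 : ∃ w1 w2, (∀ x', x' ≤ w1 → x' ∈ Λ) ∧ w2 ≤ q ∧ A ⊆ pp l w1 w2) : (VV l Λ q).p = A := by
  ext i; constructor
  · rintro ⟨x', k1, y', k2, k3⟩; exact h1 x' k1 y' k2 k3
  · intro hi
    obtain ⟨w1, w2, k1, k2, k3⟩ := h2
    obtain ⟨x', y', j1, j2, -, j3⟩ := k3 hi
    exact ⟨x', k1 x' j1, y', j2.trans k2, j3⟩

/-- the situation in a box with bottom cluster `(A',B')` and top cluster `(A,B)` -/
structure SF (X : Set (Ds ι)) (l : ℝ → ℝ → Set ι) (x y : ℝ → ℝ) (s0 s1 : ℝ) (A' B' A B : Set ι) : Prop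
    extends Cv X l x y s0 s1 where
  bd : ∀ p ∈ Ioo (x s0) (x s1), ∀ q ∈ Ioo (y s1) (y s0), A ⊆ ff l p q ∧ ff l p q ⊆ A' ∧
    B' ⊆ pp l p q ∧ pp l p q ⊆ B ∧ l p q ⊆ A' ∧ l p q ⊆ B
  nU : ∀ u v, s0 ≤ u → u ≤ v → v ≤ s1 → ¬ EE X l x y u v →
    ∃ p ∈ Ioo (x u) (x v), ∃ q ∈ Ioo (y v) (y u), tD l A B p q
  nD : ∀ u v, s0 ≤ u → u ≤ v → v ≤ s1 → ¬ EE X l x y u v →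
    ∃ p ∈ Ioo (x u) (x v), ∃ q ∈ Ioo (y v) (y u), tD l A' B' p q

section
variable {X : Set (Ds ι)} {l : ℝ → ℝ → Set ι} {x y : ℝ → ℝ} {s0 s1 : ℝ} {A' B' A B : Set ι}
  (h : SF X l x y s0 s1 A' B' A B)
include h

/-- the box -/
def SF.inQ (_ : SF X l x y s0 s1 A' B' A B) (p q : ℝ) : Prop := p ∈ Ioo (x s0) (x s1) ∧ q ∈ Ioo (y s1) (y s0)

theorem SF.upD {p q p' q' : ℝ} (hD : tD l A B p q) (h1 : p ≤ p') (h2 : q ≤ q') (hQ : h.inQ p' q') : tD l A B p' q' := by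
  obtain ⟨b1, b2, b3, b4, b5, b6⟩ := h.bd p' hQ.1 q' hQ.2
  refine ⟨subset_antisymm ?_ b1, subset_antisymm b4 ?_, hD.up h1 h2, b6⟩
  · rintro i ⟨x', y', j1, j2, -, j3⟩
    exact hD.up (h1.trans j1) (h2.trans j2) j3
  · intro i hi
    rw [← hD.2.1] at hi
    obtain ⟨x', y', j1, j2, j4, j3⟩ := hi
    refine ⟨x', y', j1.trans h1, j2.trans h2, ?_, j3⟩
    rintro ⟨rfl, rfl⟩
    exact j4 ⟨le_antisymm j1 h1, le_antisymm j2 h2⟩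

theorem SF.dnD {p q p' q' : ℝ} (hD : tD l A' B' p q) (h1 : p' ≤ p) (h2 : q' ≤ q) (hQ : h.inQ p' q') : tD l A' B' p' q' := by
  obtain ⟨b1, b2, b3, b4, b5, b6⟩ := h.bd p' hQ.1 q' hQ.2
  refine ⟨subset_antisymm b2 ?_, subset_antisymm ?_ b3, b5, hD.dn h1 h2⟩
  · intro i hi
    rw [← hD.1] at hi
    obtain ⟨x', y', j1, j2, j4, j3⟩ := hi
    refine ⟨x', y', h1.trans j1, h2.trans j2, ?_, j3⟩
    rintro ⟨rfl, rfl⟩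
    exact j4 ⟨le_antisymm h1 j1, le_antisymm h2 j2⟩
  · rintro i ⟨x', y', j1, j2, -, j3⟩
    exact hD.dn (j1.trans h1) (j2.trans h2) j3

theorem SF.nQ {u v : ℝ} (h1 : s0 ≤ u) (h3 : v ≤ s1) (hn : ¬ QQ (EE X l x y) u v) :
    (∃ p ∈ Ioo (x u) (x v), ∃ q ∈ Ioo (y v) (y u), tD l A B p q) ∧
    (∃ p ∈ Ioo (x u) (x v), ∃ q ∈ Ioo (y v) (y u), tD l A' B' p q) := by
  simp only [QQ, not_forall] at hn
  obtain ⟨s, t, k1, k2, k3, k4⟩ := hn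
  have e1 := h.mx k1
  have e2 := h.mx k3
  have e3 := h.my k1
  have e4 := h.my k3
  constructor
  · obtain ⟨p, hp, q, hq, hd⟩ := h.nU s t (h1.trans k1) k2 (k3.trans h3) k4
    exact ⟨p, ⟨by linarith [hp.1], by linarith [hp.2]⟩, q, ⟨by linarith [hq.1], by linarith [hq.2]⟩, hd⟩
  · obtain ⟨p, hp, q, hq, hd⟩ := h.nD s t (h1.trans k1) k2 (k3.trans h3) k4
    exact ⟨p, ⟨by linarith [hp.1], by linarith [hp.2]⟩, q, ⟨by linarith [hq.1], by linarith [hq.2]⟩, hd⟩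

omit h in
/-- left / right inequivalent points -/
def LN (E : ℝ → ℝ → Prop) (s0 r : ℝ) : Prop := ∀ s, s0 ≤ s → s < r → ¬ QQ E s r
omit h in
def RN (E : ℝ → ℝ → Prop) (s1 r : ℝ) : Prop := ∀ s, r < s → s ≤ s1 → ¬ QQ E r s

theorem SF.ltL {r : ℝ} (h0 : s0 < r) (h1 : r ≤ s1) (hn : LN (EE X l x y) s0 r) : x s0 < x r ∧ y r < y s0 := by
  obtain ⟨⟨p, hp, q, hq, -⟩, -⟩ := h.nQ le_rfl h1 (hn s0 le_rfl h0)
  exact ⟨hp.1.trans hp.2, hq.1.trans hq.2⟩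
theorem SF.ltR {r : ℝ} (h0 : s0 ≤ r) (h1 : r < s1) (hn : RN (EE X l x y) s1 r) : x r < x s1 ∧ y s1 < y r := by
  obtain ⟨⟨p, hp, q, hq, -⟩, -⟩ := h.nQ h0 le_rfl (hn s1 h1 le_rfl)
  exact ⟨hp.1.trans hp.2, hq.1.trans hq.2⟩

theorem SF.nearL {r e : ℝ} (h0 : s0 < r) (he : 0 < e) : ∃ s, s0 ≤ s ∧ s < r ∧ x r - x s < e ∧ y s - y r < e := by
  refine ⟨max s0 (r - e / 4), le_max_left _ _, max_lt h0 (by linarith), ?_, ?_⟩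
  · have := h.mx (le_max_right s0 (r - e / 4))
    have := h.toCv.lipx (show r - e / 4 ≤ r by linarith)
    linarith
  · have := h.my (le_max_right s0 (r - e / 4))
    have := h.toCv.lipy (show r - e / 4 ≤ r by linarith)
    linarith
theorem SF.nearR {r e : ℝ} (h0 : r < s1) (he : 0 < e) : ∃ s, s ≤ s1 ∧ r < s ∧ x s - x r < e ∧ y r - y s < e := by
  refine ⟨min s1 (r + e / 4), min_le_left _ _, lt_min h0 (by linarith), ?_, ?_⟩
  · have := h.mx (min_le_right s1 (r + e / 4))
    have := h.toCv.lipx (show r ≤ r + e / 4 by linarith)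
    linarith
  · have := h.my (min_le_right s1 (r + e / 4))
    have := h.toCv.lipy (show r ≤ r + e / 4 by linarith)
    linarith

theorem SF.LPU {r : ℝ} (h0 : s0 < r) (h1 : r ≤ s1) (hn : LN (EE X l x y) s0 r) {p q : ℝ} (hQ : h.inQ p q)
    (hp : x r ≤ p) (hq : y r < q) : tD l A B p q := by
  obtain ⟨s, k1, k2, k3, k4⟩ := h.nearL h0 (show 0 < q - y r by linarith)
  obtain ⟨⟨w1, hw1, w2, hw2, hd⟩, -⟩ := h.nQ k1 h1 (hn s k1 k2)
  exact h.upD hd (by linarith [hw1.2]) (by linarith [hw2.2]) hQ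
theorem SF.LPD {r : ℝ} (h0 : s0 < r) (h1 : r ≤ s1) (hn : LN (EE X l x y) s0 r) {p q : ℝ} (hQ : h.inQ p q)
    (hp : p < x r) (hq : q ≤ y r) : tD l A' B' p q := by
  obtain ⟨s, k1, k2, k3, k4⟩ := h.nearL h0 (show 0 < x r - p by linarith)
  obtain ⟨-, w1, hw1, w2, hw2, hd⟩ := h.nQ k1 h1 (hn s k1 k2)
  exact h.dnD hd (by linarith [hw1.1]) (by linarith [hw2.1]) hQ
theorem SF.RPU {r : ℝ} (h0 : s0 ≤ r) (h1 : r < s1) (hn : RN (EE X l x y) s1 r) {p q : ℝ} (hQ : h.inQ p q)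
    (hp : x r < p) (hq : y r ≤ q) : tD l A B p q := by
  obtain ⟨s, k1, k2, k3, k4⟩ := h.nearR h1 (show 0 < p - x r by linarith)
  obtain ⟨⟨w1, hw1, w2, hw2, hd⟩, -⟩ := h.nQ h0 k1 (hn s k2 k1)
  exact h.upD hd (by linarith [hw1.2]) (by linarith [hw2.2]) hQ
theorem SF.RPD {r : ℝ} (h0 : s0 ≤ r) (h1 : r < s1) (hn : RN (EE X l x y) s1 r) {p q : ℝ} (hQ : h.inQ p q)
    (hp : p ≤ x r) (hq : q < y r) : tD l A' B' p q := by
  obtain ⟨s, k1, k2, k3, k4⟩ := h.nearR h1 (show 0 < y r - q by linarith)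
  obtain ⟨-, w1, hw1, w2, hw2, hd⟩ := h.nQ h0 k1 (hn s k2 k1)
  exact h.dnD hd (by linarith [hw1.1]) (by linarith [hw2.1]) hQ

-- consequences outside the box as well
theorem SF.uL {r : ℝ} (h0 : s0 < r) (h1 : r < s1) (hn : LN (EE X l x y) s0 r) (hb : x r < x s1 ∧ y s1 < y r)
    {p q : ℝ} (hp : x r ≤ p) (hq : y r < q) : l p q ⊆ A := by
  have e := h.ltL h0 h1.le hn
  obtain ⟨q', k1, k2⟩ := exists_between (lt_min hq e.2)
  have k3 := k2.trans_le (min_le_left _ _)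
  have k4 := k2.trans_le (min_le_right _ _)
  exact (h.LPU h0 h1.le hn (p := x r) (q := q') ⟨⟨e.1, hb.1⟩, ⟨by linarith, k4⟩⟩ le_rfl k1).up hp k3.le
theorem SF.dL {r : ℝ} (h0 : s0 < r) (h1 : r < s1) (hn : LN (EE X l x y) s0 r) (hb : x r < x s1 ∧ y s1 < y r)
    {p q : ℝ} (hp : p < x r) (hq : q ≤ y r) : l p q ⊆ B' := by
  have e := h.ltL h0 h1.le hn
  obtain ⟨q', k1, k2⟩ := exists_between (max_lt hp e.1)
  have k3 := (le_max_left _ _).trans_lt k1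
  have k4 := (le_max_right _ _).trans_lt k1
  exact (h.LPD h0 h1.le hn (p := q') (q := y r) ⟨⟨k4, by linarith⟩, ⟨by linarith, e.2⟩⟩ k2 le_rfl).dn k3.le hq
theorem SF.uR {r : ℝ} (h0 : s0 < r) (h1 : r < s1) (hn : RN (EE X l x y) s1 r) (hb : x s0 < x r ∧ y r < y s0)
    {p q : ℝ} (hp : x r < p) (hq : y r ≤ q) : l p q ⊆ A := by
  have e := h.ltR h0.le h1 hn
  obtain ⟨q', k1, k2⟩ := exists_between (lt_min hp e.1)
  have k3 := k2.trans_le (min_le_left _ _)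
  have k4 := k2.trans_le (min_le_right _ _)
  exact (h.RPU h0.le h1 hn (p := q') (q := y r) ⟨⟨by linarith, k4⟩, ⟨e.2, hb.2⟩⟩ k1 le_rfl).up k3.le hq
theorem SF.dR {r : ℝ} (h0 : s0 < r) (h1 : r < s1) (hn : RN (EE X l x y) s1 r) (hb : x s0 < x r ∧ y r < y s0)
    {p q : ℝ} (hp : p ≤ x r) (hq : q < y r) : l p q ⊆ B' := by
  have e := h.ltR h0.le h1 hn
  obtain ⟨q', k1, k2⟩ := exists_between (max_lt hq e.2)
  have k3 := (le_max_left _ _).trans_lt k1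
  have k4 := (le_max_right _ _).trans_lt k1
  exact (h.RPD h0.le h1 hn (p := x r) (q := q') ⟨⟨hb.1, e.1⟩, ⟨k4, by linarith⟩⟩ le_rfl k2).dn hp k3.le

/-- label at a singleton class -/
theorem SF.sing {r : ℝ} (h0 : s0 < r) (h1 : r < s1) (hl : LN (EE X l x y) s0 r) (hr : RN (EE X l x y) s1 r) :
    h.inQ (x r) (y r) ∧ ff l (x r) (y r) = A ∧ pp l (x r) (y r) = B' := by
  have e := h.ltL h0 h1.le hl
  have e' := h.ltR h0.le h1 hr
  have hQ : h.inQ (x r) (y r) := ⟨⟨e.1, e'.1⟩, ⟨e'.2, e.2⟩⟩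
  have b := h.bd _ hQ.1 _ hQ.2
  refine ⟨hQ, subset_antisymm ?_ b.1, subset_antisymm ?_ b.2.2.1⟩
  · rintro i ⟨x', y', j1, j2, j4, j3⟩
    rcases eq_or_lt_of_le j1 with k | k
    · exact h.uL h0 h1 hl e' j1 (lt_of_le_of_ne j2 (fun k' => j4 ⟨k.symm, k'.symm⟩)) j3
    · exact h.uR h0 h1 hr e k j2 j3
  · rintro i ⟨x', y', j1, j2, j4, j3⟩
    rcases eq_or_lt_of_le j1 with k | k
    · exact h.dR h0 h1 hr e j1 (lt_of_le_of_ne j2 (fun k' => j4 ⟨k, k'⟩)) j3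
    · exact h.dL h0 h1 hl e' k j2 j3
end
end Temporal
end

section
set_option linter.unusedVariables false
namespace Temporal
variable {ι : Type}
open Set

theorem lo_cc {a b : ℝ} (h : a ≤ b) : lo (Icc a b) = Iio a := by
  ext z; constructor
  · intro hz; exact hz a ⟨le_rfl, h⟩
  · intro hz x hx; exact lt_of_lt_of_le hz hx.1
theorem hi_cc {a b : ℝ} (h : a ≤ b) : hi (Icc a b) = Iic b := by
  ext z; constructor
  · rintro ⟨w, hw, h⟩; exact h.trans hw.2
  · intro hz; exact ⟨b, ⟨h, le_rfl⟩, hz⟩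

theorem Cv.contx {X : Set (Ds ι)} {l : ℝ → ℝ → Set ι} {x y : ℝ → ℝ} {s0 s1 : ℝ} (h : Cv X l x y s0 s1) :
    Continuous x := by
  refine (LipschitzWith.of_dist_le_mul (K := 2) ?_).continuous
  intro s t
  rw [Real.dist_eq, Real.dist_eq]
  rcases le_total s t with k | k
  · rw [abs_sub_comm, abs_sub_comm s t, abs_of_nonneg (sub_nonneg.2 (h.mx k)), abs_of_nonneg (sub_nonneg.2 k)]
    exact h.lipx k
  · rw [abs_of_nonneg (sub_nonneg.2 (h.mx k)), abs_of_nonneg (sub_nonneg.2 k)]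
    exact h.lipx k
theorem Cv.conty {X : Set (Ds ι)} {l : ℝ → ℝ → Set ι} {x y : ℝ → ℝ} {s0 s1 : ℝ} (h : Cv X l x y s0 s1) :
    Continuous y := by
  have : y = fun s => x s - 2 * s := by funext s; have := h.xy s; linarith
  rw [this]
  exact h.contx.sub (continuous_const.mul continuous_id)

section
variable {C : Lab ι → Prop} {X : Set (Ds ι)} {l : ℝ → ℝ → Set ι} {x y : ℝ → ℝ} {s0 s1 : ℝ} {A' B' A B : Set ι}
  (hc : Cx C X l) (h : SF X l x y s0 s1 A' B' A B)
include hc h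

omit hc in
theorem SF.inQ01 {p q : ℝ} (hQ : h.inQ p q) : p ∈ Ioo (0:ℝ) 1 ∧ q ∈ Ioo (0:ℝ) 1 :=
  ⟨⟨h.x0.trans_lt hQ.1.1, hQ.1.2.trans_le h.x1⟩, ⟨h.y0.trans_lt hQ.2.1, hQ.2.2.trans_le h.y1⟩⟩

theorem SF.tc {A B : Set ι} {p q : ℝ} (hQ : h.inQ p q) (hD : tD l A B p q) : TC C A B ⟨l p q, ff l p q, pp l p q⟩ :=
  ⟨hc.md p (h.inQ01 hQ).1 q (h.inQ01 hQ).2, hD.1, hD.2.1, hD.2.2.1, hD.2.2.2⟩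

theorem SF.item [Finite ι] {m M : ℝ} (h0 : s0 < m) (hm : m ≤ M) (h1 : M < s1) (hl : LN (EE X l x y) s0 m)
    (hr : RN (EE X l x y) s1 M) (hQ : QQ (EE X l x y) m M) :
    dsc l (Icc (x m) (x M)) (Icc (y M) (y m)) ∈ X ∧ Item B' A (dsc l (Icc (x m) (x M)) (Icc (y M) (y m))) := by
  have e := h.ltL h0 (by linarith) hl
  have e' := h.ltR (by linarith) h1 hr
  have hx := h.mx hm
  have hy := h.my hm
  have b1 := h.x0
  have b2 := h.x1
  have b3 := h.y0
  have b4 := h.y1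
  have iI : Iv (Icc (x m) (x M)) := ⟨nonempty_Icc.2 hx, ordConnected_Icc, fun z hz => ⟨by linarith [hz.1], by linarith [hz.2]⟩⟩
  have iJ : Iv (Icc (y M) (y m)) := ⟨nonempty_Icc.2 hy, ordConnected_Icc, fun z hz => ⟨by linarith [hz.1], by linarith [hz.2]⟩⟩
  have lm : m < s1 := by linarith
  have lM : s0 < M := by linarith
  have em : x m < x s1 ∧ y s1 < y m := ⟨by linarith, by linarith⟩
  have eM : x s0 < x M ∧ y M < y s0 := ⟨by linarith, by linarith⟩
  constructor
  · rcases eq_or_lt_of_le hx with k | k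
    · rw [k, Icc_self]
      exact DR_line hc ⟨by linarith, by linarith⟩ iJ
    rcases eq_or_lt_of_le hy with k' | k'
    · rw [k', Icc_self]
      exact DR_lineY hc ⟨by linarith, by linarith⟩ iI
    · exact DR_box hc iI iJ k k' Ioo_subset_Icc_self (fun z hz => hz) Ioo_subset_Icc_self (fun z hz => hz)
        (hQ m M le_rfl hm le_rfl)
  · refine ⟨⟨_, isLeast_Icc hx⟩, ⟨_, isGreatest_Icc hx⟩, ⟨_, isLeast_Icc hy⟩, ⟨_, isGreatest_Icc hy⟩, ?_, ?_, ?_, ?_⟩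
    all_goals simp only [dsc, lo_cc hx, lo_cc hy, hi_cc hx, hi_cc hy]
    · rintro _ ⟨q, hq, rfl⟩
      refine genp (fun x' hx' y' hy' => h.dL h0 lm hl em hx' (hy'.trans hq.2)) ?_
      obtain ⟨w, w1, w2⟩ := exists_between e.1
      refine ⟨w, y M, fun z hz => lt_of_le_of_lt hz w2, hq.1, ?_⟩
      exact (h.bd w ⟨w1, by linarith⟩ (y M) ⟨by linarith, by linarith⟩).2.2.1
    · rintro _ ⟨q, hq, rfl⟩
      refine genp (fun x' hx' y' hy' => h.dR lM h1 hr eM (hy'.trans hq.2) hx') ?_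
      obtain ⟨w, w1, w2⟩ := exists_between e'.2
      refine ⟨w, x m, fun z hz => lt_of_le_of_lt hz w2, hq.1, ?_⟩
      rw [pp_lsw]
      exact (h.bd (x m) ⟨by linarith, by linarith⟩ w ⟨w1, by linarith⟩).2.2.1
    · rintro _ ⟨q, hq, rfl⟩
      refine genf (fun x' hx' y' hy' => h.uR lM h1 hr eM (not_le.1 hx') (hq.1.trans hy')) ?_
      obtain ⟨w, w1, w2⟩ := exists_between e'.1
      refine ⟨w, y m, fun z hz => not_le.2 (lt_of_lt_of_le w1 hz), hq.2, ?_⟩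
      exact (h.bd w ⟨by linarith, by linarith⟩ (y m) ⟨by linarith, by linarith⟩).1
    · rintro _ ⟨q, hq, rfl⟩
      refine genf (fun x' hx' y' hy' => h.uL h0 lm hl em (hq.1.trans hy') (not_le.1 hx')) ?_
      obtain ⟨w, w1, w2⟩ := exists_between e.2
      refine ⟨w, x M, fun z hz => not_le.2 (lt_of_lt_of_le w1 hz), hq.2, ?_⟩
      rw [ff_lsw]
      exact (h.bd (x M) ⟨by linarith, by linarith⟩ w ⟨by linarith, by linarith⟩).1

/-- coverage -/
theorem SF.cover [Finite ι] {r0 r1 : ℝ} (h0 : s0 ≤ r0) (h01 : r0 < r1) (h1 : r1 ≤ s1)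
    (hr0 : RN (EE X l x y) s1 r0) (hr1 : LN (EE X l x y) s0 r1) {p q : ℝ} (hp : p ∈ Ioo (x r0) (x r1))
    (hq : q ∈ Ioo (y r1) (y r0)) : tD l A B p q ∨ tD l A' B' p q ∨
    ∃ m M, r0 < m ∧ m ≤ M ∧ M < r1 ∧ LN (EE X l x y) s0 m ∧ RN (EE X l x y) s1 M ∧ QQ (EE X l x y) m M ∧
      p ∈ Icc (x m) (x M) ∧ q ∈ Icc (y M) (y m) := by
  have her := EE_ER hc h.toCv
  obtain ⟨t, ht, rfl⟩ := intermediate_value_Ioo h01.le h.toCv.contx.continuousOn hp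
  obtain ⟨s, hs, rfl⟩ := intermediate_value_Ioo' h01.le h.toCv.conty.continuousOn hq
  have hQ : h.inQ (x t) (y s) := ⟨⟨lt_of_le_of_lt (h.mx h0) hp.1, lt_of_lt_of_le hp.2 (h.mx h1)⟩,
    ⟨lt_of_le_of_lt (h.my h1) hq.1, lt_of_lt_of_le hq.2 (h.my h0)⟩⟩
  have hs1 := hs.1
  have hs2 := hs.2
  have ht1 := ht.1
  have ht2 := ht.2
  -- common end
  have fin : ∀ a b, a ≤ b → r0 < a → b < r1 → QQ (EE X l x y) a b → x a ≤ x t → x t ≤ x b → y b ≤ y s → y s ≤ y a →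
      ∃ m M, r0 < m ∧ m ≤ M ∧ M < r1 ∧ LN (EE X l x y) s0 m ∧ RN (EE X l x y) s1 M ∧ QQ (EE X l x y) m M ∧
      x t ∈ Icc (x m) (x M) ∧ y s ∈ Icc (y M) (y m) := by
    intro a b hab ha hb hq c1 c2 c3 c4
    obtain ⟨m, m1, m2, m3, m4⟩ := her.inf (s := a) (by linarith) (by linarith)
    obtain ⟨M, M1, M2, M3, M4⟩ := her.sup (s := b) (by linarith) (by linarith)
    refine ⟨m, M, ?_, by linarith, ?_, m4, M4, ?_, ⟨(h.mx m2).trans c1, c2.trans (h.mx M1)⟩,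
      ⟨(h.my M1).trans c3, c4.trans (h.my m2)⟩⟩
    · by_contra hcc
      exact hr0 a ha (by linarith) (m3.sub (not_lt.1 hcc) le_rfl)
    · by_contra hcc
      exact hr1 b (by linarith) hb (M3.sub le_rfl (not_lt.1 hcc))
    · exact her.qtr m1 M2 m3 (her.qtr (by linarith) M2 hq M3 hab M1) m2 (hab.trans M1)
  rcases le_total s t with k | k
  · by_cases hQQ : QQ (EE X l x y) s t
    · right; right
      exact fin s t k hs1 ht2 hQQ (h.mx k) le_rfl (h.my k) le_rfl
    · left
      obtain ⟨⟨w1, hw1, w2, hw2, hd⟩, -⟩ := h.nQ (by linarith) (by linarith) hQQ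
      exact h.upD hd hw1.2.le hw2.2.le hQ
  · by_cases hQQ : QQ (EE X l x y) t s
    · right; right
      exact fin t s k ht1 hs2 hQQ le_rfl (h.mx k) le_rfl (h.my k)
    · right; left
      obtain ⟨-, w1, hw1, w2, hw2, hd⟩ := h.nQ (by linarith) (by linarith) hQQ
      exact h.dnD hd hw1.1.le hw2.1.le hQ

theorem SF.main [Finite ι] {r0 r1 : ℝ} (h0 : s0 ≤ r0) (h01 : r0 < r1) (h1 : r1 ≤ s1)
    (hr0 : RN (EE X l x y) s1 r0) (hr1 : LN (EE X l x y) s0 r1) {oL oR oT oB : Set ι}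
    (hL : ∀ q ∈ Ioo (y r1) (y r0), (VV l (Iic (x r0)) q).p = oL)
    (hR : ∀ q ∈ Ioo (y r1) (y r0), (VV l (Iio (x r1)) q).f = oR)
    (hT : ∀ p ∈ Ioo (x r0) (x r1), (VV (lsw l) (Iio (y r0)) p).f = oT)
    (hB : ∀ p ∈ Ioo (x r0) (x r1), (VV (lsw l) (Iic (y r1)) p).p = oB) : EE X l x y r0 r1 := by
  intro hxx hyy
  have her := EE_ER hc h.toCv
  have X0 := h.mx h0
  have X1 := h.mx h1
  have Y0 := h.my h0
  have Y1 := h.my h1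
  have hnq : ¬ QQ (EE X l x y) r0 r1 := hr0 r1 h01 h1
  have hS : ∀ {p q : ℝ}, p ∈ Ioo (x r0) (x r1) → q ∈ Ioo (y r1) (y r0) → h.inQ p q := fun hp hq =>
    ⟨⟨by linarith [hp.1], by linarith [hp.2]⟩, ⟨by linarith [hq.1], by linarith [hq.2]⟩⟩
  obtain ⟨⟨u1, hu1, u2, hu2, hu⟩, d1, hd1, d2, hd2, hd⟩ := h.nQ h0 h1 hnq
  obtain ⟨r, g1, g2, g3, g4⟩ := her.single h0 h01 h1 hnq
  obtain ⟨rQ, rf, rp⟩ := h.sing (lt_of_le_of_lt h0 g1) (lt_of_lt_of_le g2 h1) (fun s _ => g3 s) (fun s hs _ => g4 s hs)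
  have oRA : oR ⊆ A := by
    rw [← hR u2 hu2]
    rintro i ⟨x', j1, y', j2, j3⟩
    exact hu.up (hu1.2.le.trans (not_lt.1 j1)) j2 j3
  have oTA : oT ⊆ A := by
    rw [← hT u1 hu1]
    rintro i ⟨y', j1, x', j2, j3⟩
    exact hu.up j2 (hu2.2.le.trans (not_lt.1 j1)) j3
  have oLB : oL ⊆ B' := by
    rw [← hL d2 hd2]
    rintro i ⟨x', j1, y', j2, j3⟩
    exact hd.dn (le_trans j1 hd1.1.le) j2 j3
  have oBB : oB ⊆ B' := by
    rw [← hB d1 hd1]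
    rintro i ⟨y', j1, x', j2, j3⟩
    exact hd.dn j2 (le_trans j1 hd2.1.le) j3
  have AA' : A ⊆ A' := (h.bd d1 (hS hd1 hd2).1 d2 (hS hd1 hd2).2).1.trans (h.bd d1 (hS hd1 hd2).1 d2 (hS hd1 hd2).2).2.1
  have BB' : B' ⊆ B := (h.bd d1 (hS hd1 hd2).1 d2 (hS hd1 hd2).2).2.2.1.trans (h.bd d1 (hS hd1 hd2).1 d2 (hS hd1 hd2).2).2.2.2.1
  have LitA : ∀ A B, Lit C A B ⊆ A := by
    rintro A B i ⟨t, ht, hi⟩; exact ht.2.2.2.1 hi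
  have LitB : ∀ A B, Lit C A B ⊆ B := by
    rintro A B i ⟨t, ht, hi⟩; exact ht.2.2.2.2 hi
  -- future points of a point in `S`
  have futS : ∀ p ∈ Ioo (x r0) (x r1), ∀ q ∈ Ioo (y r1) (y r0), ∀ i ∈ ff l p q,
      (∃ p' ∈ Ioo (x r0) (x r1), ∃ q' ∈ Ioo (y r1) (y r0), p ≤ p' ∧ q ≤ q' ∧ i ∈ l p' q') ∨ i ∈ oR ∨ i ∈ oT := by
    rintro p hp q hq i ⟨x', y', j1, j2, -, j3⟩
    by_cases k1 : x' < x r1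
    · by_cases k2 : y' < y r0
      · left; exact ⟨x', ⟨by linarith [hp.1], k1⟩, y', ⟨by linarith [hq.1], k2⟩, j1, j2, j3⟩
      · right; right; rw [← hT p hp]; exact ⟨y', k2, x', j1, j3⟩
    · right; left; rw [← hR q hq]; exact ⟨x', k1, y', j2, j3⟩
  have pasS : ∀ p ∈ Ioo (x r0) (x r1), ∀ q ∈ Ioo (y r1) (y r0), ∀ i ∈ pp l p q,
      (∃ p' ∈ Ioo (x r0) (x r1), ∃ q' ∈ Ioo (y r1) (y r0), p' ≤ p ∧ q' ≤ q ∧ i ∈ l p' q') ∨ i ∈ oL ∨ i ∈ oB := by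
    rintro p hp q hq i ⟨x', y', j1, j2, -, j3⟩
    by_cases k1 : x' ≤ x r0
    · right; left; rw [← hL q hq]; exact ⟨x', k1, y', j2, j3⟩
    · by_cases k2 : y' ≤ y r1
      · right; right; rw [← hB p hp]; exact ⟨y', k2, x', j1, j3⟩
      · left; exact ⟨x', ⟨not_le.1 k1, by linarith [hp.2]⟩, y', ⟨not_le.1 k2, by linarith [hq.2]⟩, j1, j2, j3⟩
  let K : Set (Ds ι) := {d | ∃ m M, r0 < m ∧ m ≤ M ∧ M < r1 ∧ LN (EE X l x y) s0 m ∧ RN (EE X l x y) s1 M ∧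
    QQ (EE X l x y) m M ∧ d = dsc l (Icc (x m) (x M)) (Icc (y M) (y m))}
  have rb := h.bd _ rQ.1 _ rQ.2
  have key := hc.cl.shuf A' B' A B oL oR oT oB ⟨l (x r) (y r), ff l (x r) (y r), pp l (x r) (y r)⟩ K
    ⟨_, h.tc hc (hS hd1 hd2) hd⟩ ⟨_, h.tc hc (hS hu1 hu2) hu⟩ ?_ ?_ (hc.md _ (h.inQ01 rQ).1 _ (h.inQ01 rQ).2)
    rf rp rb.2.2.2.2.1 rb.2.2.2.2.2 ?_ ?_ ?_
  rotate_left
  · apply subset_antisymm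
    · intro i hi
      rw [← hu.1] at hi
      rcases futS u1 hu1 u2 hu2 i hi with ⟨p', hp', q', hq', k1, k2, k3⟩ | k | k
      · left; left; exact ⟨_, h.tc hc (hS hp' hq') (h.upD hu k1 k2 (hS hp' hq')), k3⟩
      · left; right; exact k
      · right; exact k
    · exact union_subset (union_subset (LitA _ _) oRA) oTA
  · apply subset_antisymm
    · intro i hi
      rw [← hd.2.1] at hi
      rcases pasS d1 hd1 d2 hd2 i hi with ⟨p', hp', q', hq', k1, k2, k3⟩ | k | k
      · left; left; exact ⟨_, h.tc hc (hS hp' hq') (h.dnD hd k1 k2 (hS hp' hq')), k3⟩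
      · left; right; exact k
      · right; exact k
    · exact union_subset (union_subset (LitB _ _) oLB) oBB
  · rintro _ ⟨m, M, k1, k2, k3, k4, k5, k6, rfl⟩
    exact h.item hc (by linarith) k2 (by linarith) k4 k5 k6
  · apply subset_antisymm
    · intro i hi
      rw [← hd.1] at hi
      rcases futS d1 hd1 d2 hd2 i hi with ⟨p', hp', q', hq', k1, k2, k3⟩ | k | k
      · rcases h.cover hc h0 h01 h1 hr0 hr1 hp' hq' with j | j | ⟨m, M, j1, j2, j3, j4, j5, j6, j7, j8⟩
        · left; left; right; exact j.2.2.1 k3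
        · left; left; left; exact ⟨_, h.tc hc (hS hp' hq') j, k3⟩
        · right
          refine ⟨_, ⟨m, M, j1, j2, j3, j4, j5, j6, rfl⟩, _, ⟨q', j8, rfl⟩, p', ?_, q', le_rfl, k3⟩
          rw [lo_cc (h.mx j2)]; exact not_lt.2 j7.1
      · left; left; right; exact oRA k
      · left; left; right; exact oTA k
    · refine union_subset (union_subset (union_subset (LitA _ _) AA') rb.2.2.2.2.1) ?_
      rintro i ⟨_, ⟨m, M, k1, k2, k3, k4, k5, k6, rfl⟩, _, ⟨q, hq, rfl⟩, x', j1, y', j2, j3⟩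
      rw [lo_cc (h.mx k2)] at j1
      have e := h.ltL (r := m) (by linarith) (by linarith) k4
      have e' := h.ltR (r := M) (by linarith) (by linarith) k5
      have e3 := h.mx k2
      have b := h.bd (x m) ⟨by linarith, by linarith⟩ q ⟨by linarith [hq.1], by linarith [hq.2]⟩
      rcases mem_lpf l j3 (not_lt.1 j1) j2 with k | k
      · exact b.2.2.2.2.1 k
      · exact b.2.1 k
  · apply subset_antisymm
    · intro i hi
      rw [← hu.2.1] at hi
      rcases pasS u1 hu1 u2 hu2 i hi with ⟨p', hp', q', hq', k1, k2, k3⟩ | k | k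
      · rcases h.cover hc h0 h01 h1 hr0 hr1 hp' hq' with j | j | ⟨m, M, j1, j2, j3, j4, j5, j6, j7, j8⟩
        · left; left; left; exact ⟨_, h.tc hc (hS hp' hq') j, k3⟩
        · left; left; right; exact j.2.2.2 k3
        · right
          refine ⟨_, ⟨m, M, j1, j2, j3, j4, j5, j6, rfl⟩, _, ⟨q', j8, rfl⟩, p', ?_, q', le_rfl, k3⟩
          rw [hi_cc (h.mx j2)]; exact j7.2
      · left; left; right; exact oLB k
      · left; left; right; exact oBB k
    · refine union_subset (union_subset (union_subset (LitB _ _) BB') rb.2.2.2.2.2) ?_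
      rintro i ⟨_, ⟨m, M, k1, k2, k3, k4, k5, k6, rfl⟩, _, ⟨q, hq, rfl⟩, x', j1, y', j2, j3⟩
      rw [hi_cc (h.mx k2)] at j1
      have e := h.ltL (r := m) (by linarith) (by linarith) k4
      have e' := h.ltR (r := M) (by linarith) (by linarith) k5
      have e3 := h.mx k2
      have b := h.bd (x M) ⟨by linarith, by linarith⟩ q ⟨by linarith [hq.1], by linarith [hq.2]⟩
      rcases mem_lpp l j3 j1 j2 with k | k
      · exact b.2.2.2.2.2 k
      · exact b.2.2.2.1 k
  -- edges
  have inA : ∀ p ∈ Ioo (x r0) (x r1), ∀ q ∈ Ioo (y r1) (y r0), ∀ p' q', p ≤ p' → q ≤ q' → l p' q' ⊆ A' := by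
    intro p hp q hq p' q' k1 k2 i hi
    have b := h.bd p (hS hp hq).1 q (hS hp hq).2
    rcases mem_lpf l hi k1 k2 with k | k
    · exact b.2.2.2.2.1 k
    · exact b.2.1 k
  have inB : ∀ p ∈ Ioo (x r0) (x r1), ∀ q ∈ Ioo (y r1) (y r0), ∀ p' q', p' ≤ p → q' ≤ q → l p' q' ⊆ B := by
    intro p hp q hq p' q' k1 k2 i hi
    have b := h.bd p (hS hp hq).1 q (hS hp hq).2
    rcases mem_lpp l hi k1 k2 with k | k
    · exact b.2.2.2.2.2 k
    · exact b.2.2.2.1 k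
  have btw : ∀ {a b c : ℝ}, a < b → a < c → ∃ w, w ∈ Ioo a b ∧ w ≤ c := fun k1 k2 => by
    obtain ⟨w, w1, w2⟩ := exists_between (lt_min k1 k2)
    exact ⟨w, ⟨w1, w2.trans_le (min_le_left _ _)⟩, (w2.trans_le (min_le_right _ _)).le⟩
  have btw' : ∀ {a b c : ℝ}, a < b → c < b → ∃ w, w ∈ Ioo a b ∧ c ≤ w := fun k1 k2 => by
    obtain ⟨w, w1, w2⟩ := exists_between (max_lt k1 k2)
    exact ⟨w, ⟨(le_max_left _ _).trans_lt w1, w2⟩, ((le_max_right _ _).trans_lt w1).le⟩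
  convert key using 1
  refine Ds.ext (kd_oo hxx) (kd_oo hyy) ?_ ?_ ?_ ?_
  all_goals simp only [dsc, lo_oo hxx, hi_oo hxx, lo_oo hyy, hi_oo hyy]
  · rw [← kd_oo hyy]; refine W_const _ _ (fun q hq => Mo.ext (hL q hq) (genf ?_ ?_))
    · intro x' hx' y' hy'
      obtain ⟨w, w1, w2⟩ := btw hxx (not_le.1 hx')
      exact inA w w1 q hq x' y' w2 hy'
    · obtain ⟨s, k1, k2, k3, k4⟩ := h.nearR (show r0 < s1 by linarith) (show 0 < y r0 - q by linarith [hq.2])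
      obtain ⟨-, w1, hw1, w2, hw2, hw⟩ := h.nQ h0 k1 (hr0 s k2 k1)
      exact ⟨w1, w2, fun z hz => not_le.2 (lt_of_lt_of_le hw1.1 hz), by linarith [hw2.1], hw.1.ge⟩
  · rw [← kd_oo hyy]; refine W_const _ _ (fun q hq => Mo.ext (genp ?_ ?_) (hR q hq))
    · intro x' hx' y' hy'
      obtain ⟨w, w1, w2⟩ := btw' hxx hx'
      exact inB w w1 q hq x' y' w2 hy'
    · obtain ⟨s, k1, k2, k3, k4⟩ := h.nearL (show s0 < r1 by linarith) (show 0 < q - y r1 by linarith [hq.1])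
      obtain ⟨⟨w1, hw1, w2, hw2, hw⟩, -⟩ := h.nQ k1 h1 (hr1 s k1 k2)
      exact ⟨w1, w2, fun z hz => lt_of_le_of_lt hz hw1.2, by linarith [hw2.2], hw.2.1.ge⟩
  · rw [← kd_oo hxx]; refine W_const _ _ (fun p hp => Mo.ext (genp ?_ ?_) (hT p hp))
    · intro x' hx' y' hy'
      obtain ⟨w, w1, w2⟩ := btw' hyy hx'
      exact inB p hp w w1 y' x' hy' w2
    · obtain ⟨s, k1, k2, k3, k4⟩ := h.nearR (show r0 < s1 by linarith) (show 0 < p - x r0 by linarith [hp.1])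
      obtain ⟨⟨w1, hw1, w2, hw2, hw⟩, -⟩ := h.nQ h0 k1 (hr0 s k2 k1)
      exact ⟨w2, w1, fun z hz => lt_of_le_of_lt hz hw2.2, by linarith [hw1.2], by rw [pp_lsw]; exact hw.2.1.ge⟩
  · rw [← kd_oo hxx]; refine W_const _ _ (fun p hp => Mo.ext (hB p hp) (genf ?_ ?_))
    · intro x' hx' y' hy'
      obtain ⟨w, w1, w2⟩ := btw hyy (not_le.1 hx')
      exact inA p hp w w1 y' x' hy' w2
    · obtain ⟨s, k1, k2, k3, k4⟩ := h.nearL (show s0 < r1 by linarith) (show 0 < x r1 - p by linarith [hp.2])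
      obtain ⟨-, w1, hw1, w2, hw2, hw⟩ := h.nQ k1 h1 (hr1 s k1 k2)
      exact ⟨w2, w1, fun z hz => not_le.2 (lt_of_lt_of_le hw2.1 hz), by linarith [hw1.1], by rw [ff_lsw]; exact hw.1.ge⟩
end
end Temporal
end

section
set_option linter.unusedVariables false
namespace Temporal
variable {ι : Type}
open Set

section
variable {C : Lab ι → Prop} {X : Set (Ds ι)} {l : ℝ → ℝ → Set ι} {x y : ℝ → ℝ} {s0 s1 : ℝ} {A' B' A B : Set ι}

theorem SF.oR (h : SF X l x y s0 s1 A' B' A B) {r : ℝ} (h0 : s0 < r) (h1 : r < s1)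
    (hl : LN (EE X l x y) s0 r) (hr : RN (EE X l x y) s1 r) {q : ℝ} (k1 : y r < q) (k2 : q < y s0) :
    (VV l (Iio (x r)) q).f = A := by
  have e := h.ltL h0 h1.le hl
  have e' := h.ltR h0.le h1 hr
  refine genf (fun x' hx' y' hy' => h.uL h0 h1 hl e' (not_lt.1 hx') (k1.trans_le hy')) ?_
  exact ⟨x r, q, fun x' hx' => not_lt.2 hx', le_rfl, (h.bd _ ⟨e.1, e'.1⟩ _ ⟨e'.2.trans k1, k2⟩).1⟩
theorem SF.oB (h : SF X l x y s0 s1 A' B' A B) {r : ℝ} (h0 : s0 < r) (h1 : r < s1)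
    (hl : LN (EE X l x y) s0 r) (hr : RN (EE X l x y) s1 r) {p : ℝ} (k1 : x s0 < p) (k2 : p < x r) :
    (VV (lsw l) (Iic (y r)) p).p = B' := by
  have e := h.ltL h0 h1.le hl
  have e' := h.ltR h0.le h1 hr
  refine genp (fun x' hx' y' hy' => h.dL h0 h1 hl e' (hy'.trans_lt k2) hx') ?_
  exact ⟨y r, p, fun x' hx' => hx', le_rfl, by
    rw [pp_lsw]; exact (h.bd _ ⟨k1, k2.trans e'.1⟩ _ ⟨e'.2, e.2⟩).2.2.1⟩
theorem SF.oL (h : SF X l x y s0 s1 A' B' A B) {r : ℝ} (h0 : s0 < r) (h1 : r < s1)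
    (hl : LN (EE X l x y) s0 r) (hr : RN (EE X l x y) s1 r) {q : ℝ} (k1 : y s1 < q) (k2 : q < y r) :
    (VV l (Iic (x r)) q).p = B' := by
  have e := h.ltL h0 h1.le hl
  have e' := h.ltR h0.le h1 hr
  refine genp (fun x' hx' y' hy' => h.dR h0 h1 hr e hx' (lt_of_le_of_lt hy' k2)) ?_
  exact ⟨x r, q, fun x' hx' => hx', le_rfl, (h.bd _ ⟨e.1, e'.1⟩ _ ⟨k1, k2.trans e.2⟩).2.2.1⟩
theorem SF.oT (h : SF X l x y s0 s1 A' B' A B) {r : ℝ} (h0 : s0 < r) (h1 : r < s1)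
    (hl : LN (EE X l x y) s0 r) (hr : RN (EE X l x y) s1 r) {p : ℝ} (k1 : x r < p) (k2 : p < x s1) :
    (VV (lsw l) (Iio (y r)) p).f = A := by
  have e := h.ltL h0 h1.le hl
  have e' := h.ltR h0.le h1 hr
  refine genf (fun x' hx' y' hy' => h.uR h0 h1 hr e (k1.trans_le hy') (not_lt.1 hx')) ?_
  exact ⟨y r, p, fun x' hx' => not_lt.2 hx', le_rfl, by
    rw [ff_lsw]; exact (h.bd _ ⟨e.1.trans k1, k2⟩ _ ⟨e'.2, e.2⟩).1⟩

theorem SF.all [Finite ι] (hc : Cx C X l) (h : SF X l x y s0 s1 A' B' A B) (h01 : s0 ≤ s1) : EE X l x y s0 s1 := by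
  have her := EE_ER hc h.toCv
  by_cases hq : QQ (EE X l x y) s0 s1
  · exact hq s0 s1 le_rfl h01 le_rfl
  obtain ⟨m0, a1, a2, a3, a4⟩ := her.sup le_rfl h01
  obtain ⟨m1, b1, b2, b3, b4⟩ := her.inf h01 le_rfl
  have hm : m0 < m1 := by
    by_contra hcc
    exact hq (her.qtr le_rfl le_rfl a3 (b3.sub (not_lt.1 hcc) le_rfl) a1 a2)
  -- nearness at m0
  obtain ⟨qL, c1, mL, c2⟩ := ev_left (VV l (Iic (x m0))) (VV_mono _ _) (y m0)
  obtain ⟨qT, d1, mT, d2⟩ := ev_right (VV (lsw l) (Iio (y m0))) (VV_mono _ _) (x m0)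
  obtain ⟨t0, e1, e2, e3, e4⟩ := h.nearR (r := m0) (e := min (y m0 - qL) (qT - x m0)) (lt_of_lt_of_le hm b2)
    (lt_min (by linarith) (by linarith))
  have e3' := e3.trans_le (min_le_right _ _)
  have e4' := e4.trans_le (min_le_left _ _)
  have f0 : m0 < min t0 m1 := lt_min e2 hm
  obtain ⟨r0, g1, g2, g3, g4⟩ := her.single a1 f0 ((min_le_left _ _).trans e1) (a4 _ f0 ((min_le_left _ _).trans e1))
  have g2a := g2.trans_le (min_le_left _ _)
  have g2b := g2.trans_le (min_le_right _ _)
  -- nearness at m1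
  obtain ⟨qR, c1', mR, c2'⟩ := ev_right (VV l (Iio (x m1))) (VV_mono _ _) (y m1)
  obtain ⟨qB, d1', mB, d2'⟩ := ev_left (VV (lsw l) (Iic (y m1))) (VV_mono _ _) (x m1)
  obtain ⟨t1, i1, i2, i3, i4⟩ := h.nearL (r := m1) (e := min (qR - y m1) (x m1 - qB)) (lt_of_le_of_lt a1 hm)
    (lt_min (by linarith) (by linarith))
  have i3' := i3.trans_le (min_le_right _ _)
  have i4' := i4.trans_le (min_le_left _ _)
  have f1 : max t1 r0 < m1 := max_lt i2 g2b
  have f2 : s0 ≤ max t1 r0 := i1.trans (le_max_left _ _)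
  obtain ⟨r1, j1, j2, j3, j4⟩ := her.single f2 f1 b2 (b4 _ f2 f1)
  have j1a := (le_max_left _ _).trans_lt j1
  have j1b := (le_max_right _ _).trans_lt j1
  have L0 : LN (EE X l x y) s0 r0 := fun s _ k => g3 s k
  have R0 : RN (EE X l x y) s1 r0 := fun s k _ => g4 s k
  have L1 : LN (EE X l x y) s0 r1 := fun s _ k => j3 s k
  have R1 : RN (EE X l x y) s1 r1 := fun s k _ => j4 s k
  have z1 : s0 < r0 := by linarith
  have z2 : r0 < s1 := by linarith
  have z3 : s0 < r1 := by linarith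
  have z4 : r1 < s1 := by linarith
  have x1 := h.mx a1
  have x2 := h.mx g1.le
  have x3 := h.mx j1b.le
  have x4 := h.mx j2.le
  have x5 := h.mx b2
  have x6 := h.mx g2a.le
  have x7 := h.mx j1a.le
  have y1 := h.my a1
  have y2 := h.my g1.le
  have y3 := h.my j1b.le
  have y4 := h.my j2.le
  have y5 := h.my b2
  have y6 := h.my g2a.le
  have y7 := h.my j1a.le
  have E1 : EE X l x y m0 r0 := SF.main hc h a1 g1 z2.le a4 L0
    (fun q hq => by rw [c2 q (by linarith [hq.1]) hq.2])
    (fun q hq => h.oR z1 z2 L0 R0 hq.1 (by linarith [hq.2]))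
    (fun p hp => by rw [d2 p (by linarith [hp.2]) hp.1])
    (fun p hp => h.oB z1 z2 L0 R0 (by linarith [hp.1]) hp.2)
  have E2 : EE X l x y r0 r1 := SF.main hc h z1.le j1b z4.le R0 L1
    (fun q hq => h.oL z1 z2 L0 R0 (by linarith [hq.1]) hq.2)
    (fun q hq => h.oR z3 z4 L1 R1 hq.1 (by linarith [hq.2]))
    (fun p hp => h.oT z1 z2 L0 R0 hp.1 (by linarith [hp.2]))
    (fun p hp => h.oB z3 z4 L1 R1 (by linarith [hp.1]) hp.2)
  have E3 : EE X l x y r1 m1 := SF.main hc h z3.le j2 b2 R1 b4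
    (fun q hq => h.oL z3 z4 L1 R1 (by linarith [hq.1]) hq.2)
    (fun q hq => by rw [c2' q (by linarith [hq.2]) hq.1])
    (fun p hp => h.oT z3 z4 L1 R1 hp.1 (by linarith [hp.2]))
    (fun p hp => by rw [d2' p (by linarith [hp.1]) hp.2])
  have E0 := a3 s0 m0 le_rfl a1 le_rfl
  have E4 := b3 m1 s1 le_rfl b2 le_rfl
  have tr := fun s m s' k1 k2 k3 k4 => EE.tr hc h.toCv (s := s) (m := m) (s' := s') k1 k2 k3 k4
  refine tr s0 m0 s1 le_rfl a1 a2 le_rfl E0 ?_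
  refine tr m0 r0 s1 a1 g1.le z2.le le_rfl E1 ?_
  refine tr r0 r1 s1 z1.le j1b.le z4.le le_rfl E2 ?_
  exact tr r1 m1 s1 z3.le j2.le b2 le_rfl E3 E4
end
end Temporal
end

section
set_option linter.unusedVariables false
namespace Temporal
variable {ι : Type}
open Set

theorem ff_anti (l : ℝ → ℝ → Set ι) {p q p' q' : ℝ} (h1 : p ≤ p') (h2 : q ≤ q') : ff l p' q' ⊆ ff l p q := by
  rintro i ⟨x', y', j1, j2, j4, j3⟩
  refine ⟨x', y', h1.trans j1, h2.trans j2, ?_, j3⟩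
  rintro ⟨rfl, rfl⟩
  exact j4 ⟨le_antisymm h1 j1, le_antisymm h2 j2⟩
theorem pp_mono (l : ℝ → ℝ → Set ι) {p q p' q' : ℝ} (h1 : p ≤ p') (h2 : q ≤ q') : pp l p q ⊆ pp l p' q' := by
  rintro i ⟨x', y', j1, j2, j4, j3⟩
  refine ⟨x', y', j1.trans h1, j2.trans h2, ?_, j3⟩
  rintro ⟨rfl, rfl⟩
  exact j4 ⟨le_antisymm j1 h1, le_antisymm j2 h2⟩

/-- a monotone map from an open box into a finite order takes a least and a greatest value -/
theorem box_inf {T : Type} [PartialOrder T] [Finite T] (κ : ℝ → ℝ → T)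
    (hκ : ∀ p q p' q', p ≤ p' → q ≤ q' → κ p q ≤ κ p' q') {a b c d : ℝ} (hab : a < b) (hcd : c < d) :
    ∃ p ∈ Ioo a b, ∃ q ∈ Ioo c d, ∀ p' ∈ Ioo a b, ∀ q' ∈ Ioo c d, κ p q ≤ κ p' q' := by
  obtain ⟨p0, hp0⟩ := nonempty_Ioo.2 hab
  obtain ⟨q0, hq0⟩ := nonempty_Ioo.2 hcd
  obtain ⟨m, ⟨⟨p, q⟩, ⟨hp, hq⟩, rfl⟩, hm⟩ :=
    (Set.toFinite ((fun z : ℝ × ℝ => κ z.1 z.2) '' (Ioo a b ×ˢ Ioo c d))).exists_minimal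
      ⟨_, ⟨(p0, q0), ⟨hp0, hq0⟩, rfl⟩⟩
  refine ⟨p, hp, q, hq, fun p' hp' q' hq' => ?_⟩
  have h1 : κ (min p p') (min q q') ≤ κ p q := hκ _ _ _ _ (min_le_left _ _) (min_le_left _ _)
  have h2 := hm (y := κ (min p p') (min q q')) ⟨(min p p', min q q'),
    ⟨⟨lt_min hp.1 hp'.1, (min_le_left _ _).trans_lt hp.2⟩, ⟨lt_min hq.1 hq'.1, (min_le_left _ _).trans_lt hq.2⟩⟩, rfl⟩ h1
  exact h2.trans (hκ _ _ _ _ (min_le_right _ _) (min_le_right _ _))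
theorem box_sup {T : Type} [PartialOrder T] [Finite T] (κ : ℝ → ℝ → T)
    (hκ : ∀ p q p' q', p ≤ p' → q ≤ q' → κ p q ≤ κ p' q') {a b c d : ℝ} (hab : a < b) (hcd : c < d) :
    ∃ p ∈ Ioo a b, ∃ q ∈ Ioo c d, ∀ p' ∈ Ioo a b, ∀ q' ∈ Ioo c d, κ p' q' ≤ κ p q := by
  obtain ⟨p, hp, q, hq, h⟩ := box_inf (T := Tᵒᵈ) (fun p q => OrderDual.toDual (κ (-p) (-q)))
    (fun p q p' q' h1 h2 => OrderDual.toDual_le_toDual.2 (hκ _ _ _ _ (neg_le_neg h1) (neg_le_neg h2))) (neg_lt_neg hab) (neg_lt_neg hcd)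
  refine ⟨-p, ⟨by linarith [hp.2], by linarith [hp.1]⟩, -q, ⟨by linarith [hq.2], by linarith [hq.1]⟩, ?_⟩
  intro p' hp' q' hq'
  have := h (-p') ⟨by linarith [hp'.2], by linarith [hp'.1]⟩ (-q') ⟨by linarith [hq'.2], by linarith [hq'.1]⟩
  simpa using this

theorem corners [Finite ι] (l : ℝ → ℝ → Set ι) {a b c d : ℝ} (hab : a < b) (hcd : c < d) :
    ∃ A' B' A B : Set ι,
      (∀ p ∈ Ioo a b, ∀ q ∈ Ioo c d, A ⊆ ff l p q ∧ ff l p q ⊆ A' ∧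
        B' ⊆ pp l p q ∧ pp l p q ⊆ B ∧ l p q ⊆ A' ∧ l p q ⊆ B) ∧
      (∃ p ∈ Ioo a b, ∃ q ∈ Ioo c d, tD l A' B' p q) ∧ (∃ p ∈ Ioo a b, ∃ q ∈ Ioo c d, tD l A B p q) := by
  have mono : ∀ p q p' q' : ℝ, p ≤ p' → q ≤ q' →
      (⟨pp l p q, ff l p q⟩ : Mo ι) ≤ ⟨pp l p' q', ff l p' q'⟩ :=
    fun p q p' q' h1 h2 => ⟨pp_mono l h1 h2, ff_anti l h1 h2⟩
  obtain ⟨p0, hp0, q0, hq0, h0⟩ := box_inf (fun p q => (⟨pp l p q, ff l p q⟩ : Mo ι)) mono hab hcd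
  obtain ⟨p1, hp1, q1, hq1, h1⟩ := box_sup (fun p q => (⟨pp l p q, ff l p q⟩ : Mo ι)) mono hab hcd
  have bl : ∀ p ∈ Ioo a b, ∀ q ∈ Ioo c d, l p q ⊆ ff l p0 q0 := by
    intro p hp q hq
    obtain ⟨p', k1, k2⟩ := exists_between hp.1
    obtain ⟨q', k3, k4⟩ := exists_between hq.1
    refine Subset.trans ?_ (h0 p' ⟨k1, k2.trans hp.2⟩ q' ⟨k3, k4.trans hq.2⟩).2
    intro i hi
    exact ⟨p, q, k2.le, k4.le, fun h => k2.ne' h.1, hi⟩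
  have bu : ∀ p ∈ Ioo a b, ∀ q ∈ Ioo c d, l p q ⊆ pp l p1 q1 := by
    intro p hp q hq
    obtain ⟨p', k1, k2⟩ := exists_between hp.2
    obtain ⟨q', k3, k4⟩ := exists_between hq.2
    refine Subset.trans ?_ (h1 p' ⟨hp.1.trans k1, k2⟩ q' ⟨hq.1.trans k3, k4⟩).1
    intro i hi
    exact ⟨p, q, k1.le, k3.le, fun h => k1.ne h.1, hi⟩
  refine ⟨ff l p0 q0, pp l p0 q0, ff l p1 q1, pp l p1 q1, ?_, ?_, ?_⟩
  · intro p hp q hq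
    exact ⟨(h1 p hp q hq).2, (h0 p hp q hq).2, (h0 p hp q hq).1, (h1 p hp q hq).1, bl p hp q hq, bu p hp q hq⟩
  · obtain ⟨p', k1, k2⟩ := exists_between hp0.1
    obtain ⟨q', k3, k4⟩ := exists_between hq0.1
    have hp' : p' ∈ Ioo a b := ⟨k1, k2.trans hp0.2⟩
    have hq' : q' ∈ Ioo c d := ⟨k3, k4.trans hq0.2⟩
    refine ⟨p', hp', q', hq', ?_, ?_, bl _ hp' _ hq', ?_⟩
    · exact subset_antisymm (h0 p' hp' q' hq').2 (ff_anti l k2.le k4.le)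
    · exact subset_antisymm (pp_mono l k2.le k4.le) (h0 p' hp' q' hq').1
    · intro i hi
      exact ⟨p', q', k2.le, k4.le, fun h => k2.ne h.1, hi⟩
  · obtain ⟨p', k1, k2⟩ := exists_between hp1.2
    obtain ⟨q', k3, k4⟩ := exists_between hq1.2
    have hp' : p' ∈ Ioo a b := ⟨hp1.1.trans k1, k2⟩
    have hq' : q' ∈ Ioo c d := ⟨hq1.1.trans k3, k4⟩
    refine ⟨p', hp', q', hq', ?_, ?_, ?_, bu _ hp' _ hq'⟩
    · exact subset_antisymm (ff_anti l k1.le k3.le) (h1 p' hp' q' hq').2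
    · exact subset_antisymm (h1 p' hp' q' hq').1 (pp_mono l k1.le k3.le)
    · intro i hi
      exact ⟨p', q', k1.le, k3.le, fun h => k1.ne' h.1, hi⟩

/-- the boundary curve of a lower subset of a box -/
theorem curve {a b c d : ℝ} (hab : a < b) (hcd : c < d) (D : ℝ → ℝ → Prop)
    (hD : ∀ p ∈ Ioo a b, ∀ q ∈ Ioo c d, ∀ p' ∈ Ioo a b, ∀ q' ∈ Ioo c d, p' ≤ p → q' ≤ q → D p q → D p' q') :
    ∃ x y : ℝ → ℝ, Monotone x ∧ Antitone y ∧ (∀ s, x s - y s = 2 * s) ∧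
      x ((a - d) / 2) = a ∧ y ((a - d) / 2) = d ∧ x ((b - c) / 2) = b ∧ y ((b - c) / 2) = c ∧
      (∀ s, ∀ p ∈ Ioo a b, ∀ q ∈ Ioo c d, p < x s → q < y s → D p q) ∧
      (∀ s, ∀ p ∈ Ioo a b, ∀ q ∈ Ioo c d, x s < p → y s < q → ¬ D p q) := by
  set H : ℝ → ℝ → Prop := fun p q => p ≤ a ∨ q ≤ c ∨ (p ∈ Ioo a b ∧ q ∈ Ioo c d ∧ D p q) with hH
  have low : ∀ p q p' q', p' ≤ p → q' ≤ q → H p q → H p' q' := by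
    intro p q p' q' h1 h2 h
    by_cases k1 : p' ≤ a
    · exact Or.inl k1
    by_cases k2 : q' ≤ c
    · exact Or.inr (Or.inl k2)
    rcases h with h | h | ⟨h3, h4, h5⟩
    · exact absurd (h1.trans h) k1
    · exact absurd (h2.trans h) k2
    · have k3 : p' ∈ Ioo a b := ⟨not_le.1 k1, h1.trans_lt h3.2⟩
      have k4 : q' ∈ Ioo c d := ⟨not_le.1 k2, h2.trans_lt h4.2⟩
      exact Or.inr (Or.inr ⟨k3, k4, hD p h3 q h4 p' k3 q' k4 h1 h2 h5⟩)
  set S : ℝ → Set ℝ := fun s => {t | H (t + s) (t - s)} with hS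
  have bdd : ∀ s, BddAbove (S s) := by
    intro s
    refine ⟨max (b - s) (c + s), fun t ht => ?_⟩
    rcases ht with h | h | ⟨h, -⟩
    · exact le_max_of_le_left (by linarith)
    · exact le_max_of_le_right (by linarith)
    · exact le_max_of_le_left (by linarith [h.2])
  have ne : ∀ s, (S s).Nonempty := fun s => ⟨a - s, Or.inl (by linarith)⟩
  set T : ℝ → ℝ := fun s => sSup (S s) with hT
  have up : ∀ s t, T s < t → ¬ H (t + s) (t - s) := fun s t h hh => absurd (le_csSup (bdd s) hh) (not_le.2 h)
  have dn : ∀ s t, t < T s → H (t + s) (t - s) := by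
    intro s t h
    obtain ⟨t', h1, h2⟩ := exists_lt_of_lt_csSup (ne s) h
    exact low _ _ _ _ (by linarith) (by linarith) h1
  have upp : ∀ s p q, T s + s < p → T s - s < q → ¬ H p q := by
    intro s p q h1 h2 hh
    have h3 := min_le_left (p - s) (q + s)
    have h4 := min_le_right (p - s) (q + s)
    exact up s (min (p - s) (q + s)) (lt_min (by linarith) (by linarith))
      (low _ _ _ _ (by linarith) (by linarith) hh)
  have dnn : ∀ s p q, p < T s + s → q < T s - s → H p q := by
    intro s p q h1 h2
    have h3 := le_max_left (p - s) (q + s)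
    have h4 := le_max_right (p - s) (q + s)
    exact low _ _ _ _ (by linarith) (by linarith) (dn s (max (p - s) (q + s)) (max_lt (by linarith) (by linarith)))
  have T0 : T ((a - d) / 2) = (a + d) / 2 := by
    apply le_antisymm
    · refine csSup_le (ne _) (fun t ht => ?_)
      rcases ht with h | h | ⟨h, h', -⟩
      · linarith
      · linarith
      · linarith [h'.2]
    · exact le_csSup (bdd _) (Or.inl (by linarith))
  have T1 : T ((b - c) / 2) = (b + c) / 2 := by
    apply le_antisymm
    · refine csSup_le (ne _) (fun t ht => ?_)
      rcases ht with h | h | ⟨h, h', -⟩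
      · linarith
      · linarith
      · linarith [h.2]
    · exact le_csSup (bdd _) (Or.inr (Or.inl (by linarith)))
  refine ⟨fun s => T s + s, fun s => T s - s, ?_, ?_, fun s => by ring, ?_, ?_, ?_, ?_, ?_, ?_⟩
  · intro s t hst
    have : T s ≤ T t + t - s := by
      refine csSup_le (ne s) (fun u hu => ?_)
      have := le_csSup (bdd t) (show u + s - t ∈ S t from low _ _ _ _ (by linarith) (by linarith) hu)
      have e : sSup (S t) = T t := rfl
      linarith
    show T s + s ≤ T t + t
    linarith
  · intro s t hst
    have : T t ≤ T s - s + t := by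
      refine csSup_le (ne t) (fun u hu => ?_)
      have := le_csSup (bdd s) (show u - t + s ∈ S s from low _ _ _ _ (by linarith) (by linarith) hu)
      have e : sSup (S s) = T s := rfl
      linarith
    show T t - t ≤ T s - s
    linarith
  · show T _ + _ = _
    rw [T0]; ring
  · show T _ - _ = _
    rw [T0]; ring
  · show T _ + _ = _
    rw [T1]; ring
  · show T _ - _ = _
    rw [T1]; ring
  · intro s p hp q hq h1 h2
    rcases dnn s p q h1 h2 with h | h | h
    · exact absurd h (not_le.2 hp.1)
    · exact absurd h (not_le.2 hq.1)
    · exact h.2.2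
  · intro s p hp q hq h1 h2 hh
    exact upp s p q h1 h2 (Or.inr (Or.inr ⟨hp, hq, hh⟩))

/-- the reflexive clusters occurring in a box -/
def clu (l : ℝ → ℝ → Set ι) (a b c d : ℝ) : Set (Set ι × Set ι) :=
  {z | ∃ p ∈ Ioo a b, ∃ q ∈ Ioo c d, tD l z.1 z.2 p q}

theorem DO_all [Finite ι] {C : Lab ι → Prop} {X : Set (Ds ι)} {l : ℝ → ℝ → Set ι} (hc : Cx C X l) :
    ∀ (n : ℕ) (a b c d : ℝ), 0 ≤ a → b ≤ 1 → 0 ≤ c → d ≤ 1 → (clu l a b c d).ncard < n → DO X l a b c d := by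
  intro n
  induction n with
  | zero => intro a b c d _ _ _ _ h; exact absurd h (Nat.not_lt_zero _)
  | succ n ih =>
    intro a b c d ha hb hc0 hd hn hab hcd
    obtain ⟨A', B', A, B, bd, exD, exU⟩ := corners l hab hcd
    -- boxes missing a cluster
    have sub : ∀ (M N : Set ι), (∃ p ∈ Ioo a b, ∃ q ∈ Ioo c d, tD l M N p q) → ∀ a1 b1 c1 d1, a ≤ a1 → b1 ≤ b →
        c ≤ c1 → d1 ≤ d → (∀ p ∈ Ioo a1 b1, ∀ q ∈ Ioo c1 d1, ¬ tD l M N p q) → DO X l a1 b1 c1 d1 := by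
      intro M N hex a1 b1 c1 d1 h1 h2 h3 h4 hno
      refine ih a1 b1 c1 d1 (ha.trans h1) (h2.trans hb) (hc0.trans h3) (h4.trans hd) ?_
      refine lt_of_lt_of_le (Set.ncard_lt_ncard (t := clu l a b c d) ?_ (Set.toFinite _)) (Nat.lt_succ_iff.1 hn)
      refine ⟨?_, ?_⟩
      · rintro z ⟨p, hp, q, hq, hz⟩
        exact ⟨p, ⟨h1.trans_lt hp.1, hp.2.trans_le h2⟩, q, ⟨h3.trans_lt hq.1, hq.2.trans_le h4⟩, hz⟩
      · intro hsub
        have hm : ((M, N) : Set ι × Set ι) ∈ clu l a b c d := hex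
        obtain ⟨p, hp, q, hq, hz⟩ := hsub hm
        exact hno p hp q hq hz
    -- the set D'
    have dn : ∀ p ∈ Ioo a b, ∀ q ∈ Ioo c d, ∀ p' ∈ Ioo a b, ∀ q' ∈ Ioo c d, p' ≤ p → q' ≤ q →
        tD l A' B' p q → tD l A' B' p' q' := by
      intro p hp q hq p' hp' q' hq' h1 h2 h
      obtain ⟨b1, b2, b3, b4, b5, b6⟩ := bd p' hp' q' hq'
      refine ⟨subset_antisymm b2 ?_, subset_antisymm ?_ b3, b5, h.dn h1 h2⟩
      · rw [← h.1]; exact ff_anti l h1 h2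
      · rw [← h.2.1]; exact pp_mono l h1 h2
    obtain ⟨x, y, mx, my, xy, xs0, ys0, xs1, ys1, hLL, hUR⟩ := curve hab hcd (tD l A' B') dn
    set s0 := (a - d) / 2 with hs0
    set s1 := (b - c) / 2 with hs1
    have in1 : ∀ s, s0 ≤ s → a ≤ x s ∧ y s ≤ d := fun s h => ⟨xs0 ▸ mx h, ys0 ▸ my h⟩
    have in2 : ∀ s, s ≤ s1 → x s ≤ b ∧ c ≤ y s := fun s h => ⟨xs1 ▸ mx h, ys1 ▸ my h⟩
    have hSF : SF X l x y s0 s1 A' B' A B := by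
      refine ⟨⟨mx, my, xy, by rw [xs0]; exact ha, by rw [xs1]; exact hb, by rw [ys1]; exact hc0, by rw [ys0]; exact hd,
        ?_, ?_⟩, ?_, ?_, ?_⟩
      · intro s m s' h0 h1 h2 h3 k1 k2
        have e1 := in1 s h0
        have e2 := in2 s' h3
        have e3 := in1 m (h0.trans h1)
        have e4 := in2 m (h2.trans h3)
        refine DR_const hc (A := A') (B := B') (Iv.oo k1 (by linarith) (by linarith)) (Iv.oo k2 (by linarith) (by linarith)) ?_
        intro p hp q hq
        exact hLL m p ⟨e1.1.trans_lt hp.1, hp.2.trans_le e4.1⟩ q ⟨e2.2.trans_lt hq.1, hq.2.trans_le e3.2⟩ hp.2 hq.2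
      · intro s m s' h0 h1 h2 h3
        have e1 := in1 s h0
        have e2 := in2 s' h3
        have e3 := in1 m (h0.trans h1)
        have e4 := in2 m (h2.trans h3)
        refine sub A' B' exD _ _ _ _ e3.1 e2.1 e4.2 e1.2 ?_
        intro p hp q hq
        exact hUR m p ⟨e3.1.trans_lt hp.1, hp.2.trans_le e2.1⟩ q ⟨e4.2.trans_lt hq.1, hq.2.trans_le e1.2⟩ hp.1 hq.1
      · rw [xs0, xs1, ys0, ys1]; exact bd
      · intro u v h0 h1 h2 hne
        by_contra hcc
        refine hne (sub A B exU _ _ _ _ (in1 u h0).1 (in2 v h2).1 (in2 v h2).2 (in1 u h0).2 ?_)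
        intro p hp q hq hd
        exact hcc ⟨p, hp, q, hq, hd⟩
      · intro u v h0 h1 h2 hne
        by_contra hcc
        refine hne (sub A' B' exD _ _ _ _ (in1 u h0).1 (in2 v h2).1 (in2 v h2).2 (in1 u h0).2 ?_)
        intro p hp q hq hd
        exact hcc ⟨p, hp, q, hq, hd⟩
    have := hSF.all hc (by rw [hs0, hs1]; linarith)
    rw [EE, xs0, xs1, ys0, ys1] at this
    exact this hab hcd

theorem complete [Finite ι] {C : Lab ι → Prop} {X : Set (Ds ι)} {l : ℝ → ℝ → Set ι} (hc : Cx C X l) :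
    dsc l (Ioo 0 1) (Ioo 0 1) ∈ X :=
  DO_all hc _ 0 1 0 1 le_rfl le_rfl le_rfl le_rfl (Nat.lt_succ_self _) one_pos one_pos
end Temporal
end

section
set_option linter.unusedVariables false
namespace Temporal
variable {ι : Type}
open Set

/-- descriptions of whole models containing `k` -/
def Goal (k : ι) (d : Ds ι) : Prop :=
  d.kI = koo ∧ d.kJ = koo ∧ (∀ m, (d.L m).ne → m.p = ∅) ∧ (∀ m, (d.B m).ne → m.p = ∅) ∧
  (∀ m, (d.R m).ne → m.f = ∅) ∧ (∀ m, (d.T m).ne → m.f = ∅) ∧ ∃ m, (d.L m).ne ∧ k ∈ m.f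

def Model (C : Lab ι → Prop) (k : ι) : Prop :=
  ∃ l : ℝ → ℝ → Set ι, (∀ x y, C ⟨l x y, ff l x y, pp l x y⟩) ∧ ∃ x y, k ∈ l x y

theorem crit_fwd [Finite ι] (C : Lab ι → Prop) (k : ι) (h : Model C k) (X : Set (Ds ι)) (hX : Closed C X) :
    ∃ d ∈ X, Goal k d := by
  obtain ⟨l, hl, x0, y0, hk⟩ := h
  obtain ⟨g, hg⟩ := exists_SIso (S := Ioo (0:ℝ) 1) (S' := univ) ordConnected_Ioo ordConnected_univ
    (by rw [kd_univ, kd_oo one_pos])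
  set l' : ℝ → ℝ → Set ι := fun x y => {i | x ∈ Ioo (0:ℝ) 1 ∧ y ∈ Ioo (0:ℝ) 1 ∧ i ∈ l (g x) (g y)} with hl'
  have hf : ∀ x ∈ Ioo (0:ℝ) 1, ∀ y ∈ Ioo (0:ℝ) 1, ff l' x y = ff l (g x) (g y) := by
    intro x hx y hy
    ext i; constructor
    · rintro ⟨x', y', j1, j2, j3, ⟨j4, j5, j6⟩⟩
      exact ⟨g x', g y', (hg.le_iff hx j4).2 j1, (hg.le_iff hy j5).2 j2, fun hh => j3
        ⟨(hg.eq_iff j4 hx).1 hh.1, (hg.eq_iff j5 hy).1 hh.2⟩, j6⟩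
    · rintro ⟨x', y', j1, j2, j3, j4⟩
      obtain ⟨x', hx', rfl⟩ := hg.ex (mem_univ x')
      obtain ⟨y', hy', rfl⟩ := hg.ex (mem_univ y')
      exact ⟨x', y', (hg.le_iff hx hx').1 j1, (hg.le_iff hy hy').1 j2, fun hh => j3
        ⟨by rw [hh.1], by rw [hh.2]⟩, hx', hy', j4⟩
  have hp : ∀ x ∈ Ioo (0:ℝ) 1, ∀ y ∈ Ioo (0:ℝ) 1, pp l' x y = pp l (g x) (g y) := by
    intro x hx y hy
    ext i; constructor
    · rintro ⟨x', y', j1, j2, j3, ⟨j4, j5, j6⟩⟩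
      exact ⟨g x', g y', (hg.le_iff j4 hx).2 j1, (hg.le_iff j5 hy).2 j2, fun hh => j3
        ⟨(hg.eq_iff j4 hx).1 hh.1, (hg.eq_iff j5 hy).1 hh.2⟩, j6⟩
    · rintro ⟨x', y', j1, j2, j3, j4⟩
      obtain ⟨x', hx', rfl⟩ := hg.ex (mem_univ x')
      obtain ⟨y', hy', rfl⟩ := hg.ex (mem_univ y')
      exact ⟨x', y', (hg.le_iff hx' hx).1 j1, (hg.le_iff hy' hy).1 j2, fun hh => j3
        ⟨by rw [hh.1], by rw [hh.2]⟩, hx', hy', j4⟩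
  have hcx : Cx C X l' := ⟨hX, fun x hx y hy => by
    have e : l' x y = l (g x) (g y) := by
      ext i; exact ⟨fun h => h.2.2, fun h => ⟨hx, hy, h⟩⟩
    rw [e, hf x hx y hy, hp x hx y hy]; exact hl _ _⟩
  refine ⟨_, complete hcx, kd_oo one_pos, kd_oo one_pos, ?_, ?_, ?_, ?_, ?_⟩
  · rintro m ⟨y, hy, rfl⟩
    rw [eq_empty_iff_forall_notMem]
    rintro i ⟨x', hx', y', hy', hi⟩
    exact absurd (hx' x' hi.1) (lt_irrefl _)
  · rintro m ⟨y, hy, rfl⟩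
    rw [eq_empty_iff_forall_notMem]
    rintro i ⟨x', hx', y', hy', hi⟩
    exact absurd (hx' x' hi.2.1) (lt_irrefl _)
  · rintro m ⟨y, hy, rfl⟩
    rw [eq_empty_iff_forall_notMem]
    rintro i ⟨x', hx', y', hy', hi⟩
    exact hx' ⟨x', hi.1, le_rfl⟩
  · rintro m ⟨y, hy, rfl⟩
    rw [eq_empty_iff_forall_notMem]
    rintro i ⟨x', hx', y', hy', hi⟩
    exact hx' ⟨x', hi.2.1, le_rfl⟩
  · obtain ⟨x, hx, rfl⟩ := hg.ex (mem_univ x0)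
    obtain ⟨y, hy, rfl⟩ := hg.ex (mem_univ y0)
    refine ⟨VV l' (lo (Ioo 0 1)) y, ⟨y, hy, rfl⟩, x, ?_, y, le_rfl, hx, hy, hk⟩
    exact fun hh => absurd (hh x hx) (lt_irrefl _)

theorem crit_bwd [Finite ι] (C : Lab ι → Prop) (k : ι) (h : ∀ X : Set (Ds ι), Closed C X → ∃ d ∈ X, Goal k d) :
    Model C k := by
  obtain ⟨d, ⟨r0, hr0, rfl⟩, g1, g2, gL, gB, gR, gT, gk⟩ := h _ (Rl_closed C)
  obtain ⟨ex, hex⟩ := exists_SIso (S := univ) (S' := r0.I) ordConnected_univ hr0.Ic (by rw [kd_univ]; exact g1.symm)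
  obtain ⟨ey, hey⟩ := exists_SIso (S := univ) (S' := r0.J) ordConnected_univ hr0.Jc (by rw [kd_univ]; exact g2.symm)
  have hr := RD.place_ok hex hey hr0 ordConnected_univ ordConnected_univ
  rw [← RD.place_desc hex hey] at gL gB gR gT gk
  generalize hre : r0.place univ univ ex ey = r at *
  have rI : r.I = univ := by rw [← hre]; rfl
  have rJ : r.J = univ := by rw [← hre]; rfl
  have memI : ∀ x, x ∈ r.I := fun x => by rw [rI]; trivial
  have memJ : ∀ x, x ∈ r.J := fun x => by rw [rJ]; trivial
  have oL : ∀ y, r.oL y = ∅ := fun y => gL (r.eL y) ⟨y, memJ y, rfl⟩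
  have oR : ∀ y, r.oR y = ∅ := fun y => gR (r.eR y) ⟨y, memJ y, rfl⟩
  have oB : ∀ y, r.oB y = ∅ := fun y => gB (r.eB y) ⟨y, memI y, rfl⟩
  have oT : ∀ y, r.oT y = ∅ := fun y => gT (r.eT y) ⟨y, memI y, rfl⟩
  refine ⟨fun x y => (r.h x y).l, fun x y => ?_, ?_⟩
  · have := hr.hC x (memI x) y (memJ y)
    convert this using 1
    ext i
    · rfl
    · rw [hr.hf x (memI x) y (memJ y) i, oR, oT]
      constructor
      · rintro ⟨x', y', j1, j2, j3, j4⟩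
        exact Or.inl ⟨x', y', ⟨memI _, memJ _, j4⟩, j1, j2, j3⟩
      · rintro (⟨x', y', ⟨-, -, j4⟩, j1, j2, j3⟩ | h | h)
        · exact ⟨x', y', j1, j2, j3, j4⟩
        · exact h.elim
        · exact h.elim
    · rw [hr.hp x (memI x) y (memJ y) i, oL, oB]
      constructor
      · rintro ⟨x', y', j1, j2, j3, j4⟩
        exact Or.inl ⟨x', y', ⟨memI _, memJ _, j4⟩, j1, j2, j3⟩
      · rintro (⟨x', y', ⟨-, -, j4⟩, j1, j2, j3⟩ | h | h)
        · exact ⟨x', y', j1, j2, j3, j4⟩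
        · exact h.elim
        · exact h.elim
  · obtain ⟨m, ⟨y, -, rfl⟩, hk⟩ := gk
    rcases hk with ⟨x', y', ⟨-, -, hh⟩, -⟩ | hh | ⟨x, -, hh⟩
    · exact ⟨x', y', hh⟩
    · rw [oR] at hh; exact hh.elim
    · rw [oT] at hh; exact hh.elim

theorem crit [Finite ι] (C : Lab ι → Prop) (k : ι) :
    Model C k ↔ ∀ X : Set (Ds ι), Closed C X → ∃ d ∈ X, Goal k d :=
  ⟨crit_fwd C k, crit_bwd C k⟩
end Temporal
end

section
set_option linter.unusedVariables false
namespace Temporal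
open Set

theorem decodeT_0 {n : ℕ} (h : n % 5 = 0) : decodeT n = .prop (n / 5) := by
  rw [decodeT]; simp [h]
theorem decodeT_1 {n : ℕ} (h : n % 5 = 1) : decodeT n = .neg (decodeT (n / 5)) := by
  conv_lhs => rw [decodeT]
  simp [h]
theorem decodeT_2 {n : ℕ} (h : n % 5 = 2) :
    decodeT n = .or (decodeT (n / 5).unpair.1) (decodeT (n / 5).unpair.2) := by
  conv_lhs => rw [decodeT]
  simp [h]
theorem decodeT_3 {n : ℕ} (h : n % 5 = 3) : decodeT n = .fut (decodeT (n / 5)) := by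
  conv_lhs => rw [decodeT]
  simp [h]
theorem decodeT_4 {n : ℕ} (h : n % 5 = 4) : decodeT n = .past (decodeT (n / 5)) := by
  conv_lhs => rw [decodeT]
  simp [h]

def cd (r : ℕ) (i j : ℕ) : Prop := i % 5 = r ∧ j = i / 5
def cd2 (i j k : ℕ) : Prop := i % 5 = 2 ∧ j = (i / 5).unpair.1 ∧ k = (i / 5).unpair.2

/-- local conditions on labels -/
def Cn (n : ℕ) (t : Lab (Fin (n + 1))) : Prop :=
  ∀ i j : Fin (n + 1), (cd 1 i j → (i ∈ t.l ↔ j ∉ t.l)) ∧ (cd 3 i j → (i ∈ t.l ↔ j ∈ t.f)) ∧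
    (cd 4 i j → (i ∈ t.l ↔ j ∈ t.p)) ∧
    ∀ k : Fin (n + 1), cd2 i j k → (i ∈ t.l ↔ (j ∈ t.l ∨ k ∈ t.l))

abbrev RR : ℝ × ℝ → ℝ × ℝ → Prop := fun p q => p ≤ q ∧ p ≠ q

theorem model_fwd (n : ℕ) (h : Model (Cn n) (Fin.last n)) : TSatisfiable RR (decodeT n) := by
  obtain ⟨l, hl, x, y, hk⟩ := h
  set v : ℕ → Set (ℝ × ℝ) := fun m => {z | ∃ h : 5 * m < n + 1, (⟨5 * m, h⟩ : Fin (n + 1)) ∈ l z.1 z.2} with hv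
  have key : ∀ i (hi : i < n + 1) (z : ℝ × ℝ), TSat RR v (decodeT i) z ↔ (⟨i, hi⟩ : Fin (n + 1)) ∈ l z.1 z.2 := by
    intro i
    induction i using Nat.strong_induction_on with
    | _ i ih =>
      intro hi z
      have hC := hl z.1 z.2
      have d0 : i / 5 ≤ i := Nat.div_le_self _ _
      have u1 := Nat.unpair_left_le (i / 5)
      have u2 := Nat.unpair_right_le (i / 5)
      have hm : i % 5 = 0 ∨ i % 5 = 1 ∨ i % 5 = 2 ∨ i % 5 = 3 ∨ i % 5 = 4 := by omega
      rcases hm with hm | hm | hm | hm | hm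
      · rw [decodeT_0 hm]
        have e : 5 * (i / 5) = i := by omega
        simp only [TSat, hv, mem_ofPred_eq, e]
        exact ⟨fun ⟨_, h⟩ => h, fun h => ⟨hi, h⟩⟩
      · rw [decodeT_1 hm]
        have d1 : i / 5 < i := by omega
        rw [TSat, ih _ d1 (by omega)]
        exact ((hC ⟨i, hi⟩ ⟨i / 5, by omega⟩).1 ⟨hm, rfl⟩).symm
      · rw [decodeT_2 hm]
        have d1 : i / 5 < i := by omega
        rw [TSat, ih _ (u1.trans_lt d1) (by omega), ih _ (u2.trans_lt d1) (by omega)]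
        exact ((hC ⟨i, hi⟩ ⟨(i / 5).unpair.1, by omega⟩).2.2.2 ⟨(i / 5).unpair.2, by omega⟩ ⟨hm, rfl, rfl⟩).symm
      · rw [decodeT_3 hm]
        have d1 : i / 5 < i := by omega
        rw [TSat, (hC ⟨i, hi⟩ ⟨i / 5, by omega⟩).2.1 ⟨hm, rfl⟩]
        constructor
        · rintro ⟨w, ⟨h1, h2⟩, h3⟩
          rw [ih _ d1 (by omega)] at h3
          exact ⟨w.1, w.2, h1.1, h1.2, fun hh => h2 (Prod.ext hh.1.symm hh.2.symm), h3⟩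
        · rintro ⟨x', y', h1, h2, h3, h4⟩
          exact ⟨(x', y'), ⟨⟨h1, h2⟩, fun hh => h3 ⟨by rw [hh], by rw [hh]⟩⟩, (ih _ d1 (by omega) _).2 h4⟩
      · rw [decodeT_4 hm]
        have d1 : i / 5 < i := by omega
        rw [TSat, (hC ⟨i, hi⟩ ⟨i / 5, by omega⟩).2.2.1 ⟨hm, rfl⟩]
        constructor
        · rintro ⟨w, ⟨h1, h2⟩, h3⟩
          rw [ih _ d1 (by omega)] at h3
          exact ⟨w.1, w.2, h1.1, h1.2, fun hh => h2 (Prod.ext hh.1 hh.2), h3⟩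
        · rintro ⟨x', y', h1, h2, h3, h4⟩
          exact ⟨(x', y'), ⟨⟨h1, h2⟩, fun hh => h3 ⟨by rw [← hh], by rw [← hh]⟩⟩, (ih _ d1 (by omega) _).2 h4⟩
  exact ⟨v, (x, y), (key n (Nat.lt_succ_self n) (x, y)).2 hk⟩

theorem model_bwd (n : ℕ) (h : TSatisfiable RR (decodeT n)) : Model (Cn n) (Fin.last n) := by
  obtain ⟨v, z, hz⟩ := h
  set l : ℝ → ℝ → Set (Fin (n + 1)) := fun x y => {i | TSat RR v (decodeT i) (x, y)} with hl
  have hf : ∀ x y (j : Fin (n + 1)), j ∈ ff l x y ↔ TSat RR v (.fut (decodeT j)) (x, y) := by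
    intro x y j
    constructor
    · rintro ⟨x', y', h1, h2, h3, h4⟩
      exact ⟨(x', y'), ⟨⟨h1, h2⟩, fun hh => by
        have a1 := congrArg Prod.fst hh
        have a2 := congrArg Prod.snd hh
        exact h3 ⟨a1.symm, a2.symm⟩⟩, h4⟩
    · rintro ⟨w, ⟨h1, h2⟩, h3⟩
      exact ⟨w.1, w.2, h1.1, h1.2, fun hh => h2 (Prod.ext hh.1.symm hh.2.symm), h3⟩
  have hp : ∀ x y (j : Fin (n + 1)), j ∈ pp l x y ↔ TSat RR v (.past (decodeT j)) (x, y) := by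
    intro x y j
    constructor
    · rintro ⟨x', y', h1, h2, h3, h4⟩
      exact ⟨(x', y'), ⟨⟨h1, h2⟩, fun hh => by
        have a1 := congrArg Prod.fst hh
        have a2 := congrArg Prod.snd hh
        exact h3 ⟨a1, a2⟩⟩, h4⟩
    · rintro ⟨w, ⟨h1, h2⟩, h3⟩
      exact ⟨w.1, w.2, h1.1, h1.2, fun hh => h2 (Prod.ext hh.1 hh.2), h3⟩
  refine ⟨l, fun x y i j => ⟨?_, ?_, ?_, ?_⟩, z.1, z.2, hz⟩
  · rintro ⟨h1, h2⟩
    show TSat RR v (decodeT i) (x, y) ↔ ¬ TSat RR v (decodeT j) (x, y)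
    rw [decodeT_1 h1, ← h2]; rfl
  · rintro ⟨h1, h2⟩
    show TSat RR v (decodeT i) (x, y) ↔ j ∈ ff l x y
    rw [decodeT_3 h1, ← h2, hf]
  · rintro ⟨h1, h2⟩
    show TSat RR v (decodeT i) (x, y) ↔ j ∈ pp l x y
    rw [decodeT_4 h1, ← h2, hp]
  · rintro k ⟨h1, h2, h3⟩
    show TSat RR v (decodeT i) (x, y) ↔ TSat RR v (decodeT j) (x, y) ∨ TSat RR v (decodeT k) (x, y)
    rw [decodeT_2 h1, ← h2, ← h3]; rfl

def Crit (n : ℕ) : Prop :=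
  ∀ X : Set (Ds (Fin (n + 1))), Closed (Cn n) X → ∃ d ∈ X, Goal (Fin.last n) d

theorem sat_iff (n : ℕ) : TSatisfiable RR (decodeT n) ↔ Crit n :=
  ⟨fun h => (crit _ _).1 (model_bwd n h), fun h => model_fwd n ((crit _ _).2 h)⟩

theorem valid_iff (φ : TForm) : TValid RR φ ↔ ¬ Crit (5 * encodeT φ + 1) := by
  rw [← sat_iff, decodeT_1 (by omega), show (5 * encodeT φ + 1) / 5 = encodeT φ by omega, decodeT_encodeT]
  simp only [TValid, TSatisfiable, TSat, not_exists, not_not]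

theorem reduce (h : PrimrecPred Crit) :
    ComputablePred (fun φ : TForm => TValid (fun p q : ℝ × ℝ => p ≤ q ∧ p ≠ q) φ) := by
  have h1 : PrimrecPred (fun φ : TForm => ¬ Crit (5 * Encodable.encode φ + 1)) := by
    refine PrimrecPred.not ?_
    exact h.comp (Primrec.nat_add.comp (Primrec.nat_mul.comp (Primrec.const 5) Primrec.encode) (Primrec.const 1))
  have h2 : (fun φ : TForm => TValid (fun p q : ℝ × ℝ => p ≤ q ∧ p ≠ q) φ) =
      (fun φ : TForm => ¬ Crit (5 * Encodable.encode φ + 1)) := by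
    funext φ; exact propext (valid_iff φ)
  rw [h2]
  exact h1.computablePred
end Temporal
end

section
set_option linter.unusedVariables false
namespace Temporal

/-- uniformly finite families of types -/
class UF (T : ℕ → Type) where
  s : ℕ → ℕ
  hs : Primrec s
  e : ∀ n, T n ≃ Fin (s n)

def cod {T : ℕ → Type} [UF T] {n : ℕ} (x : T n) : ℕ := (UF.e n x : ℕ)

theorem cod_lt {T : ℕ → Type} [UF T] {n : ℕ} (x : T n) : cod x < UF.s T n := (UF.e n x).2

theorem cod_inj {T : ℕ → Type} [UF T] {n : ℕ} {x y : T n} (h : cod x = cod y) : x = y :=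
  (UF.e n).injective (Fin.ext h)

theorem cod_ex {T : ℕ → Type} [UF T] {n : ℕ} {d : ℕ} (h : d < UF.s T n) : ∃ x : T n, cod x = d :=
  ⟨(UF.e n).symm ⟨d, h⟩, by simp [cod]⟩

def UT {Γ T : ℕ → Type} [UF Γ] [UF T] (t : ∀ n, Γ n → T n) : Prop :=
  ∃ g : ℕ → ℕ → ℕ, Primrec₂ g ∧ ∀ n (x : Γ n), g n (cod x) = cod (t n x)

@[reducible] def UF.tr {T : ℕ → Type} [UF T] {S : ℕ → Type} (e : ∀ n, S n ≃ T n) : UF S where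
  s := UF.s T
  hs := UF.hs
  e n := (e n).trans (UF.e n)

instance : UF (fun n => Fin (n + 1)) := ⟨fun n => n + 1, Primrec.succ, fun n => Equiv.refl _⟩
instance : UF (fun _ => Unit) := ⟨fun n => 1, Primrec.const 1, fun n => finOneEquiv.symm.trans (Equiv.refl _)⟩

open Classical in
noncomputable instance ufProp : UF (fun _ => Prop) := ⟨fun n => 2, Primrec.const 2, fun n =>
  ⟨fun p => if p then 1 else 0, fun i => i = 1, fun p => by by_cases h : p <;> simp [h], fun i => by
    fin_cases i <;> simp⟩⟩

instance ufProd {A B : ℕ → Type} [UF A] [UF B] : UF (fun n => A n × B n) :=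
  ⟨fun n => UF.s A n * UF.s B n, Primrec.nat_mul.comp UF.hs UF.hs,
    fun n => ((UF.e n).prodCongr (UF.e n)).trans finProdFinEquiv⟩

theorem prim_pow : Primrec₂ (fun a b : ℕ => a ^ b) := by
  have : Primrec (fun z : ℕ × ℕ => (Nat.rec 1 (fun _ acc => acc * z.1) z.2 : ℕ)) :=
    Primrec.nat_rec' Primrec.snd (Primrec.const 1)
      (Primrec.nat_mul.comp (Primrec.snd.comp Primrec.snd) (Primrec.fst.comp Primrec.fst)).to₂
  refine this.of_eq ?_
  rintro ⟨a, b⟩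
  induction b with
  | zero => rfl
  | succ b ih => simp only [pow_succ] at ih ⊢; rw [ih]

theorem prim_sum {s : ℕ → ℕ} (hs : Primrec s) {g : ℕ × ℕ → ℕ → ℕ} (hg : Primrec₂ g) :
    Primrec₂ (fun n c : ℕ => ∑ d ∈ Finset.range (s n), g (n, c) d) := by
  have : Primrec (fun z : ℕ × ℕ => (Nat.rec 0 (fun d acc => acc + g z d) (s z.1) : ℕ)) :=
    Primrec.nat_rec' (hs.comp Primrec.fst) (Primrec.const 0)
      (Primrec.nat_add.comp (Primrec.snd.comp Primrec.snd)
        (hg.comp Primrec.fst (Primrec.fst.comp Primrec.snd))).to₂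
  refine this.of_eq ?_
  rintro ⟨n, c⟩
  simp only
  induction s n with
  | zero => rfl
  | succ b ih => rw [Finset.sum_range_succ, ← ih]

theorem prim_prod {s : ℕ → ℕ} (hs : Primrec s) {g : ℕ × ℕ → ℕ → ℕ} (hg : Primrec₂ g) :
    Primrec₂ (fun n c : ℕ => ∏ d ∈ Finset.range (s n), g (n, c) d) := by
  have : Primrec (fun z : ℕ × ℕ => (Nat.rec 1 (fun d acc => acc * g z d) (s z.1) : ℕ)) :=
    Primrec.nat_rec' (hs.comp Primrec.fst) (Primrec.const 1)
      (Primrec.nat_mul.comp (Primrec.snd.comp Primrec.snd)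
        (hg.comp Primrec.fst (Primrec.fst.comp Primrec.snd))).to₂
  refine this.of_eq ?_
  rintro ⟨n, c⟩
  simp only
  induction s n with
  | zero => rfl
  | succ b ih => rw [Finset.prod_range_succ, ← ih]

instance ufFun {A B : ℕ → Type} [UF A] [UF B] : UF (fun n => A n → B n) :=
  ⟨fun n => UF.s B n ^ UF.s A n, prim_pow.comp UF.hs UF.hs,
    fun n => ((UF.e n).arrowCongr (UF.e n)).trans finFunctionFinEquiv⟩

noncomputable instance ufSet {A : ℕ → Type} [UF A] : UF (fun n => Set (A n)) :=
  UF.tr (T := fun n => A n → Prop) (fun n => ⟨fun s x => x ∈ s, fun p => {x | p x}, fun s => rfl, fun p => rfl⟩)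

section
variable {Γ A B : ℕ → Type} [UF Γ] [UF A] [UF B]

theorem cod_pair {n : ℕ} (a : A n) (b : B n) :
    cod (T := fun n => A n × B n) (n := n) (a, b) = cod b + UF.s B n * cod a := rfl

theorem cod_prop {n : ℕ} (p : Prop) [Decidable p] : cod (T := fun _ => Prop) (n := n) p = if p then 1 else 0 := by
  simp only [cod, UF.e, Equiv.coe_fn_mk]
  by_cases h : p <;> simp [h, UF.s]

theorem cod_fun {n : ℕ} (f : A n → B n) :
    cod (T := fun n => A n → B n) f = ∑ i : Fin (UF.s A n), cod (f ((UF.e n).symm i)) * UF.s B n ^ (i : ℕ) := by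
  simp only [cod, UF.e, Equiv.trans_apply, finFunctionFinEquiv_apply]
  rfl

theorem UT.id : UT (Γ := Γ) (fun n x => x) := ⟨fun n c => c, Primrec₂.right, fun n x => rfl⟩

theorem UT.map {op : ∀ n, A n → B n} (hop : UT op) {t : ∀ n, Γ n → A n} (h : UT t) :
    UT (fun n x => op n (t n x)) := by
  obtain ⟨g, hg, h1⟩ := hop
  obtain ⟨g', hg', h2⟩ := h
  exact ⟨fun n c => g n (g' n c), hg.comp Primrec.fst hg', fun n x => by beta_reduce; rw [h2, h1]⟩

theorem UT.pair {t : ∀ n, Γ n → A n} {t' : ∀ n, Γ n → B n} (h : UT t) (h' : UT t') :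
    UT (T := fun n => A n × B n) (fun n x => (t n x, t' n x)) := by
  obtain ⟨g, hg, h1⟩ := h
  obtain ⟨g', hg', h2⟩ := h'
  refine ⟨fun n c => g' n c + UF.s B n * g n c, Primrec.nat_add.comp hg' (Primrec.nat_mul.comp (UF.hs.comp Primrec.fst) hg), fun n x => ?_⟩
  beta_reduce
  rw [cod_pair, h1, h2]

theorem UT.fst {t : ∀ n, Γ n → A n × B n} (h : UT (T := fun n => A n × B n) t) :
    UT (fun n x => (t n x).1) := by
  refine UT.map (A := fun n => A n × B n) (op := fun n z => z.1) ?_ h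
  refine ⟨fun n c => c / UF.s B n, Primrec.nat_div.comp Primrec.snd (UF.hs.comp Primrec.fst), ?_⟩
  rintro n ⟨a, b⟩
  have := cod_lt b
  beta_reduce
  rw [cod_pair, Nat.add_mul_div_left _ _ (by omega), Nat.div_eq_of_lt this, zero_add]

theorem UT.snd {t : ∀ n, Γ n → A n × B n} (h : UT (T := fun n => A n × B n) t) :
    UT (fun n x => (t n x).2) := by
  refine UT.map (A := fun n => A n × B n) (op := fun n z => z.2) ?_ h
  refine ⟨fun n c => c % UF.s B n, Primrec.nat_mod.comp Primrec.snd (UF.hs.comp Primrec.fst), ?_⟩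
  rintro n ⟨a, b⟩
  have := cod_lt b
  beta_reduce
  rw [cod_pair, Nat.add_mul_mod_self_left, Nat.mod_eq_of_lt this]

theorem UT.app {f : ∀ n, Γ n → A n → B n} {t : ∀ n, Γ n → A n} (hf : UT (T := fun n => A n → B n) f)
    (ht : UT t) : UT (fun n x => f n x (t n x)) := by
  obtain ⟨g, hg, h1⟩ := hf
  obtain ⟨g', hg', h2⟩ := ht
  refine ⟨fun n c => g n c / UF.s B n ^ g' n c % UF.s B n, Primrec.nat_mod.comp (Primrec.nat_div.comp hg
    (prim_pow.comp (UF.hs.comp Primrec.fst) hg')) (UF.hs.comp Primrec.fst), fun n x => ?_⟩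
  beta_reduce
  rw [h1, h2]
  have := congrFun (finFunctionFinEquiv.symm_apply_apply (fun i => UF.e n (f n x ((UF.e n).symm i)))) (UF.e n (t n x))
  have h3 := congrArg Fin.val this
  have h4 : (UF.e n).symm (UF.e n (t n x)) = t n x := Equiv.symm_apply_apply _ _
  refine Eq.trans h3 ?_
  rw [h4]; rfl

theorem UT.fn {f : ∀ n, Γ n → A n → B n} (hf : UT (Γ := fun n => Γ n × A n) (fun n z => f n z.1 z.2)) :
    UT (T := fun n => A n → B n) f := by
  obtain ⟨g, hg, h1⟩ := hf
  refine ⟨fun n c => ∑ d ∈ Finset.range (UF.s A n), g n (d + UF.s A n * c) * UF.s B n ^ d,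
    prim_sum (g := fun z d => g z.1 (d + UF.s A z.1 * z.2) * UF.s B z.1 ^ d) UF.hs ?_, fun n x => ?_⟩
  · refine Primrec.nat_mul.comp (hg.comp (Primrec.fst.comp Primrec.fst) (Primrec.nat_add.comp Primrec.snd
      (Primrec.nat_mul.comp (UF.hs.comp (Primrec.fst.comp Primrec.fst)) (Primrec.snd.comp Primrec.fst))))
      (prim_pow.comp (UF.hs.comp (Primrec.fst.comp Primrec.fst)) Primrec.snd)
  · beta_reduce
    rw [cod_fun, ← Fin.sum_univ_eq_sum_range (fun d => g n (d + UF.s A n * cod x) * UF.s B n ^ d)]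
    refine Finset.sum_congr rfl fun i _ => ?_
    have := h1 n (x, (UF.e n).symm i)
    rw [cod_pair] at this
    rw [← this]
    simp [cod]

theorem UT.of_iff {p q : ∀ n, Γ n → Prop} (h : UT (T := fun _ => Prop) q) (hh : ∀ n x, p n x ↔ q n x) :
    UT (T := fun _ => Prop) p := by
  have : p = q := by funext n x; exact propext (hh n x)
  rwa [this]

theorem UT.eq {t t' : ∀ n, Γ n → A n} (h : UT t) (h' : UT t') :
    UT (T := fun _ => Prop) (fun n x => t n x = t' n x) := by
  classical
  obtain ⟨g, hg, h1⟩ := h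
  obtain ⟨g', hg', h2⟩ := h'
  refine ⟨fun n c => if g n c = g' n c then 1 else 0, ?_, fun n x => ?_⟩
  · exact Primrec.ite (PrimrecRel.comp Primrec.eq hg hg') (Primrec.const 1) (Primrec.const 0)
  · beta_reduce
    rw [cod_prop, h1, h2]
    refine if_congr ⟨fun h => cod_inj h, fun h => by rw [h]⟩ rfl rfl

theorem UT.not {p : ∀ n, Γ n → Prop} (h : UT (T := fun _ => Prop) p) :
    UT (T := fun _ => Prop) (fun n x => ¬ p n x) := by
  classical
  obtain ⟨g, hg, h1⟩ := h
  refine ⟨fun n c => 1 - g n c, Primrec.nat_sub.comp (Primrec.const 1) hg, fun n x => ?_⟩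
  beta_reduce
  rw [h1, cod_prop, cod_prop]
  by_cases h : p n x <;> simp [h]

theorem UT.and {p q : ∀ n, Γ n → Prop} (h : UT (T := fun _ => Prop) p) (h' : UT (T := fun _ => Prop) q) :
    UT (T := fun _ => Prop) (fun n x => p n x ∧ q n x) := by
  classical
  obtain ⟨g, hg, h1⟩ := h
  obtain ⟨g', hg', h2⟩ := h'
  refine ⟨fun n c => g n c * g' n c, Primrec.nat_mul.comp hg hg', fun n x => ?_⟩
  beta_reduce
  rw [h1, h2, cod_prop, cod_prop, cod_prop]
  by_cases h : p n x <;> by_cases h' : q n x <;> simp [h, h']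

theorem UT.or {p q : ∀ n, Γ n → Prop} (h : UT (T := fun _ => Prop) p) (h' : UT (T := fun _ => Prop) q) :
    UT (T := fun _ => Prop) (fun n x => p n x ∨ q n x) :=
  (UT.not (h.not.and h'.not)).of_iff (by intros; tauto)

theorem UT.imp {p q : ∀ n, Γ n → Prop} (h : UT (T := fun _ => Prop) p) (h' : UT (T := fun _ => Prop) q) :
    UT (T := fun _ => Prop) (fun n x => p n x → q n x) :=
  (h.not.or h').of_iff (by intros; tauto)

theorem UT.iff {p q : ∀ n, Γ n → Prop} (h : UT (T := fun _ => Prop) p) (h' : UT (T := fun _ => Prop) q) :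
    UT (T := fun _ => Prop) (fun n x => p n x ↔ q n x) :=
  ((h.imp h').and (h'.imp h)).of_iff (by intros; tauto)

theorem UT.tt : UT (Γ := Γ) (T := fun _ => Prop) (fun n x => True) := by
  classical
  exact ⟨fun n c => 1, Primrec.const 1, fun n x => by rw [cod_prop]; simp⟩
theorem UT.ff : UT (Γ := Γ) (T := fun _ => Prop) (fun n x => False) :=
  UT.tt.not.of_iff (by simp)

theorem UT.all {P : ∀ n, Γ n → A n → Prop}
    (h : UT (Γ := fun n => Γ n × A n) (T := fun _ => Prop) (fun n z => P n z.1 z.2)) :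
    UT (T := fun _ => Prop) (fun n x => ∀ y, P n x y) := by
  classical
  obtain ⟨g, hg, h1⟩ := h
  refine ⟨fun n c => ∏ d ∈ Finset.range (UF.s A n), g n (d + UF.s A n * c),
    prim_prod (g := fun z d => g z.1 (d + UF.s A z.1 * z.2)) UF.hs ?_, fun n x => ?_⟩
  · exact (hg.comp (Primrec.fst.comp Primrec.fst) (Primrec.nat_add.comp Primrec.snd
      (Primrec.nat_mul.comp (UF.hs.comp (Primrec.fst.comp Primrec.fst)) (Primrec.snd.comp Primrec.fst))))
  · have h2 : ∀ y : A n, g n (cod y + UF.s A n * cod x) = if P n x y then 1 else 0 := by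
      intro y
      have := h1 n (x, y)
      rwa [cod_pair, cod_prop] at this
    rw [cod_prop]
    by_cases h : ∀ y, P n x y
    · rw [if_pos h]
      refine Finset.prod_eq_one fun d hd => ?_
      obtain ⟨y, rfl⟩ := cod_ex (T := A) (Finset.mem_range.1 hd)
      rw [h2, if_pos (h y)]
    · rw [if_neg h]
      push Not at h
      obtain ⟨y, hy⟩ := h
      exact Finset.prod_eq_zero (Finset.mem_range.2 (cod_lt y)) (by rw [h2, if_neg hy])

theorem UT.ex {P : ∀ n, Γ n → A n → Prop}
    (h : UT (Γ := fun n => Γ n × A n) (T := fun _ => Prop) (fun n z => P n z.1 z.2)) :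
    UT (T := fun _ => Prop) (fun n x => ∃ y, P n x y) :=
  (UT.not (UT.all (P := fun n x y => ¬ P n x y) h.not)).of_iff (by intros; push Not; rfl)

theorem UT.set {f : ∀ n, Γ n → Set (A n)}
    (hf : UT (Γ := fun n => Γ n × A n) (T := fun _ => Prop) (fun n z => z.2 ∈ f n z.1)) :
    UT (T := fun n => Set (A n)) f :=
  UT.fn (B := fun _ => Prop) (f := fun n x y => y ∈ f n x) hf

theorem UT.mem {f : ∀ n, Γ n → Set (A n)} {t : ∀ n, Γ n → A n} (hf : UT (T := fun n => Set (A n)) f)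
    (ht : UT t) : UT (T := fun _ => Prop) (fun n x => t n x ∈ f n x) :=
  UT.app (B := fun _ => Prop) (f := fun n x y => y ∈ f n x) hf ht

/-- weakening -/
theorem UT.wk {t : ∀ n, Γ n → A n} (h : UT t) : UT (Γ := fun n => Γ n × B n) (fun n z => t n z.1) :=
  h.map (UT.fst (A := Γ) (B := B) UT.id)

theorem UT.setOf {P : ∀ n, Γ n → A n → Prop}
    (h : UT (Γ := fun n => Γ n × A n) (T := fun _ => Prop) (fun n z => P n z.1 z.2)) :
    UT (T := fun n => Set (A n)) (fun n x => {y | P n x y}) := UT.set h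

theorem UT.union {f g : ∀ n, Γ n → Set (A n)} (hf : UT (T := fun n => Set (A n)) f)
    (hg : UT (T := fun n => Set (A n)) g) : UT (T := fun n => Set (A n)) (fun n x => f n x ∪ g n x) :=
  UT.set ((UT.mem hf.wk (UT.snd UT.id)).or (UT.mem hg.wk (UT.snd UT.id)))

theorem UT.empty : UT (Γ := Γ) (T := fun n => Set (A n)) (fun n x => (∅ : Set (A n))) := UT.set UT.ff

theorem UT.sub {f g : ∀ n, Γ n → Set (A n)} (hf : UT (T := fun n => Set (A n)) f)
    (hg : UT (T := fun n => Set (A n)) g) : UT (T := fun _ => Prop) (fun n x => f n x ⊆ g n x) :=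
  UT.all (P := fun n x y => y ∈ f n x → y ∈ g n x)
    ((UT.mem hf.wk (UT.snd UT.id)).imp (UT.mem hg.wk (UT.snd UT.id)))

theorem UT.fin_rel {R : ℕ → ℕ → Prop} (hR : PrimrecRel R) {a b : ∀ n, Γ n → Fin (n + 1)}
    (ha : UT (T := fun n => Fin (n + 1)) a) (hb : UT (T := fun n => Fin (n + 1)) b) :
    UT (T := fun _ => Prop) (fun n x => R (a n x) (b n x)) := by
  classical
  obtain ⟨g, hg, h1⟩ := ha
  obtain ⟨g', hg', h2⟩ := hb
  refine ⟨fun n c => if R (g n c) (g' n c) then 1 else 0, ?_, fun n x => ?_⟩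
  · exact Primrec.ite (PrimrecRel.comp hR hg hg') (Primrec.const 1) (Primrec.const 0)
  · beta_reduce
    rw [cod_prop, h1, h2]; rfl

theorem UT.last : UT (Γ := Γ) (T := fun n => Fin (n + 1)) (fun n x => Fin.last n) :=
  ⟨fun n c => n, Primrec₂.left, fun n x => rfl⟩
end

theorem UT.primrecPred {p : ℕ → Prop} (h : UT (Γ := fun _ => Unit) (T := fun _ => Prop) (fun n _ => p n)) :
    PrimrecPred p := by
  classical
  obtain ⟨g, hg, h1⟩ := h
  have h2 : PrimrecPred (fun n => g n (cod (T := fun _ => Unit) (n := 0) ()) = 1) :=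
    PrimrecRel.comp Primrec.eq (hg.comp Primrec.id (Primrec.const _)) (Primrec.const 1)
  refine h2.of_eq fun n => ?_
  have := h1 n ()
  rw [cod_prop] at this
  have h3 : cod (T := fun _ => Unit) (n := 0) () = cod (T := fun _ => Unit) (n := n) () := rfl
  rw [h3, this]
  by_cases h : p n <;> simp [h]
end Temporal
end

section
set_option linter.unusedVariables false
namespace Temporal

noncomputable instance ufKd : UF (fun _ => Kd) :=
  UF.tr (T := fun _ => Prop × Prop × Prop × Prop)
    (fun n => ⟨fun k => (k.ne, k.mn, k.mx, k.sg), fun t => ⟨t.1, t.2.1, t.2.2.1, t.2.2.2⟩, fun _ => rfl, fun _ => rfl⟩)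

noncomputable instance ufMo : UF (fun n => Mo (Fin (n + 1))) :=
  UF.tr (T := fun n => Set (Fin (n + 1)) × Set (Fin (n + 1)))
    (fun n => ⟨fun m => (m.p, m.f), fun t => ⟨t.1, t.2⟩, fun _ => rfl, fun _ => rfl⟩)

noncomputable instance ufLab : UF (fun n => Lab (Fin (n + 1))) :=
  UF.tr (T := fun n => Set (Fin (n + 1)) × Set (Fin (n + 1)) × Set (Fin (n + 1)))
    (fun n => ⟨fun m => (m.l, m.f, m.p), fun t => ⟨t.1, t.2.1, t.2.2⟩, fun _ => rfl, fun _ => rfl⟩)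

noncomputable instance ufDs : UF (fun n => Ds (Fin (n + 1))) :=
  UF.tr (T := fun n => Kd × Kd × (Mo (Fin (n + 1)) → Kd) × (Mo (Fin (n + 1)) → Kd) ×
      (Mo (Fin (n + 1)) → Kd) × (Mo (Fin (n + 1)) → Kd))
    (fun n => ⟨fun d => (d.kI, d.kJ, d.L, d.R, d.T, d.B),
      fun t => ⟨t.1, t.2.1, t.2.2.1, t.2.2.2.1, t.2.2.2.2.1, t.2.2.2.2.2⟩, fun _ => rfl, fun _ => rfl⟩)

theorem UT.of_tr {Γ T S : ℕ → Type} [UF Γ] [UF T] {e : ∀ n, S n ≃ T n} {t : ∀ n, Γ n → S n}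
    (h : UT (fun n x => e n (t n x))) :
    @UT Γ S _ (UF.tr e) t := h

theorem UT.to_tr {Γ T S : ℕ → Type} [UF Γ] [UF T] {e : ∀ n, S n ≃ T n} {t : ∀ n, Γ n → S n}
    (h : @UT Γ S _ (UF.tr e) t) :
    UT (fun n x => e n (t n x)) := h

abbrev FSm : ℕ → Type := fun n => Set (Fin (n + 1))
abbrev FMm : ℕ → Type := fun n => Mo (Fin (n + 1))
abbrev FLm : ℕ → Type := fun n => Lab (Fin (n + 1))
abbrev FDm : ℕ → Type := fun n => Ds (Fin (n + 1))
abbrev FPm : ℕ → Type := fun _ => Prop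
abbrev FKm : ℕ → Type := fun _ => Kd
abbrev FWm : ℕ → Type := fun n => Mo (Fin (n + 1)) → Kd

section
variable {Γ : ℕ → Type} [UF Γ]

theorem UT.kd_ne {t : ∀ n, Γ n → FKm n} (h : UT (T := FKm) t) :
    UT (T := FPm) (fun n x => (t n x).ne) :=
  UT.fst (UT.to_tr h)

theorem UT.kd_mn {t : ∀ n, Γ n → FKm n} (h : UT (T := FKm) t) :
    UT (T := FPm) (fun n x => (t n x).mn) :=
  UT.fst (UT.snd (UT.to_tr h))

theorem UT.kd_mx {t : ∀ n, Γ n → FKm n} (h : UT (T := FKm) t) :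
    UT (T := FPm) (fun n x => (t n x).mx) :=
  UT.fst (UT.snd (UT.snd (UT.to_tr h)))

theorem UT.kd_sg {t : ∀ n, Γ n → FKm n} (h : UT (T := FKm) t) :
    UT (T := FPm) (fun n x => (t n x).sg) :=
  UT.snd (UT.snd (UT.snd (UT.to_tr h)))

theorem UT.kd_mk {a0 : ∀ n, Γ n → FPm n} {a1 : ∀ n, Γ n → FPm n} {a2 : ∀ n, Γ n → FPm n} {a3 : ∀ n, Γ n → FPm n}
    (h0 : UT (T := FPm) a0) (h1 : UT (T := FPm) a1) (h2 : UT (T := FPm) a2) (h3 : UT (T := FPm) a3) :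
    UT (T := FKm) (fun n x => Kd.mk (a0 n x) (a1 n x) (a2 n x) (a3 n x)) :=
  UT.of_tr (UT.pair h0 (UT.pair h1 (UT.pair h2 (h3))))

theorem UT.mo_p {t : ∀ n, Γ n → FMm n} (h : UT (T := FMm) t) :
    UT (T := FSm) (fun n x => (t n x).p) :=
  UT.fst (UT.to_tr h)

theorem UT.mo_f {t : ∀ n, Γ n → FMm n} (h : UT (T := FMm) t) :
    UT (T := FSm) (fun n x => (t n x).f) :=
  UT.snd (UT.to_tr h)

theorem UT.mo_mk {a0 : ∀ n, Γ n → FSm n} {a1 : ∀ n, Γ n → FSm n}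
    (h0 : UT (T := FSm) a0) (h1 : UT (T := FSm) a1) :
    UT (T := FMm) (fun n x => Mo.mk (a0 n x) (a1 n x)) :=
  UT.of_tr (UT.pair h0 (h1))

theorem UT.lab_l {t : ∀ n, Γ n → FLm n} (h : UT (T := FLm) t) :
    UT (T := FSm) (fun n x => (t n x).l) :=
  UT.fst (UT.to_tr h)

theorem UT.lab_f {t : ∀ n, Γ n → FLm n} (h : UT (T := FLm) t) :
    UT (T := FSm) (fun n x => (t n x).f) :=
  UT.fst (UT.snd (UT.to_tr h))

theorem UT.lab_p {t : ∀ n, Γ n → FLm n} (h : UT (T := FLm) t) :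
    UT (T := FSm) (fun n x => (t n x).p) :=
  UT.snd (UT.snd (UT.to_tr h))

theorem UT.lab_mk {a0 : ∀ n, Γ n → FSm n} {a1 : ∀ n, Γ n → FSm n} {a2 : ∀ n, Γ n → FSm n}
    (h0 : UT (T := FSm) a0) (h1 : UT (T := FSm) a1) (h2 : UT (T := FSm) a2) :
    UT (T := FLm) (fun n x => Lab.mk (a0 n x) (a1 n x) (a2 n x)) :=
  UT.of_tr (UT.pair h0 (UT.pair h1 (h2)))

theorem UT.ds_kI {t : ∀ n, Γ n → FDm n} (h : UT (T := FDm) t) :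
    UT (T := FKm) (fun n x => (t n x).kI) :=
  UT.fst (UT.to_tr h)

theorem UT.ds_kJ {t : ∀ n, Γ n → FDm n} (h : UT (T := FDm) t) :
    UT (T := FKm) (fun n x => (t n x).kJ) :=
  UT.fst (UT.snd (UT.to_tr h))

theorem UT.ds_L {t : ∀ n, Γ n → FDm n} (h : UT (T := FDm) t) :
    UT (T := FWm) (fun n x => (t n x).L) :=
  UT.fst (UT.snd (UT.snd (UT.to_tr h)))

theorem UT.ds_R {t : ∀ n, Γ n → FDm n} (h : UT (T := FDm) t) :
    UT (T := FWm) (fun n x => (t n x).R) :=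
  UT.fst (UT.snd (UT.snd (UT.snd (UT.to_tr h))))

theorem UT.ds_T {t : ∀ n, Γ n → FDm n} (h : UT (T := FDm) t) :
    UT (T := FWm) (fun n x => (t n x).T) :=
  UT.fst (UT.snd (UT.snd (UT.snd (UT.snd (UT.to_tr h)))))

theorem UT.ds_B {t : ∀ n, Γ n → FDm n} (h : UT (T := FDm) t) :
    UT (T := FWm) (fun n x => (t n x).B) :=
  UT.snd (UT.snd (UT.snd (UT.snd (UT.snd (UT.to_tr h)))))

theorem UT.ds_mk {a0 : ∀ n, Γ n → FKm n} {a1 : ∀ n, Γ n → FKm n} {a2 : ∀ n, Γ n → FWm n} {a3 : ∀ n, Γ n → FWm n} {a4 : ∀ n, Γ n → FWm n} {a5 : ∀ n, Γ n → FWm n}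
    (h0 : UT (T := FKm) a0) (h1 : UT (T := FKm) a1) (h2 : UT (T := FWm) a2) (h3 : UT (T := FWm) a3) (h4 : UT (T := FWm) a4) (h5 : UT (T := FWm) a5) :
    UT (T := FDm) (fun n x => Ds.mk (a0 n x) (a1 n x) (a2 n x) (a3 n x) (a4 n x) (a5 n x)) :=
  UT.of_tr (UT.pair h0 (UT.pair h1 (UT.pair h2 (UT.pair h3 (UT.pair h4 (h5))))))

theorem UT.app_L {d : ∀ n, Γ n → FDm n} {m : ∀ n, Γ n → FMm n} (hd : UT (T := FDm) d) (hm : UT (T := FMm) m) :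
    UT (T := FKm) (fun n x => (d n x).L (m n x)) :=
  UT.app (A := FMm) (B := FKm) (UT.ds_L hd) hm

theorem UT.app_R {d : ∀ n, Γ n → FDm n} {m : ∀ n, Γ n → FMm n} (hd : UT (T := FDm) d) (hm : UT (T := FMm) m) :
    UT (T := FKm) (fun n x => (d n x).R (m n x)) :=
  UT.app (A := FMm) (B := FKm) (UT.ds_R hd) hm

theorem UT.app_T {d : ∀ n, Γ n → FDm n} {m : ∀ n, Γ n → FMm n} (hd : UT (T := FDm) d) (hm : UT (T := FMm) m) :
    UT (T := FKm) (fun n x => (d n x).T (m n x)) :=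
  UT.app (A := FMm) (B := FKm) (UT.ds_T hd) hm

theorem UT.app_B {d : ∀ n, Γ n → FDm n} {m : ∀ n, Γ n → FMm n} (hd : UT (T := FDm) d) (hm : UT (T := FMm) m) :
    UT (T := FKm) (fun n x => (d n x).B (m n x)) :=
  UT.app (A := FMm) (B := FKm) (UT.ds_B hd) hm


theorem UT.kpt : UT (Γ := Γ) (T := FKm) (fun n x => kpt) := UT.kd_mk UT.tt UT.tt UT.tt UT.tt
theorem UT.koo : UT (Γ := Γ) (T := FKm) (fun n x => koo) := UT.kd_mk UT.tt UT.ff UT.ff UT.ff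
theorem UT.kco : UT (Γ := Γ) (T := FKm) (fun n x => kco) := UT.kd_mk UT.tt UT.tt UT.ff UT.ff
theorem UT.koc : UT (Γ := Γ) (T := FKm) (fun n x => koc) := UT.kd_mk UT.tt UT.ff UT.tt UT.ff

theorem UT.comb {a b : ∀ n, Γ n → FKm n} (ha : UT (T := FKm) a) (hb : UT (T := FKm) b) :
    UT (T := FKm) (fun n x => (a n x).comb (b n x)) :=
  UT.kd_mk (ha.kd_ne.or hb.kd_ne) ((ha.kd_ne.and ha.kd_mn).or (ha.kd_ne.not.and hb.kd_mn))
    ((hb.kd_ne.and hb.kd_mx).or (hb.kd_ne.not.and ha.kd_mx))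
    ((ha.kd_sg.and hb.kd_ne.not).or (hb.kd_sg.and ha.kd_ne.not))

theorem UT.combW {a b : ∀ n, Γ n → FWm n} (ha : UT (T := FWm) a) (hb : UT (T := FWm) b) :
    UT (T := FWm) (fun n x => combW (a n x) (b n x)) :=
  UT.fn (A := FMm) (B := FKm) (UT.comb (UT.app (A := FMm) (B := FKm) ha.wk (UT.snd UT.id))
    (UT.app (A := FMm) (B := FKm) hb.wk (UT.snd UT.id)))

theorem UT.cW {k : ∀ n, Γ n → FKm n} {m : ∀ n, Γ n → FMm n} (hk : UT (T := FKm) k) (hm : UT (T := FMm) m) :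
    UT (T := FWm) (fun n x => cW (k n x) (m n x)) := by
  have e : UT (Γ := fun n => Γ n × FMm n) (T := FPm) (fun n z => z.2 = m n z.1) :=
    UT.eq (A := FMm) (UT.snd UT.id) hm.wk
  exact UT.fn (A := FMm) (B := FKm) (UT.kd_mk (e.and (UT.kd_ne hk.wk)) (e.and (UT.kd_mn hk.wk))
    (e.and (UT.kd_mx hk.wk)) (e.imp (UT.kd_sg hk.wk)))

theorem UT.mo_le {a b : ∀ n, Γ n → FMm n} (ha : UT (T := FMm) a) (hb : UT (T := FMm) b) :
    UT (T := FPm) (fun n x => a n x ≤ b n x) :=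
  (UT.sub ha.mo_p hb.mo_p).and (UT.sub hb.mo_f ha.mo_f)

theorem UT.ds_swap {d : ∀ n, Γ n → FDm n} (hd : UT (T := FDm) d) :
    UT (T := FDm) (fun n x => (d n x).swap) :=
  UT.ds_mk hd.ds_kJ hd.ds_kI hd.ds_B hd.ds_T hd.ds_R hd.ds_L
end
end Temporal
end

section
set_option linter.unusedVariables false
set_option linter.unusedTactic false
set_option linter.unreachableTactic false
namespace Temporal

theorem prim_cd (r : ℕ) : PrimrecRel (cd r) := by
  have h1 : PrimrecPred (fun z : ℕ × ℕ => z.1 % 5 = r) :=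
    PrimrecRel.comp Primrec.eq (Primrec.nat_mod.comp Primrec.fst (Primrec.const 5)) (Primrec.const r)
  have h2 : PrimrecPred (fun z : ℕ × ℕ => z.2 = z.1 / 5) :=
    PrimrecRel.comp Primrec.eq Primrec.snd (Primrec.nat_div.comp Primrec.fst (Primrec.const 5))
  exact h1.and h2

theorem prim_cd2a : PrimrecRel (fun i j => i % 5 = 2 ∧ j = (i / 5).unpair.1) := by
  have h1 : PrimrecPred (fun z : ℕ × ℕ => z.1 % 5 = 2) :=
    PrimrecRel.comp Primrec.eq (Primrec.nat_mod.comp Primrec.fst (Primrec.const 5)) (Primrec.const 2)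
  have h2 : PrimrecPred (fun z : ℕ × ℕ => z.2 = (z.1 / 5).unpair.1) :=
    PrimrecRel.comp Primrec.eq Primrec.snd (Primrec.fst.comp (Primrec.unpair.comp (Primrec.nat_div.comp Primrec.fst (Primrec.const 5))))
  exact h1.and h2

theorem prim_cd2b : PrimrecRel (fun i j => j = (i / 5).unpair.2) := by
  exact PrimrecRel.comp Primrec.eq Primrec.snd (Primrec.snd.comp (Primrec.unpair.comp (Primrec.nat_div.comp Primrec.fst (Primrec.const 5))))

section
variable {Γ : ℕ → Type} [UF Γ]

theorem UT.cd (r : ℕ) {a b : ∀ n, Γ n → Fin (n + 1)}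
    (ha : UT (T := fun n => Fin (n + 1)) a) (hb : UT (T := fun n => Fin (n + 1)) b) :
    UT (T := fun _ => Prop) (fun n x => cd r (a n x) (b n x)) := UT.fin_rel (prim_cd r) ha hb

theorem UT.cd2 {a b c : ∀ n, Γ n → Fin (n + 1)}
    (ha : UT (T := fun n => Fin (n + 1)) a) (hb : UT (T := fun n => Fin (n + 1)) b)
    (hc : UT (T := fun n => Fin (n + 1)) c) :
    UT (T := fun _ => Prop) (fun n x => cd2 (a n x) (b n x) (c n x)) :=
  ((UT.fin_rel prim_cd2a ha hb).and (UT.fin_rel prim_cd2b ha hc)).of_iff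
    (by intro n x; simp only [Temporal.cd2, and_assoc])

theorem UT.Cn0 : UT (Γ := FLm) (T := FPm) (fun n t => Cn n t) := by
  unfold Cn
  repeat' with_reducible first
    | apply UT.id | apply UT.and | apply UT.iff | apply UT.not | apply UT.or | apply UT.mem | apply UT.cd | apply UT.cd2
    | apply UT.lab_l | apply UT.lab_f | apply UT.lab_p | apply UT.all | apply UT.imp | apply UT.fst | apply UT.snd

theorem UT.Cn {t : ∀ n, Γ n → FLm n} (h : UT (T := FLm) t) : UT (T := FPm) (fun n x => Cn n (t n x)) := by
  have h := UT.map (A := FLm) (B := FPm) UT.Cn0 h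
  exact h

theorem UT.TC {a b : ∀ n, Γ n → FSm n} {t : ∀ n, Γ n → FLm n} (ha : UT (T := FSm) a) (hb : UT (T := FSm) b)
    (h : UT (T := FLm) t) : UT (T := FPm) (fun n x => TC (Temporal.Cn n) (a n x) (b n x) (t n x)) := by
  unfold Temporal.TC
  repeat' with_reducible first
    | assumption | apply UT.id | apply UT.and | apply UT.iff | apply UT.not | apply UT.or | apply UT.mem
    | apply UT.app_L | apply UT.app_R | apply UT.app_T | apply UT.app_B | apply UT.eq | apply UT.sub | apply UT.union
    | apply UT.empty | apply UT.setOf | apply UT.cW | apply UT.combW | apply UT.comb | apply UT.kpt | apply UT.koo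
    | apply UT.kco | apply UT.koc | apply UT.ds_kI | apply UT.ds_kJ | apply UT.ds_L | apply UT.ds_R | apply UT.ds_T
    | apply UT.ds_B | apply UT.ds_swap | apply UT.kd_ne | apply UT.kd_mn | apply UT.kd_mx
    | apply UT.kd_sg | apply UT.mo_p | apply UT.mo_f | apply UT.mo_le | apply UT.lab_l
    | apply UT.lab_f | apply UT.lab_p | apply UT.Cn | apply UT.ex | apply UT.all | apply UT.imp
    | apply UT.fst | apply UT.snd | apply UT.mo_mk | apply UT.ds_mk

theorem UT.Lit0 : UT (Γ := fun n => FSm n × FSm n) (T := FSm) (fun n x => Lit (Temporal.Cn n) x.1 x.2) := by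
  unfold Temporal.Lit
  repeat' with_reducible first
    | assumption | apply UT.id | apply UT.and | apply UT.iff | apply UT.not | apply UT.or | apply UT.mem
    | apply UT.app_L | apply UT.app_R | apply UT.app_T | apply UT.app_B | apply UT.eq | apply UT.sub | apply UT.union
    | apply UT.empty | apply UT.setOf | apply UT.cW | apply UT.combW | apply UT.comb | apply UT.kpt | apply UT.koo
    | apply UT.kco | apply UT.koc | apply UT.ds_kI | apply UT.ds_kJ | apply UT.ds_L | apply UT.ds_R | apply UT.ds_T
    | apply UT.ds_B | apply UT.ds_swap | apply UT.kd_ne | apply UT.kd_mn | apply UT.kd_mx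
    | apply UT.kd_sg | apply UT.mo_p | apply UT.mo_f | apply UT.mo_le | apply UT.lab_l
    | apply UT.lab_f | apply UT.lab_p | apply UT.TC | apply UT.ex | apply UT.all | apply UT.imp
    | apply UT.fst | apply UT.snd | apply UT.mo_mk | apply UT.ds_mk

theorem UT.Lit {a b : ∀ n, Γ n → FSm n} (ha : UT (T := FSm) a) (hb : UT (T := FSm) b) :
    UT (T := FSm) (fun n x => Lit (Temporal.Cn n) (a n x) (b n x)) := by
  have h := UT.map (A := fun n => FSm n × FSm n) (B := FSm) UT.Lit0 (UT.pair ha hb)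
  exact h

theorem UT.Item0 : UT (Γ := fun n => FSm n × FSm n × FDm n) (T := FPm) (fun n x => Item x.1 x.2.1 x.2.2) := by
  have e : ∀ n (x : FSm n × FSm n × FDm n), Item x.1 x.2.1 x.2.2 ↔ x.2.2.kI.mn ∧ x.2.2.kI.mx ∧ x.2.2.kJ.mn ∧
      x.2.2.kJ.mx ∧ (∀ m, (x.2.2.L m).ne → m.p = x.1) ∧ (∀ m, (x.2.2.B m).ne → m.p = x.1) ∧
      (∀ m, (x.2.2.R m).ne → m.f = x.2.1) ∧ (∀ m, (x.2.2.T m).ne → m.f = x.2.1) :=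
    fun n x => ⟨fun ⟨a, b, c, d, e, f, g, h⟩ => ⟨a, b, c, d, e, f, g, h⟩,
      fun ⟨a, b, c, d, e, f, g, h⟩ => ⟨a, b, c, d, e, f, g, h⟩⟩
  refine UT.of_iff ?_ e
  clear e
  repeat' with_reducible first
    | assumption | apply UT.id | apply UT.and | apply UT.iff | apply UT.not | apply UT.or | apply UT.mem
    | apply UT.app_L | apply UT.app_R | apply UT.app_T | apply UT.app_B | apply UT.eq | apply UT.sub | apply UT.union
    | apply UT.empty | apply UT.setOf | apply UT.cW | apply UT.combW | apply UT.comb | apply UT.kpt | apply UT.koo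
    | apply UT.kco | apply UT.koc | apply UT.ds_kI | apply UT.ds_kJ | apply UT.ds_L | apply UT.ds_R | apply UT.ds_T
    | apply UT.ds_B | apply UT.ds_swap | apply UT.kd_ne | apply UT.kd_mn | apply UT.kd_mx
    | apply UT.kd_sg | apply UT.mo_p | apply UT.mo_f | apply UT.mo_le | apply UT.lab_l
    | apply UT.lab_f | apply UT.lab_p | apply UT.ex | apply UT.all | apply UT.imp
    | apply UT.fst | apply UT.snd | apply UT.mo_mk | apply UT.ds_mk

theorem UT.Item {a b : ∀ n, Γ n → FSm n} {d : ∀ n, Γ n → FDm n} (ha : UT (T := FSm) a) (hb : UT (T := FSm) b)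
    (hd : UT (T := FDm) d) : UT (T := FPm) (fun n x => Item (a n x) (b n x) (d n x)) := by
  have h := UT.map (A := fun n => FSm n × FSm n × FDm n) (B := FPm) UT.Item0 (UT.pair ha (UT.pair hb hd))
  exact h

theorem UT.Goal0 : UT (Γ := FDm) (T := FPm) (fun n x => Goal (Fin.last n) x) := by
  unfold Temporal.Goal
  repeat' with_reducible first
    | assumption | apply UT.id | apply UT.and | apply UT.iff | apply UT.not | apply UT.or | apply UT.mem
    | apply UT.app_L | apply UT.app_R | apply UT.app_T | apply UT.app_B | apply UT.eq | apply UT.sub | apply UT.union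
    | apply UT.empty | apply UT.setOf | apply UT.cW | apply UT.combW | apply UT.comb | apply UT.kpt | apply UT.koo
    | apply UT.kco | apply UT.koc | apply UT.ds_kI | apply UT.ds_kJ | apply UT.ds_L | apply UT.ds_R | apply UT.ds_T
    | apply UT.ds_B | apply UT.ds_swap | apply UT.kd_ne | apply UT.kd_mn | apply UT.kd_mx
    | apply UT.kd_sg | apply UT.mo_p | apply UT.mo_f | apply UT.mo_le | apply UT.lab_l
    | apply UT.lab_f | apply UT.lab_p | apply UT.last | apply UT.ex | apply UT.all | apply UT.imp
    | apply UT.fst | apply UT.snd | apply UT.mo_mk | apply UT.ds_mk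

theorem UT.Goal {d : ∀ n, Γ n → FDm n} (hd : UT (T := FDm) d) :
    UT (T := FPm) (fun n x => Goal (Fin.last n) (d n x)) := by
  have h := UT.map (A := FDm) (B := FPm) UT.Goal0 hd
  exact h
end

abbrev FQm : ℕ → Type := fun n => FMm n × FMm n × FDm n × FDm n × FDm n × FDm n × FDm n

theorem ut_LStep0 : UT (Γ := FQm) (T := FPm) (fun n x => LStep x.1 x.2.1 x.2.2.1 x.2.2.2.1 x.2.2.2.2.1
    x.2.2.2.2.2.1 x.2.2.2.2.2.2) := by
  have e : ∀ n (x : FQm n), LStep x.1 x.2.1 x.2.2.1 x.2.2.2.1 x.2.2.2.2.1 x.2.2.2.2.2.1 x.2.2.2.2.2.2 ↔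
      (x.2.2.1.kI = koo) ∧
      (x.2.2.1.kJ = koo) ∧
      (x.2.2.1.R = cW koo x.1) ∧
      (x.2.2.1.B = cW koo x.2.1) ∧
      (x.2.2.2.1.kI = koc) ∧
      (x.2.2.2.1.kJ = kco) ∧
      (x.2.2.2.2.1.kI = koo) ∧
      (x.2.2.2.2.1.kJ = kco) ∧
      (x.2.2.2.2.2.1.kI = koc) ∧
      (x.2.2.2.2.2.1.kJ = koo) ∧
      (∃ m0, x.2.2.2.2.2.1.L = cW koo m0 ∧ (x.2.2.2.1.L m0).ne ∧ (x.2.2.2.1.L m0).mn ∧ ¬ (x.2.2.2.1.L m0).sg ∧ (∀ m, (x.2.2.2.1.L m).ne → m0 ≤ m) ∧ x.2.2.1.L = combW (cW koo m0) x.2.2.2.1.L) ∧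
      (∃ m1, x.2.2.2.2.1.T = cW koo m1 ∧ (x.2.2.2.1.T m1).ne ∧ (x.2.2.2.1.T m1).mx ∧ ¬ (x.2.2.2.1.T m1).sg ∧ (∀ m, (x.2.2.2.1.T m).ne → m ≤ m1) ∧ x.2.2.1.T = combW x.2.2.2.1.T (cW koo m1)) ∧
      (x.2.2.2.2.1.R = cW kco x.1) ∧
      (x.2.2.2.2.2.1.B = cW koc x.2.1) ∧
      (x.2.2.2.1.R = x.2.2.2.2.1.L) ∧
      (x.2.2.2.2.2.1.R = x.2.2.2.2.2.2.L) ∧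
      (x.2.2.2.1.B = x.2.2.2.2.2.1.T) ∧
      (x.2.2.2.2.1.B = x.2.2.2.2.2.2.T) ∧
      (∀ m m', (x.2.2.2.1.B m).ne → (x.2.2.2.2.1.B m').ne → m ≤ m') ∧
      (∀ m m', (x.2.2.2.2.2.1.R m).ne → (x.2.2.2.1.R m').ne → m ≤ m') :=
    fun n x => ⟨fun ⟨h0, h1, h2, h3, h4, h5, h6, h7, h8, h9, h10, h11, h12, h13, h14, h15, h16, h17, h18, h19⟩ =>
      ⟨h0, h1, h2, h3, h4, h5, h6, h7, h8, h9, h10, h11, h12, h13, h14, h15, h16, h17, h18, h19⟩,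
      fun ⟨h0, h1, h2, h3, h4, h5, h6, h7, h8, h9, h10, h11, h12, h13, h14, h15, h16, h17, h18, h19⟩ =>
      ⟨h0, h1, h2, h3, h4, h5, h6, h7, h8, h9, h10, h11, h12, h13, h14, h15, h16, h17, h18, h19⟩⟩
  refine UT.of_iff ?_ e
  clear e
  repeat' with_reducible first
    | assumption | apply UT.id | apply UT.and | apply UT.iff | apply UT.not | apply UT.or | apply UT.mem
    | apply UT.app_L | apply UT.app_R | apply UT.app_T | apply UT.app_B | apply UT.eq | apply UT.sub | apply UT.union
    | apply UT.empty | apply UT.setOf | apply UT.cW | apply UT.combW | apply UT.comb | apply UT.kpt | apply UT.koo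
    | apply UT.kco | apply UT.koc | apply UT.ds_kI | apply UT.ds_kJ | apply UT.ds_L | apply UT.ds_R | apply UT.ds_T
    | apply UT.ds_B | apply UT.ds_swap | apply UT.kd_ne | apply UT.kd_mn | apply UT.kd_mx
    | apply UT.kd_sg | apply UT.mo_p | apply UT.mo_f | apply UT.mo_le | apply UT.lab_l
    | apply UT.lab_f | apply UT.lab_p | apply UT.ex | apply UT.all | apply UT.imp
    | apply UT.fst | apply UT.snd | apply UT.mo_mk | apply UT.ds_mk

theorem UT.LStep {Γ : ℕ → Type} [UF Γ] {mr mb : ∀ n, Γ n → FMm n} {d1 d2 d3 d4 d5 : ∀ n, Γ n → FDm n}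
    (ha : UT (T := FMm) mr) (hb : UT (T := FMm) mb) (h1 : UT (T := FDm) d1) (h2 : UT (T := FDm) d2)
    (h3 : UT (T := FDm) d3) (h4 : UT (T := FDm) d4) (h5 : UT (T := FDm) d5) :
    UT (T := FPm) (fun n x => LStep (mr n x) (mb n x) (d1 n x) (d2 n x) (d3 n x) (d4 n x) (d5 n x)) := by
  have h := UT.map (A := FQm) (B := FPm) ut_LStep0
    (UT.pair ha (UT.pair hb (UT.pair h1 (UT.pair h2 (UT.pair h3 (UT.pair h4 h5))))))
  exact h

abbrev FXm : ℕ → Type := fun n => Set (Ds (Fin (n + 1)))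

def Cl_pt (n : ℕ) (X : Set (Ds (Fin (n + 1)))) : Prop :=
  ∀ (t : Lab (Fin (n + 1))) (oL oR oT oB : Set (Fin (n + 1))), (Temporal.Cn n) t → t.f = oR ∪ oT → t.p = oL ∪ oB →
    (⟨kpt, kpt, cW kpt ⟨oL, t.l ∪ t.f⟩, cW kpt ⟨t.l ∪ t.p, oR⟩, cW kpt ⟨t.l ∪ t.p, oT⟩,
      cW kpt ⟨oB, t.l ∪ t.f⟩⟩ : Ds (Fin (n + 1))) ∈ X

theorem UT.Cl_pt : UT (Γ := FXm) (T := FPm) Cl_pt := by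
  unfold Temporal.Cl_pt
  repeat' with_reducible first
    | assumption | apply UT.id | apply UT.and | apply UT.iff | apply UT.not | apply UT.or | apply UT.mem
    | apply UT.app_L | apply UT.app_R | apply UT.app_T | apply UT.app_B | apply UT.eq | apply UT.sub | apply UT.union
    | apply UT.empty | apply UT.setOf | apply UT.cW | apply UT.combW | apply UT.comb | apply UT.kpt | apply UT.koo
    | apply UT.kco | apply UT.koc | apply UT.ds_kI | apply UT.ds_kJ | apply UT.ds_L | apply UT.ds_R | apply UT.ds_T
    | apply UT.ds_B | apply UT.ds_swap | apply UT.kd_ne | apply UT.kd_mn | apply UT.kd_mx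
    | apply UT.kd_sg | apply UT.mo_p | apply UT.mo_f | apply UT.mo_le | apply UT.lab_l
    | apply UT.lab_f | apply UT.lab_p | apply UT.Cn | apply UT.TC | apply UT.Lit | apply UT.Item | apply UT.LStep | apply UT.ex | apply UT.all | apply UT.imp
    | apply UT.fst | apply UT.snd | apply UT.mo_mk | apply UT.ds_mk

def Cl_cl (n : ℕ) (X : Set (Ds (Fin (n + 1)))) : Prop :=
  ∀ (kI kJ : Kd) (A B' oL oR oT oB : Set (Fin (n + 1))), (kI = kpt ∨ kI = koo) → (kJ = kpt ∨ kJ = koo) →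
    ¬ (kI = kpt ∧ kJ = kpt) → (∃ t, TC (Temporal.Cn n) A B' t) →
    A = Lit (Temporal.Cn n) A B' ∪ oR ∪ oT → B' = Lit (Temporal.Cn n) A B' ∪ oL ∪ oB →
    (⟨kI, kJ, cW kJ ⟨oL, A⟩, cW kJ ⟨B', oR⟩, cW kI ⟨B', oT⟩, cW kI ⟨oB, A⟩⟩ : Ds (Fin (n + 1))) ∈ X

theorem UT.Cl_cl : UT (Γ := FXm) (T := FPm) Cl_cl := by
  unfold Temporal.Cl_cl
  repeat' with_reducible first
    | assumption | apply UT.id | apply UT.and | apply UT.iff | apply UT.not | apply UT.or | apply UT.mem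
    | apply UT.app_L | apply UT.app_R | apply UT.app_T | apply UT.app_B | apply UT.eq | apply UT.sub | apply UT.union
    | apply UT.empty | apply UT.setOf | apply UT.cW | apply UT.combW | apply UT.comb | apply UT.kpt | apply UT.koo
    | apply UT.kco | apply UT.koc | apply UT.ds_kI | apply UT.ds_kJ | apply UT.ds_L | apply UT.ds_R | apply UT.ds_T
    | apply UT.ds_B | apply UT.ds_swap | apply UT.kd_ne | apply UT.kd_mn | apply UT.kd_mx
    | apply UT.kd_sg | apply UT.mo_p | apply UT.mo_f | apply UT.mo_le | apply UT.lab_l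
    | apply UT.lab_f | apply UT.lab_p | apply UT.Cn | apply UT.TC | apply UT.Lit | apply UT.Item | apply UT.LStep | apply UT.ex | apply UT.all | apply UT.imp
    | apply UT.fst | apply UT.snd | apply UT.mo_mk | apply UT.ds_mk

def Cl_join (n : ℕ) (X : Set (Ds (Fin (n + 1)))) : Prop :=
  ∀ d1 ∈ X, ∀ d2 ∈ X, d1.R = d2.L → d1.kJ = d2.kJ → (d1.kI.mx ↔ ¬ d2.kI.mn) →
    (∀ m m', (d1.B m).ne → (d2.B m').ne → m ≤ m') →
    (∀ m m', (d1.T m).ne → (d2.T m').ne → m ≤ m') →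
    (⟨d1.kI.comb d2.kI, d1.kJ, d1.L, d2.R, combW d1.T d2.T, combW d1.B d2.B⟩ : Ds (Fin (n + 1))) ∈ X

theorem UT.Cl_join : UT (Γ := FXm) (T := FPm) Cl_join := by
  unfold Temporal.Cl_join
  repeat' with_reducible first
    | assumption | apply UT.id | apply UT.and | apply UT.iff | apply UT.not | apply UT.or | apply UT.mem
    | apply UT.app_L | apply UT.app_R | apply UT.app_T | apply UT.app_B | apply UT.eq | apply UT.sub | apply UT.union
    | apply UT.empty | apply UT.setOf | apply UT.cW | apply UT.combW | apply UT.comb | apply UT.kpt | apply UT.koo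
    | apply UT.kco | apply UT.koc | apply UT.ds_kI | apply UT.ds_kJ | apply UT.ds_L | apply UT.ds_R | apply UT.ds_T
    | apply UT.ds_B | apply UT.ds_swap | apply UT.kd_ne | apply UT.kd_mn | apply UT.kd_mx
    | apply UT.kd_sg | apply UT.mo_p | apply UT.mo_f | apply UT.mo_le | apply UT.lab_l
    | apply UT.lab_f | apply UT.lab_p | apply UT.Cn | apply UT.TC | apply UT.Lit | apply UT.Item | apply UT.LStep | apply UT.ex | apply UT.all | apply UT.imp
    | apply UT.fst | apply UT.snd | apply UT.mo_mk | apply UT.ds_mk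

def Cl_swap (n : ℕ) (X : Set (Ds (Fin (n + 1)))) : Prop :=
  ∀ d ∈ X, d.swap ∈ X

theorem UT.Cl_swap : UT (Γ := FXm) (T := FPm) Cl_swap := by
  unfold Temporal.Cl_swap
  repeat' with_reducible first
    | assumption | apply UT.id | apply UT.and | apply UT.iff | apply UT.not | apply UT.or | apply UT.mem
    | apply UT.app_L | apply UT.app_R | apply UT.app_T | apply UT.app_B | apply UT.eq | apply UT.sub | apply UT.union
    | apply UT.empty | apply UT.setOf | apply UT.cW | apply UT.combW | apply UT.comb | apply UT.kpt | apply UT.koo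
    | apply UT.kco | apply UT.koc | apply UT.ds_kI | apply UT.ds_kJ | apply UT.ds_L | apply UT.ds_R | apply UT.ds_T
    | apply UT.ds_B | apply UT.ds_swap | apply UT.kd_ne | apply UT.kd_mn | apply UT.kd_mx
    | apply UT.kd_sg | apply UT.mo_p | apply UT.mo_f | apply UT.mo_le | apply UT.lab_l
    | apply UT.lab_f | apply UT.lab_p | apply UT.Cn | apply UT.TC | apply UT.Lit | apply UT.Item | apply UT.LStep | apply UT.ex | apply UT.all | apply UT.imp
    | apply UT.fst | apply UT.snd | apply UT.mo_mk | apply UT.ds_mk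

def Cl_lim (n : ℕ) (X : Set (Ds (Fin (n + 1)))) : Prop :=
  ∀ (Y : Set (Ds (Fin (n + 1)))) (mr mb : Mo (Fin (n + 1))),
    (∀ d ∈ Y, ∃ d' ∈ Y, ∃ UL ∈ X, ∃ UR ∈ X, ∃ LL ∈ X, LStep mr mb d UL UR LL d') →
    ∀ d ∈ Y, d ∈ X

theorem UT.Cl_lim : UT (Γ := FXm) (T := FPm) Cl_lim := by
  unfold Temporal.Cl_lim
  repeat' with_reducible first
    | assumption | apply UT.id | apply UT.and | apply UT.iff | apply UT.not | apply UT.or | apply UT.mem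
    | apply UT.app_L | apply UT.app_R | apply UT.app_T | apply UT.app_B | apply UT.eq | apply UT.sub | apply UT.union
    | apply UT.empty | apply UT.setOf | apply UT.cW | apply UT.combW | apply UT.comb | apply UT.kpt | apply UT.koo
    | apply UT.kco | apply UT.koc | apply UT.ds_kI | apply UT.ds_kJ | apply UT.ds_L | apply UT.ds_R | apply UT.ds_T
    | apply UT.ds_B | apply UT.ds_swap | apply UT.kd_ne | apply UT.kd_mn | apply UT.kd_mx
    | apply UT.kd_sg | apply UT.mo_p | apply UT.mo_f | apply UT.mo_le | apply UT.lab_l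
    | apply UT.lab_f | apply UT.lab_p | apply UT.Cn | apply UT.TC | apply UT.Lit | apply UT.Item | apply UT.LStep | apply UT.ex | apply UT.all | apply UT.imp
    | apply UT.fst | apply UT.snd | apply UT.mo_mk | apply UT.ds_mk

def Cl_shuf (n : ℕ) (X : Set (Ds (Fin (n + 1)))) : Prop :=
  ∀ (A' B' A B oL oR oT oB : Set (Fin (n + 1))) (t : Lab (Fin (n + 1))) (K : Set (Ds (Fin (n + 1)))),
    (∃ s, TC (Temporal.Cn n) A' B' s) → (∃ s, TC (Temporal.Cn n) A B s) →
    A = Lit (Temporal.Cn n) A B ∪ oR ∪ oT → B' = Lit (Temporal.Cn n) A' B' ∪ oL ∪ oB →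
    (Temporal.Cn n) t → t.f = A → t.p = B' → t.l ⊆ A' → t.l ⊆ B →
    (∀ d ∈ K, d ∈ X ∧ Item B' A d) →
    A' = Lit (Temporal.Cn n) A' B' ∪ A ∪ t.l ∪ {i | ∃ d ∈ K, ∃ m, (d.L m).ne ∧ i ∈ m.f} →
    B = Lit (Temporal.Cn n) A B ∪ B' ∪ t.l ∪ {i | ∃ d ∈ K, ∃ m, (d.R m).ne ∧ i ∈ m.p} →
    (⟨koo, koo, cW koo ⟨oL, A'⟩, cW koo ⟨B, oR⟩, cW koo ⟨B, oT⟩, cW koo ⟨oB, A'⟩⟩ : Ds (Fin (n + 1))) ∈ X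

theorem UT.Cl_shuf : UT (Γ := FXm) (T := FPm) Cl_shuf := by
  unfold Temporal.Cl_shuf
  repeat' with_reducible first
    | assumption | apply UT.id | apply UT.and | apply UT.iff | apply UT.not | apply UT.or | apply UT.mem
    | apply UT.app_L | apply UT.app_R | apply UT.app_T | apply UT.app_B | apply UT.eq | apply UT.sub | apply UT.union
    | apply UT.empty | apply UT.setOf | apply UT.cW | apply UT.combW | apply UT.comb | apply UT.kpt | apply UT.koo
    | apply UT.kco | apply UT.koc | apply UT.ds_kI | apply UT.ds_kJ | apply UT.ds_L | apply UT.ds_R | apply UT.ds_T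
    | apply UT.ds_B | apply UT.ds_swap | apply UT.kd_ne | apply UT.kd_mn | apply UT.kd_mx
    | apply UT.kd_sg | apply UT.mo_p | apply UT.mo_f | apply UT.mo_le | apply UT.lab_l
    | apply UT.lab_f | apply UT.lab_p | apply UT.Cn | apply UT.TC | apply UT.Lit | apply UT.Item | apply UT.LStep | apply UT.ex | apply UT.all | apply UT.imp
    | apply UT.fst | apply UT.snd | apply UT.mo_mk | apply UT.ds_mk

theorem closed_iff (n : ℕ) (X : Set (Ds (Fin (n + 1)))) : Closed (Cn n) X ↔
    Temporal.Cl_pt n X ∧ Temporal.Cl_cl n X ∧ Temporal.Cl_join n X ∧ Temporal.Cl_swap n X ∧ Temporal.Cl_lim n X ∧ Temporal.Cl_shuf n X :=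
  ⟨fun ⟨h0, h1, h2, h3, h4, h5⟩ => ⟨h0, h1, h2, h3, h4, h5⟩, fun ⟨h0, h1, h2, h3, h4, h5⟩ => ⟨h0, h1, h2, h3, h4, h5⟩⟩

theorem ut_Closed : UT (Γ := FXm) (T := FPm) (fun n X => Closed (Cn n) X) := by
  refine UT.of_iff ?_ closed_iff
  exact UT.Cl_pt.and (UT.Cl_cl.and (UT.Cl_join.and (UT.Cl_swap.and (UT.Cl_lim.and UT.Cl_shuf))))

theorem crit_primrec : PrimrecPred Crit := by
  refine UT.primrecPred ?_
  unfold Crit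
  refine UT.all (A := FXm) (UT.imp (UT.map (A := FXm) (B := FPm) ut_Closed (UT.snd UT.id)) ?_)
  refine UT.ex (A := FDm) (UT.and ?_ (UT.Goal (UT.snd UT.id)))
  exact UT.mem (A := FDm) (UT.snd (A := fun _ => Unit) (B := FXm) (UT.fst UT.id)) (UT.snd UT.id)
end Temporal
end

namespace Temporal

/-- The validity problem for temporal formulas over the frame `(ℝ², <)`, where `<`
is the irreflexive part of the componentwise order on ℝ², is decidable. -/
theorem validity_R2_lt_decidable :
    ComputablePred (fun φ : TForm =>
      TValid (fun p q : ℝ × ℝ => p ≤ q ∧ p ≠ q) φ) := by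
  exact reduce crit_primrec

end Temporal
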